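/- There exists an absolute constant C > 0 such that for every positive integer m, liminf_{n → ∞} (p_{n+m} − p_n) ≤ C · m^3 · e^{4m + 5}. -/

import Mathlib

open Filter

namespace MaynardGap

open Finset hiding card_fin
open Real (add_one_le_exp exp exp_add exp_le_exp exp_mul exp_nat_mul exp_neg exp_pos exp_sub
  le_log_iff_exp_le log log_div log_exp log_le_iff_le_exp log_le_log log_mul log_natCast_nonneg
  log_nonneg log_pos log_pow log_two_gt_d9 mul_rpow mul_self_sqrt norm_eq_abs norm_of_nonneg
  one_le_exp rpow_add rpow_def_of_pos rpow_le_rpow_of_exponent_le rpow_le_rpow_of_nonpos rpow_mul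
  rpow_one sin sq_sqrt sqrt_eq_rpow sqrt_mul sqrt_sq)
open Complex (continuous_re norm_real mul_conj' ofReal_cpow ofReal_tsum ofReal_mul ofReal_sub
  ofReal_sum)
open Nat (cast_nonneg floor_le le_ceil Coprime le_of_dvd ModEq nth count cast_prod cast_sub
  cast_le cast_mul le_floor sub_le pow_log_le_self card_Ioc)
open Fintype (card_fin sum_option card_pos_iff)
open DirichletCharacter (norm_le_one LFunction_eq_LSeries changeLevel)
open Int (fract)
open ZMod (isUnit_iff_coprime stdAddChar natCast_zmod_val)
open Function (Injective update)
open scoped ArithmeticFunction.vonMangoldt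
open ArithmeticFunction (vonMangoldt_nonneg moebius zeta abs_moebius_le_one
  coe_moebius_mul_coe_zeta coe_mul_zeta_apply intCoe_apply natCoe_apply log_apply
  sum_Ioc_mul_eq_sum_sum vonMangoldt_le_log vonMangoldt_mul_zeta vonMangoldt_sum zeta_apply_ne)

open Complex in
lemma norm_cpow_neg_sub_cpow_neg_le {x y : ℝ} (hy : 0 < y) (hxy : y ≤ x) {s : ℂ} (hs : 0 ≤ s.re) :
    ‖(x : ℂ) ^ (-s) - (y : ℂ) ^ (-s)‖ ≤ ‖s‖ * y ^ (-s.re - 1) * (x - y) := by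
  have hderiv : ∀ t ∈ Set.Icc y x, HasDerivWithinAt (fun t : ℝ => (t : ℂ) ^ (-s))
      (-s * (t : ℂ) ^ (-s - 1)) (Set.Icc y x) t := by
    intro t ht
    have ht0 : 0 < t := lt_of_lt_of_le hy ht.1
    have h1 : HasDerivAt (fun z : ℂ => z ^ (-s)) (-s * (t : ℂ) ^ (-s - 1) * 1) (t : ℂ) :=
      (hasDerivAt_id (t : ℂ)).cpow_const (Or.inl (by simpa using ht0))
    rw [mul_one] at h1
    exact h1.comp_ofReal.hasDerivWithinAt
  have hb : ∀ t ∈ Set.Icc y x, ‖-s * (t : ℂ) ^ (-s - 1)‖ ≤ ‖s‖ * y ^ (-s.re - 1) := by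
    intro t ht
    have ht0 : 0 < t := lt_of_lt_of_le hy ht.1
    rw [norm_mul, norm_neg, norm_cpow_eq_rpow_re_of_pos ht0]
    gcongr
    simp only [sub_re, neg_re, one_re]
    exact Real.rpow_le_rpow_of_nonpos hy ht.1 (by linarith)
  have := (convex_Icc y x).norm_image_sub_le_of_norm_hasDerivWithin_le hderiv hb
    (Set.left_mem_Icc.2 hxy) (Set.right_mem_Icc.2 hxy)
  rwa [Real.norm_of_nonneg (by linarith : 0 ≤ x - y)] at this

/-- The sum of the terms of the Dirichlet series of `χ` over the `b`-th block of length `q`. -/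
noncomputable def charBlock {q : ℕ} (χ : DirichletCharacter ℂ q) (b : ℕ) (s : ℂ) : ℂ :=
  ∑ i : Fin q, LSeries.term (fun n => χ n) s (b * q + i)

lemma sum_fin_char_eq_zero {q : ℕ} [NeZero q] {χ : DirichletCharacter ℂ q} (hχ : χ ≠ 1) :
    ∑ i : Fin q, χ ((i : ℕ) : ZMod q) = 0 := by
  rw [← MulChar.sum_eq_zero_of_ne_one hχ]
  refine Fintype.sum_bijective (fun i : Fin q => ((i : ℕ) : ZMod q)) ?_ _ _ (fun i => rfl)
  rw [Fintype.bijective_iff_injective_and_card]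
  refine ⟨fun i j h => ?_, by simp [ZMod.card]⟩
  have h' := (ZMod.natCast_eq_natCast_iff' _ _ _).1 h
  rw [Nat.mod_eq_of_lt i.2, Nat.mod_eq_of_lt j.2] at h'
  exact Fin.ext h'

lemma norm_charBlock_le {q : ℕ} [NeZero q] {χ : DirichletCharacter ℂ q} (hχ : χ ≠ 1) {b : ℕ}
    (hb : 1 ≤ b) {s : ℂ} (hs : 0 ≤ s.re) :
    ‖charBlock χ b s‖ ≤ ‖s‖ * (q : ℝ) ^ (1 - s.re) * (b : ℝ) ^ (-s.re - 1) := by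
  have hq : 0 < q := NeZero.pos q
  have hbq : (0 : ℝ) < (b : ℝ) * q := by positivity
  have h1 : charBlock χ b s = ∑ i : Fin q, χ ((i : ℕ) : ZMod q) *
      ((((b * q + i : ℕ) : ℝ) : ℂ) ^ (-s) - (((b * q : ℕ) : ℝ) : ℂ) ^ (-s)) := by
    simp only [mul_sub, sum_sub_distrib]
    rw [← sum_mul, sum_fin_char_eq_zero hχ, zero_mul, sub_zero]
    refine sum_congr rfl (fun i _ => ?_)
    rw [LSeries.term_of_ne_zero (by positivity), div_eq_mul_inv, ← Complex.cpow_neg]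
    congr 2
    simp
  rw [h1]
  calc _ ≤ ∑ i : Fin q, ‖s‖ * ((b : ℝ) * q) ^ (-s.re - 1) * q := by
        refine (norm_sum_le _ _).trans (sum_le_sum fun i _ => ?_)
        rw [norm_mul]
        have h2 := norm_cpow_neg_sub_cpow_neg_le (x := ((b * q + i : ℕ) : ℝ))
          (y := ((b * q : ℕ) : ℝ)) (by exact_mod_cast hbq) (by push_cast; simp) hs
        calc _ ≤ 1 * _ := mul_le_mul (norm_le_one _ _) h2 (norm_nonneg _) zero_le_one
          _ ≤ _ := by
            rw [one_mul]; push_cast; gcongr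
            simp only [add_sub_cancel_left]
            exact_mod_cast i.2.le
    _ = _ := by
        rw [sum_const, card_univ, card_fin, nsmul_eq_mul,
          mul_rpow (by positivity) (by positivity)]
        have : (q : ℝ) ^ (1 - s.re) = q * q * (q : ℝ) ^ (-s.re - 1) := by
          rw [show 1 - s.re = 1 + 1 + (-s.re - 1) by ring, rpow_add (by positivity),
            rpow_add (by positivity), rpow_one]
        rw [this]; ring

lemma LFunction_eq_tsum_charBlock {q : ℕ} [NeZero q] {χ : DirichletCharacter ℂ q} (hχ : χ ≠ 1)
    {s : ℂ} (hs : 1 / 2 < s.re) (hs3 : ‖s‖ < 3) :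
    χ.LFunction s = ∑' b, charBlock χ b s := by
  set U : Set ℂ := {s : ℂ | 1 / 2 < s.re} ∩ Metric.ball 0 3
  have hUo : IsOpen U := (isOpen_lt continuous_const continuous_re).inter Metric.isOpen_ball
  have hUc : IsPreconnected U := by
    refine Convex.isPreconnected ?_
    exact (convex_halfSpace_re_gt _).inter (convex_ball _ _)
  have hblockd : ∀ b, DifferentiableOn ℂ (charBlock χ b) U := by
    intro b
    refine Differentiable.differentiableOn ?_
    unfold charBlock
    refine Differentiable.fun_sum fun i _ => ?_
    rcases eq_or_ne (b * q + (i : ℕ)) 0 with h | h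
    · simp only [h, LSeries.term_zero]; fun_prop
    · intro z
      exact (LSeries.hasDerivAt_term _ _ z).differentiableAt
  have hsum1 : Summable (fun b : ℕ => 3 * (q : ℝ) * (((b : ℕ) : ℝ) ^ (-(3 / 2 : ℝ)))) := by
    exact (Real.summable_nat_rpow.2 (by norm_num)).mul_left _
  have hle : ∀ b : ℕ, ∀ w ∈ U, ‖charBlock χ (b + 1) w‖ ≤
      3 * (q : ℝ) * ((b + 1 : ℕ) : ℝ) ^ (-(3 / 2 : ℝ)) := by
    rintro b w ⟨hw1, hw2⟩
    simp only [Set.mem_ofPred_eq, Metric.mem_ball, dist_zero_right] at hw1 hw2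
    refine (norm_charBlock_le hχ (by omega) (by linarith)).trans ?_
    have hq1 : (1 : ℝ) ≤ q := by exact_mod_cast NeZero.pos q
    have hb1 : (1 : ℝ) ≤ ((b + 1 : ℕ) : ℝ) := by push_cast; linarith [cast_nonneg (α := ℝ) b]
    gcongr
    · calc (q : ℝ) ^ (1 - w.re) ≤ (q : ℝ) ^ (1 : ℝ) := by
            apply rpow_le_rpow_of_exponent_le hq1; linarith
        _ = q := rpow_one _
    · linarith
  have hdiff : DifferentiableOn ℂ (fun s => ∑' b, charBlock χ (b + 1) s) U :=
    Complex.differentiableOn_tsum_of_summable_norm ((summable_nat_add_iff 1).2 hsum1)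
      (fun b => hblockd (b + 1)) hUo hle
  have hsumm : ∀ s ∈ U, Summable (fun b => charBlock χ b s) := fun w hw =>
    (summable_nat_add_iff 1).1
      (Summable.of_norm_bounded ((summable_nat_add_iff 1).2 hsum1) fun b => hle b w hw)
  have hdiff' : DifferentiableOn ℂ (fun s => ∑' b, charBlock χ b s) U := by
    refine DifferentiableOn.congr (f := fun s => charBlock χ 0 s + ∑' b, charBlock χ (b + 1) s)
      ((hblockd 0).add hdiff) ?_
    intro w hw
    exact (hsumm w hw).tsum_eq_zero_add
  have hgt : ∀ w : ℂ, 1 < w.re → χ.LFunction w = ∑' b, charBlock χ b w := by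
    intro w hw
    rw [LFunction_eq_LSeries χ hw]
    have hs := (DirichletCharacter.LSeriesSummable_of_one_lt_re χ hw).LSeriesHasSum
    have h2 := (Nat.divModEquiv q).symm.hasSum_iff.mpr hs
    exact (h2.prod_fiberwise (g := fun b => charBlock χ b w) (fun b => by
      have := hasSum_fintype (fun i : Fin q => LSeries.term (fun n => χ n) w (b * q + i))
      simpa [charBlock, Function.comp_def, Nat.divModEquiv] using this)).tsum_eq.symm
  have h2U : (2 : ℂ) ∈ U := by
    constructor <;> simp <;> norm_num
  have hsU : s ∈ U := ⟨hs, by simpa using hs3⟩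
  refine AnalyticOnNhd.eqOn_of_preconnected_of_eventuallyEq (f := χ.LFunction)
    (((DirichletCharacter.differentiable_LFunction hχ).differentiableOn).analyticOnNhd hUo)
    (hdiff'.analyticOnNhd hUo) hUc h2U ?_ hsU
  have : {w : ℂ | 1 < w.re} ∈ nhds (2 : ℂ) :=
    (isOpen_lt continuous_const continuous_re).mem_nhds (by simp)
  filter_upwards [this] with w hw using hgt w hw

lemma sum_range_inv_le_one_add_log (q : ℕ) :
    ∑ n ∈ range q, ((n : ℝ))⁻¹ ≤ 1 + log q := by
  rcases eq_zero_or_pos q with rfl | hq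
  · simp
  have h := harmonic_le_one_add_log q
  rw [harmonic_eq_sum_Icc] at h
  push_cast at h
  refine le_trans ?_ h
  have h1 : ∑ n ∈ range q, ((n : ℝ))⁻¹ = ∑ n ∈ (range q).filter (· ≠ 0), ((n : ℝ))⁻¹ := by
    rw [sum_filter_of_ne]
    intro x _ hx h0
    simp [h0] at hx
  rw [h1]
  refine sum_le_sum_of_subset_of_nonneg ?_ (fun _ _ _ => by positivity)
  intro n hn
  simp only [mem_filter, mem_range, mem_Icc] at hn ⊢
  omega

lemma exists_norm_LFunction_le : ∃ C : ℝ, 1 ≤ C ∧ ∀ (q : ℕ) [NeZero q] (χ : DirichletCharacter ℂ q),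
    χ ≠ 1 → ∀ s : ℂ, ‖s - 1‖ ≤ 1 / (4 * (1 + log q)) →
      ‖χ.LFunction s‖ ≤ C * (1 + log q) := by
  set S : ℝ := ∑' b : ℕ, ((b : ℝ) ^ (-(3 / 2 : ℝ))) with hS
  have hSs : Summable (fun b : ℕ => ((b : ℝ) ^ (-(3 / 2 : ℝ)))) :=
    Real.summable_nat_rpow.2 (by norm_num)
  refine ⟨exp 1 + 3 * exp 1 * S, ?_, ?_⟩
  · have := add_one_le_exp (1 : ℝ)
    have h2 : 0 ≤ 3 * exp 1 * S := by positivity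
    linarith
  intro q _ χ hχ s hs
  have hq1 : (1 : ℝ) ≤ q := by exact_mod_cast NeZero.pos q
  have hlog : 0 ≤ log q := log_nonneg hq1
  set ℓ : ℝ := 1 + log q
  have hℓ1 : 1 ≤ ℓ := by linarith
  have hs4 : 1 / (4 * ℓ) ≤ 1 / 4 := by
    apply one_div_le_one_div_of_le <;> linarith
  have hre : |s.re - 1| ≤ 1 / (4 * ℓ) := by
    have := Complex.abs_re_le_norm (s - 1)
    simp only [Complex.sub_re, Complex.one_re] at this
    linarith
  have hre1 := (abs_le.1 hre).1
  have hn3 : ‖s‖ < 3 := by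
    calc ‖s‖ = ‖(s - 1) + 1‖ := by ring_nf
      _ ≤ ‖s - 1‖ + ‖(1 : ℂ)‖ := norm_add_le _ _
      _ < 3 := by rw [norm_one]; linarith
  have hpow : ∀ n : ℝ, 1 ≤ n → n ≤ q → n ^ (1 - s.re) ≤ exp 1 := by
    intro n hn1 hnq
    rw [rpow_def_of_pos (by linarith)]
    apply exp_le_exp.2
    have h1 : log n ≤ log q := log_le_log (by linarith) hnq
    have h0 : 0 ≤ log n := log_nonneg hn1
    calc log n * (1 - s.re) ≤ log n * (1 / (4 * ℓ)) := by
          apply mul_le_mul_of_nonneg_left _ h0; linarith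
      _ ≤ ℓ * (1 / (4 * ℓ)) := by gcongr; linarith
      _ ≤ 1 := by field_simp; linarith
  rw [LFunction_eq_tsum_charBlock hχ (by linarith) hn3]
  have hb : ∀ b : ℕ, ‖charBlock χ (b + 1) s‖ ≤ 3 * exp 1 * (((b + 1 : ℕ) : ℝ) ^ (-(3 / 2 : ℝ))) := by
    intro b
    refine (norm_charBlock_le hχ (by omega) (by linarith)).trans ?_
    have hb1 : (1 : ℝ) ≤ ((b + 1 : ℕ) : ℝ) := by push_cast; linarith [cast_nonneg (α := ℝ) b]
    have := hpow q hq1 le_rfl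
    gcongr
    · linarith
  have hsum : Summable (fun b => ‖charBlock χ (b + 1) s‖) :=
    Summable.of_nonneg_of_le (fun _ => norm_nonneg _) hb
      (((summable_nat_add_iff 1).2 hSs).mul_left _)
  have hsum0 : Summable (fun b => charBlock χ b s) := (summable_nat_add_iff 1).1 hsum.of_norm
  rw [hsum0.tsum_eq_zero_add]
  have h1 : ‖∑' b, charBlock χ (b + 1) s‖ ≤ 3 * exp 1 * S := by
    refine (norm_tsum_le_tsum_norm hsum).trans ?_
    refine (hsum.tsum_le_tsum hb (((summable_nat_add_iff 1).2 hSs).mul_left _)).trans ?_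
    rw [tsum_mul_left]
    gcongr
    rw [hS, hSs.tsum_eq_zero_add]
    have : (0 : ℝ) ≤ ((0 : ℕ) : ℝ) ^ (-(3 / 2 : ℝ)) := by positivity
    linarith
  have h2 : ‖charBlock χ 0 s‖ ≤ exp 1 * ℓ := by
    unfold charBlock
    refine (norm_sum_le _ _).trans ?_
    rw [Fin.sum_univ_eq_sum_range (fun i => ‖LSeries.term (fun n => χ n) s (0 * q + i)‖)]
    calc _ ≤ ∑ n ∈ range q, exp 1 * ((n : ℝ))⁻¹ := by
          refine sum_le_sum fun n hn => ?_
          rw [zero_mul, zero_add]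
          rcases eq_zero_or_pos n with rfl | hn0
          · simp
          have hn1 : (1 : ℝ) ≤ n := by exact_mod_cast hn0
          rw [LSeries.term_of_ne_zero (by omega), norm_div, Complex.norm_natCast_cpow_of_pos hn0]
          have h3 := hpow n hn1 (by exact_mod_cast (mem_range.1 hn).le)
          rw [Real.rpow_sub (by linarith), rpow_one] at h3
          calc _ ≤ 1 / (n : ℝ) ^ s.re := by gcongr; exact norm_le_one _ _
            _ = (n / (n : ℝ) ^ s.re) * (n : ℝ)⁻¹ := by field_simp
            _ ≤ _ := by gcongr
      _ = exp 1 * ∑ n ∈ range q, ((n : ℝ))⁻¹ := by rw [mul_sum]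
      _ ≤ _ := by gcongr; exact sum_range_inv_le_one_add_log q
  calc _ ≤ ‖charBlock χ 0 s‖ + ‖∑' b, charBlock χ (b + 1) s‖ := norm_add_le _ _
    _ ≤ exp 1 * ℓ + 3 * exp 1 * S * 1 := by linarith
    _ ≤ exp 1 * ℓ + 3 * exp 1 * S * ℓ := by gcongr
    _ = _ := by ring

open Metric (ball ball_subset_closedBall closedBall closedBall_subset_ball isOpen_ball mem_ball)

open Complex in
lemma hasSum_log_pow_mul_rpow {f : ℕ → ℂ} (hf : ∀ s : ℂ, 1 < s.re → LSeriesSummable f s) (J : ℕ)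
    {δ : ℝ} (hδ : 0 < δ) :
    HasSum (fun n : ℕ => f n * (((Real.log n) ^ J * (n : ℝ) ^ (-(1 + δ)) : ℝ) : ℂ))
      ((-1) ^ J * iteratedDeriv J (LSeries f) (1 + δ)) := by
  have habs : LSeries.abscissaOfAbsConv f ≤ ((1 : ℝ) : EReal) :=
    LSeries.abscissaOfAbsConv_le_of_forall_lt_LSeriesSummable fun y hy => hf _ (by simpa using hy)
  have hlt : LSeries.abscissaOfAbsConv f < ((1 + δ : ℂ)).re := by
    refine lt_of_le_of_lt habs ?_
    exact_mod_cast (by simpa using hδ : (1:ℝ) < ((1 + δ : ℂ)).re)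
  have h1 := LSeries_iteratedDeriv J hlt
  have h2 : LSeriesSummable (LSeries.logMul^[J] f) (1 + δ) := by
    apply LSeriesSummable_of_abscissaOfAbsConv_lt_re
    rwa [LSeries.absicssaOfAbsConv_logPowMul]
  have h3 : ∀ n : ℕ, LSeries.logMul^[J] f n = f n * (Complex.log n) ^ J := by
    intro n
    induction J generalizing f with
    | zero => simp
    | succ J ih =>
      rw [Function.iterate_succ_apply']
      unfold LSeries.logMul
      rw [ih hf habs hlt (LSeries_iteratedDeriv J hlt) ?_]
      · ring
      · apply LSeriesSummable_of_abscissaOfAbsConv_lt_re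
        rwa [LSeries.absicssaOfAbsConv_logPowMul]
  rw [h1, ← mul_assoc, ← mul_pow]
  simp only [mul_neg, mul_one, neg_neg, one_pow, one_mul]
  have h4 := h2.LSeriesHasSum
  unfold LSeriesHasSum at h4
  convert! h4 using 1
  funext n
  rcases eq_zero_or_pos n with rfl | hn
  · rw [Nat.cast_zero, Real.zero_rpow (show -(1 + δ) ≠ 0 by linarith)]; simp
  · rw [LSeries.term_of_ne_zero hn.ne', h3]
    push_cast
    rw [ofReal_cpow (by positivity)]
    push_cast
    rw [Complex.cpow_neg, div_eq_mul_inv, mul_assoc]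

open Complex in
lemma norm_iteratedDeriv_le_of_bounded {G : ℂ → ℂ} {R M δ : ℝ} (hR : 0 < R)
    (hG : DifferentiableOn ℂ G (ball 1 R)) (hM : ∀ z ∈ ball (1 : ℂ) R, ‖G z‖ ≤ M)
    (hδ : 0 < δ) (hδR : δ ≤ R / 4) (J : ℕ) :
    ‖iteratedDeriv J G (1 + δ)‖ ≤ J.factorial * (M * (2 / R) ^ J) := by
  have hsub : closedBall ((1 : ℂ) + δ) (R / 2) ⊆ ball 1 R := by
    apply Metric.closedBall_subset_ball'
    rw [dist_eq_norm, add_sub_cancel_left, norm_real, Real.norm_of_nonneg hδ.le]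
    linarith
  have := Complex.norm_iteratedDeriv_le_of_forall_mem_sphere_norm_le (c := 1 + δ) (R := R / 2)
    (C := M) J (by positivity) (DifferentiableOn.diffContOnCl_ball hG hsub)
    (fun z hz => hM z (hsub (Metric.sphere_subset_closedBall hz)))
  refine this.trans (le_of_eq ?_)
  rw [div_pow, div_pow]; field_simp

/-- Nontrivial case: the twisted sum is small. -/
lemma norm_tsum_log_pow_le {f : ℕ → ℂ} (hf : ∀ s : ℂ, 1 < s.re → LSeriesSummable f s)
    {G : ℂ → ℂ} {R M δ : ℝ} (hR : 0 < R)
    (hG : DifferentiableOn ℂ G (ball 1 R)) (hM : ∀ z ∈ ball (1 : ℂ) R, ‖G z‖ ≤ M)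
    (hfG : ∀ s : ℂ, 1 < s.re → s ∈ ball (1 : ℂ) R → LSeries f s = G s)
    (hδ : 0 < δ) (hδR : δ ≤ R / 4) (J : ℕ) :
    ‖∑' n : ℕ, f n * (((log n) ^ J * (n : ℝ) ^ (-(1 + δ)) : ℝ) : ℂ)‖ ≤
      J.factorial * (M * (2 / R) ^ J) := by
  rw [(hasSum_log_pow_mul_rpow hf J hδ).tsum_eq, norm_mul, norm_pow, norm_neg, norm_one, one_pow,
    one_mul]
  have hmem : ((1 : ℂ) + δ) ∈ ball (1 : ℂ) R := by
    rw [mem_ball, dist_eq_norm, add_sub_cancel_left, norm_real,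
      norm_of_nonneg hδ.le]; linarith
  have hev : LSeries f =ᶠ[nhds ((1 : ℂ) + δ)] G := by
    have h1 : {s : ℂ | 1 < s.re} ∈ nhds ((1 : ℂ) + δ) :=
      (isOpen_lt continuous_const continuous_re).mem_nhds (by simpa using hδ)
    filter_upwards [h1, isOpen_ball.mem_nhds hmem] with s hs hs2 using hfG s hs hs2
  rw [hev.iteratedDeriv_eq]
  exact norm_iteratedDeriv_le_of_bounded hR hG hM hδ hδR J

/-- Simple pole with residue one. -/
lemma norm_tsum_log_pow_sub_le {f : ℕ → ℂ} (hf : ∀ s : ℂ, 1 < s.re → LSeriesSummable f s)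
    {G : ℂ → ℂ} {R M δ : ℝ} (hR : 0 < R)
    (hG : DifferentiableOn ℂ G (ball 1 R)) (hM : ∀ z ∈ ball (1 : ℂ) R, ‖G z‖ ≤ M)
    (hfG : ∀ s : ℂ, 1 < s.re → s ∈ ball (1 : ℂ) R → LSeries f s = (s - 1)⁻¹ + G s)
    (hδ : 0 < δ) (hδR : δ ≤ R / 4) (J : ℕ) :
    ‖∑' n : ℕ, f n * (((log n) ^ J * (n : ℝ) ^ (-(1 + δ)) : ℝ) : ℂ) -
      (J.factorial / δ ^ (J + 1) : ℝ)‖ ≤ J.factorial * (M * (2 / R) ^ J) := by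
  rw [(hasSum_log_pow_mul_rpow hf J hδ).tsum_eq]
  have hmem : ((1 : ℂ) + δ) ∈ ball (1 : ℂ) R := by
    rw [mem_ball, dist_eq_norm, add_sub_cancel_left, norm_real,
      norm_of_nonneg hδ.le]; linarith
  have hev : LSeries f =ᶠ[nhds ((1 : ℂ) + δ)] ((fun s => (s - 1)⁻¹) + G) := by
    have h1 : {s : ℂ | 1 < s.re} ∈ nhds ((1 : ℂ) + δ) :=
      (isOpen_lt continuous_const continuous_re).mem_nhds (by simpa using hδ)
    filter_upwards [h1, isOpen_ball.mem_nhds hmem] with s hs hs2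
    simpa using hfG s hs hs2
  have hδ0 : (δ : ℂ) ≠ 0 := by exact_mod_cast hδ.ne'
  have hinv : iteratedDeriv J (fun s : ℂ => (s - 1)⁻¹) (1 + δ) =
      (-1) ^ J * J.factorial / (δ : ℂ) ^ (J + 1) := by
    have := congrFun (iter_deriv_inv_linear_sub (𝕜 := ℂ) J 1 1) (1 + δ)
    simp only [one_mul, one_pow, mul_one, add_sub_cancel_left] at this
    rw [iteratedDeriv_eq_iterate, this, div_eq_mul_inv, ← zpow_natCast (δ : ℂ), ← zpow_neg]
    congr 2
    push_cast; ring
  rw [hev.iteratedDeriv_eq, iteratedDeriv_add, hinv]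
  · have : ((-1 : ℂ)) ^ J * (-1) ^ J = 1 := by rw [← mul_pow]; simp
    have h2 : (-1 : ℂ) ^ J * ((-1) ^ J * J.factorial / (δ : ℂ) ^ (J + 1) + iteratedDeriv J G (1 + δ)) -
        (J.factorial / δ ^ (J + 1) : ℝ) = (-1) ^ J * iteratedDeriv J G (1 + δ) := by
      push_cast
      linear_combination ((J.factorial : ℂ) / (δ : ℂ) ^ (J + 1)) * this
    rw [h2, norm_mul, norm_pow, norm_neg, norm_one, one_pow, one_mul]
    exact norm_iteratedDeriv_le_of_bounded hR hG hM hδ hδR J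
  · have : ContDiffAt ℂ J (fun s : ℂ => s - 1) (1 + δ) := by fun_prop
    exact this.inv (by simpa using hδ0)
  · exact ((hG.analyticOnNhd isOpen_ball) _ hmem).contDiffAt

open DirichletCharacter in
/-- The regular part of `ζ` and of `-ζ'/ζ` near `1`. -/
lemma exists_riemannZeta_eq : ∃ R M : ℝ, 0 < R ∧ ∃ G1 G2 : ℂ → ℂ,
    DifferentiableOn ℂ G1 (ball 1 R) ∧ DifferentiableOn ℂ G2 (ball 1 R) ∧
    (∀ z ∈ ball (1 : ℂ) R, ‖G1 z‖ ≤ M) ∧ (∀ z ∈ ball (1 : ℂ) R, ‖G2 z‖ ≤ M) ∧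
    (∀ s : ℂ, s ≠ 1 → s ∈ ball (1 : ℂ) R → riemannZeta s = (s - 1)⁻¹ + G1 s) ∧
    (∀ s : ℂ, s ≠ 1 → s ∈ ball (1 : ℂ) R →
      -deriv riemannZeta s / riemannZeta s = (s - 1)⁻¹ + G2 s) := by
  set G := LFunctionTrivChar₁ 1 with hGdef
  have hG : Differentiable ℂ G := differentiable_LFunctionTrivChar₁ 1
  have hG1 : G 1 = 1 := by simp [hGdef]
  have hGs : ∀ s : ℂ, s ≠ 1 → G s = (s - 1) * riemannZeta s := by
    intro s hs
    rw [hGdef, LFunctionTrivChar₁, Function.update_of_ne hs, LFunctionTrivChar, LFunction_modOne_eq]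
  have hGd : ∀ s : ℂ, s ≠ 1 → deriv G s = (s - 1) * deriv riemannZeta s + riemannZeta s := by
    intro s hs
    rw [hGdef, deriv_LFunctionTrivChar₁_apply_of_ne_one 1 hs, LFunctionTrivChar, LFunction_modOne_eq]
  have hne : ∀ᶠ z in nhds (1 : ℂ), G z ≠ 0 :=
    hG.continuous.continuousAt.eventually_ne (by rw [hG1]; exact one_ne_zero)
  have hds : Differentiable ℂ (dslope G 1) := by
    rw [← differentiableOn_univ] at hG ⊢
    exact (Complex.differentiableOn_dslope (by simp)).2 hG
  set G2 : ℂ → ℂ := fun s => -(deriv G s / G s) with hG2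
  obtain ⟨R, hR, hRne⟩ := Metric.eventually_nhds_iff_ball.1 hne
  have hdG : Differentiable ℂ (deriv G) := by
    have := hG.differentiableOn (s := Set.univ)
    have h2 := this.deriv isOpen_univ
    rwa [differentiableOn_univ] at h2
  have hG2d : DifferentiableOn ℂ G2 (ball 1 R) :=
    ((hdG.differentiableOn).div hG.differentiableOn hRne).neg
  have hsub : closedBall (1 : ℂ) (R / 2) ⊆ ball 1 R :=
    closedBall_subset_ball (by linarith)
  obtain ⟨M1, hM1⟩ := (isCompact_closedBall (1 : ℂ) (R / 2)).exists_bound_of_continuousOn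
    hds.continuous.continuousOn
  obtain ⟨M2, hM2⟩ := (isCompact_closedBall (1 : ℂ) (R / 2)).exists_bound_of_continuousOn
    (hG2d.continuousOn.mono hsub)
  refine ⟨R / 2, max M1 M2, by positivity, dslope G 1, G2, hds.differentiableOn,
    hG2d.mono (ball_subset_closedBall.trans hsub),
    fun z hz => (hM1 z (ball_subset_closedBall hz)).trans (le_max_left _ _),
    fun z hz => (hM2 z (ball_subset_closedBall hz)).trans (le_max_right _ _), ?_, ?_⟩
  · intro s hs _
    have hs1 : s - 1 ≠ 0 := sub_ne_zero.2 hs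
    rw [dslope_of_ne _ hs, slope_def_field, hGs s hs, hG1]
    field_simp
    ring
  · intro s hs hsR
    have hs1 : s - 1 ≠ 0 := sub_ne_zero.2 hs
    have h0 : G s ≠ 0 := hRne s (hsub (ball_subset_closedBall hsR))
    have hz : riemannZeta s ≠ 0 := by
      intro h; rw [hGs s hs, h, mul_zero] at h0; exact h0 rfl
    simp only [hG2]
    rw [hGd s hs, hGs s hs]
    field_simp
    ring

lemma one_le_one_add_log (q : ℕ) [NeZero q] : 1 ≤ 1 + log q := by
  have hq1 : (1 : ℝ) ≤ q := by exact_mod_cast NeZero.pos q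
  linarith [log_nonneg hq1]

lemma exists_LFunction_bounds : ∃ C : ℝ, 4 ≤ C ∧
    ∀ (q : ℕ) [NeZero q] (χ : DirichletCharacter ℂ q), χ ≠ 1 →
      (∀ s : ℂ, ‖s - 1‖ ≤ 1 / (4 * (1 + log q)) → ‖χ.LFunction s‖ ≤ C * (1 + log q)) ∧
      (∀ s : ℂ, ‖s - 1‖ ≤ 1 / (8 * (1 + log q)) →
        ‖deriv χ.LFunction s‖ ≤ C * (1 + log q) ^ 2) ∧
      (∀ s : ℂ, ‖s - 1‖ ≤ 1 / (8 * (1 + log q)) →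
        ‖χ.LFunction s - χ.LFunction 1‖ ≤ C * (1 + log q) ^ 2 * ‖s - 1‖) := by
  obtain ⟨C, hC1, hC⟩ := exists_norm_LFunction_le
  refine ⟨8 * C, by linarith, ?_⟩
  intro q _ χ hχ
  have hℓ1 := one_le_one_add_log q
  set ℓ : ℝ := 1 + log q
  have hd := DirichletCharacter.differentiable_LFunction hχ
  have hder : ∀ s : ℂ, ‖s - 1‖ ≤ 1 / (8 * ℓ) → ‖deriv χ.LFunction s‖ ≤ 8 * C * ℓ ^ 2 := by
    intro s hs
    have := Complex.norm_deriv_le_of_forall_mem_sphere_norm_le (c := s) (R := 1 / (8 * ℓ))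
      (C := C * ℓ) (f := χ.LFunction) (by positivity) hd.diffContOnCl (fun z hz => by
        apply hC q χ hχ
        have h1 : ‖z - s‖ = 1 / (8 * ℓ) := by simpa [dist_eq_norm] using hz
        calc ‖z - 1‖ = ‖(z - s) + (s - 1)‖ := by ring_nf
          _ ≤ ‖z - s‖ + ‖s - 1‖ := norm_add_le _ _
          _ ≤ 1 / (8 * ℓ) + 1 / (8 * ℓ) := by linarith
          _ = 1 / (4 * ℓ) := by field_simp; norm_num)
    refine this.trans (le_of_eq ?_)
    field_simp
  refine ⟨?_, hder, ?_⟩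
  · intro s hs
    refine (hC q χ hχ s hs).trans ?_
    gcongr; linarith
  · intro s hs
    have := (convex_closedBall (1 : ℂ) (1 / (8 * ℓ))).norm_image_sub_le_of_norm_deriv_le
      (f := χ.LFunction) (C := 8 * C * ℓ ^ 2) (x := 1) (y := s) (fun x _ => hd x)
      (fun x hx => hder x (by simpa [dist_eq_norm] using hx))
      (Metric.mem_closedBall_self (by positivity)) (by simpa [dist_eq_norm] using hs)
    exact this

lemma exists_norm_twist_sum_le : ∃ C : ℝ, 4 ≤ C ∧
    ∀ (q : ℕ) [NeZero q] (χ : DirichletCharacter ℂ q), χ ≠ 1 →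
      ∀ η : ℝ, 0 < η → η ≤ 1 → η ≤ ‖χ.LFunction 1‖ → ∀ R : ℝ, R = η / (C * (1 + log q) ^ 2) →
      ∀ δ : ℝ, 0 < δ → δ ≤ R / 4 → ∀ J : ℕ,
      ‖∑' n : ℕ, (χ n * Λ n) *
        (((log n) ^ J * (n : ℝ) ^ (-(1 + δ)) : ℝ) : ℂ)‖ ≤
      J.factorial * (1 / R * (2 / R) ^ J) := by
  obtain ⟨C, hC1, hC⟩ := exists_LFunction_bounds
  refine ⟨2 * C, by linarith, ?_⟩
  intro q _ χ hχ η hη hη1 hηL R hR δ hδ hδR J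
  obtain ⟨-, hder, hsub⟩ := hC q χ hχ
  have hℓ1 := one_le_one_add_log q
  set ℓ : ℝ := 1 + log q
  have hR0 : 0 < R := by rw [hR]; positivity
  have hR8 : R ≤ 1 / (8 * ℓ) := by
    rw [hR]
    rw [div_le_div_iff₀ (by positivity) (by positivity)]
    nlinarith [mul_le_mul hη1 hℓ1 zero_le_one zero_le_one, mul_nonneg (by linarith : 0 ≤ C - 4) (by nlinarith : 0 ≤ ℓ ^ 2)]
  have hball : ∀ z ∈ Metric.ball (1 : ℂ) R, ‖z - 1‖ ≤ 1 / (8 * ℓ) ∧ η / 2 ≤ ‖χ.LFunction z‖ := by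
    intro z hz
    rw [Metric.mem_ball, dist_eq_norm] at hz
    refine ⟨by linarith, ?_⟩
    have h1 := hsub z (by linarith)
    have h2 : C * ℓ ^ 2 * ‖z - 1‖ ≤ C * ℓ ^ 2 * R := by gcongr
    have h3 : C * ℓ ^ 2 * R = η / 2 := by rw [hR]; field_simp
    have h4 := norm_sub_norm_le (χ.LFunction 1) (χ.LFunction 1 - χ.LFunction z)
    rw [sub_sub_cancel, norm_sub_rev (χ.LFunction 1)] at h4
    linarith
  have hd := DirichletCharacter.differentiable_LFunction hχ
  have hdd : Differentiable ℂ (deriv χ.LFunction) := by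
    have h2 := (hd.differentiableOn (s := Set.univ)).deriv isOpen_univ
    rwa [differentiableOn_univ] at h2
  have hne : ∀ z ∈ Metric.ball (1 : ℂ) R, χ.LFunction z ≠ 0 := by
    intro z hz h0
    have := (hball z hz).2
    rw [h0, norm_zero] at this; linarith
  refine norm_tsum_log_pow_le (f := fun n => χ n * Λ n)
    (G := fun s => -deriv χ.LFunction s / χ.LFunction s) ?_ hR0
    (hdd.differentiableOn.neg.div hd.differentiableOn hne) ?_ ?_ hδ hδR J
  · intro s hs
    exact DirichletCharacter.LSeriesSummable_twist_vonMangoldt χ hs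
  · intro z hz
    obtain ⟨h1, h2⟩ := hball z hz
    rw [norm_div, norm_neg]
    have h3 := hder z h1
    calc _ ≤ (C * ℓ ^ 2) / (η / 2) := by gcongr
      _ = 1 / R := by rw [hR]; field_simp
  · intro s hs _
    have := DirichletCharacter.LSeries_twist_vonMangoldt_eq χ hs
    have h1 : deriv (LSeries (fun n => χ n)) s = deriv χ.LFunction s := by
      refine Filter.EventuallyEq.deriv_eq ?_
      filter_upwards [(isOpen_lt continuous_const continuous_re).mem_nhds hs] with z hz
      exact (LFunction_eq_LSeries χ hz).symm
    rw [h1, ← LFunction_eq_LSeries χ hs] at this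
    exact this

lemma exists_norm_riemannZeta_le : ∃ C : ℝ, 1 ≤ C ∧ ∀ x : ℝ, 0 < x → x ≤ 1 →
    ‖riemannZeta (1 + x)‖ ≤ C / x := by
  obtain ⟨M, hM⟩ := (isCompact_closedBall (1 : ℂ) 1).exists_bound_of_continuousOn
    (DirichletCharacter.differentiable_LFunctionTrivChar₁ 1).continuous.continuousOn
  refine ⟨max M 1, le_max_right _ _, ?_⟩
  intro x hx hx1
  have hx0 : (x : ℂ) ≠ 0 := by exact_mod_cast hx.ne'
  have h := hM (1 + x) (by simp [dist_eq_norm, abs_of_pos hx, hx1])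
  rw [DirichletCharacter.LFunctionTrivChar₁, Function.update_of_ne (by simpa using hx0),
    DirichletCharacter.LFunctionTrivChar, DirichletCharacter.LFunction_modOne_eq, norm_mul,
    add_sub_cancel_left, norm_real, norm_of_nonneg hx.le] at h
  rw [le_div_iff₀ hx, mul_comm]
  exact h.trans (le_max_left _ _)

lemma norm_LSeries_one_le {q : ℕ} {x : ℝ} (hx : 0 < x) :
    ‖LSeries (fun n => (1 : DirichletCharacter ℂ q) n) (1 + x)‖ ≤ ‖riemannZeta (1 + x)‖ := by
  have hre : 1 < ((1 : ℂ) + x).re := by simpa using hx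
  have hs1 : LSeriesSummable 1 ((1 : ℂ) + x) := LSeriesSummable_one_iff.2 hre
  have hn : ∀ n : ℕ, LSeries.term 1 ((1 : ℂ) + x) n = ((‖LSeries.term 1 ((1 : ℂ) + x) n‖ : ℝ) : ℂ) := by
    intro n
    rcases eq_zero_or_pos n with rfl | hn
    · simp
    · rw [LSeries.term_of_ne_zero hn.ne']
      rw [norm_div, Complex.norm_natCast_cpow_of_pos hn]
      simp only [Pi.one_apply, norm_one, Complex.add_re, Complex.one_re, Complex.ofReal_re]
      rw [Complex.ofReal_div, ofReal_cpow (by positivity)]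
      simp
  have h1 : riemannZeta (1 + x) = ((∑' n, ‖LSeries.term 1 ((1 : ℂ) + x) n‖ : ℝ) : ℂ) := by
    rw [← LSeries_one_eq_riemannZeta hre, LSeries, ofReal_tsum]
    exact tsum_congr hn
  have hle : ∀ n, ‖LSeries.term (fun n => (1 : DirichletCharacter ℂ q) n) ((1 : ℂ) + x) n‖ ≤
      ‖LSeries.term 1 ((1 : ℂ) + x) n‖ := by
    intro n
    apply LSeries.norm_term_le
    simpa using norm_le_one _ _
  rw [h1, norm_real, norm_of_nonneg (tsum_nonneg fun _ => norm_nonneg _)]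
  have hsum : Summable (fun n => ‖LSeries.term (fun n => (1 : DirichletCharacter ℂ q) n) ((1 : ℂ) + x) n‖) :=
    Summable.of_nonneg_of_le (fun _ => norm_nonneg _) hle hs1.norm
  exact (norm_tsum_le_tsum_norm hsum).trans (hsum.tsum_le_tsum hle hs1.norm)

lemma one_le_norm_product_of_sq_eq_one {q1 q2 q3 : ℕ} {χ1 : DirichletCharacter ℂ q1}
    {χ2 : DirichletCharacter ℂ q2} {χ3 : DirichletCharacter ℂ q3} (h₁ : χ1 ^ 2 = 1) (h2 : χ2 ^ 2 = 1)
    (h3 : ∀ n : ℕ, χ3 n = χ1 n * χ2 n) {x : ℝ} (hx : 0 < x) :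
    1 ≤ ‖riemannZeta (1 + x) * LSeries (fun n => χ1 n) (1 + x) * LSeries (fun n => χ2 n) (1 + x) *
      LSeries (fun n => χ3 n) (1 + x)‖ := by
  have hre : 1 < ((1 : ℂ) + x).re := by simpa using hx
  have hp := (((riemannZeta_eulerProduct_hasProd hre).mul
    (DirichletCharacter.LSeries_eulerProduct_hasProd χ1 hre)).mul
    (DirichletCharacter.LSeries_eulerProduct_hasProd χ2 hre)).mul
    (DirichletCharacter.LSeries_eulerProduct_hasProd χ3 hre)
  refine ge_of_tendsto hp.norm (Filter.Eventually.of_forall fun s => ?_)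
  refine s.prod_induction _ (fun t : ℝ => 1 ≤ t) (fun a b ha hb => one_le_mul_of_one_le_of_one_le ha hb) le_rfl ?_
  intro p _
  have hval : ∀ {q : ℕ} {χ : DirichletCharacter ℂ q}, χ ^ 2 = 1 → ∀ n : ℕ, χ n = 0 ∨ χ n = 1 ∨ χ n = -1 := by
    intro q χ hχ n
    by_cases hu : IsUnit ((n : ZMod q))
    · right
      have h1 : (χ ^ 2) n = 1 := by rw [hχ]; exact MulChar.one_apply hu
      rw [MulChar.pow_apply' _ two_ne_zero] at h1
      exact mul_self_eq_one_iff.1 (by rwa [← sq])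
    · left; exact χ.map_nonunit hu
  have hp1 : (1 : ℝ) < p := by exact_mod_cast p.2.one_lt
  obtain ⟨y, hy0, hy1, hy⟩ : ∃ y : ℝ, 0 < y ∧ y < 1 ∧ ((p : ℕ) : ℂ) ^ (-(1 + x : ℂ)) = y := by
    refine ⟨(p : ℝ) ^ (-(1 + x)), by positivity, Real.rpow_lt_one_of_one_lt_of_neg hp1 (by linarith), ?_⟩
    rw [ofReal_cpow (by positivity)]
    push_cast; rfl
  rw [h3, hy]
  have key : ∀ t : ℝ, 0 < t → t ≤ 1 → ∀ z : ℂ, z = ((t⁻¹ : ℝ) : ℂ) → 1 ≤ ‖z‖ := by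
    intro t ht ht1 z hz
    rw [hz, norm_real, norm_of_nonneg (by positivity)]
    exact (one_le_inv₀ ht).2 ht1
  have hy2 : 0 < 1 - y := by linarith
  have hm : (1 - y) * (1 - y) ≤ 1 := by nlinarith
  have hs : (1 - y) * (1 + y) ≤ 1 := by nlinarith
  rcases hval h₁ p with h | h | h <;> rcases hval h2 p with h' | h' | h' <;> rw [h, h']
  · exact key (1 - y) hy2 (by linarith) _ (by push_cast; simp)
  · exact key ((1 - y) * (1 - y)) (by positivity) hm _ (by push_cast; simp)
  · exact key ((1 - y) * (1 + y)) (by positivity) hs _ (by push_cast; simp [mul_comm])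
  · exact key ((1 - y) * (1 - y)) (by positivity) hm _ (by push_cast; simp)
  · exact key ((1 - y) * (1 - y) * ((1 - y) * (1 - y))) (by positivity)
      (mul_le_one₀ hm (by positivity) hm) _ (by push_cast; simp; ring)
  · exact key ((1 - y) * (1 + y) * ((1 - y) * (1 + y))) (by positivity)
      (mul_le_one₀ hs (by positivity) hs) _ (by push_cast; simp; ring)
  · exact key ((1 - y) * (1 + y)) (by positivity) hs _ (by push_cast; simp [mul_comm])
  · exact key ((1 - y) * (1 + y) * ((1 - y) * (1 + y))) (by positivity)
      (mul_le_one₀ hs (by positivity) hs) _ (by push_cast; simp; ring)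
  · exact key ((1 - y) * (1 + y) * ((1 - y) * (1 + y))) (by positivity)
      (mul_le_one₀ hs (by positivity) hs) _ (by push_cast; simp; ring)

lemma exists_product_three_four_one : ∃ C : ℝ, 1 ≤ C ∧ ∀ (q : ℕ) [NeZero q]
    (χ : DirichletCharacter ℂ q), χ ^ 2 ≠ 1 → ∀ x : ℝ, 0 < x → x ≤ 1 / (8 * (1 + log q)) →
      1 ≤ (C / x) ^ 3 * ‖χ.LFunction (1 + x)‖ ^ 4 * (C * (1 + log q)) := by
  obtain ⟨C1, hC1, hζ⟩ := exists_norm_riemannZeta_le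
  obtain ⟨C2, hC2, hL⟩ := exists_LFunction_bounds
  refine ⟨max C1 C2, le_max_of_le_left hC1, ?_⟩
  intro q _ χ hχ x hx hxq
  have hℓ1 := one_le_one_add_log q
  set ℓ : ℝ := 1 + log q
  have hx1 : x ≤ 1 := by
    refine hxq.trans ?_
    rw [div_le_one (by positivity)]; linarith
  have hre : 1 < ((1 : ℂ) + x).re := by simpa using hx
  have h := DirichletCharacter.norm_LSeries_product_ge_one χ hx 0
  simp only [Complex.ofReal_zero, mul_zero, add_zero] at h
  rw [norm_mul, norm_mul, norm_pow, norm_pow, ← LFunction_eq_LSeries χ hre,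
    ← LFunction_eq_LSeries (χ ^ 2) hre] at h
  have h1 := (norm_LSeries_one_le (q := q) hx).trans (hζ x hx hx1)
  have h2 := (hL q (χ ^ 2) hχ).1 (1 + x) (by
    rw [add_sub_cancel_left, norm_real, norm_of_nonneg hx.le]
    refine hxq.trans ?_
    apply one_div_le_one_div_of_le <;> linarith)
  refine le_trans h ?_
  gcongr
  · exact h1.trans (by gcongr; exact le_max_left _ _)
  · exact h2.trans (by gcongr; exact le_max_right _ _)

lemma changeLevel_mul_changeLevel_apply {q1 q2 : ℕ} [NeZero q1] [NeZero q2]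
    (χ1 : DirichletCharacter ℂ q1) (χ2 : DirichletCharacter ℂ q2) (n : ℕ) :
    (changeLevel (dvd_mul_right q1 q2) χ1 *
      changeLevel (dvd_mul_left q2 q1) χ2) n = χ1 n * χ2 n := by
  rw [MulChar.mul_apply]
  by_cases h : n.Coprime (q1 * q2)
  · have h' : IsCoprime (n : ℤ) ((q1 * q2 : ℕ) : ℤ) := Nat.isCoprime_iff_coprime.2 h
    have e1 := DirichletCharacter.changeLevel_eq_cast_of_dvd' χ1 (dvd_mul_right q1 q2) h'
    have e2 := DirichletCharacter.changeLevel_eq_cast_of_dvd' χ2 (dvd_mul_left q2 q1) h'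
    push_cast at e1 e2
    rw [e1, e2]
  · have h0 : ¬ IsUnit ((n : ℕ) : ZMod (q1 * q2)) := by rwa [isUnit_iff_coprime]
    rw [MulChar.map_nonunit _ h0, zero_mul]
    rw [Nat.coprime_mul_iff_right, not_and_or] at h
    rcases h with h | h
    · rw [MulChar.map_nonunit χ1 (by rwa [isUnit_iff_coprime]), zero_mul]
    · rw [MulChar.map_nonunit χ2 (by rwa [isUnit_iff_coprime]), mul_zero]

lemma changeLevel_mul_changeLevel_ne_one {q1 q2 : ℕ} [NeZero q1] [NeZero q2]
    {χ1 : DirichletCharacter ℂ q1} {χ2 : DirichletCharacter ℂ q2}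
    (hp1 : χ1.IsPrimitive) (hp2 : χ2.IsPrimitive) (h1 : χ1 ^ 2 = 1)
    (hne : (⟨q1, χ1⟩ : Σ q, DirichletCharacter ℂ q) ≠ ⟨q2, χ2⟩) :
    changeLevel (dvd_mul_right q1 q2) χ1 *
      changeLevel (dvd_mul_left q2 q1) χ2 ≠ 1 := by
  intro h
  apply hne
  have hsq : (changeLevel (dvd_mul_right q1 q2) χ1) ^ 2 = 1 := by
    rw [← map_pow, h1, map_one]
  have heq : changeLevel (dvd_mul_right q1 q2) χ1 =
      changeLevel (dvd_mul_left q2 q1) χ2 := by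
    have := congrArg (changeLevel (dvd_mul_right q1 q2) χ1 * ·) h
    simp only [← mul_assoc, ← sq, mul_one] at this
    rw [hsq, one_mul] at this
    exact this.symm
  have hc := congrArg DirichletCharacter.conductor heq
  rw [DirichletCharacter.conductor_changeLevel, DirichletCharacter.conductor_changeLevel] at hc
  rw [DirichletCharacter.isPrimitive_def] at hp1 hp2
  rw [hp1, hp2] at hc
  subst hc
  congr 1
  exact DirichletCharacter.changeLevel_injective _ heq

lemma exists_product_pair : ∃ C : ℝ, 1 ≤ C ∧ ∀ (q1 q2 : ℕ) [NeZero q1] [NeZero q2]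
    (χ1 : DirichletCharacter ℂ q1) (χ2 : DirichletCharacter ℂ q2),
    χ1.IsPrimitive → χ2.IsPrimitive → χ1 ^ 2 = 1 → χ2 ^ 2 = 1 →
    (⟨q1, χ1⟩ : Σ q, DirichletCharacter ℂ q) ≠ ⟨q2, χ2⟩ →
    ∀ x : ℝ, 0 < x → x ≤ 1 / (8 * (1 + log (q1 * q2 : ℕ))) →
      1 ≤ (C / x) * ‖χ1.LFunction (1 + x)‖ * ‖χ2.LFunction (1 + x)‖ *
        (C * (1 + log (q1 * q2 : ℕ))) := by
  obtain ⟨C1, hC1, hζ⟩ := exists_norm_riemannZeta_le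
  obtain ⟨C2, hC2, hL⟩ := exists_LFunction_bounds
  refine ⟨max C1 C2, le_max_of_le_left hC1, ?_⟩
  intro q1 q2 _ _ χ1 χ2 hp1 hp2 h1 h₂ hne x hx hxq
  have : NeZero (q1 * q2) := ⟨mul_ne_zero (NeZero.ne _) (NeZero.ne _)⟩
  have hℓ1 := one_le_one_add_log (q1 * q2)
  set ℓ : ℝ := 1 + log (q1 * q2 : ℕ)
  have hx1 : x ≤ 1 := by
    refine hxq.trans ?_
    rw [div_le_one (by positivity)]; linarith
  have hre : 1 < ((1 : ℂ) + x).re := by simpa using hx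
  have h := one_le_norm_product_of_sq_eq_one h1 h₂ (changeLevel_mul_changeLevel_apply χ1 χ2) hx
  rw [norm_mul, norm_mul, norm_mul, ← LFunction_eq_LSeries χ1 hre,
    ← LFunction_eq_LSeries χ2 hre, ← LFunction_eq_LSeries _ hre] at h
  have h2 := (hL (q1 * q2) _ (changeLevel_mul_changeLevel_ne_one hp1 hp2 h1 hne)).1 (1 + x) (by
    rw [add_sub_cancel_left, norm_real, norm_of_nonneg hx.le]
    refine hxq.trans ?_
    apply one_div_le_one_div_of_le <;> linarith)
  refine le_trans h ?_
  gcongr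
  · exact (hζ x hx hx1).trans (by gcongr; exact le_max_left _ _)
  · exact h2.trans (by gcongr; exact le_max_right _ _)

lemma eventually_mul_log_pow_le (c : ℝ) (hc : 0 ≤ c) (k : ℕ) {a : ℝ} (ha : 0 < a) :
    ∀ᶠ x : ℝ in atTop, (c * (1 + log x)) ^ k ≤ x ^ a := by
  set b : ℝ := a / (2 * (k + 1)) with hb
  have hb0 : 0 < b := by positivity
  set K : ℝ := (c * (1 + 1 / b)) ^ k
  have h1 := (tendsto_rpow_atTop (half_pos ha)).eventually_ge_atTop K
  filter_upwards [h1, eventually_ge_atTop (1 : ℝ)] with x hx hx1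
  have hx0 : 0 < x := by linarith
  have hl0 : 0 ≤ log x := log_nonneg hx1
  have hl := Real.log_le_rpow_div hx0.le hb0
  have h1b : 1 ≤ x ^ b := Real.one_le_rpow hx1 hb0.le
  calc (c * (1 + log x)) ^ k ≤ (c * ((1 + 1 / b) * x ^ b)) ^ k := by
        gcongr
        rw [add_mul, one_mul, one_div, inv_mul_eq_div]; linarith
    _ = K * (x ^ b) ^ k := by rw [← mul_assoc, mul_pow]
    _ ≤ x ^ (a / 2) * x ^ (a / 2) := by
        gcongr
        rw [← Real.rpow_natCast, ← rpow_mul hx0.le]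
        apply rpow_le_rpow_of_exponent_le hx1
        rw [hb, div_mul_eq_mul_div, div_le_div_iff₀ (by positivity) (by positivity)]
        nlinarith
    _ = x ^ a := by rw [← rpow_add hx0]; congr 1; ring

lemma eventually_mul_log_succ_pow_le (c : ℝ) (hc : 0 ≤ c) (k : ℕ) {a : ℝ} (ha : 0 < a) :
    ∀ᶠ L : ℕ in atTop, (c * (1 + log (L + 1))) ^ k ≤ (L : ℝ) ^ a := by
  have h := tendsto_natCast_atTop_atTop (R := ℝ) |>.eventually
    (eventually_mul_log_pow_le (2 * c) (by positivity) k ha)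
  filter_upwards [h, eventually_ge_atTop 2] with L hL hL2
  have hL' : (2 : ℝ) ≤ L := by exact_mod_cast hL2
  refine le_trans ?_ hL
  have h1 : log (L + 1) ≤ 2 * log L := by
    rw [show 2 * log L = log (L ^ 2) by rw [log_pow]; norm_num]
    apply log_le_log <;> nlinarith
  have h2 : 0 ≤ log (L + 1) := log_nonneg (by linarith)
  refine pow_le_pow_left₀ (by positivity) ?_ k
  nlinarith

/-- Infinitely many scales have no exceptional characters of small conductor. -/
theorem frequently_le_norm_LFunction_one (B : ℕ) : ∃ᶠ L : ℕ in atTop,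
    ∀ (r : ℕ) [NeZero r], r ≤ L ^ B → ∀ χ : DirichletCharacter ℂ r, χ.IsPrimitive → χ ≠ 1 →
      (L : ℝ) ^ (-(1 / 2) : ℝ) ≤ ‖χ.LFunction 1‖ := by
  intro hev
  obtain ⟨C1, hC1, hL⟩ := exists_LFunction_bounds
  obtain ⟨C2, hC2, h341⟩ := exists_product_three_four_one
  obtain ⟨C3, hC3, hpair⟩ := exists_product_pair
  set C := max C1 (max C2 C3)
  have hCC₁ : C1 ≤ C := le_max_left _ _
  have hCC₂ : C2 ≤ C := (le_max_left _ _).trans (le_max_right _ _)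
  have hCC₃ : C3 ≤ C := (le_max_right _ _).trans (le_max_right _ _)
  have hC4 : 4 ≤ C := hC1.trans hCC₁
  have hlog := eventually_mul_log_succ_pow_le (32 * C * (2 * B + 1)) (by positivity) 9
    (show (0 : ℝ) < 1 / 4 by norm_num)
  obtain ⟨L0, hL0⟩ := eventually_atTop.1 ((hev.and hlog).and (eventually_ge_atTop 2))
  -- facts at a given scale
  set lam : ℕ → ℝ := fun L => 1 + 2 * B * log (L + 1) with hlam
  have hlam1 : ∀ L, 1 ≤ lam L := by
    intro L
    have : 0 ≤ log ((L : ℝ) + 1) := log_nonneg (by linarith [cast_nonneg (α := ℝ) L])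
    simp only [hlam]
    have : 0 ≤ 2 * (B : ℝ) * log (L + 1) := by positivity
    linarith
  have hlamC : ∀ L, L0 ≤ L → 16 * C ^ 8 * lam L ^ 9 * (L : ℝ) ^ (-(1 / 2) : ℝ) < 1 := by
    intro L hLL
    have h2 : (2 : ℝ) ≤ L := by exact_mod_cast (hL0 L hLL).2
    have h0 : 0 ≤ log ((L : ℝ) + 1) := log_nonneg (by linarith)
    have h := (hL0 L hLL).1.2
    have h3 : 16 * C ^ 8 * lam L ^ 9 ≤ (32 * C * (2 * B + 1) * (1 + log (L + 1))) ^ 9 := by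
      have : lam L ≤ (2 * B + 1) * (1 + log (L + 1)) := by
        simp only [hlam]; nlinarith [cast_nonneg (α := ℝ) B]
      calc 16 * C ^ 8 * lam L ^ 9 ≤ 32 ^ 9 * C ^ 9 * ((2 * B + 1) * (1 + log (L + 1))) ^ 9 := by
            have hl := hlam1 L
            have : C ^ 8 ≤ C ^ 9 := pow_le_pow_right₀ (by linarith) (by norm_num)
            gcongr; norm_num
        _ = _ := by ring
    calc _ ≤ (L : ℝ) ^ (1 / 4 : ℝ) * (L : ℝ) ^ (-(1 / 2) : ℝ) := by gcongr; exact h3.trans h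
      _ = (L : ℝ) ^ (-(1 / 4) : ℝ) := by rw [← rpow_add (by linarith)]; norm_num
      _ < 1 := Real.rpow_lt_one_of_one_lt_of_neg (by linarith) (by norm_num)
  have hx8 : ∀ L, L0 ≤ L → ∀ q : ℝ, 1 ≤ q → q ≤ lam L → (L : ℝ) ^ (-(1 / 2) : ℝ) ≤ 1 / (8 * q) := by
    intro L hLL q hq1 hq
    have h := (hlamC L hLL).le
    have hl := hlam1 L
    have h1 : lam L ≤ lam L ^ 9 := le_self_pow₀ hl (by norm_num)
    have h2 : 1 ≤ C ^ 8 := one_le_pow₀ (by linarith)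
    have h3 : 0 ≤ (L : ℝ) ^ (-(1 / 2) : ℝ) := by positivity
    rw [le_div_iff₀ (by positivity)]
    calc (L : ℝ) ^ (-(1 / 2) : ℝ) * (8 * q) ≤ (L : ℝ) ^ (-(1 / 2) : ℝ) * (16 * C ^ 8 * lam L ^ 9) := by
          refine mul_le_mul_of_nonneg_left ?_ h3
          calc 8 * q ≤ 16 * 1 * lam L ^ 9 := by linarith
            _ ≤ 16 * C ^ 8 * lam L ^ 9 := by gcongr
      _ ≤ 1 := by linarith
  have hval : ∀ L, L0 ≤ L → ∀ (r : ℕ) [NeZero r], 1 + log r ≤ lam L →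
      ∀ χ : DirichletCharacter ℂ r, χ ≠ 1 → ‖χ.LFunction 1‖ < (L : ℝ) ^ (-(1 / 2) : ℝ) →
      ‖χ.LFunction (1 + ((L : ℝ) ^ (-(1 / 2) : ℝ) : ℝ))‖ ≤ 2 * C * lam L ^ 2 * (L : ℝ) ^ (-(1 / 2) : ℝ) := by
    intro L hLL r _ hr χ hχ hlt
    set x := (L : ℝ) ^ (-(1 / 2) : ℝ)
    have hx0 : 0 ≤ x := by positivity
    have hr1 := one_le_one_add_log r
    have h := (hL r χ hχ).2.2 (1 + (x : ℂ)) (by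
      rw [add_sub_cancel_left, norm_real, norm_of_nonneg hx0]
      exact hx8 L hLL _ hr1 hr)
    rw [add_sub_cancel_left, norm_real, norm_of_nonneg hx0] at h
    have h2 := norm_le_norm_add_norm_sub' (χ.LFunction (1 + x)) (χ.LFunction 1)
    have h3 : C1 * (1 + log r) ^ 2 * x ≤ C * lam L ^ 2 * x := by gcongr
    have h4 : x ≤ C * lam L ^ 2 * x := by
      have : 1 ≤ C * lam L ^ 2 := one_le_mul_of_one_le_of_one_le (by linarith) (one_le_pow₀ (hlam1 L))
      nlinarith
    calc _ ≤ _ := h2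
      _ ≤ x + C1 * (1 + log r) ^ 2 * x := by linarith
      _ ≤ _ := by linarith
  -- choose a bad character at each scale
  have hloglam : ∀ L r : ℕ, 0 < r → r ≤ (L + 1) ^ (2 * B) → 1 + log r ≤ lam L := by
    intro L r hr0 hr
    have h1 : log r ≤ log (((L : ℝ) + 1) ^ (2 * B)) := by
      apply log_le_log (by exact_mod_cast hr0)
      exact_mod_cast hr
    rw [log_pow] at h1
    push_cast at h1
    simp only [hlam]; linarith
  have hpowB : ∀ L r : ℕ, r ≤ (L + 1) ^ B → r ≤ (L + 1) ^ (2 * B) := by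
    intro L r hr
    exact hr.trans (Nat.pow_le_pow_right (by omega) (by omega))
  have hbad : ∀ L : ℕ, L0 ≤ L → ∃ X : Σ q, DirichletCharacter ℂ q, ∃ h : NeZero X.1, X.1 ≤ L ^ B ∧
      X.2.IsPrimitive ∧ X.2 ≠ 1 ∧ X.2 ^ 2 = 1 ∧ ‖X.2.LFunction 1‖ < (L : ℝ) ^ (-(1 / 2) : ℝ) := by
    intro L hLL
    have h := (hL0 L hLL).1.1
    have h2 : (2 : ℝ) ≤ L := by exact_mod_cast (hL0 L hLL).2
    push Not at h
    obtain ⟨r, hr, hrL, χ, hprim, hne, hlt⟩ := h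
    refine ⟨⟨r, χ⟩, hr, hrL, hprim, hne, ?_, hlt⟩
    by_contra hsq
    have hrl : 1 + log r ≤ lam L := hloglam L r (pos_of_ne_zero hr.out)
      (hpowB L r (hrL.trans (Nat.pow_le_pow_left (by omega) _)))
    have hr1 := one_le_one_add_log r
    have hx0 : 0 < (L : ℝ) ^ (-(1 / 2) : ℝ) := by positivity
    have h1 := h341 r χ hsq _ hx0 (hx8 L hLL _ hr1 hrl)
    have h3 := hval L hLL r hrl χ hne hlt
    have h4 := hlamC L hLL
    set x := (L : ℝ) ^ (-(1 / 2) : ℝ)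
    have h5 : (C2 / x) ^ 3 * ‖χ.LFunction (1 + (x : ℂ))‖ ^ 4 * (C2 * (1 + log r)) ≤
        (C / x) ^ 3 * (2 * C * lam L ^ 2 * x) ^ 4 * (C * lam L) := by gcongr
    have h6 : (C / x) ^ 3 * (2 * C * lam L ^ 2 * x) ^ 4 * (C * lam L) = 16 * C ^ 8 * lam L ^ 9 * x := by
      field_simp; ring
    linarith
  choose! X hX0 hX using hbad
  by_cases hcase : ∃ L, L0 ≤ L ∧ X L ≠ X (L + 1)
  · obtain ⟨L, hLL, hne⟩ := hcase
    have h2 : (2 : ℝ) ≤ L := by exact_mod_cast (hL0 L hLL).2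
    have i1 := hX0 L hLL
    have i2 := hX0 (L + 1) (by omega)
    obtain ⟨a1, a2, a3, a4, a5⟩ := hX L hLL
    obtain ⟨b1, b2, b3, b4, b5⟩ := hX (L + 1) (by omega)
    set χ1 := (X L).2
    set χ2 := (X (L + 1)).2
    have c1 : 0 < (X L).1 := pos_of_ne_zero i1.out
    have c2 : 0 < (X (L + 1)).1 := pos_of_ne_zero i2.out
    have a1' : (X L).1 ≤ (L + 1) ^ B := a1.trans (Nat.pow_le_pow_left (by omega) _)
    have d1 := hloglam L _ c1 (hpowB L _ a1')
    have d2 := hloglam L _ c2 (hpowB L _ b1)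
    have d3 : 1 + log ((X L).1 * (X (L + 1)).1 : ℕ) ≤ lam L := by
      refine hloglam L _ (by positivity) ?_
      rw [two_mul, pow_add]
      exact Nat.mul_le_mul a1' b1
    have hmono : ((L + 1 : ℕ) : ℝ) ^ (-(1 / 2) : ℝ) ≤ (L : ℝ) ^ (-(1 / 2) : ℝ) :=
      rpow_le_rpow_of_nonpos (by linarith) (by push_cast; linarith) (by norm_num)
    have e1 := hval L hLL _ d1 χ1 a3 a5
    have e2 := hval L hLL _ d2 χ2 b3 (b5.trans_le hmono)
    have inz : NeZero ((X L).1 * (X (L + 1)).1) := ⟨by positivity⟩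
    have hr1 := one_le_one_add_log ((X L).1 * (X (L + 1)).1)
    have hx0 : 0 < (L : ℝ) ^ (-(1 / 2) : ℝ) := by positivity
    have h1 := hpair _ _ χ1 χ2 a2 b2 a4 b4 hne _ hx0 (hx8 L hLL _ hr1 d3)
    have h4 := hlamC L hLL
    set x := (L : ℝ) ^ (-(1 / 2) : ℝ)
    have hl := hlam1 L
    have h5 : (C3 / x) * ‖χ1.LFunction (1 + (x : ℂ))‖ * ‖χ2.LFunction (1 + (x : ℂ))‖ *
        (C3 * (1 + log ((X L).1 * (X (L + 1)).1 : ℕ))) ≤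
        (C / x) * (2 * C * lam L ^ 2 * x) * (2 * C * lam L ^ 2 * x) * (C * lam L) := by gcongr
    have h6 : (C / x) * (2 * C * lam L ^ 2 * x) * (2 * C * lam L ^ 2 * x) * (C * lam L) =
        4 * C ^ 4 * lam L ^ 5 * x := by
      field_simp; norm_num
    have h7 : 4 * C ^ 4 * lam L ^ 5 * x ≤ 16 * C ^ 8 * lam L ^ 9 * x := by
      have : C ^ 4 ≤ C ^ 8 := pow_le_pow_right₀ (by linarith) (by norm_num)
      have : lam L ^ 5 ≤ lam L ^ 9 := pow_le_pow_right₀ hl (by norm_num)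
      gcongr; norm_num
    linarith
  · push Not at hcase
    have hconst : ∀ n, X (L0 + n) = X L0 := by
      intro n
      induction n with
      | zero => rfl
      | succ n ih => rw [← ih, ← add_assoc]; exact (hcase (L0 + n) (by omega)).symm
    have i0 := hX0 L0 le_rfl
    obtain ⟨-, -, a3, -, -⟩ := hX L0 le_rfl
    have hpos : 0 < ‖(X L0).2.LFunction 1‖ := by
      rw [norm_pos_iff]
      exact DirichletCharacter.LFunction_apply_one_ne_zero a3
    have hlt : ∀ n, ‖(X L0).2.LFunction 1‖ < ((L0 + n : ℕ) : ℝ) ^ (-(1 / 2) : ℝ) := by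
      intro n
      have i := hX0 (L0 + n) (by omega)
      have h := (hX (L0 + n) (by omega)).2.2.2.2
      have key : ∀ Y : Σ q, DirichletCharacter ℂ q, ∀ i : NeZero Y.1, Y = X L0 →
          ‖Y.2.LFunction 1‖ = ‖(X L0).2.LFunction 1‖ := by
        rintro Y i rfl; rfl
      rwa [key _ i (hconst n)] at h
    have ht : Tendsto (fun n : ℕ => ((L0 + n : ℕ) : ℝ) ^ (-(1 / 2) : ℝ)) atTop (nhds 0) := by
      refine (tendsto_rpow_neg_atTop (by norm_num)).comp ?_
      exact tendsto_natCast_atTop_atTop.comp (tendsto_add_atTop_nat L0 |>.congr (fun n => add_comm _ _))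
    have := ge_of_tendsto ht (Eventually.of_forall fun n => (hlt n).le)
    linarith

lemma sum_Ioc_mul_eq_abel (X0 N : ℕ) (w : ℕ → ℝ) (a : ℕ → ℂ) :
    ∑ n ∈ Ioc X0 (X0 + N), (w n : ℂ) * a n =
      w (X0 + N) * ∑ n ∈ Ioc X0 (X0 + N), a n +
        ∑ n ∈ Ico X0 (X0 + N), ((w n - w (n + 1) : ℝ) : ℂ) * ∑ m ∈ Ioc X0 n, a m := by
  induction N with
  | zero => simp
  | succ N ih =>
    rw [← add_assoc, sum_Ioc_succ_top (by omega), sum_Ioc_succ_top (by omega),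
      sum_Ico_succ_top (by omega), ih]
    push_cast
    ring

lemma sum_Ico_sub_mul_eq (X0 N : ℕ) (w : ℕ → ℝ) :
    w (X0 + N) * ((X0 + N : ℕ) : ℝ) + ∑ n ∈ Ico X0 (X0 + N), (w n - w (n + 1)) * n =
      X0 * w X0 + ∑ n ∈ Ioc X0 (X0 + N), w n := by
  induction N with
  | zero => simp [mul_comm]
  | succ N ih =>
    rw [← add_assoc, sum_Ioc_succ_top (by omega), sum_Ico_succ_top (by omega),
      ← add_assoc]
    push_cast at ih ⊢
    linarith

/-- Partial summation against an antitone weight, summed over a family of sequences. -/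
lemma sum_norm_sum_mul_le_of_antitone {ι : Type*} (s : Finset ι) (a : ι → ℕ → ℂ) {w : ℕ → ℝ}
    {X0 X1 : ℕ} (hX : X0 ≤ X1) (hw0 : ∀ n, 0 ≤ w n) (hw : ∀ n, X0 ≤ n → w (n + 1) ≤ w n) {E : ℝ}
    (hE : 0 ≤ E)
    (h : ∀ y ∈ Ioc X0 X1, ∑ i ∈ s, ‖∑ n ∈ Ioc X0 y, a i n‖ ≤ E * y) :
    ∑ i ∈ s, ‖∑ n ∈ Ioc X0 X1, (w n : ℂ) * a i n‖ ≤
      E * (X0 * w X0 + ∑ n ∈ Ioc X0 X1, w n) := by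
  obtain ⟨N, rfl⟩ := Nat.exists_eq_add_of_le hX
  have h' : ∀ y, X0 ≤ y → y ≤ X0 + N → ∑ i ∈ s, ‖∑ n ∈ Ioc X0 y, a i n‖ ≤ E * y := by
    intro y hy hy'
    rcases hy.eq_or_lt with rfl | hlt
    · simp; positivity
    · exact h y (mem_Ioc.mpr ⟨hlt, hy'⟩)
  calc ∑ i ∈ s, ‖∑ n ∈ Ioc X0 (X0 + N), (w n : ℂ) * a i n‖
      ≤ ∑ i ∈ s, (w (X0 + N) * ‖∑ n ∈ Ioc X0 (X0 + N), a i n‖ +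
        ∑ n ∈ Ico X0 (X0 + N), (w n - w (n + 1)) * ‖∑ m ∈ Ioc X0 n, a i m‖) := by
        refine sum_le_sum fun i _ => ?_
        rw [sum_Ioc_mul_eq_abel]
        refine (norm_add_le _ _).trans (add_le_add ?_ ((norm_sum_le _ _).trans ?_))
        · rw [norm_mul, norm_real, norm_of_nonneg (hw0 _)]
        · refine sum_le_sum fun n hn => ?_
          rw [norm_mul, norm_real,
            norm_of_nonneg (sub_nonneg.mpr (hw n (mem_Ico.mp hn).1))]
    _ = w (X0 + N) * ∑ i ∈ s, ‖∑ n ∈ Ioc X0 (X0 + N), a i n‖ +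
        ∑ n ∈ Ico X0 (X0 + N), (w n - w (n + 1)) *
          ∑ i ∈ s, ‖∑ m ∈ Ioc X0 n, a i m‖ := by
        rw [sum_add_distrib, mul_sum, sum_comm]
        simp_rw [mul_sum]
    _ ≤ w (X0 + N) * (E * ((X0 + N : ℕ) : ℝ)) +
        ∑ n ∈ Ico X0 (X0 + N), (w n - w (n + 1)) * (E * n) := by
        refine add_le_add (mul_le_mul_of_nonneg_left (h' _ hX le_rfl) (hw0 _))
          (sum_le_sum fun n hn => ?_)
        obtain ⟨h1, h2⟩ := mem_Ico.mp hn
        exact mul_le_mul_of_nonneg_left (h' n h1 h2.le) (sub_nonneg.mpr (hw n h1))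
    _ = E * (X0 * w X0 + ∑ n ∈ Ioc X0 (X0 + N), w n) := by
        rw [← sum_Ico_sub_mul_eq, mul_add, mul_sum]
        congr 1
        · ring
        · exact sum_congr rfl fun n _ => by ring

/-- The unnormalised weight `(log n)^J n^{-(1+δ)}`. -/
noncomputable def logPowWeight (J : ℕ) (δ : ℝ) (n : ℕ) : ℝ :=
  log n ^ J * (n : ℝ) ^ (-(1 + δ))

lemma logPowWeight_nonneg (J : ℕ) (δ : ℝ) (n : ℕ) : 0 ≤ logPowWeight J δ n :=
  mul_nonneg (pow_nonneg (log_natCast_nonneg n) _) (by positivity)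

lemma logPowWeight_eq (J : ℕ) (δ δ' : ℝ) {n : ℕ} (hn : 0 < n) :
    logPowWeight J δ n = exp ((δ' - δ) * log n) * logPowWeight J δ' n := by
  have h0 : (0 : ℝ) < n := by exact_mod_cast hn
  unfold logPowWeight
  rw [rpow_def_of_pos h0, rpow_def_of_pos h0, mul_left_comm, ← exp_add]
  congr 2; ring

/-- Outside the bulk range the weight is dominated by weights with shifted exponents. -/
lemma logPowWeight_le_of_notMem {J L : ℕ} (hL : 0 < L) {ε δ : ℝ} (hε : 0 < ε)
    (hδ : δ = J / L) {n : ℕ} (hn : 0 < n)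
    (hmem : n ∉ Ioc ⌊exp ((1 - ε) * L)⌋₊ ⌊exp ((1 + ε) * L)⌋₊) :
    logPowWeight J δ n ≤
      exp (-((1 + ε) * ε / 2 * J)) * logPowWeight J ((1 - ε / 2) * δ) n +
      exp ((1 - ε) * ε / 2 * J) * logPowWeight J ((1 + ε / 2) * δ) n := by
  have h0 : (0 : ℝ) < n := by exact_mod_cast hn
  have hδ0 : 0 ≤ δ := by rw [hδ]; positivity
  have hJ : δ * L = J := by rw [hδ]; field_simp
  rw [mem_Ioc, not_and_or, not_lt, not_le] at hmem
  rcases hmem with h | h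
  · have h1 : log n ≤ (1 - ε) * L := by
      rw [log_le_iff_le_exp h0]
      exact (cast_le.mpr h).trans (floor_le (exp_pos _).le)
    rw [logPowWeight_eq J δ ((1 + ε / 2) * δ) hn]
    refine le_add_of_nonneg_of_le (mul_nonneg (exp_pos _).le (logPowWeight_nonneg _ _ _))
      (mul_le_mul_of_nonneg_right (exp_le_exp.mpr ?_) (logPowWeight_nonneg _ _ _))
    rw [← hJ]
    have := mul_le_mul_of_nonneg_left h1 (by positivity : 0 ≤ ε / 2 * δ)
    nlinarith
  · have h1 : (1 + ε) * L ≤ log n := by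
      rw [le_log_iff_exp_le h0]
      exact ((Nat.floor_lt (exp_pos _).le).mp h).le
    rw [logPowWeight_eq J δ ((1 - ε / 2) * δ) hn]
    refine le_add_of_le_of_nonneg (mul_le_mul_of_nonneg_right (exp_le_exp.mpr ?_)
      (logPowWeight_nonneg _ _ _)) (mul_nonneg (exp_pos _).le (logPowWeight_nonneg _ _ _))
    rw [← hJ]
    have := mul_le_mul_of_nonneg_left h1 (by positivity : 0 ≤ ε / 2 * δ)
    nlinarith

lemma rankin_factor_le {J : ℕ} {ε δ : ℝ} (hε : 0 < ε) (hε1 : ε ≤ 1 / 2) (hδ : 0 < δ) :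
    (exp (-((1 + ε) * ε / 2 * J)) * (2 * J.factorial / ((1 - ε / 2) * δ) ^ (J + 1)) +
      exp ((1 - ε) * ε / 2 * J) * (2 * J.factorial / ((1 + ε / 2) * δ) ^ (J + 1))) *
        (δ ^ (J + 1) / J.factorial) ≤ 8 * exp (-(ε ^ 2 / 4 * J)) := by
  have e1 : (0 : ℝ) < 1 - ε / 2 := by linarith
  have e2 : (0 : ℝ) < 1 + ε / 2 := by linarith
  have h1 : ((1 - ε / 2) ^ (J + 1))⁻¹ ≤ 2 * exp ((ε / 2 + ε ^ 2 / 4) * J) := by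
    have h2 : exp (-(ε / 2 + ε ^ 2 / 4)) ≤ 1 - ε / 2 := by
      have h3 := Real.quadratic_le_exp_of_nonneg (x := ε / 2 + ε ^ 2 / 4) (by positivity)
      rw [exp_neg]
      refine (inv_anti₀ (by positivity) h3).trans ?_
      rw [inv_le_iff_one_le_mul₀ (by positivity)]
      have h4 : (1 - ε / 2) * (1 + (ε / 2 + ε ^ 2 / 4) + (ε / 2 + ε ^ 2 / 4) ^ 2 / 2) - 1 =
        ε ^ 2 / 8 * (1 - ε / 2 - ε ^ 2 / 4 - ε ^ 3 / 8) := by ring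
      have h5 : 0 ≤ 1 - ε / 2 - ε ^ 2 / 4 - ε ^ 3 / 8 := by
        have : ε ^ 2 ≤ (1 / 2) ^ 2 := by gcongr
        have : ε ^ 3 ≤ (1 / 2) ^ 3 := by gcongr
        linarith
      have := mul_nonneg (by positivity : 0 ≤ ε ^ 2 / 8) h5
      linarith
    rw [pow_succ, mul_inv, mul_comm]
    refine mul_le_mul ?_ ?_ (by positivity) (by norm_num)
    · rw [inv_le_comm₀ e1 (by norm_num)]; linarith
    · rw [← inv_pow]
      calc ((1 - ε / 2)⁻¹) ^ J ≤ (exp (ε / 2 + ε ^ 2 / 4)) ^ J := by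
            refine pow_le_pow_left₀ (by positivity) ?_ _
            rw [inv_le_comm₀ e1 (exp_pos _), ← exp_neg]; exact h2
        _ = _ := by rw [← exp_nat_mul]; ring_nf
  have h2 : ((1 + ε / 2) ^ (J + 1))⁻¹ ≤ 2 * exp (-(ε / 2 - ε ^ 2 / 4) * J) := by
    have h2 : exp (ε / 2 - ε ^ 2 / 4) ≤ 1 + ε / 2 := by
      have h3 := add_one_le_exp (-(ε / 2 - ε ^ 2 / 4))
      have h4 : (0 : ℝ) < -(ε / 2 - ε ^ 2 / 4) + 1 := by nlinarith
      have h5 : exp (ε / 2 - ε ^ 2 / 4) = (exp (-(ε / 2 - ε ^ 2 / 4)))⁻¹ := by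
        rw [← exp_neg, neg_neg]
      rw [h5]
      refine (inv_anti₀ h4 h3).trans ?_
      rw [inv_le_iff_one_le_mul₀ h4]
      nlinarith [mul_pos hε hε, mul_pos (mul_pos hε hε) hε]
    rw [pow_succ, mul_inv, mul_comm]
    refine mul_le_mul ?_ ?_ (by positivity) (by norm_num)
    · rw [inv_le_comm₀ e2 (by norm_num)]; linarith
    · rw [← inv_pow]
      calc ((1 + ε / 2)⁻¹) ^ J ≤ (exp (-(ε / 2 - ε ^ 2 / 4))) ^ J := by
            refine pow_le_pow_left₀ (by positivity) ?_ _
            rw [exp_neg]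
            exact inv_anti₀ (exp_pos _) h2
        _ = _ := by rw [← exp_nat_mul]; ring_nf
  have h3 : (exp (-((1 + ε) * ε / 2 * J)) * (2 * J.factorial / ((1 - ε / 2) * δ) ^ (J + 1)) +
      exp ((1 - ε) * ε / 2 * J) * (2 * J.factorial / ((1 + ε / 2) * δ) ^ (J + 1))) *
        (δ ^ (J + 1) / J.factorial) =
      2 * (exp (-((1 + ε) * ε / 2 * J)) * ((1 - ε / 2) ^ (J + 1))⁻¹) +
      2 * (exp ((1 - ε) * ε / 2 * J) * ((1 + ε / 2) ^ (J + 1))⁻¹) := by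
    rw [mul_pow, mul_pow]
    field_simp
  rw [h3]
  have h4 : exp (-((1 + ε) * ε / 2 * J)) * ((1 - ε / 2) ^ (J + 1))⁻¹ ≤
      2 * exp (-(ε ^ 2 / 4 * J)) := by
    refine (mul_le_mul_of_nonneg_left h1 (exp_pos _).le).trans (le_of_eq ?_)
    rw [mul_left_comm, ← exp_add]; ring_nf
  have h5 : exp ((1 - ε) * ε / 2 * J) * ((1 + ε / 2) ^ (J + 1))⁻¹ ≤
      2 * exp (-(ε ^ 2 / 4 * J)) := by
    refine (mul_le_mul_of_nonneg_left h2 (exp_pos _).le).trans (le_of_eq ?_)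
    rw [mul_left_comm, ← exp_add]; ring_nf
  linarith

/-- Truncating a sum against the weight to the bulk range costs little. -/
lemma norm_tsum_sub_sum_Ioc_le {J L : ℕ} (hJ : 0 < J) (hL : 0 < L) {ε δ : ℝ} (hε : 0 < ε)
    (hε1 : ε ≤ 1 / 2) (hδ : δ = J / L) {f : ℕ → ℂ} {g : ℕ → ℝ} (hfg : ∀ n, ‖f n‖ ≤ g n) {δ0 : ℝ}
    (hδ₀ : 2 * δ ≤ δ0)
    (hg : ∀ δ' : ℝ, 0 < δ' → δ' ≤ δ0 → Summable (fun n => g n * logPowWeight J δ' n) ∧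
      ∑' n, g n * logPowWeight J δ' n ≤ 2 * J.factorial / δ' ^ (J + 1)) :
    ‖∑' n, f n * (logPowWeight J δ n : ℂ) -
      ∑ n ∈ Ioc ⌊exp ((1 - ε) * L)⌋₊ ⌊exp ((1 + ε) * L)⌋₊,
        f n * (logPowWeight J δ n : ℂ)‖ * (δ ^ (J + 1) / J.factorial) ≤
      8 * exp (-(ε ^ 2 / 4 * J)) := by
  have hδ0 : 0 < δ := by rw [hδ]; positivity
  have hg0 : ∀ n, 0 ≤ g n := fun n => (norm_nonneg _).trans (hfg n)
  set S := Ioc ⌊exp ((1 - ε) * L)⌋₊ ⌊exp ((1 + ε) * L)⌋₊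
  obtain ⟨s0, -⟩ := hg δ hδ0 (by linarith)
  obtain ⟨s1, b1⟩ := hg ((1 - ε / 2) * δ) (mul_pos (by linarith) hδ0) (by nlinarith)
  obtain ⟨s2, b2⟩ := hg ((1 + ε / 2) * δ) (by positivity) (by nlinarith)
  have hnorm : ∀ n, ‖f n * (logPowWeight J δ n : ℂ)‖ ≤ g n * logPowWeight J δ n := by
    intro n
    rw [norm_mul, norm_real, norm_of_nonneg (logPowWeight_nonneg _ _ _)]
    exact mul_le_mul_of_nonneg_right (hfg n) (logPowWeight_nonneg _ _ _)
  have hs : Summable fun n => f n * (logPowWeight J δ n : ℂ) :=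
    Summable.of_norm_bounded s0 hnorm
  refine le_trans (mul_le_mul_of_nonneg_right ?_ (by positivity))
    (rankin_factor_le (J := J) hε hε1 hδ0)
  have hS := (hasSum_sum_of_ne_finset_zero (L := .unconditional ℕ) (f := fun n => if n ∈ S then
    f n * (logPowWeight J δ n : ℂ) else 0) (s := S) (fun n hn => by simp [hn]))
  rw [sum_congr rfl (fun n hn => if_pos hn)] at hS
  rw [← hS.tsum_eq, ← hs.tsum_sub hS.summable]
  have s3 := (s1.mul_left (exp (-((1 + ε) * ε / 2 * J)))).add
    (s2.mul_left (exp ((1 - ε) * ε / 2 * J)))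
  refine (tsum_of_norm_bounded (f := fun n => f n * (logPowWeight J δ n : ℂ) -
    if n ∈ S then f n * (logPowWeight J δ n : ℂ) else 0) s3.hasSum ?_).trans ?_
  · intro n
    by_cases hn : n ∈ S
    · simp only [hn, if_true, sub_self, norm_zero]
      exact add_nonneg (mul_nonneg (exp_pos _).le (mul_nonneg (hg0 _) (logPowWeight_nonneg _ _ _)))
        (mul_nonneg (exp_pos _).le (mul_nonneg (hg0 _) (logPowWeight_nonneg _ _ _)))
    · simp only [hn, if_false, sub_zero]
      refine (hnorm n).trans ?_
      rcases eq_zero_or_pos n with rfl | hn0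
      · simp [logPowWeight, hJ.ne']
      · have := mul_le_mul_of_nonneg_left
          (logPowWeight_le_of_notMem hL hε hδ hn0 hn) (hg0 n)
        linarith
  · rw [(s1.mul_left _).tsum_add (s2.mul_left _), tsum_mul_left, tsum_mul_left]
    gcongr

lemma summable_and_abs_tsum_sub_le {g : ℕ → ℝ}
    (hf : ∀ s : ℂ, 1 < s.re → LSeriesSummable (fun n => (g n : ℂ)) s)
    {G : ℂ → ℂ} {R M δ : ℝ} (hR : 0 < R)
    (hG : DifferentiableOn ℂ G (Metric.ball 1 R)) (hM : ∀ z ∈ Metric.ball (1 : ℂ) R, ‖G z‖ ≤ M)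
    (hfG : ∀ s : ℂ, 1 < s.re → s ∈ Metric.ball (1 : ℂ) R →
      LSeries (fun n => (g n : ℂ)) s = (s - 1)⁻¹ + G s)
    (hδ : 0 < δ) (hδR : δ ≤ R / 4) (J : ℕ) :
    Summable (fun n => g n * logPowWeight J δ n) ∧
      |∑' n, g n * logPowWeight J δ n - J.factorial / δ ^ (J + 1)| ≤
        J.factorial / δ ^ (J + 1) * (M * δ) := by
  have hs := (hasSum_log_pow_mul_rpow hf J hδ).summable
  have hs' : Summable fun n => ((g n * logPowWeight J δ n : ℝ) : ℂ) := by
    refine hs.congr fun n => ?_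
    exact (ofReal_mul _ _).symm
  have hM0 : 0 ≤ M := (norm_nonneg _).trans (hM 1 (Metric.mem_ball_self hR))
  refine ⟨Complex.summable_ofReal.mp hs', ?_⟩
  have h := norm_tsum_log_pow_sub_le hf hR hG hM hfG hδ hδR J
  have h1 : ∑' n : ℕ, (g n : ℂ) * (((log n) ^ J * (n : ℝ) ^ (-(1 + δ)) : ℝ) : ℂ) =
      ((∑' n, g n * logPowWeight J δ n : ℝ) : ℂ) := by
    rw [ofReal_tsum]
    refine tsum_congr fun n => ?_
    exact (ofReal_mul _ _).symm
  rw [h1, ← ofReal_sub, norm_real, norm_eq_abs] at h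
  refine h.trans ?_
  have h2 : (J.factorial : ℝ) / δ ^ (J + 1) * (M * δ) = J.factorial * (M * (1 / δ) ^ J) := by
    rw [one_div, inv_pow, pow_succ]
    field_simp
  rw [h2]
  have h3 : 2 / R ≤ 1 / δ := by
    rw [div_le_div_iff₀ hR hδ]; linarith
  gcongr

lemma exists_tsum_logPowWeight_bounds : ∃ M δ0 : ℝ, 0 < M ∧ 0 < δ0 ∧ δ0 * M ≤ 1 ∧
    ∀ g : ℕ → ℝ, (g = (fun _ => 1) ∨ g = fun n => Λ n) →
      ∀ δ : ℝ, 0 < δ → δ ≤ δ0 → ∀ J : ℕ, Summable (fun n => g n * logPowWeight J δ n) ∧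
      |∑' n, g n * logPowWeight J δ n - J.factorial / δ ^ (J + 1)| ≤
        J.factorial / δ ^ (J + 1) * (M * δ) := by
  obtain ⟨R, M, hR, G1, G2, d1, d2, b1, b2, e1, e2⟩ := exists_riemannZeta_eq
  have hM0 : 0 ≤ M := (norm_nonneg _).trans (b1 1 (Metric.mem_ball_self hR))
  have hs1 : ∀ s : ℂ, 1 < s.re → s ≠ 1 := by
    rintro s hs rfl; simp at hs
  refine ⟨M + 1, min (R / 4) (1 / (M + 1)), by positivity, by positivity, ?_, ?_⟩
  · calc min (R / 4) (1 / (M + 1)) * (M + 1) ≤ 1 / (M + 1) * (M + 1) := by gcongr; exact min_le_right _ _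
      _ = 1 := by field_simp
  rintro g (rfl | rfl) δ hδ hδ' J
  · refine summable_and_abs_tsum_sub_le (G := G1) (M := M + 1) (fun s hs => ?_) hR d1
      (fun z hz => (b1 z hz).trans (by linarith)) (fun s hs hsR => ?_) hδ (hδ'.trans (min_le_left _ _)) J
    · have h1 : (fun n : ℕ => (((fun _ => (1 : ℝ)) n : ℝ) : ℂ)) = 1 := by funext n; simp
      rw [h1]; exact LSeriesSummable_one_iff.mpr hs
    · rw [← e1 s (hs1 s hs) hsR, ← LSeries_one_eq_riemannZeta hs]
      rfl
  · refine summable_and_abs_tsum_sub_le (G := G2) (M := M + 1) (fun s hs => ?_) hR d2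
      (fun z hz => (b2 z hz).trans (by linarith)) (fun s hs hsR => ?_) hδ (hδ'.trans (min_le_left _ _)) J
    · exact ArithmeticFunction.LSeriesSummable_vonMangoldt hs
    · rw [← e2 s (hs1 s hs) hsR, ← ArithmeticFunction.LSeries_vonMangoldt_eq_deriv_riemannZeta_div hs]

lemma logPowWeight_succ_le {J n : ℕ} {δ : ℝ} (hδ : 0 ≤ δ) (hn : 1 < n) (hJ : (J : ℝ) ≤ log n) :
    logPowWeight J δ (n + 1) ≤ logPowWeight J δ n := by
  have h0 : (0 : ℝ) < n := by positivity
  have h1 : (0 : ℝ) < ((n + 1 : ℕ) : ℝ) := by positivity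
  have ht : 0 < log n := log_pos (by exact_mod_cast hn)
  have htt : log n ≤ log (n + 1 : ℕ) := log_le_log h0 (by simp)
  unfold logPowWeight
  rw [rpow_def_of_pos h0, rpow_def_of_pos h1]
  set t := log n
  set t' := log (n + 1 : ℕ)
  have h2 : t' ^ J ≤ t ^ J * exp (t' - t) := by
    have h3 : t' ≤ t * exp ((t' - t) / t) := by
      have := mul_le_mul_of_nonneg_left (add_one_le_exp ((t' - t) / t)) ht.le
      have h4 : t * ((t' - t) / t + 1) = t' := by field_simp; ring
      linarith
    calc t' ^ J ≤ (t * exp ((t' - t) / t)) ^ J := pow_le_pow_left₀ (ht.le.trans htt) h3 _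
      _ = t ^ J * exp (J * ((t' - t) / t)) := by rw [mul_pow, exp_nat_mul]
      _ ≤ _ := by
        gcongr
        rw [mul_div_assoc', div_le_iff₀ ht, mul_comm]
        exact mul_le_mul_of_nonneg_left hJ (by linarith)
  calc t' ^ J * exp (t' * -(1 + δ)) ≤ t ^ J * exp (t' - t) * exp (t' * -(1 + δ)) := by
        gcongr
    _ = t ^ J * exp (t' - t + t' * -(1 + δ)) := by rw [mul_assoc, ← exp_add]
    _ ≤ _ := by
      gcongr
      have := mul_le_mul_of_nonneg_left htt hδ
      linarith

lemma logPowWeight_mul_le_inv {J n : ℕ} (hJ : 0 < J) {δ : ℝ} (hδ : 0 < δ) (hδ1 : δ ≤ 1) :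
    logPowWeight J δ n * (δ ^ (J + 1) / J.factorial) ≤ 1 / n := by
  rcases eq_zero_or_pos n with rfl | hn
  · simp [logPowWeight, hJ.ne']
  have h0 : (0 : ℝ) < n := by exact_mod_cast hn
  have h1 := Real.pow_div_factorial_le_exp (δ * log n) (by positivity) J
  have h2 : logPowWeight J δ n * (δ ^ (J + 1) / J.factorial) =
      δ * (((δ * log n) ^ J / J.factorial) * exp (-(δ * log n))) * (1 / n) := by
    unfold logPowWeight
    rw [neg_add, rpow_add h0, Real.rpow_neg_one, rpow_def_of_pos h0 (-δ)]
    have : log n * -δ = -(δ * log n) := by ring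
    rw [this, mul_pow, pow_succ]
    field_simp
  rw [h2]
  have h3 : ((δ * log n) ^ J / J.factorial) * exp (-(δ * log n)) ≤ 1 := by
    rw [exp_neg, ← div_eq_mul_inv]
    exact div_le_one_of_le₀ h1 (exp_pos _).le
  have h4 : δ * (((δ * log n) ^ J / J.factorial) * exp (-(δ * log n))) ≤ 1 * 1 := by
    gcongr
  calc _ ≤ 1 * 1 * (1 / (n : ℝ)) := by gcongr
    _ = _ := by ring

/-- The indicator of the primes weighted by the logarithm. -/
noncomputable def primeLog (n : ℕ) : ℝ := if n.Prime then log n else 0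

lemma primeLog_le_vonMangoldt (n : ℕ) : primeLog n ≤ Λ n := by
  unfold primeLog; split_ifs with h
  · rw [ArithmeticFunction.vonMangoldt_apply_prime h]
  · exact vonMangoldt_nonneg

lemma sum_vonMangoldt_sub_primeLog_le {x y : ℕ} (hy : 1 ≤ y) :
    ∑ n ∈ Ioc x y, (Λ n - primeLog n) ≤
      2 * √y * log y := by
  have h := Chebyshev.psi_sub_theta_le (x := (y : ℝ)) (by exact_mod_cast hy)
  refine le_trans ?_ h
  rw [Chebyshev.psi, Chebyshev.theta, Nat.floor_natCast, sum_filter, ← sum_sub_distrib]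
  have h2 : ∀ n ∈ Ioc 0 y, Λ n -
      (if n.Prime then log n else 0) = Λ n - primeLog n :=
    fun n _ => rfl
  rw [sum_congr rfl h2]
  exact sum_le_sum_of_subset_of_nonneg (Ioc_subset_Ioc_left (Nat.zero_le _))
    fun n _ _ => sub_nonneg.mpr (primeLog_le_vonMangoldt n)

/-- A weight behaving like a smooth version of `1 / n` restricted to `(X0, X1]`, normalised to
have total mass about one both over the integers and over the (logarithmically weighted) primes. -/
structure IsBulkWeight (ε : ℝ) (X0 X1 : ℕ) (w : ℕ → ℝ) : Prop where
  nonneg : ∀ n, 0 ≤ w n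
  succ_le : ∀ n, X0 ≤ n → w (n + 1) ≤ w n
  le_inv : ∀ n, w n ≤ 1 / n
  sum_le : ∑ n ∈ Ioc X0 X1, w n ≤ 1 + ε
  le_sum_primeLog : 1 - ε ≤ ∑ n ∈ Ioc X0 X1, w n * primeLog n

/-- Lower end of the range of the weight. -/
noncomputable def lowerEnd (ε : ℝ) (L : ℕ) : ℕ := ⌊exp ((1 - ε) * L)⌋₊

/-- Upper end of the range of the weight. -/
noncomputable def upperEnd (ε : ℝ) (L : ℕ) : ℕ := ⌊exp ((1 + ε) * L)⌋₊

lemma lowerEnd_le_upperEnd {ε : ℝ} (hε : 0 ≤ ε) (L : ℕ) : lowerEnd ε L ≤ upperEnd ε L := by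
  refine Nat.floor_le_floor (exp_le_exp.mpr ?_)
  gcongr; linarith

/-- On the bulk range prime powers contribute little, after summation by parts. -/
lemma sum_mul_vonMangoldt_sub_primeLog_le {ε : ℝ} (hε : 0 < ε) (hε1 : ε ≤ 1 / 4) {L : ℕ} {w : ℕ → ℝ}
    (hw0 : ∀ n, 0 ≤ w n) (hw : ∀ n, lowerEnd ε L ≤ n → w (n + 1) ≤ w n) (hw1 : ∀ n, w n ≤ 1 / n)
    (hws : ∑ n ∈ Ioc (lowerEnd ε L) (upperEnd ε L), w n ≤ 1 + ε) :
    ∑ n ∈ Ioc (lowerEnd ε L) (upperEnd ε L),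
      w n * (Λ n - primeLog n) ≤ 12 * L * exp (-(L / 4)) := by
  have key := sum_norm_sum_mul_le_of_antitone (univ : Finset Unit)
    (fun _ n => ((Λ n - primeLog n : ℝ) : ℂ))
    (lowerEnd_le_upperEnd hε.le L) hw0 hw (E := 4 * L * exp (-(L / 4))) (by positivity) ?_
  · simp only [univ_unique, sum_singleton, ← ofReal_mul, ← ofReal_sum,
      norm_real] at key
    refine (le_abs_self _).trans (key.trans ?_)
    have h1 : (lowerEnd ε L : ℝ) * w (lowerEnd ε L) ≤ 1 := by
      refine (mul_le_mul_of_nonneg_left (hw1 _) (by positivity)).trans ?_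
      rw [mul_one_div]; exact div_self_le_one _
    calc _ ≤ 4 * L * exp (-(L / 4)) * (1 + (1 + ε)) := by gcongr
      _ ≤ 4 * L * exp (-(L / 4)) * 3 := by gcongr; linarith
      _ = _ := by ring
  · intro y hy
    simp only [univ_unique, sum_singleton, ← ofReal_sum, norm_real]
    obtain ⟨h1, h2⟩ := mem_Ioc.mp hy
    have hy1 : 1 ≤ y := by omega
    have hy0 : (0 : ℝ) < y := by exact_mod_cast hy1
    rw [norm_of_nonneg (sum_nonneg fun n _ => sub_nonneg.mpr (primeLog_le_vonMangoldt n))]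
    refine (sum_vonMangoldt_sub_primeLog_le hy1).trans ?_
    have h3 : (1 - ε) * L ≤ log y := by
      rw [le_log_iff_exp_le hy0]
      exact ((Nat.floor_lt (exp_pos _).le).mp h1).le
    have h4 : log y ≤ (1 + ε) * L := by
      rw [log_le_iff_le_exp hy0]
      exact (cast_le.mpr h2).trans (floor_le (exp_pos _).le)
    have h5 : 1 ≤ √y * exp (-(L / 4)) := by
      rw [sqrt_eq_rpow, rpow_def_of_pos hy0, ← exp_add]
      exact one_le_exp (by nlinarith)
    calc 2 * √y * log y ≤ 2 * √y * ((1 + ε) * L) := by gcongr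
      _ ≤ 2 * √y * (2 * L) := by gcongr; linarith
      _ ≤ 2 * √y * (2 * L) * (√y * exp (-(L / 4))) := le_mul_of_one_le_right (by positivity) h5
      _ = 4 * L * exp (-(L / 4)) * (√y * √y) := by ring
      _ = _ := by rw [mul_self_sqrt hy0.le]

lemma eventually_weight_parameters (ε δ0 M C : ℝ) (hε : 0 < ε) (hδ0 : 0 < δ0) (hM : 0 < M)
    (hC : 1 ≤ C) (K B A : ℕ) (hK : 0 < K) : ∀ᶠ L : ℕ in atTop, 64 ≤ L ∧
      (1 : ℝ) ≤ K * log L ∧ (K * log L + 1 : ℝ) ≤ (L : ℝ) ^ (1 / 4 : ℝ) ∧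
      2 * (L : ℝ) ^ (-(3 / 4) : ℝ) ≤ δ0 ∧ M * (L : ℝ) ^ (-(3 / 4) : ℝ) ≤ ε / 4 ∧
      C * (1 + B * log L) ^ 2 ≤ (L : ℝ) ^ (1 / 16 : ℝ) ∧
      8 * (L : ℝ) ^ (1 / 16 : ℝ) * exp 1 ≤ (L : ℝ) ^ (1 / 8 : ℝ) ∧
      12 * L * exp (-(L / 4)) ≤ 1 / (L : ℝ) ^ (A + 1) ∧ 1 / (L : ℝ) ^ (A + 1) ≤ ε / 4 ∧
      16 / (L : ℝ) ^ (A + 2) ≤ ε / 4 := by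
  have hcast := tendsto_natCast_atTop_atTop (R := ℝ)
  have t34 : Tendsto (fun L : ℕ => (L : ℝ) ^ (-(3 / 4) : ℝ)) atTop (nhds 0) :=
    (tendsto_rpow_neg_atTop (by norm_num)).comp hcast
  have tpow : ∀ k : ℕ, Tendsto (fun L : ℕ => 1 / (L : ℝ) ^ (k + 1)) atTop (nhds 0) := by
    intro k
    have := (tendsto_inv_atTop_zero.comp (tendsto_pow_atTop (α := ℝ) (n := k + 1) (by omega))).comp hcast
    refine this.congr fun L => ?_
    simp only [Function.comp, one_div]
  have texp : Tendsto (fun L : ℕ => (L : ℝ) ^ (A + 2) * exp (-(L / 4))) atTop (nhds 0) := by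
    have h1 := (Real.tendsto_pow_mul_exp_neg_atTop_nhds_zero (A + 2)).comp
      (hcast.atTop_div_const (by norm_num : (0 : ℝ) < 4))
    have h2 := h1.const_mul (4 ^ (A + 2) : ℝ)
    rw [mul_zero] at h2
    refine h2.congr fun L => ?_
    simp only [Function.comp]
    rw [div_pow]; field_simp
  have t16 : Tendsto (fun L : ℕ => (L : ℝ) ^ (1 / 16 : ℝ)) atTop atTop :=
    (tendsto_rpow_atTop (by norm_num)).comp hcast
  have tlog : Tendsto (fun L : ℕ => log L) atTop atTop := Real.tendsto_log_atTop.comp hcast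
  have c1 := hcast.eventually (eventually_mul_log_pow_le (K + 1) (by positivity) 1
    (by norm_num : (0 : ℝ) < 1 / 4))
  have c2 := hcast.eventually (eventually_mul_log_pow_le (C * (B + 1)) (by positivity) 2
    (by norm_num : (0 : ℝ) < 1 / 16))
  filter_upwards [eventually_ge_atTop 64, tlog.eventually_ge_atTop 1, c1, c2,
    t34.eventually_le_const (by positivity : 0 < δ0 / 2),
    t34.eventually_le_const (by positivity : 0 < ε / 4 / M), t16.eventually_ge_atTop (8 * exp 1),
    texp.eventually_le_const (by norm_num : (0 : ℝ) < 1 / 12),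
    (tpow A).eventually_le_const (by positivity : 0 < ε / 4),
    (tpow (A + 1)).eventually_le_const (by positivity : 0 < ε / 64)] with L h64 hl1 d1 d2 d3 d4 d5 d6 d7 d8
  have hL0 : (0 : ℝ) < L := by positivity
  have hK1 : (1 : ℝ) ≤ K := by exact_mod_cast hK
  refine ⟨h64, by nlinarith, ?_, by linarith, ?_, ?_, ?_, ?_, d7, ?_⟩
  · rw [pow_one] at d1
    nlinarith
  · rw [le_div_iff₀ hM] at d4; linarith
  · refine le_trans ?_ d2
    rw [mul_pow]
    have hb : (1 + B * log L : ℝ) ≤ (B + 1) * (1 + log L) := by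
      have : (0 : ℝ) ≤ B := by positivity
      nlinarith
    calc C * (1 + B * log L) ^ 2 ≤ C ^ 2 * ((B + 1) * (1 + log L)) ^ 2 := by
          gcongr; nlinarith
      _ = _ := by ring
  · have : (L : ℝ) ^ (1 / 8 : ℝ) = (L : ℝ) ^ (1 / 16 : ℝ) * (L : ℝ) ^ (1 / 16 : ℝ) := by
      rw [← rpow_add hL0]; norm_num
    rw [this]
    nlinarith
  · rw [le_div_iff₀ (by positivity)]
    have : 12 * L * exp (-(L / 4)) * (L : ℝ) ^ (A + 1) =
      12 * ((L : ℝ) ^ (A + 2) * exp (-(L / 4))) := by ring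
    rw [this]; linarith
  · have : 16 / (L : ℝ) ^ (A + 2) = 16 * (1 / (L : ℝ) ^ (A + 1 + 1)) := by ring
    rw [this]; linarith

lemma exp_half_lt_lowerEnd {ε : ℝ} (hε1 : ε ≤ 1 / 4) {L : ℕ} (hL : 64 ≤ L) :
    exp (L / 2) < lowerEnd ε L := by
  have hL' : (64 : ℝ) ≤ L := by exact_mod_cast hL
  have h1 : exp ((1 - ε) * L) - 1 < lowerEnd ε L := Nat.sub_one_lt_floor _
  have h3 : exp (L / 2 + 1) ≤ exp ((1 - ε) * L) := by
    refine exp_le_exp.mpr ?_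
    nlinarith
  rw [exp_add] at h3
  have h4 : 2 ≤ exp 1 := by linarith [add_one_le_exp (1 : ℝ)]
  have h5 : 1 ≤ exp (L / 2) := one_le_exp (by positivity)
  nlinarith

lemma rpow_quarter_le_half {x : ℝ} (hx : 64 ≤ x) : x ^ (1 / 4 : ℝ) ≤ x / 2 := by
  have h8 : x ^ (1 / 4 : ℝ) ≤ x ^ (1 / 2 : ℝ) :=
    rpow_le_rpow_of_exponent_le (by linarith) (by norm_num)
  rw [← sqrt_eq_rpow] at h8
  have h9 : √x * √x = x := mul_self_sqrt (by linarith)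
  have h10 : 2 ≤ √x := by
    rw [Real.le_sqrt' (by norm_num)]; linarith
  nlinarith

lemma factorial_mul_le_exp (J : ℕ) {δ R : ℝ} (hδ : 0 < δ) (hR : 0 < R) (h : 8 * exp 1 * δ ≤ R) :
    J.factorial * (1 / R * (2 / R) ^ J) * (δ ^ (J + 1) / J.factorial) ≤ 8 * exp (-(1 * J)) := by
  have he1 : 1 ≤ exp 1 := one_le_exp (by norm_num)
  calc _ = (δ / R) * (2 * δ / R) ^ J := by
        rw [pow_succ, div_pow, div_pow, mul_pow]; field_simp
    _ ≤ 8 * (exp (-1)) ^ J := by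
        gcongr
        · rw [div_le_iff₀ hR]; nlinarith
        · rw [div_le_iff₀ hR, exp_neg, inv_mul_eq_div, le_div_iff₀ (by positivity)]
          nlinarith
    _ = 8 * exp (-(1 * J)) := by rw [← exp_nat_mul]; ring_nf

lemma sixteen_div_add_le {x : ℝ} (hx : 64 ≤ x) (A : ℕ) :
    16 / x ^ (A + 2) + 1 / x ^ (A + 1) ≤ 1 / x ^ A := by
  have e1 : 16 / x ^ (A + 2) = 16 / x ^ 2 * (1 / x ^ A) := by
    rw [pow_add]; field_simp
  have e2 : 1 / x ^ (A + 1) = 1 / x * (1 / x ^ A) := by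
    rw [pow_add]; field_simp
  have e3 : 16 / x ^ 2 + 1 / x ≤ 1 := by
    have : 16 / x ^ 2 ≤ 16 / 64 ^ 2 := by gcongr
    have : 1 / x ≤ 1 / 64 := by gcongr
    norm_num at *; linarith
  rw [e1, e2, ← add_mul]
  exact mul_le_of_le_one_left (by positivity) e3

set_option maxHeartbeats 1600000 in
/-- For infinitely many scales `L` there is a bulk weight against which all nontrivial primitive
characters of conductor at most a power of `L` are small on the primes. -/
theorem frequently_exists_isBulkWeight {ε : ℝ} (hε : 0 < ε) (hε1 : ε ≤ 1 / 4) (A B : ℕ) :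
    ∃ᶠ L : ℕ in atTop, ∃ w : ℕ → ℝ, IsBulkWeight ε (lowerEnd ε L) (upperEnd ε L) w ∧
      ∀ (r : ℕ) [NeZero r], r ≤ L ^ B → ∀ χ : DirichletCharacter ℂ r, χ.IsPrimitive → χ ≠ 1 →
        ‖∑ n ∈ Ioc (lowerEnd ε L) (upperEnd ε L), (w n : ℂ) * (χ n * primeLog n)‖ ≤
          1 / (L : ℝ) ^ A := by
  obtain ⟨M, δ0, hM, hδ₀, hMδ, hbd⟩ := exists_tsum_logPowWeight_bounds
  obtain ⟨C, hC, htw⟩ := exists_norm_twist_sum_le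
  set K : ℕ := ⌈(A + 2 : ℝ) * 4 / ε ^ 2⌉₊
  have hK0 : 0 < K := Nat.ceil_pos.mpr (by positivity)
  have hKε : (A + 2 : ℝ) ≤ ε ^ 2 / 4 * K := by
    have := le_ceil ((A + 2 : ℝ) * 4 / ε ^ 2)
    rw [div_le_iff₀ (by positivity)] at this
    linarith
  refine ((frequently_le_norm_LFunction_one B).and_eventually
    (eventually_weight_parameters ε δ0 M C hε hδ₀ hM (by linarith) K B A hK0)).mono ?_
  rintro L ⟨hgood, h64, p1, p2, p3, p4, p5, p6, p7, p8, p9⟩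
  have h64' : (64 : ℝ) ≤ L := by exact_mod_cast h64
  have hL0 : (0 : ℝ) < L := by linarith
  set J : ℕ := ⌈K * log L⌉₊
  have hJge : K * log L ≤ J := le_ceil _
  have hJle : (J : ℝ) ≤ (L : ℝ) ^ (1 / 4 : ℝ) :=
    (Nat.ceil_lt_add_one (by linarith)).le.trans p2
  have hJ0 : 0 < J := Nat.ceil_pos.mpr (by linarith)
  set δ : ℝ := J / L with hδ
  have hδ0 : 0 < δ := by positivity
  have hδle : δ ≤ (L : ℝ) ^ (-(3 / 4) : ℝ) := by
    rw [hδ, div_le_iff₀ hL0]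
    refine hJle.trans (le_of_eq ?_)
    nth_rewrite 3 [← rpow_one (L : ℝ)]
    rw [← rpow_add hL0]; norm_num
  have hδ1 : δ ≤ 1 := hδle.trans (Real.rpow_le_one_of_one_le_of_nonpos (by linarith) (by norm_num))
  set Nm : ℝ := δ ^ (J + 1) / J.factorial with hNm
  have hNm0 : 0 < Nm := by positivity
  have hNinv : J.factorial / δ ^ (J + 1) * Nm = 1 := by rw [hNm]; field_simp
  have htail : 8 * exp (-(ε ^ 2 / 4 * J)) ≤ 8 / (L : ℝ) ^ (A + 2) := by
    have h1 : exp (-(ε ^ 2 / 4 * J)) ≤ ((L : ℝ) ^ (A + 2))⁻¹ := by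
      rw [← Real.exp_log (by positivity : (0 : ℝ) < (L : ℝ) ^ (A + 2)), ← exp_neg, log_pow]
      refine exp_le_exp.mpr (neg_le_neg ?_)
      push_cast
      calc (A + 2 : ℝ) * log L ≤ ε ^ 2 / 4 * K * log L := by gcongr
        _ = ε ^ 2 / 4 * (K * log L) := by ring
        _ ≤ _ := by gcongr
    rw [div_eq_mul_inv]; exact mul_le_mul_of_nonneg_left h1 (by norm_num)
  set X0 := lowerEnd ε L
  set X1 := upperEnd ε L
  set w : ℕ → ℝ := fun n => logPowWeight J δ n * Nm with hw
  have hw0 : ∀ n, 0 ≤ w n := fun n => mul_nonneg (logPowWeight_nonneg _ _ _) hNm0.le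
  have hX₀log : (J : ℝ) ≤ log X0 ∧ 1 < X0 := by
    have h6 := exp_half_lt_lowerEnd hε1 h64
    have h7 : (1 : ℝ) < X0 := lt_of_le_of_lt (one_le_exp (by positivity)) h6
    refine ⟨?_, by exact_mod_cast h7⟩
    rw [le_log_iff_exp_le (by linarith)]
    exact le_trans (exp_le_exp.mpr (hJle.trans (rpow_quarter_le_half h64'))) h6.le
  have hws : ∀ n, X0 ≤ n → w (n + 1) ≤ w n := by
    intro n hn
    refine mul_le_mul_of_nonneg_right (logPowWeight_succ_le hδ0.le (by omega) ?_) hNm0.le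
    refine hX₀log.1.trans (log_le_log (by have := hX₀log.2; positivity) (by exact_mod_cast hn))
  have hw1 : ∀ n, w n ≤ 1 / n := fun n => logPowWeight_mul_le_inv hJ0 hδ0 hδ1
  have hδδ₀ : 2 * δ ≤ δ0 := by linarith
  have hMδ' : M * δ ≤ ε / 4 := le_trans (by gcongr) p4
  have hbd2 : ∀ g : ℕ → ℝ, (g = (fun _ => 1) ∨ g = fun n => Λ n) →
      ∀ δ' : ℝ, 0 < δ' → δ' ≤ δ0 → Summable (fun n => g n * logPowWeight J δ' n) ∧
        ∑' n, g n * logPowWeight J δ' n ≤ 2 * J.factorial / δ' ^ (J + 1) := by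
    intro g hg δ' h1 h2
    obtain ⟨a1, a2⟩ := hbd g hg δ' h1 h2 J
    refine ⟨a1, ?_⟩
    have h3 : M * δ' ≤ 1 := (mul_le_mul_of_nonneg_left h2 hM.le).trans (by linarith only [hMδ])
    have h4 := (abs_le.mp a2).2
    have h5 : J.factorial / δ' ^ (J + 1) * (M * δ') ≤ J.factorial / δ' ^ (J + 1) * 1 := by gcongr
    rw [mul_div_assoc]; linarith
  have hsum1 : ∑ n ∈ Ioc X0 X1, w n ≤ 1 + ε := by
    obtain ⟨a1, a2⟩ := hbd (fun _ => 1) (Or.inl rfl) δ hδ0 (by linarith) J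
    have h1 : ∑ n ∈ Ioc X0 X1, w n ≤ (∑' n, 1 * logPowWeight J δ n) * Nm := by
      rw [hw, ← sum_mul]
      refine mul_le_mul_of_nonneg_right ?_ hNm0.le
      simp only [one_mul] at a1 ⊢
      exact a1.sum_le_tsum _ fun n _ => logPowWeight_nonneg _ _ _
    have h2 := (abs_le.mp a2).2
    have h3 : (∑' n, 1 * logPowWeight J δ n) * Nm ≤
        (J.factorial / δ ^ (J + 1) + J.factorial / δ ^ (J + 1) * (M * δ)) * Nm := by
      gcongr; linarith
    have h4 : (J.factorial / δ ^ (J + 1) + J.factorial / δ ^ (J + 1) * (M * δ)) * Nm = 1 + M * δ := by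
      linear_combination (1 + M * δ) * hNinv
    linarith
  have hpp := sum_mul_vonMangoldt_sub_primeLog_le hε hε1 hw0 hws hw1 hsum1
  refine ⟨w, ⟨hw0, hws, hw1, hsum1, ?_⟩, ?_⟩
  · obtain ⟨a1, a2⟩ := hbd _ (Or.inr rfl) δ hδ0 (by linarith) J
    have h1 := norm_tsum_sub_sum_Ioc_le hJ0 (by omega) hε (by linarith) hδ
      (f := fun n => ((Λ n : ℝ) : ℂ))
      (g := fun n => Λ n)
      (fun n => by rw [norm_real, norm_of_nonneg vonMangoldt_nonneg])
      hδδ₀ (hbd2 _ (Or.inr rfl))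
    simp_rw [← ofReal_mul] at h1
    rw [← ofReal_tsum, ← ofReal_sum, ← ofReal_sub, norm_real,
      norm_eq_abs] at h1
    set T := ∑' n, Λ n * logPowWeight J δ n
    have h1' : (T - ∑ n ∈ Ioc X0 X1, Λ n * logPowWeight J δ n) * Nm ≤
        8 / (L : ℝ) ^ (A + 2) :=
      le_trans (mul_le_mul_of_nonneg_right (le_abs_self _) hNm0.le) (h1.trans htail)
    have h2 : ∑ n ∈ Ioc X0 X1, w n * Λ n =
        (∑ n ∈ Ioc X0 X1, Λ n * logPowWeight J δ n) * Nm := by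
      rw [sum_mul]
      exact sum_congr rfl fun n _ => by simp only [hw]; ring
    have h3 : 1 - M * δ ≤ T * Nm := by
      have h4 := (abs_le.mp a2).1
      have h5 : (J.factorial / δ ^ (J + 1) - J.factorial / δ ^ (J + 1) * (M * δ)) * Nm ≤ T * Nm := by
        gcongr; linarith
      have h6 : (J.factorial / δ ^ (J + 1) - J.factorial / δ ^ (J + 1) * (M * δ)) * Nm = 1 - M * δ := by
        linear_combination (1 - M * δ) * hNinv
      linarith
    have h7 : ∑ n ∈ Ioc X0 X1, w n * primeLog n =
        ∑ n ∈ Ioc X0 X1, w n * Λ n -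
        ∑ n ∈ Ioc X0 X1, w n * (Λ n - primeLog n) := by
      rw [← sum_sub_distrib]
      exact sum_congr rfl fun n _ => by ring
    have h8 : 8 / (L : ℝ) ^ (A + 2) ≤ 16 / (L : ℝ) ^ (A + 2) := by gcongr; norm_num
    rw [h7, h2]
    linarith
  · intro r _ hr χ hprim hne
    have hr0 : 0 < r := NeZero.pos r
    have hχ1 := hgood r hr χ hprim hne
    set η : ℝ := (L : ℝ) ^ (-(1 / 2) : ℝ)
    have hη0 : 0 < η := by positivity
    have hη1 : η ≤ 1 := Real.rpow_le_one_of_one_le_of_nonpos (by linarith) (by norm_num)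
    set R : ℝ := η / (C * (1 + log r) ^ 2) with hR
    have hlr : log r ≤ B * log L := by
      have := log_le_log (by exact_mod_cast hr0) (by exact_mod_cast hr : (r : ℝ) ≤ (L : ℝ) ^ B)
      rwa [log_pow] at this
    have hden : C * (1 + log r) ^ 2 ≤ (L : ℝ) ^ (1 / 16 : ℝ) :=
      le_trans (by gcongr) p5
    have hR0 : 0 < R := by positivity
    have hδR : 8 * exp 1 * δ ≤ R := by
      rw [hR, le_div_iff₀ (by positivity)]
      calc 8 * exp 1 * δ * (C * (1 + log r) ^ 2)
          ≤ 8 * exp 1 * (L : ℝ) ^ (-(3 / 4) : ℝ) * (L : ℝ) ^ (1 / 16 : ℝ) := by gcongr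
        _ = (8 * (L : ℝ) ^ (1 / 16 : ℝ) * exp 1) * (L : ℝ) ^ (-(3 / 4) : ℝ) := by ring
        _ ≤ (L : ℝ) ^ (1 / 8 : ℝ) * (L : ℝ) ^ (-(3 / 4) : ℝ) := by gcongr
        _ = (L : ℝ) ^ (1 / 8 + -(3 / 4) : ℝ) := by rw [← rpow_add hL0]
        _ ≤ η := rpow_le_rpow_of_exponent_le (by linarith) (by norm_num)
    have he1 : 1 ≤ exp 1 := one_le_exp (by norm_num)
    have hδR4 : δ ≤ R / 4 := by
      have := mul_le_mul_of_nonneg_right he1 hδ0.le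
      linarith only [hδR, this, hδ0]
    have h1 := htw r χ hne η hη0 hη1 hχ1 R hR δ hδ0 hδR4 J
    have h2 := norm_tsum_sub_sum_Ioc_le hJ0 (by omega) hε (by linarith) hδ
      (f := fun n => χ n * ((Λ n : ℝ) : ℂ))
      (g := fun n => Λ n)
      (fun n => by
        rw [norm_mul, norm_real, norm_of_nonneg vonMangoldt_nonneg]
        exact mul_le_of_le_one_left vonMangoldt_nonneg (χ.norm_le_one _))
      hδδ₀ (hbd2 _ (Or.inr rfl))
    change ‖∑' n : ℕ, (χ n * ((Λ n : ℝ) : ℂ)) * (logPowWeight J δ n : ℂ)‖ ≤ _ at h1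
    have h2 := h2.trans htail
    set T := ∑' n : ℕ, (χ n * ((Λ n : ℝ) : ℂ)) * (logPowWeight J δ n : ℂ)
    set S := ∑ n ∈ Ioc X0 X1,
      (χ n * ((Λ n : ℝ) : ℂ)) * (logPowWeight J δ n : ℂ)
    have hTN : ‖T‖ * Nm ≤ 8 / (L : ℝ) ^ (A + 2) := by
      calc ‖T‖ * Nm ≤ J.factorial * (1 / R * (2 / R) ^ J) * Nm := by gcongr
        _ ≤ 8 * exp (-(1 * J)) := factorial_mul_le_exp J hδ0 hR0 hδR
        _ ≤ 8 * exp (-(ε ^ 2 / 4 * J)) := by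
          gcongr
          have : ε ^ 2 ≤ (1 / 4) ^ 2 := by gcongr
          linarith only [this]
        _ ≤ _ := htail
    have hSN : ‖S‖ * Nm ≤ 16 / (L : ℝ) ^ (A + 2) := by
      have h3 : ‖S‖ ≤ ‖T‖ + ‖T - S‖ := by
        have := norm_sub_le T (T - S); rwa [sub_sub_cancel] at this
      calc ‖S‖ * Nm ≤ (‖T‖ + ‖T - S‖) * Nm := by gcongr
        _ = ‖T‖ * Nm + ‖T - S‖ * Nm := by ring
        _ ≤ 8 / (L : ℝ) ^ (A + 2) + 8 / (L : ℝ) ^ (A + 2) := add_le_add hTN h2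
        _ = _ := by ring
    have h4 : ∑ n ∈ Ioc X0 X1, (w n : ℂ) * (χ n * primeLog n) = S * Nm -
        ∑ n ∈ Ioc X0 X1,
          χ n * ((w n * (Λ n - primeLog n) : ℝ) : ℂ) := by
      rw [sum_mul, ← sum_sub_distrib]
      refine sum_congr rfl fun n _ => ?_
      simp only [hw]; push_cast; ring
    rw [h4]
    refine (norm_sub_le _ _).trans ?_
    rw [norm_mul, norm_real, norm_of_nonneg hNm0.le]
    have h5 : ‖∑ n ∈ Ioc X0 X1,
        χ n * ((w n * (Λ n - primeLog n) : ℝ) : ℂ)‖ ≤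
        ∑ n ∈ Ioc X0 X1, w n * (Λ n - primeLog n) := by
      refine norm_sum_le_of_le _ fun n _ => ?_
      have h6 : 0 ≤ w n * (Λ n - primeLog n) :=
        mul_nonneg (hw0 n) (sub_nonneg.mpr (primeLog_le_vonMangoldt n))
      rw [norm_mul, norm_real, norm_of_nonneg h6]
      exact mul_le_of_le_one_left h6 (χ.norm_le_one _)
    have h6 := sixteen_div_add_le h64' A
    linarith

/-- Bombieri's inequality: a quasi-orthogonality bound for families of vectors. -/
lemma sum_norm_sq_le_of_gram {ι κ : Type*} (s : Finset ι) (t : Finset κ) (φ : ι → κ → ℂ) (a : κ → ℂ)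
    {B : ℝ} (hB0 : 0 ≤ B) (hB : ∀ i ∈ s, ∑ j ∈ s, ‖∑ n ∈ t, φ i n * (starRingEnd ℂ) (φ j n)‖ ≤ B) :
    ∑ i ∈ s, ‖∑ n ∈ t, a n * φ i n‖ ^ 2 ≤ B * ∑ n ∈ t, ‖a n‖ ^ 2 := by
  set T := ∑ i ∈ s, ‖∑ n ∈ t, a n * φ i n‖ ^ 2 with hT
  set c : ι → ℂ := fun i => (starRingEnd ℂ) (∑ n ∈ t, a n * φ i n) with hc
  have hcn : ∀ i, ‖c i‖ = ‖∑ n ∈ t, a n * φ i n‖ := fun i => RCLike.norm_conj _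
  have hT0 : 0 ≤ T := sum_nonneg fun i _ => by positivity
  have ha0 : 0 ≤ ∑ n ∈ t, ‖a n‖ ^ 2 := sum_nonneg fun i _ => by positivity
  have h1 : (T : ℂ) = ∑ n ∈ t, a n * ∑ i ∈ s, c i * φ i n := by
    rw [hT]
    push_cast
    simp_rw [mul_sum]
    rw [sum_comm]
    refine sum_congr rfl fun i _ => ?_
    rw [← mul_conj', mul_comm, mul_sum]
    exact sum_congr rfl fun n _ => by simp only [hc]; ring
  have h2 : T ^ 2 ≤ (∑ n ∈ t, ‖a n‖ ^ 2) * ∑ n ∈ t, ‖∑ i ∈ s, c i * φ i n‖ ^ 2 := by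
    have h3 : T ≤ ∑ n ∈ t, ‖a n‖ * ‖∑ i ∈ s, c i * φ i n‖ := by
      have h4 : T = ‖(T : ℂ)‖ := by rw [norm_real, norm_of_nonneg hT0]
      rw [h4, h1]
      exact (norm_sum_le _ _).trans (le_of_eq (sum_congr rfl fun n _ => norm_mul _ _))
    exact (pow_le_pow_left₀ hT0 h3 2).trans (sum_mul_sq_le_sq_mul_sq _ _ _)
  have h3 : ∑ n ∈ t, ‖∑ i ∈ s, c i * φ i n‖ ^ 2 ≤ B * T := by
    have h4 : ((∑ n ∈ t, ‖∑ i ∈ s, c i * φ i n‖ ^ 2 : ℝ) : ℂ) =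
        ∑ i ∈ s, ∑ j ∈ s, c i * (starRingEnd ℂ) (c j) *
          ∑ n ∈ t, φ i n * (starRingEnd ℂ) (φ j n) := by
      push_cast
      simp_rw [← mul_conj', map_sum, sum_mul_sum, mul_sum]
      rw [sum_comm]
      refine sum_congr rfl fun i _ => ?_
      rw [sum_comm]
      refine sum_congr rfl fun j _ => sum_congr rfl fun n _ => ?_
      rw [map_mul]; ring
    have h5 : 0 ≤ ∑ n ∈ t, ‖∑ i ∈ s, c i * φ i n‖ ^ 2 := sum_nonneg fun i _ => by positivity
    set g : ι → ι → ℝ := fun i j => ‖∑ n ∈ t, φ i n * (starRingEnd ℂ) (φ j n)‖ with hg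
    have hgs : ∀ i j, g i j = g j i := by
      intro i j
      simp only [hg]
      rw [← RCLike.norm_conj, map_sum]
      congr 1
      exact sum_congr rfl fun n _ => by rw [map_mul, Complex.conj_conj, mul_comm]
    calc _ = ‖((∑ n ∈ t, ‖∑ i ∈ s, c i * φ i n‖ ^ 2 : ℝ) : ℂ)‖ := by
          rw [norm_real, norm_of_nonneg h5]
      _ ≤ ∑ i ∈ s, ∑ j ∈ s, (‖c i‖ ^ 2 * g i j / 2 + ‖c j‖ ^ 2 * g j i / 2) := by
          rw [h4]
          refine norm_sum_le_of_le _ fun i _ => norm_sum_le_of_le _ fun j _ => ?_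
          rw [norm_mul, norm_mul, RCLike.norm_conj (c j), hgs j i]
          have h0 : 0 ≤ g i j := norm_nonneg _
          change ‖c i‖ * ‖c j‖ * g i j ≤ _
          nlinarith [mul_nonneg (sq_nonneg (‖c i‖ - ‖c j‖)) h0]
      _ = ∑ i ∈ s, ‖c i‖ ^ 2 * ∑ j ∈ s, g i j := by
          simp_rw [sum_add_distrib]
          rw [sum_comm (f := fun i j => ‖c j‖ ^ 2 * g j i / 2), ← sum_add_distrib]
          refine sum_congr rfl fun i _ => ?_
          rw [← sum_add_distrib, mul_sum]
          exact sum_congr rfl fun j _ => by ring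
      _ ≤ ∑ i ∈ s, ‖c i‖ ^ 2 * B := sum_le_sum fun i hi =>
          mul_le_mul_of_nonneg_left (hB i hi) (by positivity)
      _ = B * T := by
          rw [← sum_mul, mul_comm, hT]
          simp_rw [hcn]
  rcases hT0.eq_or_lt with h | h
  · rw [← h]; exact mul_nonneg hB0 ha0
  · have h4 : T * T ≤ (B * ∑ n ∈ t, ‖a n‖ ^ 2) * T := by
      calc T * T = T ^ 2 := by ring
        _ ≤ _ := h2
        _ ≤ (∑ n ∈ t, ‖a n‖ ^ 2) * (B * T) := by gcongr
        _ = _ := by ring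
    exact le_of_mul_le_mul_right h4 h

/-- The additive character `x ↦ e^{2π i x}`. -/
noncomputable def expTwoPiI (x : ℝ) : ℂ := Complex.exp (2 * Real.pi * x * Complex.I)

lemma expTwoPiI_add (x y : ℝ) : expTwoPiI (x + y) = expTwoPiI x * expTwoPiI y := by
  unfold expTwoPiI; rw [← Complex.exp_add]; congr 1; push_cast; ring

lemma norm_expTwoPiI (x : ℝ) : ‖expTwoPiI x‖ = 1 := by
  unfold expTwoPiI
  have : (2 * Real.pi * x * Complex.I : ℂ) = ((2 * Real.pi * x : ℝ) : ℂ) * Complex.I := by push_cast; ring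
  rw [this, Complex.norm_exp_ofReal_mul_I]

lemma conj_expTwoPiI (x : ℝ) : (starRingEnd ℂ) (expTwoPiI x) = expTwoPiI (-x) := by
  unfold expTwoPiI
  have (y : ℝ) : (2 * Real.pi * y * Complex.I : ℂ) = ((2 * Real.pi * y : ℝ) : ℂ) * Complex.I := by
    push_cast; ring
  rw [← Complex.exp_conj, this, this, map_mul, Complex.conj_ofReal, Complex.conj_I]
  congr 1; push_cast; ring

lemma expTwoPiI_natCast_mul (n : ℕ) (x : ℝ) : expTwoPiI (n * x) = expTwoPiI x ^ n := by
  unfold expTwoPiI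
  rw [← Complex.exp_nat_mul]; congr 1; push_cast; ring

lemma expTwoPiI_sub_intCast (x : ℝ) (k : ℤ) : expTwoPiI (x - k) = expTwoPiI x := by
  unfold expTwoPiI
  have : (2 * Real.pi * ((x - k : ℝ) : ℂ) * Complex.I : ℂ) =
      2 * Real.pi * x * Complex.I - k * (2 * Real.pi * Complex.I) := by push_cast; ring
  rw [this, Complex.exp_sub, Complex.exp_int_mul_two_pi_mul_I, div_one]

lemma four_mul_min_le_norm_expTwoPiI_sub_one {t : ℝ} (h0 : 0 ≤ t) (h1 : t ≤ 1) :
    4 * min t (1 - t) ≤ ‖expTwoPiI t - 1‖ := by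
  have h2 : ‖expTwoPiI t - 1‖ = 2 * sin (Real.pi * t) := by
    have : expTwoPiI t = Complex.exp (Complex.I * ((2 * Real.pi * t : ℝ) : ℂ)) := by
      unfold expTwoPiI; congr 1; push_cast; ring
    rw [this, Complex.norm_exp_I_mul_ofReal_sub_one]
    have h3 : 2 * Real.pi * t / 2 = Real.pi * t := by ring
    rw [h3, norm_of_nonneg]
    have := Real.sin_nonneg_of_nonneg_of_le_pi (mul_nonneg Real.pi_pos.le h0)
      (by nlinarith [Real.pi_pos])
    linarith
  rw [h2]
  rcases le_total t (1 / 2) with h | h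
  · have h3 := Real.mul_le_sin (x := Real.pi * t) (mul_nonneg Real.pi_pos.le h0)
      (by nlinarith [Real.pi_pos])
    have h4 : 2 / Real.pi * (Real.pi * t) = 2 * t := by field_simp
    have := min_le_left t (1 - t)
    linarith
  · have h3 := Real.mul_le_sin (x := Real.pi * (1 - t)) (mul_nonneg Real.pi_pos.le (by linarith))
      (by nlinarith [Real.pi_pos])
    have h4 : 2 / Real.pi * (Real.pi * (1 - t)) = 2 * (1 - t) := by field_simp
    have h5 : sin (Real.pi * (1 - t)) = sin (Real.pi * t) := by
      rw [← Real.sin_pi_sub]; congr 1; ring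
    have := min_le_right t (1 - t)
    linarith

lemma norm_geom_sum_expTwoPiI_le (N : ℕ) {t : ℝ} (h0 : 0 < t) (h1 : t < 1) :
    ‖∑ n ∈ range N, expTwoPiI t ^ n‖ ≤ 1 / 2 * (1 / t + 1 / (1 - t)) := by
  have h2 := four_mul_min_le_norm_expTwoPiI_sub_one h0.le h1.le
  have h3 : 0 < min t (1 - t) := lt_min h0 (by linarith)
  have hne : expTwoPiI t ≠ 1 := by
    intro h; rw [h, sub_self, norm_zero] at h2; linarith
  rw [geom_sum_eq hne, norm_div]
  have h4 : ‖expTwoPiI t ^ N - 1‖ ≤ 2 := by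
    refine (norm_sub_le _ _).trans ?_
    rw [norm_pow, norm_expTwoPiI, one_pow, norm_one]; norm_num
  calc _ ≤ 2 / (4 * min t (1 - t)) := by gcongr
    _ = 1 / 2 * (1 / min t (1 - t)) := by field_simp; norm_num
    _ ≤ _ := by
      gcongr
      have ha : 0 < 1 / t := by positivity
      have hb : 0 < 1 / (1 - t) := one_div_pos.mpr (by linarith)
      rcases min_choice t (1 - t) with h | h <;> rw [h] <;> linarith

/-- A separated set of points in `(0, 1]` has a small sum of inverses. -/
lemma sum_one_div_le_of_separated {ι : Type*} (s : Finset ι) (t : ι → ℝ) {Q : ℕ} (hQ : 0 < Q)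
    (h0 : ∀ i ∈ s, 1 / (Q : ℝ) ≤ t i) (h1 : ∀ i ∈ s, t i ≤ 1)
    (hsep : ∀ i ∈ s, ∀ j ∈ s, i ≠ j → 1 / (Q : ℝ) ≤ |t i - t j|) :
    ∑ i ∈ s, 1 / t i ≤ Q * (1 + log Q) := by
  have hQ0 : (0 : ℝ) < Q := by exact_mod_cast hQ
  have hk : ∀ i ∈ s, 1 ≤ ⌊t i * Q⌋₊ ∧ ⌊t i * Q⌋₊ ≤ Q := by
    intro i hi
    constructor
    · rw [Nat.one_le_floor_iff]
      have := h0 i hi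
      rwa [div_le_iff₀ hQ0] at this
    · refine Nat.floor_le_of_le ?_
      have := h1 i hi
      nlinarith
  calc ∑ i ∈ s, 1 / t i ≤ ∑ i ∈ s, (Q : ℝ) * ((⌊t i * Q⌋₊ : ℝ))⁻¹ := by
        refine sum_le_sum fun i hi => ?_
        have h2 : (0 : ℝ) < ⌊t i * Q⌋₊ := by exact_mod_cast (hk i hi).1
        have h3 : 0 < t i := lt_of_lt_of_le (by positivity) (h0 i hi)
        rw [← div_eq_mul_inv, div_le_div_iff₀ h3 h2]
        have := floor_le (mul_pos h3 hQ0).le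
        linarith
    _ = Q * ∑ k ∈ s.image (fun i => ⌊t i * Q⌋₊), ((k : ℝ))⁻¹ := by
        rw [← mul_sum, sum_image]
        intro i hi j hj hij
        by_contra hne
        have h4 := hsep i hi j hj hne
        have h5 : 0 < t i := lt_of_lt_of_le (by positivity) (h0 i hi)
        have h6 : 0 < t j := lt_of_lt_of_le (by positivity) (h0 j hj)
        have a1 := floor_le (mul_pos h5 hQ0).le
        have a2 := floor_le (mul_pos h6 hQ0).le
        have b1 := Nat.lt_floor_add_one (t i * Q)
        have b2 := Nat.lt_floor_add_one (t j * Q)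
        simp only at hij
        rw [hij] at a1 b1
        have h7 : |t i * Q - t j * Q| < 1 := by rw [abs_lt]; constructor <;> linarith
        rw [← sub_mul, abs_mul, abs_of_pos hQ0] at h7
        rw [div_le_iff₀ hQ0] at h4
        linarith
    _ ≤ Q * ∑ k ∈ Icc 1 Q, ((k : ℝ))⁻¹ := by
        gcongr
        intro k hk'
        obtain ⟨i, hi, rfl⟩ := mem_image.mp hk'
        exact mem_Icc.mpr (hk i hi)
    _ ≤ _ := by
        gcongr
        have := harmonic_le_one_add_log Q
        rw [harmonic_eq_sum_Icc] at this
        push_cast at this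
        exact this

/-- The additive large sieve for `1 / Q`-separated points. -/
theorem additive_large_sieve {ι : Type*} (s : Finset ι) (x : ι → ℝ) {Q : ℕ} (hQ : 0 < Q)
    (hsep : ∀ i ∈ s, ∀ j ∈ s, i ≠ j → ∀ k : ℤ, 1 / (Q : ℝ) ≤ |x i - x j - k|) (N : ℕ) (a : ℕ → ℂ) :
    ∑ i ∈ s, ‖∑ n ∈ range N, a n * expTwoPiI (n * x i)‖ ^ 2 ≤
      (N + Q * (1 + log Q)) * ∑ n ∈ range N, ‖a n‖ ^ 2 := by
  classical
  refine sum_norm_sq_le_of_gram s (range N) (fun i n => expTwoPiI (n * x i)) a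
    (by have := log_natCast_nonneg Q; positivity) fun i hi => ?_
  have hker : ∀ j, ∑ n ∈ range N,
      expTwoPiI (n * x i) * (starRingEnd ℂ) (expTwoPiI (n * x j)) =
      ∑ n ∈ range N, expTwoPiI (fract (x i - x j)) ^ n := by
    intro j
    refine sum_congr rfl fun n _ => ?_
    rw [conj_expTwoPiI, ← expTwoPiI_add, fract, expTwoPiI_sub_intCast, ← expTwoPiI_natCast_mul]
    congr 1; ring
  simp_rw [hker]
  rw [← add_sum_erase s _ hi]
  refine add_le_add ?_ ?_
  · refine (norm_sum_le _ _).trans ?_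
    simp [norm_expTwoPiI]
  have hfr : ∀ j ∈ s.erase i, 1 / (Q : ℝ) ≤ fract (x i - x j) ∧
      1 / (Q : ℝ) ≤ 1 - fract (x i - x j) := by
    intro j hj
    obtain ⟨hji, hjs⟩ := mem_erase.mp hj
    have h1 := hsep i hi j hjs hji.symm ⌊x i - x j⌋
    have h2 := hsep i hi j hjs hji.symm (⌊x i - x j⌋ + 1)
    have h3 := Int.fract_nonneg (x i - x j)
    have h4 := Int.fract_lt_one (x i - x j)
    constructor
    · rwa [show x i - x j - ⌊x i - x j⌋ = fract (x i - x j) from rfl, abs_of_nonneg h3] at h1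
    · push_cast at h2
      rw [show x i - x j - (⌊x i - x j⌋ + 1) = fract (x i - x j) - 1 by
        rw [fract]; ring, abs_of_neg (by linarith)] at h2
      linarith
  have hsep' : ∀ j ∈ s.erase i, ∀ k ∈ s.erase i, j ≠ k →
      1 / (Q : ℝ) ≤ |fract (x i - x j) - fract (x i - x k)| := by
    intro j hj k hk hjk
    have h1 := hsep j (mem_of_mem_erase hj) k (mem_of_mem_erase hk) hjk
      (⌊x i - x k⌋ - ⌊x i - x j⌋)
    rw [← abs_neg] at h1
    convert h1 using 2
    rw [fract, fract]; push_cast; ring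
  have h5 := sum_one_div_le_of_separated (s.erase i) (fun j => fract (x i - x j)) hQ
    (fun j hj => (hfr j hj).1) (fun j _ => (Int.fract_lt_one _).le) hsep'
  have h6 := sum_one_div_le_of_separated (s.erase i) (fun j => 1 - fract (x i - x j)) hQ
    (fun j hj => (hfr j hj).2) (fun j _ => by linarith [Int.fract_nonneg (x i - x j)])
    (fun j hj k hk hjk => by
      have := hsep' j hj k hk hjk
      rw [abs_sub_comm] at this
      convert this using 2; ring)
  calc ∑ j ∈ s.erase i, ‖∑ n ∈ range N, expTwoPiI (fract (x i - x j)) ^ n‖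
      ≤ ∑ j ∈ s.erase i, 1 / 2 * (1 / fract (x i - x j) + 1 / (1 - fract (x i - x j))) := by
        refine sum_le_sum fun j hj => norm_geom_sum_expTwoPiI_le N ?_ (Int.fract_lt_one _)
        exact lt_of_lt_of_le (by positivity) (hfr j hj).1
    _ = 1 / 2 * (∑ j ∈ s.erase i, 1 / fract (x i - x j) +
          ∑ j ∈ s.erase i, 1 / (1 - fract (x i - x j))) := by
        rw [← mul_sum, sum_add_distrib]
    _ ≤ _ := by linarith

lemma conj_dirichletCharacter_apply {q : ℕ} [NeZero q] (χ : DirichletCharacter ℂ q) (b : ZMod q) :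
    (starRingEnd ℂ) (χ b) = χ⁻¹ b := MulChar.star_apply' χ b

lemma norm_inv_dirichletCharacter_apply {q : ℕ} [NeZero q] (χ : DirichletCharacter ℂ q)
    (b : ZMod q) : ‖χ⁻¹ b‖ = ‖χ b‖ := by
  rw [← conj_dirichletCharacter_apply, RCLike.norm_conj]

open Classical in
lemma sum_dirichletCharacter_mul_conj {q : ℕ} [NeZero q] (b : ZMod q) {b' : ZMod q}
    (hb : IsUnit b') : ∑ χ : DirichletCharacter ℂ q, χ b * (starRingEnd ℂ) (χ b') =
      if b' = b then (q.totient : ℂ) else 0 := by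
  rw [← DirichletCharacter.sum_char_inv_mul_char_eq ℂ hb b]
  refine sum_congr rfl fun χ _ => ?_
  rw [conj_dirichletCharacter_apply, mul_comm, MulChar.inv_apply]
  congr 2
  obtain ⟨u, rfl⟩ := hb
  rw [Ring.inverse_unit, ZMod.inv_coe_unit]

open Classical in
lemma sum_norm_sq_dirichletCharacter_sum {q : ℕ} [NeZero q] (S : ZMod q → ℂ) :
    ∑ χ : DirichletCharacter ℂ q, ‖∑ b, χ b * S b‖ ^ 2 =
      q.totient * ∑ b ∈ univ.filter (fun b : ZMod q => IsUnit b), ‖S b‖ ^ 2 := by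
  set U := univ.filter (fun b : ZMod q => IsUnit b) with hU
  have h1 : ∀ χ : DirichletCharacter ℂ q, ∑ b, χ b * S b = ∑ b ∈ U, χ b * S b := by
    intro χ
    rw [hU, sum_filter]
    refine sum_congr rfl fun b _ => ?_
    split_ifs with h
    · rfl
    · rw [MulChar.map_nonunit χ h, zero_mul]
  simp_rw [h1]
  have h2 : ((∑ χ : DirichletCharacter ℂ q, ‖∑ b ∈ U, χ b * S b‖ ^ 2 : ℝ) : ℂ) =
      ∑ b ∈ U, ∑ b' ∈ U, S b * (starRingEnd ℂ) (S b') *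
        ∑ χ : DirichletCharacter ℂ q, χ b * (starRingEnd ℂ) (χ b') := by
    push_cast
    simp_rw [← mul_conj', map_sum, sum_mul_sum, mul_sum]
    rw [sum_comm]
    refine sum_congr rfl fun i _ => ?_
    rw [sum_comm]
    refine sum_congr rfl fun j _ => sum_congr rfl fun n _ => ?_
    rw [map_mul]; ring
  have h3 : ((∑ χ : DirichletCharacter ℂ q, ‖∑ b ∈ U, χ b * S b‖ ^ 2 : ℝ) : ℂ) =
      ((q.totient * ∑ b ∈ U, ‖S b‖ ^ 2 : ℝ) : ℂ) := by
    rw [h2]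
    push_cast
    rw [mul_sum]
    refine sum_congr rfl fun b hb => ?_
    rw [sum_eq_single_of_mem b hb]
    · rw [sum_dirichletCharacter_mul_conj b (mem_filter.mp hb).2, if_pos rfl,
        ← mul_conj', mul_comm]
    · intro b' hb' hne
      rw [sum_dirichletCharacter_mul_conj b (mem_filter.mp hb').2, if_neg hne, mul_zero]
  exact_mod_cast h3

lemma norm_gaussSum_sq_of_isPrimitive {q : ℕ} [NeZero q] {χ : DirichletCharacter ℂ q}
    (hχ : χ.IsPrimitive) : ‖gaussSum χ stdAddChar‖ ^ 2 = q := by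
  classical
  have hP : ((∑ n : ZMod q, ‖gaussSum χ ((stdAddChar (N := q)).mulShift n)‖ ^ 2 : ℝ) : ℂ) =
      ((q * ∑ b : ZMod q, ‖χ b‖ ^ 2 : ℝ) : ℂ) := by
    have h1 : ((∑ n : ZMod q, ‖gaussSum χ ((stdAddChar (N := q)).mulShift n)‖ ^ 2 : ℝ) : ℂ) =
        ∑ b : ZMod q, ∑ b' : ZMod q, χ b * (starRingEnd ℂ) (χ b') *
          ∑ n : ZMod q, stdAddChar (n * (b - b')) := by
      push_cast
      simp_rw [← mul_conj', gaussSum, map_sum, sum_mul_sum, mul_sum]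
      rw [sum_comm]
      refine sum_congr rfl fun i _ => ?_
      rw [sum_comm]
      refine sum_congr rfl fun j _ => sum_congr rfl fun n _ => ?_
      rw [map_mul, AddChar.mulShift_apply, AddChar.mulShift_apply, mul_sub, sub_eq_add_neg,
        AddChar.map_add_eq_mul, AddChar.map_neg_eq_conj]
      ring
    rw [h1]
    push_cast
    rw [mul_sum]
    refine sum_congr rfl fun b _ => ?_
    rw [sum_eq_single_of_mem b (mem_univ _)]
    · rw [AddChar.sum_mulShift _ (ZMod.isPrimitive_stdAddChar q), if_pos (sub_self b),
        mul_conj', ZMod.card, mul_comm]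
    · intro b' _ hne
      rw [AddChar.sum_mulShift _ (ZMod.isPrimitive_stdAddChar q),
        if_neg (sub_ne_zero.mpr hne.symm), Nat.cast_zero, mul_zero]
  have hP' : ∑ n : ZMod q, ‖gaussSum χ ((stdAddChar (N := q)).mulShift n)‖ ^ 2 =
      q * ∑ b : ZMod q, ‖χ b‖ ^ 2 := by exact_mod_cast hP
  simp_rw [gaussSum_mulShift_of_isPrimitive _ hχ, norm_mul, norm_inv_dirichletCharacter_apply,
    mul_pow] at hP'
  rw [← sum_mul, mul_comm] at hP'
  refine mul_right_cancel₀ (ne_of_gt ?_) hP'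
  refine lt_of_lt_of_le one_pos ?_
  have := single_le_sum (f := fun b : ZMod q => ‖χ b‖ ^ 2) (fun b _ => sq_nonneg _)
    (mem_univ 1)
  simpa using this

open Classical in
/-- The sum over primitive characters to a fixed modulus is dominated by a sum over reduced
fractions. -/
lemma sum_isPrimitive_norm_sq_le {q : ℕ} [NeZero q] (N : ℕ) (a : ℕ → ℂ) :
    ∑ χ ∈ univ.filter (fun χ : DirichletCharacter ℂ q => χ.IsPrimitive),
        ‖∑ n ∈ range N, a n * χ n‖ ^ 2 ≤
      ∑ b ∈ univ.filter (fun b : ZMod q => IsUnit b),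
        ‖∑ n ∈ range N, (starRingEnd ℂ) (a n) * expTwoPiI (n * (b.val / q))‖ ^ 2 := by
  have hq : (0 : ℝ) < q := by exact_mod_cast NeZero.pos q
  set S : ZMod q → ℂ := fun b =>
    ∑ n ∈ range N, (starRingEnd ℂ) (a n) * expTwoPiI (n * (b.val / q)) with hS
  have hexp : ∀ (n : ℕ) (b : ZMod q),
      expTwoPiI (n * (b.val / q)) = stdAddChar ((n : ZMod q) * b) := by
    intro n b
    have h := ZMod.stdAddChar_coe (N := q) ((n * b.val : ℕ) : ℤ)
    have h2 : (((n * b.val : ℕ) : ℤ) : ZMod q) = (n : ZMod q) * b := by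
      push_cast
      rw [natCast_zmod_val]
    rw [h2] at h
    rw [h]
    unfold expTwoPiI
    congr 1
    push_cast
    ring
  have key : ∀ χ : DirichletCharacter ℂ q, χ.IsPrimitive →
      q * ‖∑ n ∈ range N, a n * χ n‖ ^ 2 = ‖∑ b, χ b * S b‖ ^ 2 := by
    intro χ hχ
    have h1 : ‖∑ n ∈ range N, a n * χ n‖ =
        ‖∑ n ∈ range N, (starRingEnd ℂ) (a n) * χ⁻¹ (n : ZMod q)‖ := by
      rw [← RCLike.norm_conj, map_sum]
      congr 1
      refine sum_congr rfl fun n _ => ?_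
      rw [map_mul, conj_dirichletCharacter_apply]
    rw [h1, ← norm_gaussSum_sq_of_isPrimitive hχ, ← mul_pow, ← norm_mul]
    congr 2
    rw [mul_sum]
    simp_rw [hS, mul_sum]
    rw [sum_comm]
    refine sum_congr rfl fun n _ => ?_
    have h2 := gaussSum_mulShift_of_isPrimitive (stdAddChar (N := q)) hχ (n : ZMod q)
    rw [mul_left_comm, mul_comm (gaussSum _ _), ← h2, gaussSum, mul_sum]
    refine sum_congr rfl fun b _ => ?_
    rw [hexp, AddChar.mulShift_apply]; ring
  have h3 : q * ∑ χ ∈ univ.filter (fun χ : DirichletCharacter ℂ q => χ.IsPrimitive),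
        ‖∑ n ∈ range N, a n * χ n‖ ^ 2 ≤
      q * ∑ b ∈ univ.filter (fun b : ZMod q => IsUnit b), ‖S b‖ ^ 2 := by
    calc _ = ∑ χ ∈ univ.filter (fun χ : DirichletCharacter ℂ q => χ.IsPrimitive),
          ‖∑ b, χ b * S b‖ ^ 2 := by
          rw [mul_sum]
          exact sum_congr rfl fun χ hχ => key χ (mem_filter.mp hχ).2
      _ ≤ ∑ χ : DirichletCharacter ℂ q, ‖∑ b, χ b * S b‖ ^ 2 :=
          sum_le_sum_of_subset_of_nonneg (filter_subset _ _)
            fun _ _ _ => sq_nonneg _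
      _ = q.totient * _ := sum_norm_sq_dirichletCharacter_sum S
      _ ≤ _ := by
          gcongr
          · exact Nat.totient_le q
  exact le_of_mul_le_mul_left h3 hq

/-- Characters indexed together with their (positive) moduli. -/
abbrev CharIndex := Σ r : ℕ, DirichletCharacter ℂ (r + 1)

open Classical in
/-- The primitive characters of modulus at most `D`. -/
noncomputable def primChars (D : ℕ) : Finset CharIndex :=
  (range D).sigma fun r =>
    univ.filter (fun χ : DirichletCharacter ℂ (r + 1) => χ.IsPrimitive)

lemma fractions_separated {D r r' : ℕ} (hr : r < D) (hr' : r' < D) (b : ZMod (r + 1))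
    (b' : ZMod (r' + 1)) (hb : IsUnit b) (hb' : IsUnit b')
    (hne : (⟨r, b⟩ : Σ r : ℕ, ZMod (r + 1)) ≠ ⟨r', b'⟩) (k : ℤ) :
    1 / ((D ^ 2 : ℕ) : ℝ) ≤
      |(b.val : ℝ) / ((r + 1 : ℕ) : ℝ) - (b'.val : ℝ) / ((r' + 1 : ℕ) : ℝ) - k| := by
  have hc : Coprime b.val (r + 1) := by
    rw [← isUnit_iff_coprime, natCast_zmod_val]; exact hb
  have hc' : Coprime b'.val (r' + 1) := by
    rw [← isUnit_iff_coprime, natCast_zmod_val]; exact hb'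
  set z : ℤ := b.val * (r' + 1 : ℕ) - b'.val * (r + 1 : ℕ) - k * (r + 1 : ℕ) * (r' + 1 : ℕ) with hz
  have hz0 : z ≠ 0 := by
    intro h0
    have e1 : ((r + 1 : ℕ) : ℤ) ∣ (b.val : ℤ) * (r' + 1 : ℕ) :=
      ⟨b'.val + k * (r' + 1 : ℕ), by linarith⟩
    have e2 : ((r' + 1 : ℕ) : ℤ) ∣ (b'.val : ℤ) * (r + 1 : ℕ) :=
      ⟨b.val - k * (r + 1 : ℕ), by linarith⟩
    have f1 : r + 1 ∣ r' + 1 := hc.symm.dvd_of_dvd_mul_left (by exact_mod_cast e1)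
    have f2 : r' + 1 ∣ r + 1 := hc'.symm.dvd_of_dvd_mul_left (by exact_mod_cast e2)
    have f3 : r = r' := by have := Nat.dvd_antisymm f1 f2; omega
    subst f3
    apply hne
    have e3 : (b.val : ℤ) = b'.val + k * (r + 1 : ℕ) := by
      have h1 : ((r + 1 : ℕ) : ℤ) ≠ 0 := by positivity
      have h2 : ((r + 1 : ℕ) : ℤ) * (b.val) = (r + 1 : ℕ) * (b'.val + k * (r + 1 : ℕ)) := by
        linarith
      exact mul_left_cancel₀ h1 h2
    have e4 := congrArg (fun z : ℤ => (z : ZMod (r + 1))) e3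
    simp only [Int.cast_add, Int.cast_mul, Int.cast_natCast, natCast_zmod_val,
      ZMod.natCast_self, mul_zero, add_zero] at e4
    rw [e4]
  have hr0 : (0 : ℝ) < ((r + 1 : ℕ) : ℝ) := by positivity
  have hr0' : (0 : ℝ) < ((r' + 1 : ℕ) : ℝ) := by positivity
  have e : (b.val : ℝ) / ((r + 1 : ℕ) : ℝ) - (b'.val : ℝ) / ((r' + 1 : ℕ) : ℝ) - k =
      (z : ℝ) / (((r + 1 : ℕ) : ℝ) * ((r' + 1 : ℕ) : ℝ)) := by
    rw [hz]
    field_simp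
    push_cast
    ring
  have h1 : (1 : ℝ) ≤ |(z : ℝ)| := by
    rw [← Int.cast_abs]; exact_mod_cast Int.one_le_abs hz0
  rw [e, abs_div, abs_of_pos (mul_pos hr0 hr0')]
  refine div_le_div₀ (abs_nonneg _) h1 (mul_pos hr0 hr0') ?_
  have : (r + 1) * (r' + 1) ≤ D ^ 2 := by rw [sq]; exact Nat.mul_le_mul hr hr'
  exact_mod_cast this

/-- The multiplicative large sieve. -/
theorem multiplicative_large_sieve {D : ℕ} (hD : 0 < D) (N : ℕ) (a : ℕ → ℂ) :
    ∑ χ ∈ primChars D, ‖∑ n ∈ range N, a n * χ.2 n‖ ^ 2 ≤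
      (N + (D : ℝ) ^ 2 * (1 + 2 * log D)) * ∑ n ∈ range N, ‖a n‖ ^ 2 := by
  classical
  unfold primChars
  rw [sum_sigma]
  calc _ ≤ ∑ r ∈ range D, ∑ b ∈ univ.filter (fun b : ZMod (r + 1) => IsUnit b),
        ‖∑ n ∈ range N, (starRingEnd ℂ) (a n) *
          expTwoPiI (n * (b.val / ((r + 1 : ℕ) : ℝ)))‖ ^ 2 :=
        sum_le_sum fun r _ => sum_isPrimitive_norm_sq_le (q := r + 1) N a
    _ = ∑ i ∈ (range D).sigma
          (fun r => univ.filter (fun b : ZMod (r + 1) => IsUnit b)),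
        ‖∑ n ∈ range N, (starRingEnd ℂ) (a n) *
          expTwoPiI (n * (i.2.val / ((i.1 + 1 : ℕ) : ℝ)))‖ ^ 2 := by rw [sum_sigma]
    _ ≤ (N + (D ^ 2 : ℕ) * (1 + log (D ^ 2 : ℕ))) *
          ∑ n ∈ range N, ‖(starRingEnd ℂ) (a n)‖ ^ 2 := by
        refine additive_large_sieve _ _ (by positivity) ?_ N _
        rintro ⟨r, b⟩ hi ⟨r', b'⟩ hj hne k
        simp only [mem_sigma, mem_range, mem_filter, mem_univ,
          true_and] at hi hj
        exact fractions_separated hi.1 hj.1 b b' hi.2 hj.2 hne k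
    _ = _ := by
        simp_rw [RCLike.norm_conj]
        push_cast
        rw [log_pow]
        push_cast
        ring

lemma sqrt_mul_add_sqrt_mul_le {a b c d : ℝ} (ha : 0 ≤ a) (hb : 0 ≤ b) (hc : 0 ≤ c) (hd : 0 ≤ d) :
    √a * √c + √b * √d ≤ √(a + b) * √(c + d) := by
  rw [← sqrt_mul (add_nonneg ha hb)]
  refine Real.le_sqrt_of_sq_le ?_
  have e1 := sq_sqrt ha
  have e2 := sq_sqrt hb
  have e3 := sq_sqrt hc
  have e4 := sq_sqrt hd
  have h : (√a * √c + √b * √d) ^ 2 + (√a * √d - √b * √c) ^ 2 =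
      (√a ^ 2 + √b ^ 2) * (√c ^ 2 + √d ^ 2) := by ring
  rw [e1, e2, e3, e4] at h
  linarith [sq_nonneg (√a * √d - √b * √c)]

/-- A bilinear bound over rectangles implies one under a hyperbolic-type cut, with a logarithmic
loss, by repeated bisection. -/
theorem sum_norm_bilinear_cut_le {ι : Type*} (T : Finset ι) (φ : ι → ℕ → ℂ) (a b : ℕ → ℂ)
    (A : Finset ℕ) (N : ℕ) {G : ℝ} (hG : 0 ≤ G)
    (H : ∀ A' ⊆ A, ∀ B ⊆ range N,
      ∑ i ∈ T, ‖∑ m ∈ A', a m * φ i m‖ * ‖∑ l ∈ B, b l * φ i l‖ ≤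
        G * (√(∑ m ∈ A', ‖a m‖ ^ 2) * √(∑ l ∈ B, ‖b l‖ ^ 2))) (c : ℕ → ℕ) (k : ℕ) :
    ∀ A' ⊆ A, ∀ u, u + 2 ^ k ≤ N →
      ∑ i ∈ T, ‖∑ m ∈ A', a m * φ i m * ∑ l ∈ Ico u (min (c m) (u + 2 ^ k)), b l * φ i l‖ ≤
        (k + 1) * (G * (√(∑ m ∈ A', ‖a m‖ ^ 2) *
          √(∑ l ∈ Ico u (u + 2 ^ k), ‖b l‖ ^ 2))) := by
  have nn : ∀ (S : Finset ℕ) (f : ℕ → ℂ), 0 ≤ ∑ m ∈ S, ‖f m‖ ^ 2 := fun S f =>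
    sum_nonneg fun _ _ => sq_nonneg _
  induction k with
  | zero =>
    intro A' hA' u hu
    rw [pow_zero] at hu ⊢
    have h := H (A'.filter (fun m => u < c m)) ((filter_subset _ _).trans hA')
      (Ico u (u + 1)) (by intro x hx; simp only [mem_Ico, mem_range] at *; omega)
    calc _ = ∑ i ∈ T, ‖∑ m ∈ A'.filter (fun m => u < c m), a m * φ i m‖ *
          ‖∑ l ∈ Ico u (u + 1), b l * φ i l‖ := by
          refine sum_congr rfl fun i _ => ?_
          rw [← norm_mul, sum_mul, sum_filter]
          congr 1
          refine sum_congr rfl fun m _ => ?_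
          split_ifs with hm
          · rw [min_eq_right (by omega)]
          · rw [Ico_eq_empty_of_le (by omega), sum_empty, mul_zero]
      _ ≤ _ := h
      _ ≤ _ := by
          rw [Nat.cast_zero, zero_add, one_mul]
          gcongr
          exact filter_subset _ _
  | succ k ih =>
    intro A' hA' u hu
    have hpos : 0 < 2 ^ k := by positivity
    obtain ⟨v, hv⟩ : ∃ v, v = u + 2 ^ k := ⟨_, rfl⟩
    set A1 := A'.filter (fun m => c m ≤ v)
    set A2 := A'.filter (fun m => ¬ c m ≤ v)
    have h1 := ih A1 ((filter_subset _ _).trans hA') u (by omega)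
    have h2 := ih A2 ((filter_subset _ _).trans hA') v (by omega)
    have h3 := H A2 ((filter_subset _ _).trans hA') (Ico u v)
      (by intro x hx; simp only [mem_Ico, mem_range] at *; omega)
    rw [← hv] at h1
    have huv : u + 2 ^ (k + 1) = v + 2 ^ k := by omega
    rw [huv]
    have hsplit : ∀ i ∈ T, ‖∑ m ∈ A', a m * φ i m *
        ∑ l ∈ Ico u (min (c m) (v + 2 ^ k)), b l * φ i l‖ ≤
        ‖∑ m ∈ A1, a m * φ i m * ∑ l ∈ Ico u (min (c m) v), b l * φ i l‖ +
        (‖∑ m ∈ A2, a m * φ i m * ∑ l ∈ Ico v (min (c m) (v + 2 ^ k)), b l * φ i l‖ +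
        ‖∑ m ∈ A2, a m * φ i m‖ * ‖∑ l ∈ Ico u v, b l * φ i l‖) := by
      intro i _
      rw [← sum_filter_add_sum_filter_not A' (fun m => c m ≤ v)]
      refine (norm_add_le _ _).trans (add_le_add (le_of_eq ?_) ?_)
      · congr 1
        refine sum_congr rfl fun m hm => ?_
        have := (mem_filter.mp hm).2
        rw [min_eq_left this, min_eq_left (by omega)]
      · rw [← norm_mul, sum_mul]
        refine le_trans (le_of_eq ?_) (norm_add_le _ _)
        rw [← sum_add_distrib]
        congr 1
        refine sum_congr rfl fun m hm => ?_
        have := (mem_filter.mp hm).2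
        rw [← mul_add, add_comm (∑ l ∈ Ico v _, _), sum_Ico_consecutive _ (m := u) (n := v) (by omega)
          (by rw [le_min_iff]; omega)]
    refine (sum_le_sum hsplit).trans ?_
    rw [sum_add_distrib, sum_add_distrib]
    have ea : ∑ m ∈ A', ‖a m‖ ^ 2 = ∑ m ∈ A1, ‖a m‖ ^ 2 + ∑ m ∈ A2, ‖a m‖ ^ 2 :=
      (sum_filter_add_sum_filter_not A' _ _).symm
    have eb : ∑ l ∈ Ico u (v + 2 ^ k), ‖b l‖ ^ 2 =
        ∑ l ∈ Ico u v, ‖b l‖ ^ 2 + ∑ l ∈ Ico v (v + 2 ^ k), ‖b l‖ ^ 2 :=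
      (sum_Ico_consecutive _ (by omega) (by omega)).symm
    have h4 := sqrt_mul_add_sqrt_mul_le (nn A1 a) (nn A2 a) (nn (Ico u v) b)
      (nn (Ico v (v + 2 ^ k)) b)
    rw [← ea, ← eb] at h4
    have h5 : √(∑ m ∈ A2, ‖a m‖ ^ 2) * √(∑ l ∈ Ico u v, ‖b l‖ ^ 2) ≤
        √(∑ m ∈ A', ‖a m‖ ^ 2) * √(∑ l ∈ Ico u (v + 2 ^ k), ‖b l‖ ^ 2) := by
      rw [ea, eb]
      gcongr
      · linarith [nn A1 a]
      · linarith [nn (Ico v (v + 2 ^ k)) b]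
    have h4' := mul_le_mul_of_nonneg_left h4 hG
    have h5' := mul_le_mul_of_nonneg_left h5 hG
    have h6 := mul_le_mul_of_nonneg_left h4' (by positivity : (0 : ℝ) ≤ k + 1)
    push_cast
    linarith

/-- The type II estimate for a rectangle of primitive characters. -/
lemma sum_primChars_bilinear_le {D : ℕ} (hD : 0 < D) {T : Finset CharIndex} (hT : T ⊆ primChars D)
    (a b : ℕ → ℂ) {M N : ℕ} {A B : Finset ℕ} (hA : A ⊆ range M) (hB : B ⊆ range N) :
    ∑ χ ∈ T, ‖∑ m ∈ A, a m * χ.2 m‖ * ‖∑ l ∈ B, b l * χ.2 l‖ ≤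
      √((M + (D : ℝ) ^ 2 * (1 + 2 * log D)) * (N + (D : ℝ) ^ 2 * (1 + 2 * log D))) *
        (√(∑ m ∈ A, ‖a m‖ ^ 2) * √(∑ l ∈ B, ‖b l‖ ^ 2)) := by
  have ls : ∀ (a : ℕ → ℂ) (A : Finset ℕ) (M : ℕ), A ⊆ range M →
      ∑ χ ∈ T, ‖∑ m ∈ A, a m * χ.2 m‖ ^ 2 ≤
        (M + (D : ℝ) ^ 2 * (1 + 2 * log D)) * ∑ m ∈ A, ‖a m‖ ^ 2 := by
    intro a A M hA
    have h := multiplicative_large_sieve hD M (fun m => if m ∈ A then a m else 0)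
    have e1 : ∑ n ∈ range M, ‖if n ∈ A then a n else 0‖ ^ 2 = ∑ m ∈ A, ‖a m‖ ^ 2 := by
      rw [← sum_subset hA]
      · exact sum_congr rfl fun n hn => by rw [if_pos hn]
      · intro n _ hn; rw [if_neg hn]; simp
    have e2 : ∀ χ : CharIndex, ∑ n ∈ range M, (if n ∈ A then a n else 0) * χ.2 n =
        ∑ m ∈ A, a m * χ.2 m := by
      intro χ
      rw [← sum_subset hA]
      · exact sum_congr rfl fun n hn => by rw [if_pos hn]
      · intro n _ hn; rw [if_neg hn, zero_mul]
    simp_rw [e1, e2] at h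
    exact (sum_le_sum_of_subset_of_nonneg hT fun _ _ _ => sq_nonneg _).trans h
  have hcs := Real.sum_mul_le_sqrt_mul_sqrt T (fun χ => ‖∑ m ∈ A, a m * χ.2 m‖)
    (fun χ => ‖∑ l ∈ B, b l * χ.2 l‖)
  refine hcs.trans ?_
  rw [sqrt_mul (by positivity)]
  calc _ ≤ √((M + (D : ℝ) ^ 2 * (1 + 2 * log D)) * ∑ m ∈ A, ‖a m‖ ^ 2) *
        √((N + (D : ℝ) ^ 2 * (1 + 2 * log D)) * ∑ l ∈ B, ‖b l‖ ^ 2) := by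
        gcongr
        · exact ls a A M hA
        · exact ls b B N hB
    _ = _ := by
        rw [sqrt_mul (by positivity), sqrt_mul (by positivity)]
        ring

/-- The twist of a real arithmetic function by a Dirichlet character. -/
noncomputable def twist {q : ℕ} (χ : DirichletCharacter ℂ q) (f : ArithmeticFunction ℝ) :
    ArithmeticFunction ℂ := ⟨fun n => f n * χ n, by simp⟩

lemma twist_apply {q : ℕ} (χ : DirichletCharacter ℂ q) (f : ArithmeticFunction ℝ) (n : ℕ) :
    twist χ f n = f n * χ n := rfl

lemma twist_add {q : ℕ} (χ : DirichletCharacter ℂ q) (f g : ArithmeticFunction ℝ) :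
    twist χ (f + g) = twist χ f + twist χ g := by
  ext n; simp [twist_apply, add_mul]

lemma twist_sub {q : ℕ} (χ : DirichletCharacter ℂ q) (f g : ArithmeticFunction ℝ) :
    twist χ (f - g) = twist χ f - twist χ g := by
  ext n; simp [twist_apply, sub_eq_add_neg, add_mul]

lemma twist_mul {q : ℕ} (χ : DirichletCharacter ℂ q) (f g : ArithmeticFunction ℝ) :
    twist χ (f * g) = twist χ f * twist χ g := by
  ext n
  rw [twist_apply, ArithmeticFunction.mul_apply, ArithmeticFunction.mul_apply]
  push_cast
  rw [sum_mul]
  refine sum_congr rfl fun x hx => ?_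
  rw [twist_apply, twist_apply, ← (Nat.mem_divisorsAntidiagonal.mp hx).1]
  push_cast
  rw [map_mul]; ring

notation "μᵣ" => (moebius : ArithmeticFunction ℝ)
notation "ζᵣ" => (zeta : ArithmeticFunction ℝ)

/-- The part of an arithmetic function supported on `n ≤ U`. -/
noncomputable def lowPart (U : ℕ) (f : ArithmeticFunction ℝ) : ArithmeticFunction ℝ :=
  ⟨fun n => if n ≤ U then f n else 0, by simp⟩

lemma lowPart_apply (U : ℕ) (f : ArithmeticFunction ℝ) (n : ℕ) :
    lowPart U f n = if n ≤ U then f n else 0 := rfl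

notation "typeI(" U ")" => (lowPart U Λ + lowPart U μᵣ * ArithmeticFunction.log - lowPart U μᵣ * (lowPart U Λ * ζᵣ))

/-- Vaughan's identity. -/
lemma vaughan_identity (U : ℕ) :
    (Λ : ArithmeticFunction ℝ) =
      typeI(U) +
        (μᵣ - lowPart U μᵣ) *
          ((Λ - lowPart U Λ) * ζᵣ) := by
  have h1 : (Λ : ArithmeticFunction ℝ) * ζᵣ = ArithmeticFunction.log :=
    vonMangoldt_mul_zeta
  have h2 : μᵣ * ζᵣ = 1 :=
    coe_moebius_mul_coe_zeta
  set L : ArithmeticFunction ℝ := Λ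
  set M := μᵣ
  set Z := ζᵣ
  rw [← h1]
  linear_combination (-(L - lowPart U L)) * h2

lemma sum_Ioc_add_eq_sum_zmod {q : ℕ} [NeZero q] (a : ℕ) (f : ZMod q → ℂ) :
    ∑ n ∈ Ioc a (a + q), f n = ∑ x, f x := by
  refine sum_nbij (fun n : ℕ => (n : ZMod q)) (fun _ _ => mem_univ _) ?_ ?_
    (fun _ _ => rfl)
  · intro m hm n hn hmn
    simp only [coe_Ioc, Set.mem_Ioc] at hm hn
    have h := (ZMod.natCast_eq_natCast_iff _ _ _).1 hmn
    have h1 : ((q : ℕ) : ℤ) ∣ (n : ℤ) - m := (Nat.modEq_iff_dvd).1 h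
    obtain ⟨k, hk⟩ := h1
    have h2 : k = 0 := by
      have b1 : (q : ℤ) * k < q * 1 := by omega
      have b2 : (q : ℤ) * (-1) < q * k := by omega
      have hq : (0 : ℤ) < q := by exact_mod_cast NeZero.pos q
      have := lt_of_mul_lt_mul_left b1 hq.le
      have := lt_of_mul_lt_mul_left b2 hq.le
      omega
    rw [h2] at hk
    omega
  · intro x _
    refine ⟨a + 1 + (x - ((a + 1 : ℕ) : ZMod q)).val, ?_, ?_⟩
    · have := ZMod.val_lt (x - ((a + 1 : ℕ) : ZMod q))
      simp only [coe_Ioc, Set.mem_Ioc]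
      omega
    · change ((a + 1 + (x - ((a + 1 : ℕ) : ZMod q)).val : ℕ) : ZMod q) = x
      rw [Nat.cast_add, natCast_zmod_val]
      ring

lemma norm_sum_Ioc_dirichletCharacter_le {q : ℕ} [NeZero q] {χ : DirichletCharacter ℂ q}
    (hχ : χ ≠ 1) (z : ℕ) : ‖∑ n ∈ Ioc 0 z, χ n‖ ≤ q := by
  have hq : 0 < q := NeZero.pos q
  induction z using Nat.strong_induction_on with
  | _ z ih =>
    rcases lt_or_ge z q with h | h
    · refine (norm_sum_le_of_le (f := fun n : ℕ => χ (n : ZMod q)) (Ioc 0 z) fun n _ =>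
        norm_le_one χ (n : ZMod q)).trans ?_
      simp only [sum_const, card_Ioc, nsmul_eq_mul, mul_one]
      exact_mod_cast (by omega : z - 0 ≤ q)
    · have h1 : ∑ n ∈ Ioc 0 z, χ n = ∑ n ∈ Ioc 0 (z - q), χ n := by
        rw [← sum_Ioc_consecutive (n := z - q) _ (Nat.zero_le _) (sub_le _ _)]
        rw [add_eq_left]
        have := sum_Ioc_add_eq_sum_zmod (q := q) (z - q) χ
        rwa [Nat.sub_add_cancel h, MulChar.sum_eq_zero_of_ne_one hχ] at this
      rw [h1]
      exact ih _ (by omega)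

lemma norm_sum_Ioc_log_mul_dirichletCharacter_le {q : ℕ} [NeZero q] {χ : DirichletCharacter ℂ q}
    (hχ : χ ≠ 1) (z : ℕ) :
    ‖∑ n ∈ Ioc 0 z, (log n : ℂ) * χ n‖ ≤ 2 * q * log z := by
  have key : ‖(log z : ℂ) * ∑ n ∈ Ioc 0 z, χ n -
      ∑ n ∈ Ioc 0 z, (log n : ℂ) * χ n‖ ≤ q * log z := by
    induction z with
    | zero => simp
    | succ z ih =>
      have hmono : 0 ≤ log (z + 1 : ℕ) - log z := by
        rcases eq_zero_or_pos z with h | h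
        · subst h; simp
        · rw [sub_nonneg]
          exact log_le_log (by exact_mod_cast h) (by exact_mod_cast Nat.le_succ z)
      rw [sum_Ioc_succ_top (Nat.zero_le _), sum_Ioc_succ_top (Nat.zero_le _)]
      have e : (log (z + 1 : ℕ) : ℂ) * (∑ n ∈ Ioc 0 z, χ n + χ (z + 1 : ℕ)) -
          (∑ n ∈ Ioc 0 z, (log n : ℂ) * χ n +
            (log (z + 1 : ℕ) : ℂ) * χ (z + 1 : ℕ)) =
          ((log z : ℂ) * ∑ n ∈ Ioc 0 z, χ n -
            ∑ n ∈ Ioc 0 z, (log n : ℂ) * χ n) +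
          ((log (z + 1 : ℕ) - log z : ℝ) : ℂ) * ∑ n ∈ Ioc 0 z, χ n := by
        rw [ofReal_sub]; ring
      rw [e]
      refine (norm_add_le _ _).trans ?_
      rw [norm_mul, norm_real, norm_of_nonneg hmono]
      have := mul_le_mul_of_nonneg_left (norm_sum_Ioc_dirichletCharacter_le hχ z) hmono
      linarith
  have h1 := norm_sum_Ioc_dirichletCharacter_le hχ z
  have h2 := log_natCast_nonneg z
  have h3 := norm_sub_le ((log z : ℂ) * ∑ n ∈ Ioc 0 z, χ n)
    ((log z : ℂ) * ∑ n ∈ Ioc 0 z, χ n -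
      ∑ n ∈ Ioc 0 z, (log n : ℂ) * χ n)
  rw [sub_sub_cancel, norm_mul, norm_real, norm_of_nonneg h2] at h3
  have := mul_le_mul_of_nonneg_left h1 h2
  linarith

lemma norm_sum_lowPart_mul_le (U y : ℕ) (f : ArithmeticFunction ℝ) (c : ℕ → ℂ) {B : ℝ} (hB : 0 ≤ B)
    (h : ∀ n ∈ Ioc 0 y, ‖(f n : ℂ) * c n‖ ≤ B) :
    ‖∑ n ∈ Ioc 0 y, (lowPart U f n : ℂ) * c n‖ ≤ U * B := by
  have e : ∑ n ∈ Ioc 0 y, (lowPart U f n : ℂ) * c n =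
      ∑ n ∈ (Ioc 0 y).filter (fun n => n ≤ U), (f n : ℂ) * c n := by
    rw [sum_filter]
    refine sum_congr rfl fun n _ => ?_
    rw [lowPart_apply]
    split_ifs <;> simp
  rw [e]
  refine (norm_sum_le_of_le _ fun n hn => h n (mem_filter.mp hn).1).trans ?_
  rw [sum_const, nsmul_eq_mul]
  gcongr
  calc _ ≤ (Ioc 0 U).card := card_le_card fun n hn => by
        simp only [mem_filter, mem_Ioc] at *; omega
    _ = U := by simp

lemma log_natCast_le_log {n y : ℕ} (hn : n ≤ y) : log n ≤ log y := by
  rcases eq_zero_or_pos n with h | h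
  · subst h; simpa using log_natCast_nonneg y
  · exact log_le_log (by exact_mod_cast h) (by exact_mod_cast hn)

lemma norm_typeI_le {q : ℕ} [NeZero q] {χ : DirichletCharacter ℂ q} (hχ : χ ≠ 1) {U : ℕ}
    (hU : 1 ≤ U) (y : ℕ) :
    ‖∑ n ∈ Ioc 0 y, twist χ typeI(U) n‖ ≤
      4 * (U : ℝ) ^ 2 * q * (1 + log y) := by
  have hlog := Real.log_natCast_nonneg y
  have hq : (1 : ℝ) ≤ q := by exact_mod_cast NeZero.pos q
  have hU' : (1 : ℝ) ≤ U := by exact_mod_cast hU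
  have hL : ∀ n ∈ Ioc 0 y, ‖((Λ n : ℝ) : ℂ)‖ ≤ log y := by
    intro n hn
    rw [norm_real, Real.norm_of_nonneg vonMangoldt_nonneg]
    exact vonMangoldt_le_log.trans (log_natCast_le_log (mem_Ioc.mp hn).2)
  have hM : ∀ n, ‖((μᵣ n : ℝ) : ℂ)‖ ≤ 1 := by
    intro n
    rw [norm_real, intCoe_apply, Real.norm_eq_abs, ← Int.cast_abs]
    exact_mod_cast abs_moebius_le_one
  have h1 : ‖∑ n ∈ Ioc 0 y, twist χ (lowPart U Λ) n‖ ≤ U * log y := by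
    refine norm_sum_lowPart_mul_le U y Λ (fun n => χ n) hlog fun n hn => ?_
    rw [norm_mul]
    exact (mul_le_mul (hL n hn) (norm_le_one χ _) (norm_nonneg _) hlog).trans
      (by rw [mul_one])
  have h2 : ‖∑ n ∈ Ioc 0 y, twist χ (lowPart U μᵣ * ArithmeticFunction.log) n‖ ≤
      U * (2 * q * log y) := by
    rw [twist_mul, sum_Ioc_mul_eq_sum_sum]
    simp_rw [twist_apply, mul_assoc]
    refine norm_sum_lowPart_mul_le U y _ _ (by positivity) fun n hn => ?_
    rw [norm_mul, norm_mul]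
    have a1 := norm_sum_Ioc_log_mul_dirichletCharacter_le hχ (y / n)
    have a2 := mul_le_mul_of_nonneg_left (log_natCast_le_log (Nat.div_le_self y n))
      (by positivity : (0 : ℝ) ≤ 2 * q)
    simp_rw [log_apply]
    calc _ ≤ 1 * (1 * (2 * q * log y)) :=
          mul_le_mul (hM n) (mul_le_mul (norm_le_one χ _) (a1.trans a2)
            (norm_nonneg _) zero_le_one) (by positivity) zero_le_one
      _ = _ := by ring
  have h3 : ‖∑ n ∈ Ioc 0 y, twist χ (lowPart U μᵣ *
      (lowPart U Λ * ζᵣ)) n‖ ≤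
      U * (U * (log y * q)) := by
    rw [twist_mul, sum_Ioc_mul_eq_sum_sum]
    have b1 : ∀ z ≤ y, ‖∑ m ∈ Ioc 0 z, twist χ (lowPart U Λ *
        ζᵣ) m‖ ≤ U * (log y * q) := by
      intro z hz
      rw [twist_mul, sum_Ioc_mul_eq_sum_sum]
      simp_rw [twist_apply, mul_assoc]
      refine norm_sum_lowPart_mul_le U z _ _ (by positivity) fun n hn => ?_
      rw [norm_mul, norm_mul]
      have c1 : ‖∑ m ∈ Ioc 0 (z / n), ((ζᵣ m : ℝ) : ℂ) * χ m‖ ≤ q := by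
        refine le_trans (le_of_eq ?_) (norm_sum_Ioc_dirichletCharacter_le hχ (z / n))
        congr 1
        refine sum_congr rfl fun m hm => ?_
        rw [natCoe_apply, zeta_apply_ne (by have := (mem_Ioc.mp hm).1; omega)]
        simp
      have c2 := hL n (by simp only [mem_Ioc] at *; omega)
      calc _ ≤ log y * (1 * q) :=
            mul_le_mul c2 (mul_le_mul (norm_le_one χ _) c1
              (norm_nonneg _) zero_le_one) (by positivity) hlog
        _ = _ := by ring
    simp_rw [twist_apply, mul_assoc]
    simp_rw [twist_apply] at b1
    refine norm_sum_lowPart_mul_le U y _ _ (by positivity) fun n hn => ?_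
    rw [norm_mul, norm_mul]
    calc _ ≤ 1 * (1 * (U * (log y * q))) :=
          mul_le_mul (hM n) (mul_le_mul (norm_le_one χ _)
            (b1 _ (Nat.div_le_self y n)) (norm_nonneg _) zero_le_one) (by positivity) zero_le_one
      _ = _ := by ring
  rw [twist_sub, twist_add]
  simp only [sub_eq_add_neg, ArithmeticFunction.add_apply, ArithmeticFunction.neg_apply,
    sum_neg_distrib, sum_add_distrib]
  refine (norm_add_le _ _).trans ?_
  rw [norm_neg]
  refine (add_le_add (norm_add_le _ _) le_rfl).trans ?_
  have e1 : (U : ℝ) * log y ≤ U ^ 2 * q * log y := by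
    have : (U : ℝ) * 1 ≤ U ^ 2 * q := by
      rw [sq, mul_assoc]; gcongr; nlinarith
    nlinarith
  have e2 : (U : ℝ) * (2 * q * log y) ≤ 2 * (U ^ 2 * q * log y) := by
    have : (U : ℝ) * q ≤ U ^ 2 * q := by gcongr; nlinarith
    nlinarith
  have e3 : 0 ≤ (U : ℝ) ^ 2 * q := by positivity
  nlinarith

lemma bilinear_size_bound {M N Δ U y ℓ : ℝ} (hM : 0 ≤ M) (hN : 0 ≤ N) (hΔ : 0 ≤ Δ) (hU : 0 < U)
    (hy : 0 ≤ y) (hℓ : 0 ≤ ℓ) (hMN : M * N ≤ 2 * y) (hUM : U ≤ 2 * M) (hUN : U ≤ N) :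
    √((2 * M + Δ) * (N + Δ)) * (√M * (√N * ℓ)) ≤ 4 * (y + y * (√Δ / √U) + Δ * √y) * ℓ := by
  have h1 : √((2 * M + Δ) * (N + Δ)) * (√M * √N) ≤ 4 * (y + y * (√Δ / √U) + Δ * √y) := by
    rw [← sqrt_mul hM, ← sqrt_mul (by positivity)]
    refine Real.sqrt_le_iff.mpr ⟨by positivity, ?_⟩
    set P := M * N with hP
    have hP0 : 0 ≤ P := mul_nonneg hM hN
    have hPy : P * P ≤ (2 * y) * (2 * y) := mul_le_mul hMN hMN hP0 (by linarith)
    have e0 : (2 * M + Δ) * (N + Δ) * P = 2 * (P * P) + 2 * Δ * (P * M) + Δ * (P * N) + Δ ^ 2 * P := by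
      rw [hP]; ring
    have hMP : P * M ≤ 4 * (y ^ 2 / U) := by
      rw [← mul_div_assoc, le_div_iff₀ hU]
      calc P * M * U ≤ P * M * N := by gcongr
        _ = P * P := by rw [hP]; ring
        _ ≤ _ := by linarith
    have hNP : P * N ≤ 8 * (y ^ 2 / U) := by
      rw [← mul_div_assoc, le_div_iff₀ hU]
      calc P * N * U ≤ P * N * (2 * M) := by gcongr
        _ = 2 * (P * P) := by rw [hP]; ring
        _ ≤ _ := by linarith
    have e1 : (y * (√Δ / √U)) ^ 2 = Δ * (y ^ 2 / U) := by
      rw [mul_pow, div_pow, sq_sqrt hΔ, sq_sqrt hU.le]; ring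
    have e2 : (Δ * √y) ^ 2 = Δ ^ 2 * y := by rw [mul_pow, sq_sqrt hy]
    have f1 := mul_le_mul_of_nonneg_left hMP hΔ
    have f2 := mul_le_mul_of_nonneg_left hNP hΔ
    have f3 := mul_le_mul_of_nonneg_left hMN (sq_nonneg Δ)
    have g1 : 0 ≤ y * (√Δ / √U) := by positivity
    have g2 : 0 ≤ Δ * √y := by positivity
    have g3 : y ^ 2 + (y * (√Δ / √U)) ^ 2 + (Δ * √y) ^ 2 ≤ (y + y * (√Δ / √U) + Δ * √y) ^ 2 := by
      nlinarith [mul_nonneg hy g1, mul_nonneg hy g2, mul_nonneg g1 g2]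
    rw [e1, e2] at g3
    rw [e0, mul_pow]
    have g4 : 0 ≤ Δ ^ 2 * y := by positivity
    have g5 : 0 ≤ y ^ 2 := by positivity
    linarith
  calc _ = √((2 * M + Δ) * (N + Δ)) * (√M * √N) * ℓ := by ring
    _ ≤ _ := by gcongr

lemma natLog_two_add_le {y n : ℕ} (hy : 1 ≤ y) (hn : n ≤ Nat.log 2 y) :
    (n : ℝ) + 2 ≤ 2 * (1 + log y) := by
  have h1 : 2 ^ n ≤ y := (Nat.pow_le_pow_right (by norm_num) hn).trans (pow_log_le_self 2 (by omega))
  have h2 : (n : ℝ) * log 2 ≤ log y := by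
    rw [← log_pow]
    exact log_le_log (by positivity) (by exact_mod_cast h1)
  have h3 := log_two_gt_d9
  have h4 := log_natCast_nonneg y
  nlinarith

local notation "size₂(" D "," U "," y ")" => (y + y * (√((D : ℝ) ^ 2 * (1 + 2 * log D)) / √U) + (D : ℝ) ^ 2 * (1 + 2 * log D) * √y)

/-- The type II estimate on a dyadic block. -/
lemma sum_typeII_block_le {D : ℕ} (hD : 0 < D) {T : Finset CharIndex} (hT : T ⊆ primChars D)
    {U y : ℕ} (hU : 1 ≤ U) (hy : 1 ≤ y) (α β : ArithmeticFunction ℝ) (hα : ∀ n, |α n| ≤ 1)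
    (hα0 : ∀ n ≤ U, α n = 0) (hβ : ∀ n, |β n| ≤ log n) (hβ0 : ∀ n ≤ U, β n = 0) (j : ℕ) :
    ∑ χ ∈ T, ‖∑ m ∈ Ico (2 ^ j) (2 ^ (j + 1)), (α m : ℂ) * χ.2 m *
        ∑ l ∈ Ioc 0 (y / m), (β l : ℂ) * χ.2 l‖ ≤
      8 * (1 + log y) ^ 2 * size₂(D, U, y) := by
  set Δ := (D : ℝ) ^ 2 * (1 + 2 * log D)
  have hΔ0 : 0 ≤ Δ := by positivity
  set M := 2 ^ j with hM
  have hMpos : 0 < M := by positivity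
  have hM2 : 2 ^ (j + 1) = M + M := by rw [hM]; ring
  have hR0 : 0 ≤ 8 * (1 + log y) ^ 2 * (y + y * (√Δ / √U) + Δ * √y) := by positivity
  by_cases h1 : M + M ≤ U + 1
  · refine le_trans (le_of_eq (sum_eq_zero fun χ _ => ?_)) hR0
    rw [norm_eq_zero]
    refine sum_eq_zero fun m hm => ?_
    rw [hα0 m (by have := (mem_Ico.mp hm).2; omega)]; simp
  by_cases h2 : y / M ≤ U
  · refine le_trans (le_of_eq (sum_eq_zero fun χ _ => ?_)) hR0
    rw [norm_eq_zero]
    refine sum_eq_zero fun m hm => ?_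
    rw [sum_eq_zero, mul_zero]
    intro l hl
    have := Nat.div_le_div_left (a := y) (mem_Ico.mp hm).1 hMpos
    rw [hβ0 l (by have := (mem_Ioc.mp hl).2; omega)]; simp
  push Not at h1 h2
  set k := Nat.log 2 (y / M) + 1 with hk
  have hk1 : y / M < 2 ^ k := Nat.lt_pow_succ_log_self (by norm_num) _
  have hk2 : 2 ^ k ≤ 2 * (y / M) := by
    rw [hk, pow_succ, mul_comm]
    exact Nat.mul_le_mul_left 2 (pow_log_le_self 2 (by omega))
  set N := 2 ^ k with hN
  have hNpos : 0 < N := by positivity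
  have hbil := sum_norm_bilinear_cut_le T (fun χ n => χ.2 n) (fun n => (α n : ℂ))
    (fun n => (β n : ℂ)) (Ico M (M + M)) N
    (Real.sqrt_nonneg (((M + M : ℕ) + Δ) * (N + Δ)))
    (fun A' hA' B hB => sum_primChars_bilinear_le hD hT _ _
      (hA'.trans fun x hx => by simp only [mem_Ico, mem_range] at *; omega) hB)
    (fun m => y / m + 1) k (Ico M (M + M)) (Finset.Subset.refl _) 0 (by omega)
  rw [hM2]
  have hcut : ∀ χ : CharIndex, ∑ m ∈ Ico M (M + M), (α m : ℂ) * χ.2 m *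
        ∑ l ∈ Ioc 0 (y / m), (β l : ℂ) * χ.2 l =
      ∑ m ∈ Ico M (M + M), (α m : ℂ) * χ.2 m *
        ∑ l ∈ Ico 0 (min (y / m + 1) (0 + 2 ^ k)), (β l : ℂ) * χ.2 l := by
    intro χ
    refine sum_congr rfl fun m hm => ?_
    congr 1
    have := Nat.div_le_div_left (a := y) (mem_Ico.mp hm).1 hMpos
    rw [zero_add, ← hN, min_eq_left (by omega)]
    refine sum_subset (fun x hx => by simp only [mem_Ico, mem_Ioc] at *; omega)
      fun x hx hx' => ?_
    have : x = 0 := by simp only [mem_Ico, mem_Ioc] at *; omega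
    rw [this]; simp
  simp_rw [hcut]
  refine hbil.trans ?_
  have hMN : (M : ℝ) * N ≤ 2 * y := by
    have h3 : M * N ≤ 2 * y := by
      calc M * N ≤ M * (2 * (y / M)) := Nat.mul_le_mul_left _ hk2
        _ = 2 * (M * (y / M)) := by ring
        _ ≤ _ := Nat.mul_le_mul_left 2 (Nat.mul_div_le y M)
    exact_mod_cast h3
  have hNy : N ≤ 2 * y := hk2.trans (Nat.mul_le_mul_left 2 (Nat.div_le_self y M))
  have hlN : log N ≤ 1 + log y := by
    have h3 : log N ≤ log (2 * y) :=
      Real.log_le_log (by exact_mod_cast hNpos) (by exact_mod_cast hNy)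
    rw [Real.log_mul (by norm_num) (by positivity)] at h3
    linarith [Real.log_two_lt_d9]
  have hA : √(∑ m ∈ Ico M (M + M), ‖(α m : ℂ)‖ ^ 2) ≤ √M := by
    refine Real.sqrt_le_sqrt ?_
    calc _ ≤ ∑ m ∈ Ico M (M + M), (1 : ℝ) := sum_le_sum fun m _ => by
          rw [norm_real, Real.norm_eq_abs]
          exact pow_le_one₀ (abs_nonneg _) (hα m)
      _ = M := by simp
  have hB : √(∑ l ∈ Ico 0 (0 + 2 ^ k), ‖(β l : ℂ)‖ ^ 2) ≤ √N * (1 + log y) := by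
    rw [← Real.sqrt_sq (by positivity : 0 ≤ 1 + log y), ← Real.sqrt_mul (by positivity)]
    refine Real.sqrt_le_sqrt ?_
    rw [zero_add, ← hN]
    calc _ ≤ ∑ l ∈ Ico 0 N, (1 + log y) ^ 2 := sum_le_sum fun l hl => by
          rw [norm_real, Real.norm_eq_abs]
          refine pow_le_pow_left₀ (abs_nonneg _) ((hβ l).trans ?_) 2
          exact (log_natCast_le_log (mem_Ico.mp hl).2.le).trans hlN
      _ = _ := by simp
  have hk3 : (k : ℝ) + 1 ≤ 2 * (1 + log y) := by
    have := natLog_two_add_le hy (Nat.log_mono_right (b := 2) (Nat.div_le_self y M))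
    rw [hk]; push_cast; linarith
  have hfin := bilinear_size_bound (M := M) (N := N) (Δ := Δ) (U := U) (y := y)
    (ℓ := 1 + log y) (by positivity) (by positivity) hΔ0 (by exact_mod_cast hU) (by positivity)
    (by positivity) hMN (by exact_mod_cast (by omega : U ≤ 2 * M))
    (by exact_mod_cast (by omega : U ≤ N))
  have hS : √(((M + M : ℕ) + Δ) * (N + Δ)) = √((2 * M + Δ) * (N + Δ)) := by
    push_cast; rw [two_mul]
  rw [hS]
  calc _ ≤ (2 * (1 + log y)) * (√((2 * M + Δ) * (N + Δ)) * (√M * (√N * (1 + log y)))) := by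
        gcongr
    _ ≤ (2 * (1 + log y)) * (4 * (y + y * (√Δ / √U) + Δ * √y) * (1 + log y)) := by
        gcongr
    _ = _ := by ring

lemma sum_Ico_one_two_pow {f : ℕ → ℂ} (K : ℕ) :
    ∑ m ∈ Ico 1 (2 ^ K), f m =
      ∑ j ∈ range K, ∑ m ∈ Ico (2 ^ j) (2 ^ (j + 1)), f m := by
  induction K with
  | zero => simp
  | succ K ih =>
    rw [sum_range_succ, ← ih, sum_Ico_consecutive _ Nat.one_le_two_pow
      (Nat.pow_le_pow_right (by norm_num) (Nat.le_succ K))]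

theorem sum_typeII_le {D : ℕ} (hD : 0 < D) {T : Finset CharIndex} (hT : T ⊆ primChars D)
    {U y : ℕ} (hU : 1 ≤ U) (hy : 1 ≤ y) (α β : ArithmeticFunction ℝ) (hα : ∀ n, |α n| ≤ 1)
    (hα0 : ∀ n ≤ U, α n = 0) (hβ : ∀ n, |β n| ≤ log n) (hβ0 : ∀ n ≤ U, β n = 0) :
    ∑ χ ∈ T, ‖∑ n ∈ Ioc 0 y, twist χ.2 (α * β) n‖ ≤
      16 * (1 + log y) ^ 3 * size₂(D, U, y) := by
  have hdec : ∀ χ : CharIndex, ∑ n ∈ Ioc 0 y, twist χ.2 (α * β) n =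
      ∑ j ∈ range (Nat.log 2 y + 1), ∑ m ∈ Ico (2 ^ j) (2 ^ (j + 1)),
        (α m : ℂ) * χ.2 m * ∑ l ∈ Ioc 0 (y / m), (β l : ℂ) * χ.2 l := by
    intro χ
    rw [twist_mul, sum_Ioc_mul_eq_sum_sum, ← sum_Ico_one_two_pow]
    have hlt : y < 2 ^ (Nat.log 2 y + 1) := Nat.lt_pow_succ_log_self (by norm_num) y
    refine sum_subset (fun x hx => by simp only [mem_Ico, mem_Ioc] at *; omega)
      fun x hx hx' => ?_
    have : y < x := by simp only [mem_Ico, mem_Ioc] at *; omega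
    rw [Nat.div_eq_of_lt this]; simp
  simp_rw [hdec]
  calc _ ≤ ∑ χ ∈ T, ∑ j ∈ range (Nat.log 2 y + 1),
        ‖∑ m ∈ Ico (2 ^ j) (2 ^ (j + 1)),
          (α m : ℂ) * χ.2 m * ∑ l ∈ Ioc 0 (y / m), (β l : ℂ) * χ.2 l‖ :=
        sum_le_sum fun χ _ => norm_sum_le _ _
    _ ≤ ∑ j ∈ range (Nat.log 2 y + 1), 8 * (1 + log y) ^ 2 * size₂(D, U, y) := by
        rw [sum_comm]
        exact sum_le_sum fun j _ =>
          sum_typeII_block_le hD hT hU hy α β hα hα0 hβ hβ0 j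
    _ = (Nat.log 2 y + 1) * (8 * (1 + log y) ^ 2 * size₂(D, U, y)) := by
        rw [sum_const, card_range, nsmul_eq_mul]; push_cast; ring
    _ ≤ (2 * (1 + log y)) * (8 * (1 + log y) ^ 2 * size₂(D, U, y)) := by
        gcongr
        linarith [natLog_two_add_le hy le_rfl]
    _ = _ := by ring

lemma card_primChars_le (D : ℕ) : (primChars D).card ≤ D ^ 2 := by
  classical
  unfold primChars
  rw [card_sigma, sq]
  calc _ ≤ ∑ r ∈ range D, D := sum_le_sum fun r hr => by
        refine (card_le_univ _).trans ?_
        rw [← Nat.card_eq_fintype_card, DirichletCharacter.card_eq_totient_of_hasEnoughRootsOfUnity]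
        exact (Nat.totient_le _).trans (mem_range.mp hr)
    _ = _ := by simp

/-- The mean value theorem for sums of the von Mangoldt function over primitive characters. -/
theorem sum_norm_sum_vonMangoldt_le {D : ℕ} (hD : 0 < D) {T : Finset CharIndex}
    (hT : T ⊆ primChars D) (hT1 : ∀ χ ∈ T, χ.2 ≠ 1) {U y : ℕ} (hU : 1 ≤ U) (hy : 1 ≤ y) :
    ∑ χ ∈ T, ‖∑ n ∈ Ioc 0 y, (Λ n : ℂ) * χ.2 n‖ ≤
      16 * (1 + log y) ^ 3 * size₂(D, U, y) +
      4 * (U : ℝ) ^ 2 * D ^ 3 * (1 + log y) := by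
  set f1 := typeI(U)
  set α := μᵣ - lowPart U μᵣ with hα
  set β := (Λ - lowPart U Λ) * ζᵣ with hβ
  have hV : Λ = f1 + α * β := vaughan_identity U
  have hαv : ∀ n, α n = if n ≤ U then 0 else ((moebius n : ℤ) : ℝ) := by
    intro n
    rw [hα, sub_eq_add_neg, ArithmeticFunction.add_apply, ArithmeticFunction.neg_apply,
      lowPart_apply, intCoe_apply]
    split_ifs <;> simp
  have hβv : ∀ n, β n = ∑ d ∈ n.divisors, if d ≤ U then 0 else Λ d := by
    intro n
    rw [hβ, coe_mul_zeta_apply]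
    refine sum_congr rfl fun d _ => ?_
    rw [sub_eq_add_neg, ArithmeticFunction.add_apply, ArithmeticFunction.neg_apply, lowPart_apply]
    split_ifs <;> simp
  have h2 := sum_typeII_le hD hT hU hy α β (fun n => by
      rw [hαv]
      split_ifs
      · simp
      · rw [← Int.cast_abs]; exact_mod_cast abs_moebius_le_one) (fun n hn => by rw [hαv, if_pos hn])
    (fun n => by
      rw [hβv, ← vonMangoldt_sum, abs_of_nonneg]
      · refine sum_le_sum fun d _ => ?_
        split_ifs
        · exact vonMangoldt_nonneg
        · exact le_rfl
      · refine sum_nonneg fun d _ => ?_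
        split_ifs
        · exact le_rfl
        · exact vonMangoldt_nonneg) (fun n hn => by
      rw [hβv]
      refine sum_eq_zero fun d hd => ?_
      rw [if_pos ((Nat.divisor_le hd).trans hn)])
  have h1 : ∑ χ ∈ T, ‖∑ n ∈ Ioc 0 y, twist χ.2 f1 n‖ ≤
      4 * (U : ℝ) ^ 2 * D ^ 3 * (1 + log y) := by
    calc _ ≤ ∑ χ ∈ T, 4 * (U : ℝ) ^ 2 * D * (1 + log y) := by
          refine sum_le_sum fun χ hχ => (norm_typeI_le (hT1 χ hχ) hU y).trans ?_
          gcongr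
          have := mem_range.mp (mem_sigma.mp (hT hχ)).1
          exact_mod_cast this
      _ = T.card * (4 * (U : ℝ) ^ 2 * D * (1 + log y)) := by
          rw [sum_const, nsmul_eq_mul]
      _ ≤ ((D ^ 2 : ℕ) : ℝ) * (4 * (U : ℝ) ^ 2 * D * (1 + log y)) := by
          gcongr
          exact_mod_cast (card_le_card hT).trans (card_primChars_le D)
      _ = _ := by push_cast; ring
  calc _ = ∑ χ ∈ T, ‖∑ n ∈ Ioc 0 y, twist χ.2 f1 n +
        ∑ n ∈ Ioc 0 y, twist χ.2 (α * β) n‖ := by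
        refine sum_congr rfl fun χ _ => ?_
        congr 1
        rw [← sum_add_distrib]
        refine sum_congr rfl fun n _ => ?_
        rw [← ArithmeticFunction.add_apply, ← twist_add, ← hV, twist_apply]
    _ ≤ _ := (sum_le_sum fun χ _ => norm_add_le _ _).trans (by
        rw [sum_add_distrib]; linarith)

lemma le_two_pow_mul_totient (n : ℕ) : n ≤ 2 ^ n.primeFactors.card * n.totient := by
  have h := Nat.totient_mul_prod_primeFactors n
  have hpos : 0 < ∏ p ∈ n.primeFactors, p :=
    prod_pos fun p hp => (Nat.prime_of_mem_primeFactors hp).pos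
  refine Nat.le_of_mul_le_mul_right ?_ hpos
  rw [mul_assoc, h, mul_left_comm, ← prod_const, ← prod_mul_distrib]
  refine Nat.mul_le_mul_left _ (prod_le_prod' fun p hp => ?_)
  have := (Nat.prime_of_mem_primeFactors hp).two_le
  omega

lemma pow_card_div_totient_le (κ : ℕ) {n : ℕ} (hn : 0 < n) :
    (κ : ℝ) ^ n.primeFactors.card / n.totient ≤ ((2 * κ : ℕ) : ℝ) ^ n.primeFactors.card / n := by
  have h1 : (n : ℝ) ≤ 2 ^ n.primeFactors.card * n.totient := by
    exact_mod_cast le_two_pow_mul_totient n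
  have h2 : (0 : ℝ) < n.totient := by exact_mod_cast Nat.totient_pos.mpr hn
  have h3 : (0 : ℝ) < n := by exact_mod_cast hn
  rw [div_le_div_iff₀ h2 h3]
  push_cast
  rw [mul_pow]
  calc (κ : ℝ) ^ n.primeFactors.card * n ≤
      κ ^ n.primeFactors.card * (2 ^ n.primeFactors.card * n.totient) := by gcongr
    _ = _ := by ring

lemma sum_filter_dvd_le {N d : ℕ} (hd : 0 < d) (P : ℕ → Prop) [DecidablePred P] {f : ℕ → ℝ}
    (hf : ∀ n, 0 ≤ f n) :
    ∑ q ∈ ((Icc 1 N).filter P).filter (d ∣ ·), f q ≤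
      ∑ e ∈ (Icc 1 N).filter (fun e => P (d * e)), f (d * e) := by
  have hinj : Set.InjOn (fun e => d * e) ((Icc 1 N).filter (fun e => P (d * e)) : Set ℕ) :=
    fun a _ b _ h => Nat.eq_of_mul_eq_mul_left hd h
  rw [← sum_image (f := f) hinj]
  refine sum_le_sum_of_subset_of_nonneg ?_ fun i _ _ => hf i
  intro q hq
  simp only [mem_filter, mem_Icc, mem_image] at hq ⊢
  obtain ⟨⟨⟨h1, h2⟩, h3⟩, e, rfl⟩ := hq
  have he : 0 < e := pos_of_ne_zero fun h => by simp [h] at h1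
  exact ⟨e, ⟨⟨he, (Nat.le_mul_of_pos_left e hd).trans h2⟩, h3⟩, rfl⟩

lemma succ_pow_card_primeFactors (m : ℕ) {q : ℕ} (hq : Squarefree q) :
    ((m + 1 : ℕ) : ℝ) ^ q.primeFactors.card = ∑ d ∈ q.divisors, (m : ℝ) ^ d.primeFactors.card := by
  have h := (ArithmeticFunction.IsMultiplicative.prodPrimeFactors
    (fun _ => (m : ℝ))).prodPrimeFactors_one_add_of_squarefree hq
  have h1 : ∏ p ∈ q.primeFactors, (1 + (ArithmeticFunction.prodPrimeFactors fun _ => (m : ℝ)) p) =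
      ∏ p ∈ q.primeFactors, ((m + 1 : ℕ) : ℝ) := by
    refine prod_congr rfl fun p hp => ?_
    have hp := Nat.prime_of_mem_primeFactors hp
    rw [ArithmeticFunction.prodPrimeFactors_apply hp.ne_zero, hp.primeFactors]
    simp [add_comm]
  rw [h1, prod_const] at h
  rw [h]
  refine sum_congr rfl fun d hd => ?_
  rw [ArithmeticFunction.prodPrimeFactors_apply (Nat.pos_of_mem_divisors hd).ne', prod_const]

lemma sum_Icc_inv_le (N : ℕ) : ∑ n ∈ Icc 1 N, (1 : ℝ) / n ≤ 1 + log N := by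
  have h := harmonic_le_one_add_log N
  rw [harmonic_eq_sum_Icc] at h
  push_cast at h
  simpa [one_div] using h

lemma sum_squarefree_pow_card_div_le (m N : ℕ) :
    ∑ q ∈ (Icc 1 N).filter Squarefree, (m : ℝ) ^ q.primeFactors.card / q ≤
      (1 + log N) ^ m := by
  induction m with
  | zero =>
    rw [pow_zero]
    calc ∑ q ∈ (Icc 1 N).filter Squarefree, ((0 : ℕ) : ℝ) ^ q.primeFactors.card / q
        ≤ ∑ q ∈ (Icc 1 N).filter Squarefree, if q = 1 then (1 : ℝ) else 0 := by
          refine sum_le_sum fun q hq => ?_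
          simp only [mem_filter, mem_Icc] at hq
          split_ifs with h
          · simp [h]
          · have h1 : q.primeFactors.card ≠ 0 := by
              rw [card_ne_zero, Nat.nonempty_primeFactors]
              omega
            simp [h1]
      _ ≤ 1 := by
          rw [sum_ite_eq']
          split_ifs <;> norm_num
  | succ m ih =>
    set S := (Icc 1 N).filter Squarefree with hS
    calc ∑ q ∈ S, ((m + 1 : ℕ) : ℝ) ^ q.primeFactors.card / q
        = ∑ q ∈ S, ∑ d ∈ S, if d ∣ q then (m : ℝ) ^ d.primeFactors.card / q else 0 := by
          refine sum_congr rfl fun q hq => ?_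
          have hq' := hq
          simp only [hS, mem_filter, mem_Icc] at hq'
          rw [succ_pow_card_primeFactors m hq'.2, sum_div, ← sum_filter]
          refine sum_congr ?_ fun _ _ => rfl
          ext d
          simp only [hS, Nat.mem_divisors, mem_filter, mem_Icc]
          constructor
          · rintro ⟨h1, h2⟩
            exact ⟨⟨⟨Nat.pos_of_dvd_of_pos h1 hq'.1.1,
              (le_of_dvd hq'.1.1 h1).trans hq'.1.2⟩, hq'.2.squarefree_of_dvd h1⟩, h1⟩
          · rintro ⟨_, h1⟩
            exact ⟨h1, by omega⟩
      _ = ∑ d ∈ S, (m : ℝ) ^ d.primeFactors.card * ∑ q ∈ S.filter (d ∣ ·), (1 : ℝ) / q := by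
          rw [sum_comm]
          refine sum_congr rfl fun d _ => ?_
          rw [← sum_filter, mul_sum]
          refine sum_congr rfl fun q _ => by ring
      _ ≤ ∑ d ∈ S, (m : ℝ) ^ d.primeFactors.card / d * (1 + log N) := by
          refine sum_le_sum fun d hd => ?_
          simp only [hS, mem_filter, mem_Icc] at hd
          have hd0 : (0 : ℝ) < d := by exact_mod_cast hd.1.1
          rw [div_mul_eq_mul_div, mul_div_assoc]
          refine mul_le_mul_of_nonneg_left ?_ (by positivity)
          refine (sum_filter_dvd_le hd.1.1 _ fun n => by positivity).trans ?_
          calc _ ≤ ∑ e ∈ Icc 1 N, (1 : ℝ) / ((d * e : ℕ) : ℝ) :=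
                sum_le_sum_of_subset_of_nonneg (filter_subset _ _)
                  fun _ _ _ => by positivity
            _ = (∑ e ∈ Icc 1 N, (1 : ℝ) / e) / d := by
                rw [sum_div]
                refine sum_congr rfl fun e _ => ?_
                push_cast
                rw [div_div, mul_comm]
            _ ≤ _ := by gcongr; exact sum_Icc_inv_le N
      _ = (∑ d ∈ S, (m : ℝ) ^ d.primeFactors.card / d) * (1 + log N) := by
          rw [sum_mul]
      _ ≤ (1 + log N) ^ m * (1 + log N) := by gcongr
      _ = _ := (pow_succ _ _).symm

lemma sum_squarefree_dvd_le (m : ℕ) {N r : ℕ} (hr : 0 < r) :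
    ∑ q ∈ ((Icc 1 N).filter Squarefree).filter (r ∣ ·), (m : ℝ) ^ q.primeFactors.card / q ≤
      (m : ℝ) ^ r.primeFactors.card / r * (1 + log N) ^ m := by
  refine (sum_filter_dvd_le hr _ fun n => by positivity).trans ?_
  calc _ = ∑ e ∈ (Icc 1 N).filter (fun e => Squarefree (r * e)),
        (m : ℝ) ^ r.primeFactors.card / r * ((m : ℝ) ^ e.primeFactors.card / e) := by
        refine sum_congr rfl fun e he => ?_
        have hc := Nat.coprime_of_squarefree_mul (mem_filter.mp he).2
        rw [hc.primeFactors_mul, card_union_of_disjoint hc.disjoint_primeFactors, pow_add]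
        push_cast
        rw [div_mul_div_comm]
    _ ≤ _ := by
        rw [← mul_sum]
        refine mul_le_mul_of_nonneg_left (le_trans ?_ (sum_squarefree_pow_card_div_le m N))
          (by positivity)
        refine sum_le_sum_of_subset_of_nonneg ?_ fun _ _ _ => by positivity
        intro e he
        simp only [mem_filter] at he ⊢
        exact ⟨he.1, he.2.of_mul_right⟩

lemma exists_pow_card_primeFactors_le (m : ℕ) {ε : ℝ} (hε : 0 < ε) :
    ∃ C : ℝ, 1 ≤ C ∧ ∀ r : ℕ, 0 < r → (m : ℝ) ^ r.primeFactors.card ≤ C * (r : ℝ) ^ ε := by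
  set M := ⌈((m : ℝ) + 1) ^ (1 / ε)⌉₊
  refine ⟨((m : ℝ) + 1) ^ M, one_le_pow₀ (by linarith [cast_nonneg (α := ℝ) m]), fun r hr => ?_⟩
  calc (m : ℝ) ^ r.primeFactors.card ≤ ((m : ℝ) + 1) ^ r.primeFactors.card := by gcongr; linarith
    _ = ∏ p ∈ r.primeFactors, ((m : ℝ) + 1) := by simp
    _ = (∏ p ∈ r.primeFactors.filter (· < M), ((m : ℝ) + 1)) *
        ∏ p ∈ r.primeFactors.filter (¬ · < M), ((m : ℝ) + 1) :=
        (prod_filter_mul_prod_filter_not _ _ _).symm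
    _ ≤ ((m : ℝ) + 1) ^ M * ∏ p ∈ r.primeFactors, (p : ℝ) ^ ε := by
        refine mul_le_mul ?_ ?_ (prod_nonneg fun _ _ => by positivity) (by positivity)
        · rw [prod_const]
          refine pow_le_pow_right₀ (by linarith [cast_nonneg (α := ℝ) m]) ?_
          calc _ ≤ (range M).card := card_le_card fun p hp => by
                simpa using (mem_filter.mp hp).2
            _ = M := card_range M
        · calc _ ≤ ∏ p ∈ r.primeFactors.filter (¬ · < M), (p : ℝ) ^ ε := by
                refine prod_le_prod (fun _ _ => by positivity) fun p hp => ?_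
                have h1 : ((m : ℝ) + 1) ^ (1 / ε) ≤ p :=
                  (le_ceil _).trans
                    (cast_le.mpr (not_lt.mp (mem_filter.mp hp).2))
                calc (m : ℝ) + 1 = (((m : ℝ) + 1) ^ (1 / ε)) ^ ε := by
                      rw [← rpow_mul (by positivity)]
                      field_simp
                      simp
                  _ ≤ _ := by gcongr
            _ ≤ _ := by
                refine prod_le_prod_of_subset_of_one_le (filter_subset _ _)
                  (fun _ _ => by positivity) fun p hp _ => ?_
                exact Real.one_le_rpow (by
                  exact_mod_cast (Nat.prime_of_mem_primeFactors hp).one_le) hε.le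
    _ = ((m : ℝ) + 1) ^ M * ((∏ p ∈ r.primeFactors, p : ℕ) : ℝ) ^ ε := by
        rw [Real.finsetProd_rpow _ _ (fun _ _ => by positivity)]
        push_cast; rfl
    _ ≤ _ := by
        gcongr
        exact le_of_dvd hr (Nat.prod_primeFactors_dvd r)

lemma exists_primitive_changeLevel {q : ℕ} [NeZero q] (χ : DirichletCharacter ℂ q) :
    ∃ x : CharIndex, x.2.IsPrimitive ∧ ∃ h : x.1 + 1 ∣ q, changeLevel h x.2 = χ := by
  have key : ∀ (c : ℕ) (χ0 : DirichletCharacter ℂ c) (h : c ∣ q), χ0.IsPrimitive →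
      changeLevel h χ0 = χ → ∃ x : CharIndex, x.2.IsPrimitive ∧
        ∃ h : x.1 + 1 ∣ q, changeLevel h x.2 = χ := by
    intro c χ0 h hp hχ
    cases c with
    | zero => exact absurd (Nat.eq_zero_of_zero_dvd h) (NeZero.ne q)
    | succ c => exact ⟨⟨c, χ0⟩, hp, h, hχ⟩
  exact key _ χ.primitiveCharacter χ.conductor_dvd_level χ.primitiveCharacter_isPrimitive
    χ.changeLevel_primitiveCharacter

/-- The character sum over primes with weight `w` on the interval `(X0, X1]`. -/
noncomputable def primeCharSum (X0 X1 : ℕ) (w : ℕ → ℝ) (χ : CharIndex) : ℂ :=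
  ∑ n ∈ Ioc X0 X1, (w n : ℂ) * (χ.2 n * primeLog n)

lemma sum_changeLevel_eq {X0 X1 q : ℕ} [NeZero q] (hq : q ≤ X0) (w : ℕ → ℝ) {x : CharIndex}
    (h : x.1 + 1 ∣ q) :
    ∑ n ∈ Ioc X0 X1, (w n : ℂ) * (changeLevel h x.2 n * primeLog n) =
      primeCharSum X0 X1 w x := by
  refine sum_congr rfl fun n hn => ?_
  by_cases hp : n.Prime
  · have hnq : n.Coprime q := by
      refine (Nat.Prime.coprime_iff_not_dvd hp).mpr fun hd => ?_
      have := le_of_dvd (NeZero.pos q) hd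
      have := (mem_Ioc.mp hn).1
      omega
    have := DirichletCharacter.changeLevel_eq_cast_of_dvd' x.2 h (a := (n : ℤ))
      (Nat.isCoprime_iff_coprime.mpr hnq)
    simp only [Int.cast_natCast] at this
    rw [this]
  · simp [primeLog, hp]

open Classical in
/-- The nontrivial primitive characters of modulus dividing `q`. -/
noncomputable def nontrivialPrimChars (Q : ℕ) : Finset CharIndex :=
  (primChars Q).filter (fun χ => χ.2 ≠ 1)

lemma sum_norm_character_le {X0 X1 q Q : ℕ} [NeZero q] (hq : q ≤ X0) (hQ : q ≤ Q) (w : ℕ → ℝ) :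
    ∑ χ ∈ univ.erase (1 : DirichletCharacter ℂ q),
      ‖∑ n ∈ Ioc X0 X1, (w n : ℂ) * (χ n * primeLog n)‖ ≤
    ∑ x ∈ (nontrivialPrimChars Q).filter (fun x => x.1 + 1 ∣ q), ‖primeCharSum X0 X1 w x‖ := by
  classical
  choose f hf hd hc using fun χ : DirichletCharacter ℂ q => exists_primitive_changeLevel χ
  have hinj : Injective f := by
    intro a b hab
    have key : ∀ (x : CharIndex) (h : x.1 + 1 ∣ q) (y : CharIndex) (h' : y.1 + 1 ∣ q), x = y →
        changeLevel h x.2 = changeLevel h' y.2 := by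
      rintro x h y h' rfl
      rfl
    rw [← hc a, ← hc b]
    exact key _ _ _ _ hab
  have h1 : ∀ χ : DirichletCharacter ℂ q,
      ‖∑ n ∈ Ioc X0 X1, (w n : ℂ) * (χ n * primeLog n)‖ = ‖primeCharSum X0 X1 w (f χ)‖ := by
    intro χ
    rw [← sum_changeLevel_eq hq w (hd χ), hc χ]
  rw [sum_congr rfl fun χ _ => h1 χ,
    ← sum_image (f := fun x => ‖primeCharSum X0 X1 w x‖) (g := f) hinj.injOn]
  refine sum_le_sum_of_subset_of_nonneg ?_ fun _ _ _ => norm_nonneg _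
  intro x hx
  obtain ⟨χ, hχ, rfl⟩ := mem_image.mp hx
  simp only [nontrivialPrimChars, primChars, mem_filter, mem_sigma, mem_range,
    mem_univ, true_and]
  refine ⟨⟨⟨?_, hf χ⟩, fun h1 => (mem_erase.mp hχ).1 ?_⟩, hd χ⟩
  · have := le_of_dvd (NeZero.pos q) (hd χ)
    omega
  · rw [← hc χ, h1, map_one]

/-- The discrepancy of weighted primes in residue classes is controlled by character sums. -/
lemma abs_sum_residue_sub_le {X0 X1 q Q : ℕ} (hq0 : 0 < q) (hq : q ≤ X0) (hQ : q ≤ Q) (w : ℕ → ℝ)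
    {a : ℕ} (ha : a.Coprime q) :
    |∑ n ∈ (Ioc X0 X1).filter (fun n => n ≡ a [MOD q]), w n * primeLog n -
        (∑ n ∈ Ioc X0 X1, w n * primeLog n) / q.totient| ≤
      (∑ x ∈ (nontrivialPrimChars Q).filter (fun x => x.1 + 1 ∣ q), ‖primeCharSum X0 X1 w x‖) /
        q.totient := by
  classical
  have : NeZero q := ⟨hq0.ne'⟩
  have hφ : (0 : ℝ) < q.totient := by exact_mod_cast Nat.totient_pos.mpr hq0
  have hau : IsUnit (a : ZMod q) := (isUnit_iff_coprime a q).mpr ha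
  have h1 : ((q.totient : ℂ)) * ((∑ n ∈ (Ioc X0 X1).filter (fun n => n ≡ a [MOD q]),
      w n * primeLog n : ℝ) : ℂ) = ∑ χ : DirichletCharacter ℂ q, (starRingEnd ℂ) (χ a) *
        ∑ n ∈ Ioc X0 X1, (w n : ℂ) * (χ n * primeLog n) := by
    simp_rw [mul_sum]
    rw [sum_comm]
    push_cast
    rw [sum_filter, mul_sum]
    refine sum_congr rfl fun n _ => ?_
    have h := sum_dirichletCharacter_mul_conj (n : ZMod q) hau
    have h2 : ∑ χ : DirichletCharacter ℂ q, (starRingEnd ℂ) (χ a) *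
        ((w n : ℂ) * (χ n * primeLog n)) = (w n * primeLog n : ℂ) *
          ∑ χ : DirichletCharacter ℂ q, χ n * (starRingEnd ℂ) (χ a) := by
      rw [mul_sum]
      exact sum_congr rfl fun χ _ => by ring
    rw [h2, h]
    have h3 : ((n : ZMod q) = (a : ZMod q)) ↔ n ≡ a [MOD q] := ZMod.natCast_eq_natCast_iff n a q
    by_cases hna : n ≡ a [MOD q]
    · rw [if_pos hna, if_pos (h3.mpr hna).symm]; ring
    · rw [if_neg hna, if_neg (fun h => hna (h3.mp h.symm))]; ring
  have h4 : ∑ n ∈ Ioc X0 X1, (w n : ℂ) * ((1 : DirichletCharacter ℂ q) n * primeLog n) =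
      ((∑ n ∈ Ioc X0 X1, w n * primeLog n : ℝ) : ℂ) := by
    push_cast
    refine sum_congr rfl fun n hn => ?_
    by_cases hp : n.Prime
    · have hnq : n.Coprime q := by
        refine (Nat.Prime.coprime_iff_not_dvd hp).mpr fun hd => ?_
        have := le_of_dvd hq0 hd
        have := (mem_Ioc.mp hn).1
        omega
      rw [MulChar.one_apply ((isUnit_iff_coprime n q).mpr hnq), one_mul]
    · simp [primeLog, hp]
  rw [← add_sum_erase _ _ (mem_univ (1 : DirichletCharacter ℂ q)), h4,
    MulChar.one_apply hau, map_one, one_mul] at h1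
  set P := ∑ n ∈ (Ioc X0 X1).filter (fun n => n ≡ a [MOD q]), w n * primeLog n
  set S := ∑ n ∈ Ioc X0 X1, w n * primeLog n
  rw [le_div_iff₀ hφ]
  refine le_trans ?_ (sum_norm_character_le hq hQ w)
  have h5 : |P - S / q.totient| * q.totient = ‖(q.totient : ℂ) * (P : ℂ) - S‖ := by
    rw [← abs_of_pos hφ, ← abs_mul, sub_mul, abs_of_pos hφ, div_mul_cancel₀ _ hφ.ne',
      ← norm_eq_abs, ← norm_real]
    push_cast
    rw [mul_comm]
  rw [h5, h1, add_sub_cancel_left]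
  refine (norm_sum_le _ _).trans (sum_le_sum fun χ _ => ?_)
  rw [norm_mul, RCLike.norm_conj]
  exact mul_le_of_le_one_left (norm_nonneg _) (norm_le_one χ _)

/-- The bound for the mean value of `Λ` over nontrivial primitive characters of modulus at most `D`. -/
noncomputable def meanValueBound (D U y : ℕ) : ℝ :=
  16 * (1 + log y) ^ 3 * (y + y * (√((D : ℝ) ^ 2 * (1 + 2 * log D)) / √U) +
        (D : ℝ) ^ 2 * (1 + 2 * log D) * √y) +
      4 * (U : ℝ) ^ 2 * D ^ 3 * (1 + log y)

lemma meanValueBound_mono (D U : ℕ) {x y : ℕ} (hx : 1 ≤ x) (hxy : x ≤ y) :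
    meanValueBound D U x ≤ meanValueBound D U y := by
  unfold meanValueBound
  gcongr

lemma meanValueBound_le {ε L : ℝ} (hε : 0 ≤ ε) (hL : 0 ≤ L) {D U y : ℕ} (hD : 1 ≤ D)
    (hD' : (D : ℝ) ≤ exp ((1 / 2 - 3 * ε) * L)) (hU : exp (2 * ε * L) ≤ U)
    (hU' : (U : ℝ) ≤ 2 * exp (2 * ε * L)) (hy : exp ((1 - ε) * L) ≤ y)
    (hy' : (y : ℝ) ≤ exp (2 * L)) :
    2 * meanValueBound D U y + (D : ℝ) ^ 2 * (2 * √y * log y) ≤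
      98 * (1 + 2 * L) ^ 4 * (1 + D * exp (-(ε * L))) * y := by
  have hD0 : (0 : ℝ) < D := by exact_mod_cast hD
  have hy0 : (0 : ℝ) < y := (exp_pos _).trans_le hy
  have hly : log y ≤ 2 * L := by
    rw [← log_exp (2 * L)]; exact log_le_log hy0 hy'
  have hlD : 1 + 2 * log D ≤ 1 + 2 * L := by
    have : log D ≤ (1 / 2 - 3 * ε) * L := by
      rw [← log_exp ((1 / 2 - 3 * ε) * L)]; exact log_le_log hD0 hD'
    nlinarith [mul_nonneg hε hL]
  obtain ⟨ℓ, hℓ⟩ : ∃ ℓ, ℓ = 1 + 2 * L := ⟨_, rfl⟩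
  obtain ⟨v, hv⟩ : ∃ v, v = exp (-(ε * L)) := ⟨_, rfl⟩
  have hv0 : 0 < v := hv ▸ exp_pos _
  have hℓ1 : 1 ≤ ℓ := by linarith
  have hsq : √((D : ℝ) ^ 2 * (1 + 2 * log D)) ≤ D * ℓ := by
    rw [sqrt_mul (by positivity), sqrt_sq hD0.le]
    gcongr
    refine Real.sqrt_le_iff.mpr ⟨by linarith, ?_⟩
    nlinarith
  have hsU : (√(U : ℝ))⁻¹ ≤ v := by
    rw [hv, exp_neg]
    refine inv_anti₀ (exp_pos _) (Real.le_sqrt_of_sq_le ?_)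
    rw [← exp_nat_mul]
    refine le_trans (le_of_eq ?_) hU
    congr 1; push_cast; ring
  have ha1 : √((D : ℝ) ^ 2 * (1 + 2 * log D)) / √U ≤ D * ℓ * v := by
    rw [div_eq_mul_inv]
    gcongr
  have hsy : (D : ℝ) ≤ v * √y := by
    have h1 : exp ((1 - ε) * L / 2) ≤ √y := by
      refine Real.le_sqrt_of_sq_le ?_
      rw [← exp_nat_mul]
      refine le_trans (le_of_eq ?_) hy
      congr 1; push_cast; ring
    refine hD'.trans (le_trans ?_ (mul_le_mul_of_nonneg_left h1 hv0.le))
    rw [hv, ← exp_add, exp_le_exp]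
    nlinarith [mul_nonneg hε hL]
  have ha2 : (D : ℝ) ^ 2 * √y ≤ D * v * y := by
    calc (D : ℝ) ^ 2 * √y = D * √y * D := by ring
      _ ≤ D * √y * (v * √y) := by gcongr
      _ = D * v * (√y * √y) := by ring
      _ = _ := by rw [mul_self_sqrt hy0.le]
  have ha3 : (U : ℝ) ^ 2 * D ^ 3 ≤ 4 * (D * v * y) := by
    calc (U : ℝ) ^ 2 * D ^ 3 = U ^ 2 * D ^ 2 * D := by ring
      _ ≤ (2 * exp (2 * ε * L)) ^ 2 * (exp ((1 / 2 - 3 * ε) * L)) ^ 2 * D := by gcongr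
      _ = 4 * (D * v * exp ((1 - ε) * L)) := by
        have : v * exp ((1 - ε) * L) =
            exp (2 * ε * L) ^ 2 * (exp ((1 / 2 - 3 * ε) * L)) ^ 2 := by
          rw [hv, ← exp_nat_mul, ← exp_nat_mul, ← exp_add, ← exp_add]
          congr 1; push_cast; ring
        linear_combination (-4 * (D : ℝ)) * this
      _ ≤ _ := by gcongr
  rw [← hℓ, ← hv]
  have hℓ4 : ℓ ≤ ℓ ^ 4 := le_self_pow₀ hℓ1 (by norm_num)
  have hℓ34 : ℓ ^ 3 ≤ ℓ ^ 4 := pow_le_pow_right₀ hℓ1 (by norm_num)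
  have hlyℓ : 1 + log y ≤ ℓ := by linarith
  obtain ⟨t, ht⟩ : ∃ t, t = D * v * y := ⟨_, rfl⟩
  have ht0 : 0 ≤ t := by rw [ht]; positivity
  have hb1 : 16 * (1 + log y) ^ 3 * (y + y * (√((D : ℝ) ^ 2 * (1 + 2 * log D)) / √U) +
        (D : ℝ) ^ 2 * (1 + 2 * log D) * √y) ≤ 16 * ℓ ^ 3 * (y + t * ℓ + t * ℓ) := by
    have e1 : y * (√((D : ℝ) ^ 2 * (1 + 2 * log D)) / √U) ≤ t * ℓ := by
      calc _ ≤ y * (D * ℓ * v) := by gcongr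
        _ = _ := by rw [ht]; ring
    have e2 : (D : ℝ) ^ 2 * (1 + 2 * log D) * √y ≤ t * ℓ := by
      calc (D : ℝ) ^ 2 * (1 + 2 * log D) * √y = (D : ℝ) ^ 2 * √y * (1 + 2 * log D) := by ring
        _ ≤ t * ℓ := by rw [ht]; gcongr; linarith
    gcongr
  have hb2 : 4 * (U : ℝ) ^ 2 * D ^ 3 * (1 + log y) ≤ 16 * t * ℓ := by
    calc _ = 4 * ((U : ℝ) ^ 2 * D ^ 3) * (1 + log y) := by ring
      _ ≤ 4 * (4 * t) * ℓ := by rw [ht]; gcongr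
      _ = _ := by ring
  have hb3 : (D : ℝ) ^ 2 * (2 * √y * log y) ≤ 2 * t * ℓ := by
    calc _ = 2 * ((D : ℝ) ^ 2 * √y) * log y := by ring
      _ ≤ 2 * t * ℓ := by rw [ht]; gcongr; linarith
  unfold meanValueBound
  have c1 : ℓ ^ 3 * y ≤ ℓ ^ 4 * y := by gcongr
  have c2 : t * ℓ ≤ t * ℓ ^ 4 := by gcongr
  have c3 : 0 ≤ ℓ ^ 4 * y := by positivity
  calc _ ≤ 2 * (16 * ℓ ^ 3 * (y + t * ℓ + t * ℓ) + 16 * t * ℓ) + 2 * t * ℓ := by linarith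
    _ = 32 * (ℓ ^ 3 * y) + 64 * (t * ℓ ^ 4) + 34 * (t * ℓ) := by ring
    _ ≤ 98 * (ℓ ^ 4 * y) + 98 * (t * ℓ ^ 4) := by linarith
    _ = _ := by rw [ht]; ring

lemma sum_norm_primeCharSum_le {ε E : ℝ} {X0 X1 D U : ℕ} {w : ℕ → ℝ} (hw : IsBulkWeight ε X0 X1 w)
    (hε1 : ε ≤ 1) (hX0 : 1 ≤ X0) (hX : X0 ≤ X1) (hD : 0 < D) (hU : 1 ≤ U) {T : Finset CharIndex}
    (hT : T ⊆ primChars D) (hT1 : ∀ χ ∈ T, χ.2 ≠ 1) (hE : 0 ≤ E)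
    (h : ∀ y ∈ Ioc X0 X1,
      2 * meanValueBound D U y + (D : ℝ) ^ 2 * (2 * √y * log y) ≤ E * y) :
    ∑ χ ∈ T, ‖primeCharSum X0 X1 w χ‖ ≤ 3 * E := by
  have hmain := sum_norm_sum_mul_le_of_antitone T
    (fun χ n => χ.2 n * (primeLog n : ℂ)) hX hw.nonneg hw.succ_le hE (fun y hy => ?_)
  · refine hmain.trans ?_
    have h1 : (X0 : ℝ) * w X0 ≤ 1 := by
      calc (X0 : ℝ) * w X0 ≤ X0 * (1 / X0) := by gcongr; exact hw.le_inv _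
        _ = 1 := by field_simp
    have h2 := hw.sum_le
    nlinarith
  · refine le_trans ?_ (h y hy)
    have hy' := mem_Ioc.mp hy
    have hy1 : 1 ≤ y := by omega
    have hcard : (T.card : ℝ) ≤ (D : ℝ) ^ 2 := by
      exact_mod_cast (card_le_card hT).trans (card_primChars_le D)
    have key : ∀ χ ∈ T, ‖∑ n ∈ Ioc X0 y, χ.2 n * (primeLog n : ℂ)‖ ≤
        ‖∑ n ∈ Ioc 0 y, (Λ n : ℂ) * χ.2 n‖ +
        ‖∑ n ∈ Ioc 0 X0, (Λ n : ℂ) * χ.2 n‖ +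
        2 * √y * log y := by
      intro χ _
      have e1 : ∑ n ∈ Ioc X0 y, χ.2 n * (primeLog n : ℂ) =
          ∑ n ∈ Ioc 0 y, (Λ n : ℂ) * χ.2 n -
          ∑ n ∈ Ioc 0 X0, (Λ n : ℂ) * χ.2 n -
          ∑ n ∈ Ioc X0 y,
            ((Λ n - primeLog n : ℝ) : ℂ) * χ.2 n := by
        rw [← sum_Ioc_consecutive _ (Nat.zero_le X0) hy'.1.le, add_sub_cancel_left,
          ← sum_sub_distrib]
        refine sum_congr rfl fun n _ => ?_
        push_cast; ring
      rw [e1]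
      refine (norm_sub_le _ _).trans (add_le_add (norm_sub_le _ _) ?_)
      refine (norm_sum_le _ _).trans (le_trans (sum_le_sum fun n _ => ?_)
        (sum_vonMangoldt_sub_primeLog_le (x := X0) hy1))
      rw [norm_mul, norm_real, norm_eq_abs,
        abs_of_nonneg (sub_nonneg.mpr (primeLog_le_vonMangoldt n))]
      exact mul_le_of_le_one_right (sub_nonneg.mpr (primeLog_le_vonMangoldt n))
        (norm_le_one _ _)
    refine (sum_le_sum key).trans ?_
    rw [sum_add_distrib, sum_add_distrib, sum_const, nsmul_eq_mul]
    have h1 := sum_norm_sum_vonMangoldt_le hD hT hT1 hU hy1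
    have h2 := sum_norm_sum_vonMangoldt_le hD hT hT1 hU hX0
    have h3 := meanValueBound_mono D U hX0 hy'.1.le
    have h4 : (T.card : ℝ) * (2 * √y * log y) ≤ (D : ℝ) ^ 2 * (2 * √y * log y) := by
      gcongr
    unfold meanValueBound at h3 ⊢
    linarith

/-- The multiplicity weight attached to a conductor. -/
noncomputable def conductorWeight (m : ℕ) (x : CharIndex) : ℝ :=
  (m : ℝ) ^ (x.1 + 1).primeFactors.card / ((x.1 + 1 : ℕ) : ℝ)

lemma mem_nontrivialPrimChars {Q : ℕ} {x : CharIndex} :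
    x ∈ nontrivialPrimChars Q ↔ x.1 < Q ∧ x.2.IsPrimitive ∧ x.2 ≠ 1 := by
  simp [nontrivialPrimChars, primChars, and_assoc]

lemma sum_pow_card_mul_discrepancy_le (κ Q : ℕ) (f : CharIndex → ℝ) (hf : ∀ x, 0 ≤ f x) :
    ∑ q ∈ (Icc 1 Q).filter Squarefree, (κ : ℝ) ^ q.primeFactors.card *
      ((∑ x ∈ (nontrivialPrimChars Q).filter (fun x => x.1 + 1 ∣ q), f x) / q.totient) ≤
    (∑ x ∈ nontrivialPrimChars Q, conductorWeight (2 * κ) x * f x) *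
      (1 + log Q) ^ (2 * κ) := by
  calc _ ≤ ∑ q ∈ (Icc 1 Q).filter Squarefree, ∑ x ∈ nontrivialPrimChars Q,
        if x.1 + 1 ∣ q then ((2 * κ : ℕ) : ℝ) ^ q.primeFactors.card / q * f x else 0 := by
        refine sum_le_sum fun q hq => ?_
        have hq' := mem_filter.mp hq
        have hq0 : 0 < q := (mem_Icc.mp hq'.1).1
        rw [← sum_filter, ← mul_sum, mul_div_assoc', mul_div_right_comm]
        exact mul_le_mul_of_nonneg_right (pow_card_div_totient_le κ hq0)
          (sum_nonneg fun _ _ => hf _)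
    _ = ∑ x ∈ nontrivialPrimChars Q, f x *
        ∑ q ∈ ((Icc 1 Q).filter Squarefree).filter (x.1 + 1 ∣ ·),
          ((2 * κ : ℕ) : ℝ) ^ q.primeFactors.card / q := by
        rw [sum_comm]
        refine sum_congr rfl fun x _ => ?_
        rw [← sum_filter, mul_sum]
        exact sum_congr rfl fun q _ => mul_comm _ _
    _ ≤ ∑ x ∈ nontrivialPrimChars Q, f x *
        (conductorWeight (2 * κ) x * (1 + log Q) ^ (2 * κ)) :=
        sum_le_sum fun x _ => mul_le_mul_of_nonneg_left
          (sum_squarefree_dvd_le _ (Nat.succ_pos _)) (hf x)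
    _ = _ := by
        rw [sum_mul]
        exact sum_congr rfl fun x _ => by ring

lemma conductorWeight_le_rpow {m : ℕ} {C ε : ℝ}
    (hC : ∀ r : ℕ, 0 < r → (m : ℝ) ^ r.primeFactors.card ≤ C * (r : ℝ) ^ ε) (x : CharIndex) :
    conductorWeight m x ≤ C * ((x.1 + 1 : ℕ) : ℝ) ^ (ε - 1) := by
  have h0 : (0 : ℝ) < ((x.1 + 1 : ℕ) : ℝ) := by positivity
  rw [Real.rpow_sub_one h0.ne', conductorWeight, mul_div_assoc']
  gcongr
  exact hC _ (Nat.succ_pos _)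

lemma sum_shell_le {ε C : ℝ} (hε : 0 < ε) (hε1 : ε ≤ 1 / 16) {L : ℕ} (hL : 64 ≤ L)
    (hεL : 1 ≤ ε * L) {w : ℕ → ℝ} (hw : IsBulkWeight ε (lowerEnd ε L) (upperEnd ε L) w) {m : ℕ}
    (hC1 : 1 ≤ C) (hC : ∀ r : ℕ, 0 < r → (m : ℝ) ^ r.primeFactors.card ≤ C * (r : ℝ) ^ ε)
    {Q j : ℕ} (hQ : (Q : ℝ) ≤ exp ((1 / 2 - 4 * ε) * L)) {T : Finset CharIndex}
    (hT : T ⊆ nontrivialPrimChars Q) (hj : ∀ x ∈ T, Nat.log 2 (x.1 + 1) = j) {δ : ℝ}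
    (hδ : ((2 : ℝ) ^ j) ^ (-(1 / 2) : ℝ) ≤ δ) :
    ∑ x ∈ T, conductorWeight m x * ‖primeCharSum (lowerEnd ε L) (upperEnd ε L) w x‖ ≤
      600 * C * (1 + 2 * (L : ℝ)) ^ 4 * (δ + exp (-(ε * L / 2))) := by
  have hδ0 : 0 ≤ δ := le_trans (by positivity) hδ
  rcases T.eq_empty_or_nonempty with rfl | ⟨x0, hx0⟩
  · simp only [sum_empty]; positivity
  set D : ℕ := 2 ^ (j + 1) with hDdef
  have h2jQ : (2 : ℝ) ^ j ≤ Q := by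
    have h1 : 2 ^ j ≤ x0.1 + 1 := by
      rw [← hj x0 hx0]; exact pow_log_le_self 2 (Nat.succ_ne_zero _)
    have h2 := (mem_nontrivialPrimChars.mp (hT hx0)).1
    exact_mod_cast (by omega : 2 ^ j ≤ Q)
  have hDr : (D : ℝ) = 2 * 2 ^ j := by rw [hDdef]; push_cast; ring
  have hD1 : 1 ≤ D := Nat.one_le_two_pow
  have hD0 : (0 : ℝ) < D := by exact_mod_cast hD1
  have hDexp : (D : ℝ) ≤ exp ((1 / 2 - 3 * ε) * L) := by
    have h2 : (2 : ℝ) ≤ exp (ε * L) := by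
      linarith [add_one_le_exp (ε * L)]
    calc (D : ℝ) = 2 * 2 ^ j := hDr
      _ ≤ exp (ε * L) * exp ((1 / 2 - 4 * ε) * L) := by
        gcongr; exact h2jQ.trans hQ
      _ = _ := by rw [← exp_add]; congr 1; ring
  have hTp : T ⊆ primChars D := by
    intro x hx
    have h1 := Nat.lt_pow_succ_log_self (b := 2) one_lt_two (x.1 + 1)
    rw [hj x hx] at h1
    have h2 := mem_nontrivialPrimChars.mp (hT hx)
    simp only [primChars, mem_sigma, mem_range, mem_filter, mem_univ,
      true_and]
    exact ⟨by omega, h2.2.1⟩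
  set U : ℕ := ⌈exp (2 * ε * L)⌉₊ with hUdef
  have hU1 : 1 ≤ U := Nat.ceil_pos.mpr (exp_pos _)
  have hUu : (U : ℝ) ≤ 2 * exp (2 * ε * L) := by
    have h1 := Nat.ceil_lt_add_one (exp_pos (2 * ε * L)).le
    have h2 : 1 ≤ exp (2 * ε * L) := one_le_exp (by positivity)
    rw [hUdef]; linarith
  set v := exp (-(ε * L)) with hv
  have hX0 : 1 ≤ lowerEnd ε L := by
    have := exp_half_lt_lowerEnd (ε := ε) (by linarith) hL
    have h1 : (0 : ℝ) < lowerEnd ε L := (exp_pos _).trans this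
    exact_mod_cast h1
  have hmain := sum_norm_primeCharSum_le hw (by linarith) hX0 (lowerEnd_le_upperEnd hε.le L) hD1 hU1
    hTp (fun x hx => (mem_nontrivialPrimChars.mp (hT hx)).2.2)
    (E := 98 * (1 + 2 * (L : ℝ)) ^ 4 * (1 + D * v)) (by positivity) (fun y hy => by
      have hy' := mem_Ioc.mp hy
      refine meanValueBound_le hε.le (by positivity) hD1 hDexp (le_ceil _) hUu ?_ ?_
      · exact (Nat.lt_of_floor_lt hy'.1).le
      · refine ((Nat.le_floor_iff (exp_pos _).le).mp hy'.2).trans ?_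
        gcongr; linarith)
  have hwt : ∀ x ∈ T, conductorWeight m x ≤ C * (2 * (D : ℝ) ^ (ε - 1)) := by
    intro x hx
    refine (conductorWeight_le_rpow hC x).trans ?_
    gcongr
    have h1 : 2 ^ j ≤ x.1 + 1 := by
      rw [← hj x hx]; exact pow_log_le_self 2 (Nat.succ_ne_zero _)
    have h2 : (D : ℝ) / 2 ≤ ((x.1 + 1 : ℕ) : ℝ) := by
      rw [hDr]
      have : (2 : ℝ) ^ j ≤ ((x.1 + 1 : ℕ) : ℝ) := by exact_mod_cast h1
      linarith
    calc ((x.1 + 1 : ℕ) : ℝ) ^ (ε - 1) ≤ ((D : ℝ) / 2) ^ (ε - 1) :=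
          rpow_le_rpow_of_nonpos (by positivity) h2 (by linarith)
      _ = (D : ℝ) ^ (ε - 1) * ((1 / 2 : ℝ)) ^ (ε - 1) := by
          rw [div_eq_mul_one_div, mul_rpow hD0.le (by norm_num)]
      _ ≤ (D : ℝ) ^ (ε - 1) * 2 := by
          gcongr
          calc ((1 / 2 : ℝ)) ^ (ε - 1) ≤ (1 / 2 : ℝ) ^ (-1 : ℝ) :=
                Real.rpow_le_rpow_of_exponent_ge (by norm_num) (by norm_num) (by linarith)
            _ = 2 := by rw [Real.rpow_neg_one]; norm_num
      _ = _ := mul_comm _ _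
  have hD2 : (D : ℝ) ^ (ε - 1) * (1 + D * v) ≤ δ + exp (-(ε * L / 2)) := by
    have hj1 : (2 : ℝ) ^ j ≤ D := by rw [hDr]; linarith [pow_pos (two_pos (α := ℝ)) j]
    have h1 : (D : ℝ) ^ (ε - 1) ≤ δ := by
      refine le_trans ?_ hδ
      calc (D : ℝ) ^ (ε - 1) ≤ (D : ℝ) ^ (-(1 / 2) : ℝ) :=
            rpow_le_rpow_of_exponent_le (by exact_mod_cast hD1) (by linarith)
        _ ≤ _ := rpow_le_rpow_of_nonpos (by positivity) hj1 (by norm_num)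
    have h2 : (D : ℝ) ^ (ε - 1) * (D * v) ≤ exp (-(ε * L / 2)) := by
      rw [← mul_assoc, Real.rpow_sub_one hD0.ne', div_mul_cancel₀ _ hD0.ne']
      calc (D : ℝ) ^ ε * v ≤ (exp ((1 / 2 - 3 * ε) * L)) ^ ε * v := by gcongr
        _ = exp ((1 / 2 - 3 * ε) * L * ε + -(ε * L)) := by
            rw [← exp_mul, hv, ← exp_add]
        _ ≤ _ := by
            rw [exp_le_exp]
            have : 0 ≤ ε * ε * L := by positivity
            nlinarith
    rw [mul_add, mul_one]
    exact add_le_add h1 h2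
  calc _ ≤ ∑ x ∈ T, C * (2 * (D : ℝ) ^ (ε - 1)) *
        ‖primeCharSum (lowerEnd ε L) (upperEnd ε L) w x‖ :=
        sum_le_sum fun x hx => mul_le_mul_of_nonneg_right (hwt x hx) (norm_nonneg _)
    _ = C * (2 * (D : ℝ) ^ (ε - 1)) *
        ∑ x ∈ T, ‖primeCharSum (lowerEnd ε L) (upperEnd ε L) w x‖ := by rw [mul_sum]
    _ ≤ C * (2 * (D : ℝ) ^ (ε - 1)) * (3 * (98 * (1 + 2 * (L : ℝ)) ^ 4 * (1 + D * v))) := by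
        gcongr
    _ = 588 * C * (1 + 2 * (L : ℝ)) ^ 4 * ((D : ℝ) ^ (ε - 1) * (1 + D * v)) := by ring
    _ ≤ _ := by gcongr; norm_num

lemma eventually_exp_neg_le {c : ℝ} (hc : 0 < c) (k : ℕ) :
    ∀ᶠ L : ℕ in atTop, exp (-(c * L)) ≤ 1 / (L : ℝ) ^ k := by
  have h := (isLittleO_pow_exp_pos_mul_atTop k hc).bound one_pos
  filter_upwards [tendsto_natCast_atTop_atTop.eventually h, eventually_gt_atTop 0] with L hL hL0
  rw [one_mul, norm_of_nonneg (by positivity), norm_of_nonneg (exp_pos _).le] at hL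
  rw [exp_neg, one_div]
  exact inv_anti₀ (by positivity) hL

/-- The level of distribution. -/
noncomputable def levelBound (ε : ℝ) (L : ℕ) : ℕ := ⌊exp ((1 / 2 - 4 * ε) * L)⌋₊

lemma levelBound_le (ε : ℝ) (L : ℕ) : (levelBound ε L : ℝ) ≤ exp ((1 / 2 - 4 * ε) * L) :=
  floor_le (exp_pos _).le

lemma sum_small_conductor_le {ε C : ℝ} {L A B : ℕ} (hL : 0 < L) {w : ℕ → ℝ} {m Q : ℕ} (hC1 : 1 ≤ C)
    (hε1 : ε ≤ 1)
    (hC : ∀ r : ℕ, 0 < r → (m : ℝ) ^ r.primeFactors.card ≤ C * (r : ℝ) ^ ε)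
    (hw : ∀ (r : ℕ) [NeZero r], r ≤ L ^ B → ∀ χ : DirichletCharacter ℂ r, χ.IsPrimitive → χ ≠ 1 →
        ‖∑ n ∈ Ioc (lowerEnd ε L) (upperEnd ε L), (w n : ℂ) * (χ n * primeLog n)‖ ≤
          1 / (L : ℝ) ^ A) :
    ∑ x ∈ (nontrivialPrimChars Q).filter (fun x => x.1 + 1 ≤ L ^ B),
      conductorWeight m x * ‖primeCharSum (lowerEnd ε L) (upperEnd ε L) w x‖ ≤
        ((L : ℝ) ^ B) ^ 2 * (C * (1 / (L : ℝ) ^ A)) := by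
  have hterm : ∀ x ∈ (nontrivialPrimChars Q).filter (fun x => x.1 + 1 ≤ L ^ B),
      conductorWeight m x * ‖primeCharSum (lowerEnd ε L) (upperEnd ε L) w x‖ ≤
        C * (1 / (L : ℝ) ^ A) := by
    intro x hx
    obtain ⟨hx1, hx2⟩ := mem_filter.mp hx
    have hx3 := mem_nontrivialPrimChars.mp hx1
    refine mul_le_mul ?_ (hw _ hx2 x.2 hx3.2.1 hx3.2.2) (norm_nonneg _) (by linarith)
    refine (conductorWeight_le_rpow hC x).trans (mul_le_of_le_one_right (by linarith) ?_)
    exact Real.rpow_le_one_of_one_le_of_nonpos (by exact_mod_cast Nat.succ_pos _) (by linarith)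
  refine (sum_le_card_nsmul _ _ _ hterm).trans ?_
  rw [nsmul_eq_mul]
  refine mul_le_mul_of_nonneg_right ?_ (by positivity)
  have hsub : (nontrivialPrimChars Q).filter (fun x => x.1 + 1 ≤ L ^ B) ⊆ primChars (L ^ B) := by
    intro x hx
    obtain ⟨hx1, hx2⟩ := mem_filter.mp hx
    have hx3 := mem_nontrivialPrimChars.mp hx1
    simp only [primChars, mem_sigma, mem_range, mem_filter, mem_univ,
      true_and]
    exact ⟨by omega, hx3.2.1⟩
  exact_mod_cast (card_le_card hsub).trans (card_primChars_le _)

lemma sum_large_conductor_le {ε C : ℝ} (hε : 0 < ε) (hε1 : ε ≤ 1 / 16) {L : ℕ} (hL : 64 ≤ L)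
    (hεL : 1 ≤ ε * L) {w : ℕ → ℝ} (hw : IsBulkWeight ε (lowerEnd ε L) (upperEnd ε L) w) {m B : ℕ}
    (hC1 : 1 ≤ C) (hC : ∀ r : ℕ, 0 < r → (m : ℝ) ^ r.primeFactors.card ≤ C * (r : ℝ) ^ ε)
    (hB : exp (-(ε / 2 * L)) ≤ 1 / (L : ℝ) ^ B) {Q : ℕ}
    (hQ : (Q : ℝ) ≤ exp ((1 / 2 - 4 * ε) * L)) :
    ∑ x ∈ (nontrivialPrimChars Q).filter (fun x => ¬ x.1 + 1 ≤ L ^ (2 * B)),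
      conductorWeight m x * ‖primeCharSum (lowerEnd ε L) (upperEnd ε L) w x‖ ≤
        2400 * C * (1 + 2 * (L : ℝ)) ^ 5 * (1 / (L : ℝ) ^ B) := by
  have hLr : (64 : ℝ) ≤ L := by exact_mod_cast hL
  set T := (nontrivialPrimChars Q).filter (fun x => ¬ x.1 + 1 ≤ L ^ (2 * B))
  have hmaps : ∀ x ∈ T, Nat.log 2 (x.1 + 1) ∈ range (2 * L + 1) := by
    intro x hx
    have h1 := (mem_nontrivialPrimChars.mp (mem_filter.mp hx).1).1
    have h2 : 2 ^ Nat.log 2 (x.1 + 1) ≤ Q :=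
      (pow_log_le_self 2 (Nat.succ_ne_zero _)).trans h1
    have h3 : (2 : ℝ) ^ Nat.log 2 (x.1 + 1) ≤ exp L := by
      calc (2 : ℝ) ^ Nat.log 2 (x.1 + 1) ≤ Q := by exact_mod_cast h2
        _ ≤ _ := hQ.trans (by gcongr; nlinarith)
    have h4 := log_le_log (by positivity) h3
    rw [log_exp, log_pow] at h4
    have h5 : (Nat.log 2 (x.1 + 1) : ℝ) ≤ 2 * L := by
      nlinarith [log_two_gt_d9, cast_nonneg (α := ℝ) (Nat.log 2 (x.1 + 1))]
    rw [mem_range]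
    have : Nat.log 2 (x.1 + 1) ≤ 2 * L := by exact_mod_cast h5
    omega
  rw [← sum_fiberwise_of_maps_to hmaps]
  have hshell : ∀ j ∈ range (2 * L + 1), ∑ x ∈ T.filter (fun x => Nat.log 2 (x.1 + 1) = j),
      conductorWeight m x * ‖primeCharSum (lowerEnd ε L) (upperEnd ε L) w x‖ ≤
      600 * C * (1 + 2 * (L : ℝ)) ^ 4 * (2 * (1 / (L : ℝ) ^ B) + 1 / (L : ℝ) ^ B) := by
    intro j _
    rcases (T.filter (fun x => Nat.log 2 (x.1 + 1) = j)).eq_empty_or_nonempty with h0 | ⟨x0, hx0⟩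
    · rw [h0, sum_empty]; positivity
    obtain ⟨hx1, hx2⟩ := mem_filter.mp hx0
    have hδ : ((2 : ℝ) ^ j) ^ (-(1 / 2) : ℝ) ≤ 2 * (1 / (L : ℝ) ^ B) := by
      have h1 : L ^ (2 * B) < 2 ^ (j + 1) := by
        have h2 := Nat.lt_pow_succ_log_self (b := 2) one_lt_two (x0.1 + 1)
        rw [hx2] at h2
        exact (not_le.mp (mem_filter.mp hx1).2).trans h2
      have h2 : ((L : ℝ) ^ B / 2) ^ 2 ≤ 2 ^ j := by
        have h3 : (L : ℝ) ^ (2 * B) < 2 ^ (j + 1) := by exact_mod_cast h1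
        rw [pow_succ] at h3
        rw [div_pow, ← pow_mul, mul_comm B 2]
        have := pow_pos (two_pos (α := ℝ)) j
        linarith
      calc ((2 : ℝ) ^ j) ^ (-(1 / 2) : ℝ) ≤ (((L : ℝ) ^ B / 2) ^ 2) ^ (-(1 / 2) : ℝ) :=
            rpow_le_rpow_of_nonpos (by positivity) h2 (by norm_num)
        _ = 2 * (1 / (L : ℝ) ^ B) := by
            rw [Real.rpow_neg (by positivity), ← sqrt_eq_rpow, sqrt_sq (by positivity)]
            field_simp
    refine (sum_shell_le hε hε1 hL hεL hw hC1 hC hQ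
      ((filter_subset _ _).trans (filter_subset _ _))
      (fun x hx => (mem_filter.mp hx).2) hδ).trans ?_
    gcongr
    refine le_trans (le_of_eq ?_) hB
    congr 1; ring
  refine (sum_le_sum hshell).trans (le_of_eq_of_le (b := 1800 * C * (1 + 2 * (L : ℝ)) ^ 5 * (1 / (L : ℝ) ^ B)) ?_ ?_)
  · rw [sum_const, card_range, nsmul_eq_mul]
    push_cast; ring
  · gcongr; norm_num

/-- A form of the Bombieri-Vinogradov theorem for bulk weights, along a sequence of scales. -/
theorem frequently_bombieri_vinogradov {ε : ℝ} (hε : 0 < ε) (hε1 : ε ≤ 1 / 16) (κ A : ℕ) :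
    ∃ᶠ L : ℕ in atTop, ∃ w E : ℕ → ℝ, IsBulkWeight ε (lowerEnd ε L) (upperEnd ε L) w ∧
      (∀ q, 0 ≤ E q) ∧
      (∀ q, 0 < q → q ≤ levelBound ε L → ∀ a : ℕ, a.Coprime q →
        |∑ n ∈ (Ioc (lowerEnd ε L) (upperEnd ε L)).filter (fun n => n ≡ a [MOD q]),
            w n * primeLog n -
          (∑ n ∈ Ioc (lowerEnd ε L) (upperEnd ε L), w n * primeLog n) / q.totient| ≤ E q) ∧
      ∑ q ∈ (Icc 1 (levelBound ε L)).filter Squarefree,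
        (κ : ℝ) ^ q.primeFactors.card * E q ≤ 1 / (L : ℝ) ^ A := by
  set m := 2 * κ
  obtain ⟨C, hC1, hC⟩ := exists_pow_card_primeFactors_le m hε
  set B := A + m + 6 with hB
  have hfreq := frequently_exists_isBulkWeight hε (by linarith : ε ≤ 1 / 4) (2 * (2 * B) + B) (2 * B)
  have hev1 := eventually_exp_neg_le (half_pos hε) B
  have hev2 := tendsto_natCast_atTop_atTop.eventually_ge_atTop (1 / ε)
  have hev3 := tendsto_natCast_atTop_atTop.eventually_ge_atTop (2401 * C * 3 ^ (m + 5))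
  refine (hfreq.and_eventually (hev1.and (hev2.and (hev3.and (eventually_ge_atTop 64))))).mono ?_
  rintro L ⟨⟨w, hw, hsmall⟩, hL1, hL2, hL3, hL⟩
  have hLr : (64 : ℝ) ≤ L := by exact_mod_cast hL
  set Q := levelBound ε L
  have hQ := levelBound_le ε L
  refine ⟨w, fun q => (∑ x ∈ (nontrivialPrimChars Q).filter (fun x => x.1 + 1 ∣ q),
    ‖primeCharSum (lowerEnd ε L) (upperEnd ε L) w x‖) / q.totient, hw, fun q => ?_, ?_, ?_⟩
  · exact div_nonneg (sum_nonneg fun _ _ => norm_nonneg _) (cast_nonneg _)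
  · intro q hq0 hq a ha
    refine abs_sum_residue_sub_le hq0 ?_ hq w ha
    have h1 := exp_half_lt_lowerEnd (ε := ε) (by linarith) hL
    have h2 : (q : ℝ) < lowerEnd ε L := by
      calc (q : ℝ) ≤ Q := by exact_mod_cast hq
        _ ≤ exp (L / 2) := hQ.trans (by gcongr; nlinarith)
        _ < _ := h1
    exact_mod_cast h2.le
  · refine (sum_pow_card_mul_discrepancy_le κ Q _ fun _ => norm_nonneg _).trans ?_
    rw [← sum_filter_add_sum_filter_not _ (fun x : CharIndex => x.1 + 1 ≤ L ^ (2 * B))]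
    have hS := sum_small_conductor_le (Q := Q) (by omega) hC1 (by linarith) hC hsmall
    have hεL : 1 ≤ ε * L := by
      rw [div_le_iff₀ hε] at hL2; linarith
    have hLg := sum_large_conductor_le hε hε1 hL hεL hw hC1 hC hL1 (Q := Q) hQ
    have hS' : ((L : ℝ) ^ (2 * B)) ^ 2 * (C * (1 / (L : ℝ) ^ (2 * (2 * B) + B))) =
        C * (1 / (L : ℝ) ^ B) := by
      rw [pow_add, ← pow_mul, mul_comm (2 * B) 2]
      field_simp
    rw [hS'] at hS
    obtain ⟨ℓ, hℓ⟩ : ∃ ℓ, ℓ = 1 + 2 * (L : ℝ) := ⟨_, rfl⟩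
    rw [← hℓ] at hLg
    have hℓ1 : 1 ≤ ℓ := by linarith
    have hlogQ : 1 + log Q ≤ ℓ := by
      rcases eq_zero_or_pos Q with h0 | h0
      · rw [h0]; simp; linarith
      · have h1 := log_le_log (by exact_mod_cast h0) hQ
        rw [log_exp] at h1
        have : (1 / 2 - 4 * ε) * (L : ℝ) ≤ L := by nlinarith
        linarith
    have hsum0 := add_le_add hS hLg
    have hsum1 : C * (1 / (L : ℝ) ^ B) + 2400 * C * ℓ ^ 5 * (1 / (L : ℝ) ^ B) ≤
        2401 * C * ℓ ^ 5 * (1 / (L : ℝ) ^ B) := by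
      have : 1 * (C * (1 / (L : ℝ) ^ B)) ≤ ℓ ^ 5 * (C * (1 / (L : ℝ) ^ B)) :=
        mul_le_mul_of_nonneg_right (one_le_pow₀ hℓ1) (by positivity)
      linarith
    calc _ ≤ 2401 * C * ℓ ^ 5 * (1 / (L : ℝ) ^ B) * ℓ ^ m := by
          refine mul_le_mul (hsum0.trans hsum1) ?_ (by positivity) (by positivity)
          gcongr
      _ = 2401 * C * ℓ ^ (m + 5) * (1 / (L : ℝ) ^ B) := by ring
      _ ≤ 2401 * C * (3 * (L : ℝ)) ^ (m + 5) * (1 / (L : ℝ) ^ B) := by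
          gcongr; linarith
      _ = (2401 * C * 3 ^ (m + 5)) / L * (1 / (L : ℝ) ^ A) := by
          rw [hB, mul_pow, show A + m + 6 = A + (m + 5) + 1 by ring, pow_succ (L : ℝ) (A + (m + 5)),
            pow_add (L : ℝ) A]
          field_simp
          try ring
      _ ≤ 1 * (1 / (L : ℝ) ^ A) := by
          gcongr
          rw [div_le_one (by linarith)]
          exact hL3
      _ = _ := one_mul _

lemma sum_fin_succ_function {α M : Type*} [Fintype α] [AddCommMonoid M] {n : ℕ}
    (f : (Fin (n + 1) → α) → M) : ∑ s, f s = ∑ o, ∑ s' : Fin n → α, f (Fin.cons o s') := by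
  rw [← (Fin.consEquiv fun _ : Fin (n + 1) => α).sum_comp, Fintype.sum_prod_type]
  rfl

section Tensor

variable {α β : Type*} [Fintype α] [Fintype β]

/-- The mean square of a tensor expansion in a product model. -/
noncomputable def tensorMeanSq {n : ℕ} (π : Fin n → β → ℝ) (Φ : Fin n → α → β → ℝ)
    (z : (Fin n → α) → ℝ) : ℝ :=
  ∑ X : Fin n → β, (∏ i, π i (X i)) * (∑ s : Fin n → α, z s * ∏ i, Φ i (s i) (X i)) ^ 2

lemma tensorMeanSq_succ {n : ℕ} (π : Fin (n + 1) → β → ℝ) (Φ : Fin (n + 1) → α → β → ℝ)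
    (z : (Fin (n + 1) → α) → ℝ) :
    tensorMeanSq π Φ z = ∑ X' : Fin n → β, (∏ i, π i.succ (X' i)) *
      ∑ x, π 0 x * (∑ o, (∑ s' : Fin n → α, z (Fin.cons o s') * ∏ i, Φ i.succ (s' i) (X' i)) *
        Φ 0 o x) ^ 2 := by
  rw [tensorMeanSq, sum_fin_succ_function, sum_comm]
  refine sum_congr rfl fun X' _ => ?_
  rw [mul_sum]
  refine sum_congr rfl fun x _ => ?_
  rw [sum_fin_succ_function]
  simp only [Fin.prod_univ_succ, Fin.cons_zero, Fin.cons_succ]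
  rw [mul_comm (π 0 x), mul_assoc]
  congr 3
  refine sum_congr rfl fun o _ => ?_
  rw [sum_mul]
  exact sum_congr rfl fun s' _ => by ring

lemma sum_sq_mul_tensorMeanSq {n : ℕ} (π : Fin n → β → ℝ) (Φ : Fin n → α → β → ℝ)
    (z : α → (Fin n → α) → ℝ) (g : α → ℝ) :
    ∑ X' : Fin n → β, (∏ i, π i (X' i)) *
      ∑ o, (∑ s' : Fin n → α, z o s' * ∏ i, Φ i (s' i) (X' i)) ^ 2 * g o =
    ∑ o, g o * tensorMeanSq π Φ (z o) := by
  simp_rw [tensorMeanSq, mul_sum]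
  rw [sum_comm]
  exact sum_congr rfl fun o _ => sum_congr rfl fun X _ => by ring

lemma sum_sq_mul_prod_succ {n : ℕ} (z : (Fin (n + 1) → α) → ℝ) (g : Fin (n + 1) → α → ℝ) :
    ∑ s, z s ^ 2 * ∏ i, g i (s i) =
      ∑ o, g 0 o * ∑ s' : Fin n → α, z (Fin.cons o s') ^ 2 * ∏ i, g i.succ (s' i) := by
  rw [sum_fin_succ_function]
  simp only [Fin.prod_univ_succ, Fin.cons_zero, Fin.cons_succ, mul_sum]
  exact sum_congr rfl fun o _ => sum_congr rfl fun X _ => by ring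

theorem tensorMeanSq_le {n : ℕ} (π : Fin n → β → ℝ) (Φ : Fin n → α → β → ℝ) (g : Fin n → α → ℝ)
    (hπ : ∀ i x, 0 ≤ π i x) (hg : ∀ i o, 0 ≤ g i o)
    (h : ∀ i (u : α → ℝ), ∑ x, π i x * (∑ o, u o * Φ i o x) ^ 2 ≤ ∑ o, u o ^ 2 * g i o)
    (z : (Fin n → α) → ℝ) : tensorMeanSq π Φ z ≤ ∑ s, z s ^ 2 * ∏ i, g i (s i) := by
  induction n with
  | zero => simp [tensorMeanSq]
  | succ n ih =>
    rw [tensorMeanSq_succ, sum_sq_mul_prod_succ]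
    calc _ ≤ ∑ X' : Fin n → β, (∏ i, π i.succ (X' i)) *
          ∑ o, (∑ s' : Fin n → α, z (Fin.cons o s') * ∏ i, Φ i.succ (s' i) (X' i)) ^ 2 * g 0 o :=
          sum_le_sum fun X' _ => mul_le_mul_of_nonneg_left (h 0 _)
            (prod_nonneg fun _ _ => hπ _ _)
      _ = _ := sum_sq_mul_tensorMeanSq (fun i => π i.succ) (fun i => Φ i.succ)
          (fun o s' => z (Fin.cons o s')) (g 0)
      _ ≤ _ := sum_le_sum fun o _ => mul_le_mul_of_nonneg_left
          (ih _ _ _ (fun i => hπ _) (fun i => hg _) (fun i => h _) _) (hg _ _)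

theorem le_tensorMeanSq {n : ℕ} (π : Fin n → β → ℝ) (Φ : Fin n → α → β → ℝ) (g : Fin n → α → ℝ)
    (hπ : ∀ i x, 0 ≤ π i x) (hg : ∀ i o, 0 ≤ g i o)
    (h : ∀ i (u : α → ℝ), ∑ o, u o ^ 2 * g i o ≤ ∑ x, π i x * (∑ o, u o * Φ i o x) ^ 2)
    (z : (Fin n → α) → ℝ) : ∑ s, z s ^ 2 * ∏ i, g i (s i) ≤ tensorMeanSq π Φ z := by
  induction n with
  | zero => simp [tensorMeanSq]
  | succ n ih =>
    rw [tensorMeanSq_succ, sum_sq_mul_prod_succ]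
    calc _ ≤ ∑ o, g 0 o * tensorMeanSq (fun i => π i.succ) (fun i => Φ i.succ)
          (fun s' => z (Fin.cons o s')) := sum_le_sum fun o _ => mul_le_mul_of_nonneg_left
          (ih _ _ _ (fun i => hπ _) (fun i => hg _) (fun i => h _) _) (hg _ _)
      _ = _ := (sum_sq_mul_tensorMeanSq (fun i => π i.succ) (fun i => Φ i.succ)
          (fun o s' => z (Fin.cons o s')) (g 0)).symm
      _ ≤ _ :=
          sum_le_sum fun X' _ => mul_le_mul_of_nonneg_left (h 0 _)
            (prod_nonneg fun _ _ => hπ _ _)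

/-- Change of basis in a tensor expansion. -/
lemma tensorMeanSq_comp {α' : Type*} [Fintype α'] {n : ℕ} (π : Fin n → β → ℝ)
    (Φ : Fin n → α → β → ℝ) (Φ' : Fin n → α' → β → ℝ) (T : Fin n → α → α' → ℝ)
    (h : ∀ i o x, Φ i o x = ∑ o', T i o o' * Φ' i o' x) (z : (Fin n → α) → ℝ) :
    tensorMeanSq π Φ z = tensorMeanSq π Φ' (fun c => ∑ s, z s * ∏ i, T i (s i) (c i)) := by
  unfold tensorMeanSq
  refine sum_congr rfl fun X _ => ?_
  congr 2
  calc ∑ s, z s * ∏ i, Φ i (s i) (X i)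
      = ∑ s, ∑ c : Fin n → α', z s * ((∏ i, T i (s i) (c i)) * ∏ i, Φ' i (c i) (X i)) := by
        refine sum_congr rfl fun s _ => ?_
        rw [← mul_sum]
        congr 1
        simp_rw [h, ← prod_mul_distrib]
        exact prod_univ_sum (fun _ => univ)
          (fun i o' => T i (s i) o' * Φ' i o' (X i)) |>.trans (by rw [Fintype.piFinset_univ])
    _ = _ := by
        rw [sum_comm]
        refine sum_congr rfl fun c _ => ?_
        rw [sum_mul]
        exact sum_congr rfl fun s _ => by ring

/-- Coordinatewise comparison of nonnegative product weights on decreasing functions. -/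
theorem sum_mul_prod_le_of_cone [DecidableEq α] {n : ℕ} (e : α) (y : (Fin n → α) → ℝ)
    (τ τ' : Fin n → α → ℝ) (ρ : Fin n → ℝ) (hτ : ∀ i o, 0 ≤ τ i o) (hτ' : ∀ i o, 0 ≤ τ' i o)
    (hρ : ∀ i, 0 ≤ ρ i)
    (h : ∀ i (u : α → ℝ), (∀ o, 0 ≤ u o) → (∀ o, u o ≤ u e) → ∑ o, u o * τ i o ≤
      ρ i * ∑ o, u o * τ' i o)
    (hy : ∀ s, 0 ≤ y s) (hye : ∀ s i, y s ≤ y (update s i e)) :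
    ∑ s, y s * ∏ i, τ i (s i) ≤ (∏ i, ρ i) * ∑ s, y s * ∏ i, τ' i (s i) := by
  induction n with
  | zero => simp
  | succ n ih =>
    have hexp : ∀ σ : Fin (n + 1) → α → ℝ, ∑ s, y s * ∏ i, σ i (s i) =
        ∑ o, (∑ s' : Fin n → α, y (Fin.cons o s') * ∏ i, σ i.succ (s' i)) * σ 0 o := by
      intro σ
      rw [sum_fin_succ_function]
      simp only [Fin.prod_univ_succ, Fin.cons_zero, Fin.cons_succ, sum_mul]
      exact sum_congr rfl fun o _ => sum_congr rfl fun X _ => by ring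
    rw [hexp, hexp, Fin.prod_univ_succ]
    have hstep : ∀ o, ∑ s' : Fin n → α, y (Fin.cons o s') * ∏ i, τ i.succ (s' i) ≤
        (∏ i : Fin n, ρ i.succ) * ∑ s' : Fin n → α, y (Fin.cons o s') * ∏ i, τ' i.succ (s' i) := by
      intro o
      refine ih (fun s' => y (Fin.cons o s')) _ _ _ (fun i => hτ _) (fun i => hτ' _) (fun i => hρ _)
        (fun i => h _) (fun s' => hy _) fun s' i => ?_
      rw [Fin.cons_update]
      exact hye _ _
    calc _ ≤ ∑ o, ((∏ i : Fin n, ρ i.succ) *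
          ∑ s' : Fin n → α, y (Fin.cons o s') * ∏ i, τ' i.succ (s' i)) * τ 0 o :=
          sum_le_sum fun o _ => mul_le_mul_of_nonneg_right (hstep o) (hτ 0 o)
      _ = (∏ i : Fin n, ρ i.succ) *
          ∑ o, (∑ s' : Fin n → α, y (Fin.cons o s') * ∏ i, τ' i.succ (s' i)) * τ 0 o := by
          rw [mul_sum]
          exact sum_congr rfl fun o _ => by ring
      _ ≤ (∏ i : Fin n, ρ i.succ) * (ρ 0 *
          ∑ o, (∑ s' : Fin n → α, y (Fin.cons o s') * ∏ i, τ' i.succ (s' i)) * τ' 0 o) := by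
          refine mul_le_mul_of_nonneg_left (h 0 _ ?_ ?_) (prod_nonneg fun _ _ => hρ _)
          · exact fun o => sum_nonneg fun s' _ =>
              mul_nonneg (hy _) (prod_nonneg fun _ _ => hτ' _ _)
          · intro o
            refine sum_le_sum fun s' _ => mul_le_mul_of_nonneg_right ?_
              (prod_nonneg fun _ _ => hτ' _ _)
            have := hye (Fin.cons o s') 0
            rwa [Fin.update_cons_zero] at this
      _ = _ := by ring

end Tensor

section Support

variable {α : Type*} [Fintype α] [DecidableEq α]

/-- The product of the primes at which `d` differs from the default value `e`. -/
def suppProd {n : ℕ} (p : Fin n → ℕ) (e : α) (d : Fin n → α) : ℕ := ∏ i with d i ≠ e, p i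

omit [Fintype α] in
lemma suppProd_pos {n : ℕ} {p : Fin n → ℕ} (hp : ∀ i, (p i).Prime) (e : α) (d : Fin n → α) :
    0 < suppProd p e d := prod_pos fun i _ => (hp i).pos

omit [Fintype α] [DecidableEq α] in
lemma primeFactors_prod_of_injective {n : ℕ} {p : Fin n → ℕ} (hp : ∀ i, (p i).Prime)
    (hinj : Injective p) (T : Finset (Fin n)) :
    (∏ i ∈ T, p i).primeFactors = T.image p := by
  rw [← prod_image (f := fun m : ℕ => m) (g := p) hinj.injOn]
  refine Nat.primeFactors_prod fun q hq => ?_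
  obtain ⟨i, -, rfl⟩ := mem_image.1 hq
  exact hp i

omit [Fintype α] [DecidableEq α] in
lemma squarefree_prod_of_injective {n : ℕ} {p : Fin n → ℕ} (hp : ∀ i, (p i).Prime)
    (hinj : Injective p) (T : Finset (Fin n)) : Squarefree (∏ i ∈ T, p i) :=
  squarefree_prod_of_pairwise_isCoprime (fun i _ j _ hij =>
    Nat.coprime_iff_isRelPrime.1 <| (Nat.coprime_primes (hp i) (hp j)).2 (hinj.ne hij))
    fun i _ => (hp i).squarefree

lemma card_support_eq_le {n : ℕ} (e : α) (T : Finset (Fin n)) :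
    (univ.filter fun d : Fin n → α => (univ.filter fun i => d i ≠ e) = T).card ≤
      (Fintype.card α - 1) ^ T.card := by
  calc _ ≤ (Fintype.piFinset fun i => if i ∈ T then univ.erase e else {e}).card := by
        refine card_le_card fun d hd => ?_
        simp only [mem_filter, mem_univ, true_and] at hd
        rw [Fintype.mem_piFinset]
        intro i
        by_cases hi : d i = e
        · rw [if_neg (by rw [← hd]; simp [hi])]
          simp [hi]
        · rw [if_pos (by rw [← hd]; simp [hi])]
          simp [hi]
    _ = _ := by
        rw [Fintype.card_piFinset]
        simp_rw [apply_ite card, card_singleton,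
          card_erase_of_mem (mem_univ e), card_univ]
        rw [prod_ite, prod_const_one, mul_one, prod_const]
        congr 2
        ext
        simp

lemma sum_suppProd_le {n : ℕ} {p : Fin n → ℕ} (hp : ∀ i, (p i).Prime)
    (hinj : Injective p) (e : α) (F : ℕ → ℝ) (hF : ∀ m, 0 ≤ F m) (R : ℕ) :
    ∑ d : Fin n → α with suppProd p e d ≤ R, F (suppProd p e d) ≤
      ∑ m ∈ (Icc 1 R).filter Squarefree,
        ((Fintype.card α - 1 : ℕ) : ℝ) ^ m.primeFactors.card * F m := by
  have hprod : Injective fun T : Finset (Fin n) => ∏ i ∈ T, p i := by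
    intro T T' h
    have := congrArg Nat.primeFactors h
    simp only [primeFactors_prod_of_injective hp hinj] at this
    exact image_injective hinj this
  calc _ = ∑ T ∈ univ.filter fun T : Finset (Fin n) => ∏ i ∈ T, p i ≤ R,
        ∑ d : Fin n → α with suppProd p e d ≤ R ∧ (univ.filter fun i => d i ≠ e) = T,
          F (suppProd p e d) := by
        rw [← sum_fiberwise_of_maps_to (t := univ.filter fun T : Finset (Fin n) =>
          ∏ i ∈ T, p i ≤ R) (g := fun d : Fin n → α => univ.filter fun i => d i ≠ e)]
        · simp_rw [filter_filter]
        · intro d hd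
          simpa [suppProd] using hd
    _ ≤ ∑ T ∈ univ.filter fun T : Finset (Fin n) => ∏ i ∈ T, p i ≤ R,
        ((Fintype.card α - 1 : ℕ) : ℝ) ^ (∏ i ∈ T, p i).primeFactors.card * F (∏ i ∈ T, p i) := by
        refine sum_le_sum fun T hT => ?_
        calc _ = ∑ d : Fin n → α with suppProd p e d ≤ R ∧
              (univ.filter fun i => d i ≠ e) = T, F (∏ i ∈ T, p i) := by
              refine sum_congr rfl fun d hd => ?_
              rw [mem_filter] at hd
              rw [suppProd, hd.2.2]
          _ ≤ _ := by
              rw [sum_const, nsmul_eq_mul, primeFactors_prod_of_injective hp hinj,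
                card_image_of_injective _ hinj]
              refine mul_le_mul_of_nonneg_right ?_ (hF _)
              rw [← Nat.cast_pow]
              refine cast_le.2 (le_trans (card_le_card ?_) (card_support_eq_le e T))
              intro d hd
              simp only [mem_filter, mem_univ, true_and] at hd ⊢
              exact hd.2
    _ = ∑ m ∈ (univ.filter fun T : Finset (Fin n) => ∏ i ∈ T, p i ≤ R).image
          (fun T => ∏ i ∈ T, p i),
          ((Fintype.card α - 1 : ℕ) : ℝ) ^ m.primeFactors.card * F m := by
        rw [sum_image hprod.injOn]
    _ ≤ _ := by
        refine sum_le_sum_of_subset_of_nonneg ?_ fun m _ _ => mul_nonneg (by positivity)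
          (hF m)
        intro m hm
        obtain ⟨T, hT, rfl⟩ := mem_image.1 hm
        rw [mem_filter, mem_Icc]
        exact ⟨⟨prod_pos fun i _ => (hp i).pos, (mem_filter.1 hT).2⟩,
          squarefree_prod_of_injective hp hinj T⟩

end Support

section Expansion

variable {ι α β : Type*} [Fintype α] [DecidableEq α] [Fintype β]

omit [DecidableEq α] [Fintype β] in
lemma sum_mul_sq_sum (S : Finset ι) (u : ι → ℝ) (A : ι → α → ℝ) (lam : α → ℝ) :
    ∑ x ∈ S, u x * (∑ c, lam c * A x c) ^ 2 =
      ∑ c, ∑ c', lam c * lam c' * ∑ x ∈ S, u x * A x c * A x c' := by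
  simp_rw [sq, sum_mul_sum, mul_sum]
  rw [sum_comm]
  refine sum_congr rfl fun c _ => ?_
  rw [sum_comm]
  exact sum_congr rfl fun c' _ => sum_congr rfl fun x _ => by ring

lemma sum_prod_mul_prod {n : ℕ} (f : Fin n → β → ℝ) :
    ∑ X : Fin n → β, ∏ i, f i (X i) = ∏ i, ∑ x, f i x := by
  rw [prod_univ_sum, Fintype.piFinset_univ]

omit [DecidableEq α] in
lemma tensorMeanSq_eq_sum {n : ℕ} (π : Fin n → β → ℝ) (J : Fin n → α → β → ℝ)
    (lam : (Fin n → α) → ℝ) :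
    tensorMeanSq π J lam = ∑ c, ∑ c', lam c * lam c' *
      ∏ i, ∑ x, π i x * J i (c i) x * J i (c' i) x := by
  rw [tensorMeanSq, sum_mul_sq_sum univ (fun X : Fin n → β => ∏ i, π i (X i))
    (fun X c => ∏ i, J i (c i) (X i)) lam]
  simp_rw [← sum_prod_mul_prod, prod_mul_distrib]

/-- Comparison of a quadratic sieve sum with its product model. -/
theorem abs_sum_sq_sub_le {n : ℕ} {p : Fin n → ℕ} (hp : ∀ i, (p i).Prime)
    (hinj : Injective p) (e : α) (S : Finset ι) (u : ι → ℝ) (I : ι → Fin n → α → ℝ)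
    (γ : ℝ) (π : Fin n → β → ℝ) (J : Fin n → α → β → ℝ) (lam : (Fin n → α) → ℝ) {M : ℝ}
    {R : ℕ} (hM : ∀ c, |lam c| ≤ M) (hR : ∀ c, lam c ≠ 0 → suppProd p e c ≤ R) (Err : ℕ → ℝ)
    (hErr : ∀ m, 0 ≤ Err m)
    (h : ∀ c c' : Fin n → α, suppProd p (e, e) (fun i => (c i, c' i)) ≤ R ^ 2 →
      |∑ x ∈ S, u x * (∏ i, I x i (c i)) * (∏ i, I x i (c' i)) -
        γ * ∏ i, ∑ x, π i x * J i (c i) x * J i (c' i) x| ≤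
        Err (suppProd p (e, e) fun i => (c i, c' i))) :
    |∑ x ∈ S, u x * (∑ c, lam c * ∏ i, I x i (c i)) ^ 2 - γ * tensorMeanSq π J lam| ≤
      M ^ 2 * ∑ m ∈ (Icc 1 (R ^ 2)).filter Squarefree,
        ((Fintype.card α ^ 2 : ℕ) : ℝ) ^ m.primeFactors.card * Err m := by
  have hM0 : 0 ≤ M := (abs_nonneg _).trans (hM fun _ => e)
  rw [sum_mul_sq_sum S u (fun x c => ∏ i, I x i (c i)) lam, tensorMeanSq_eq_sum, mul_sum,
    ← sum_sub_distrib]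
  have hterm : ∀ c c', |lam c * lam c' * (∑ x ∈ S, u x * (∏ i, I x i (c i)) * ∏ i, I x i (c' i)) -
      γ * (lam c * lam c' * ∏ i, ∑ x, π i x * J i (c i) x * J i (c' i) x)| ≤
      M ^ 2 * if suppProd p (e, e) (fun i => (c i, c' i)) ≤ R ^ 2 then
        Err (suppProd p (e, e) fun i => (c i, c' i)) else 0 := by
    intro c c'
    rw [show lam c * lam c' * (∑ x ∈ S, u x * (∏ i, I x i (c i)) * ∏ i, I x i (c' i)) -
      γ * (lam c * lam c' * ∏ i, ∑ x, π i x * J i (c i) x * J i (c' i) x) =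
      lam c * lam c' * ((∑ x ∈ S, u x * (∏ i, I x i (c i)) * ∏ i, I x i (c' i)) -
      γ * ∏ i, ∑ x, π i x * J i (c i) x * J i (c' i) x) by ring, abs_mul, abs_mul]
    by_cases hc : lam c = 0
    · rw [hc]
      simp only [abs_zero, zero_mul]
      split_ifs
      · exact mul_nonneg (by positivity) (hErr _)
      · simp
    by_cases hc' : lam c' = 0
    · rw [hc']
      simp only [abs_zero, zero_mul, mul_zero]
      split_ifs
      · exact mul_nonneg (by positivity) (hErr _)
      · simp
    have hle : suppProd p (e, e) (fun i => (c i, c' i)) ≤ R ^ 2 := by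
      refine le_trans ?_ (le_trans (Nat.mul_le_mul (hR c hc) (hR c' hc')) (sq R).ge)
      unfold suppProd
      rw [← prod_union_inter]
      calc _ ≤ ∏ i ∈ (univ.filter fun i => c i ≠ e) ∪ univ.filter fun i => c' i ≠ e,
            p i := by
            refine le_of_eq (prod_congr ?_ fun _ _ => rfl)
            ext i
            simp only [mem_filter, mem_union, mem_univ, true_and, ne_eq,
              Prod.mk.injEq]
            tauto
        _ ≤ _ := Nat.le_mul_of_pos_right _ (prod_pos fun i _ => (hp i).pos)
    rw [if_pos hle, sq]
    exact mul_le_mul (mul_le_mul (hM c) (hM c') (abs_nonneg _) hM0)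
      (h c c' hle) (abs_nonneg _) (by positivity)
  calc _ ≤ ∑ c : Fin n → α, ∑ c' : Fin n → α, M ^ 2 * (if suppProd p (e, e) (fun i => (c i, c' i)) ≤ R ^ 2 then
        Err (suppProd p (e, e) fun i => (c i, c' i)) else 0) := by
        refine (abs_sum_le_sum_abs _ _).trans (sum_le_sum fun c _ => ?_)
        rw [mul_sum, ← sum_sub_distrib]
        exact (abs_sum_le_sum_abs _ _).trans (sum_le_sum fun c' _ => hterm c c')
    _ = M ^ 2 * ∑ d : Fin n → α × α with suppProd p (e, e) d ≤ R ^ 2,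
        Err (suppProd p (e, e) d) := by
        simp_rw [← mul_sum]
        rw [sum_filter, ← (Equiv.arrowProdEquivProdArrow (Fin n) (fun _ => α)
          (fun _ => α)).symm.sum_comp, Fintype.sum_prod_type]
        rfl
    _ ≤ _ := by
        refine mul_le_mul_of_nonneg_left ((sum_suppProd_le hp hinj (e, e) Err hErr _).trans
          (sum_le_sum fun m _ => mul_le_mul_of_nonneg_right (pow_le_pow_left₀
            (cast_nonneg _) ?_ _) (hErr m))) (by positivity)
        rw [Fintype.card_prod, sq]
        exact_mod_cast sub_le _ _

end Expansion

section SieveCoefficients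

variable {κ : Type*} [Fintype κ] [DecidableEq κ]

/-- The local change of variables from diagonal to sieve coefficients. -/
def localCoeff (a : ℝ) : Option κ → Option κ → ℝ
  | none, none => 1
  | none, some _ => 0
  | some _, none => -a
  | some j, some j' => if j = j' then 1 else 0

/-- Sieve coefficients attached to diagonal variables `z`. -/
noncomputable def sieveCoeff {n : ℕ} (a : Fin n → ℝ) (z : (Fin n → Option κ) → ℝ)
    (c : Fin n → Option κ) : ℝ := ∑ s, z s * ∏ i, localCoeff (a i) (s i) (c i)

lemma suppProd_le_of_sieveCoeff_ne_zero {n : ℕ} {p : Fin n → ℕ} (hp : ∀ i, (p i).Prime)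
    (a : Fin n → ℝ) (z : (Fin n → Option κ) → ℝ) {R : ℕ}
    (hz : ∀ s, z s ≠ 0 → suppProd p none s ≤ R) (c : Fin n → Option κ)
    (hc : sieveCoeff a z c ≠ 0) : suppProd p none c ≤ R := by
  obtain ⟨s, -, hs⟩ := exists_ne_zero_of_sum_ne_zero hc
  refine le_trans ?_ (hz s (left_ne_zero_of_mul hs))
  have h := prod_ne_zero_iff.1 (right_ne_zero_of_mul hs)
  refine prod_le_prod_of_subset_of_one_le' ?_ fun i _ _ => (hp i).pos
  intro i hi
  simp only [mem_filter, mem_univ, true_and] at hi ⊢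
  intro hsi
  have := h i (mem_univ _)
  rw [hsi] at this
  cases hci : c i with
  | none => exact hi hci
  | some j => rw [hci] at this; exact this rfl

lemma abs_sieveCoeff_le {n : ℕ} {p : Fin n → ℕ} (hp : ∀ i, (p i).Prime)
    (hinj : Injective p) (z : (Fin n → Option κ) → ℝ) {R : ℕ}
    (hz : ∀ s, z s ≠ 0 → suppProd p none s ≤ R) (hz1 : ∀ s, |z s| ≤ 1) (c : Fin n → Option κ) :
    |sieveCoeff (fun i => 1 / (p i : ℝ)) z c| ≤ (1 + log R) ^ Fintype.card κ := by
  have ha : ∀ i, 0 ≤ 1 / (p i : ℝ) := fun i => by positivity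
  calc _ ≤ ∑ s : Fin n → Option κ, (if suppProd p none s ≤ R then (1 : ℝ) else 0) *
        ∏ i, |localCoeff (1 / (p i : ℝ)) (s i) (c i)| := by
        refine (abs_sum_le_sum_abs _ _).trans (sum_le_sum fun s _ => ?_)
        rw [abs_mul, abs_prod]
        refine mul_le_mul_of_nonneg_right ?_ (prod_nonneg fun _ _ => abs_nonneg _)
        split_ifs with h
        · exact hz1 s
        · rw [not_imp_comm.1 (hz s) h, abs_zero]
    _ ≤ (∏ _i : Fin n, (1 : ℝ)) * ∑ s : Fin n → Option κ,
        (if suppProd p none s ≤ R then (1 : ℝ) else 0) *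
          ∏ i, if s i ≠ none then 1 / (p i : ℝ) else 1 := by
        refine sum_mul_prod_le_of_cone none _ (fun i o => |localCoeff (1 / (p i : ℝ)) o (c i)|)
          (fun i o => if o ≠ none then 1 / (p i : ℝ) else 1) _
          (fun _ _ => abs_nonneg _) ?_ (fun _ => zero_le_one) ?_ ?_ ?_
        · intro i o
          split_ifs
          · exact ha i
          · exact zero_le_one
        · intro i u hu hun
          rw [sum_option, sum_option, one_mul]
          cases hci : c i with
          | none =>
            simp only [localCoeff, abs_one, mul_one, abs_neg, abs_of_nonneg (ha i)]
            simp
          | some j =>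
            simp only [localCoeff, abs_zero, mul_zero, zero_add]
            rw [sum_eq_single j (fun j' _ hj' => by simp [hj']) (by simp)]
            simp only [if_true, abs_one, mul_one, ne_eq, not_true, if_false]
            exact (hun _).trans (le_add_of_nonneg_right (sum_nonneg fun o _ =>
              mul_nonneg (hu _) (by split_ifs <;> first | exact ha i | exact zero_le_one)))
        · intro s
          split_ifs
          · exact zero_le_one
          · exact le_rfl
        · intro s i
          by_cases h : suppProd p none s ≤ R
          · rw [if_pos h, if_pos]
            refine le_trans (prod_le_prod_of_subset_of_one_le' ?_ fun i _ _ => (hp i).pos) h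
            intro i' hi'
            simp only [mem_filter, mem_univ, true_and] at hi' ⊢
            intro hs
            by_cases hii : i' = i
            · subst hii; simp at hi'
            · rw [Function.update_of_ne hii] at hi'
              exact hi' hs
          · rw [if_neg h]
            split_ifs
            · exact zero_le_one
            · exact le_rfl
    _ = ∑ s : Fin n → Option κ with suppProd p none s ≤ R, 1 / (suppProd p none s : ℝ) := by
        rw [prod_const_one, one_mul, sum_filter]
        refine sum_congr rfl fun s _ => ?_
        rw [ite_mul, one_mul, zero_mul]
        congr 1
        rw [suppProd, cast_prod, ← prod_filter, one_div, ← prod_inv_distrib]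
        exact prod_congr rfl fun _ _ => one_div _
    _ ≤ _ := by
        refine (sum_suppProd_le hp hinj none (fun m => 1 / (m : ℝ)) (fun m => by positivity) R).trans
          ?_
        rw [Fintype.card_option, Nat.add_sub_cancel]
        simp_rw [mul_one_div]
        exact sum_squarefree_pow_card_div_le _ _

end SieveCoefficients

section LocalModels

variable {κ : Type*} [Fintype κ] [DecidableEq κ]

/-- The indicator that a coloured divisibility condition `c` holds in the state `x`. -/
def colorIndicator (c x : Option κ) : ℝ := if c = none ∨ c = x then 1 else 0

/-- Each colour has probability `a`. -/
def fullWeight (a : ℝ) : Option κ → ℝ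
  | none => 1 - Fintype.card κ * a
  | some _ => a

/-- Each colour other than `j` has probability `b`. -/
def deletedWeight (j : κ) (b : ℝ) : Option κ → ℝ
  | none => 1 - (Fintype.card κ - 1) * b
  | some i => if i = j then 0 else b

lemma sum_localCoeff_mul (a : ℝ) (o : Option κ) (f : Option κ → ℝ) :
    ∑ c, localCoeff a o c * f c = match o with
      | none => f none
      | some j => f (some j) - a * f none := by
  rw [sum_option]
  cases o with
  | none => simp [localCoeff]
  | some j => simp [localCoeff]; ring

lemma sum_mul_localCoeff_indicator (a : ℝ) (u : Option κ → ℝ) (x : Option κ) :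
    ∑ o, u o * ∑ c, localCoeff a o c * colorIndicator c x =
      u none - a * ∑ j, u (some j) + match x with
        | none => 0
        | some j => u (some j) := by
  simp_rw [sum_localCoeff_mul]
  rw [sum_option, mul_sum]
  have h : ∀ j, u (some j) * (colorIndicator (some j) x - a * colorIndicator none x) =
      (if x = some j then u (some j) else 0) - a * u (some j) := by
    intro j
    simp only [colorIndicator, reduceCtorEq, false_or, true_or, if_true, mul_one,
      eq_comm (a := x), mul_sub, mul_ite, mul_zero]
    ring
  change u none * colorIndicator none x +
    ∑ j, u (some j) * (colorIndicator (some j) x - a * colorIndicator none x) = _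
  simp_rw [h, sum_sub_distrib]
  cases x with
  | none => simp [colorIndicator, sub_eq_add_neg]
  | some j =>
    simp only [Option.some.injEq, sum_ite_eq, mem_univ, if_true, colorIndicator,
      true_or, mul_one]
    ring

theorem tensorMeanSq_sieveCoeff_le {n : ℕ} (a : Fin n → ℝ) (ha : ∀ i, 0 ≤ a i)
    (ha1 : ∀ i, Fintype.card κ * a i ≤ 1) (z : (Fin n → Option κ) → ℝ) :
    tensorMeanSq (fun i => fullWeight (a i)) (fun _ => colorIndicator) (sieveCoeff a z) ≤
      ∑ s, z s ^ 2 * ∏ i, if s i = none then 1 else a i := by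
  rw [show sieveCoeff a z = fun c => ∑ s, z s * ∏ i, localCoeff (a i) (s i) (c i) from rfl,
    ← tensorMeanSq_comp (fun i => fullWeight (a i))
      (fun i o x => ∑ c, localCoeff (a i) o c * colorIndicator c x) (fun _ => colorIndicator)
      (fun i => localCoeff (a i)) (fun _ _ _ => rfl)]
  refine tensorMeanSq_le _ _ (fun i o => if o = none then 1 else a i) ?_ ?_ ?_ z
  · rintro i (_ | j)
    · exact sub_nonneg.2 (ha1 i)
    · exact ha i
  · intro i o
    split_ifs
    · exact zero_le_one
    · exact ha i
  · intro i u
    simp_rw [sum_mul_localCoeff_indicator]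
    rw [sum_option, sum_option]
    simp only [fullWeight, if_true, reduceCtorEq, if_false, add_zero, mul_one]
    obtain ⟨U, hU⟩ : ∃ U, U = ∑ j, u (some j) := ⟨_, rfl⟩
    rw [← hU]
    have : ∑ j, a i * (u none - a i * U + u (some j)) ^ 2 =
        Fintype.card κ * (a i * (u none - a i * U) ^ 2) + 2 * a i * (u none - a i * U) * U +
          ∑ j, u (some j) ^ 2 * a i := by
      obtain ⟨V, hV⟩ : ∃ V, V = u none - a i * U := ⟨_, rfl⟩
      rw [← hV, hU, mul_sum, ← nsmul_eq_mul, ← card_univ, ← sum_const,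
        ← sum_add_distrib, ← sum_add_distrib]
      exact sum_congr rfl fun _ _ => by ring
    rw [this]
    linarith [mul_nonneg (sq_nonneg (a i)) (sq_nonneg U)]

/-- The change of variables diagonalizing the deleted model. -/
def deletedCoeff (j : κ) (a b : ℝ) : Option κ → Option κ → ℝ
  | none, none => 1
  | none, some _ => 0
  | some i, none => if i = j then -a else b - a
  | some i, some i' => if i = i' then 1 else 0

/-- The centred indicators of the deleted model. -/
def deletedBasis (j : κ) (b : ℝ) : Option κ → Option κ → ℝ
  | none, _ => 1
  | some i, x => (if x = some i then 1 else 0) - if i = j then 0 else b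

lemma localCoeff_eq_deletedCoeff (j : κ) (a b : ℝ) (o x : Option κ) :
    ∑ c, localCoeff a o c * colorIndicator c x =
      ∑ c, deletedCoeff j a b o c * deletedBasis j b c x := by
  rw [sum_localCoeff_mul, sum_option]
  cases o with
  | none => simp [colorIndicator, deletedCoeff, deletedBasis]
  | some i =>
    simp only [colorIndicator, deletedCoeff, deletedBasis, reduceCtorEq, false_or, true_or, if_true,
      mul_one, ite_mul, one_mul, zero_mul, sum_ite_eq, mem_univ, eq_comm (a := x)]
    split_ifs <;> ring

lemma sum_mul_deletedBasis (j : κ) (b : ℝ) (u : Option κ → ℝ) (x : Option κ) :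
    ∑ o, u o * deletedBasis j b o x = u none - b * (∑ i ∈ univ.erase j, u (some i)) +
      match x with
        | none => 0
        | some i => u (some i) := by
  rw [sum_option, ← filter_ne', sum_filter, mul_sum]
  cases x with
  | none =>
    have : ∀ i, u (some i) * deletedBasis j b (some i) none =
        -(b * if i ≠ j then u (some i) else 0) := fun i => by
      by_cases h : i = j <;> simp [deletedBasis, h, mul_comm]
    simp only [this, ← mul_sum, sum_neg_distrib]
    simp [deletedBasis, sub_eq_add_neg]
  | some i =>
    simp only [deletedBasis, mul_one, Option.some.injEq, mul_sub, sum_sub_distrib, mul_ite,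
      mul_zero, sum_ite_eq, mem_univ, if_true]
    have : ∑ x, (if x = j then 0 else u (some x) * b) =
        ∑ x, if x ≠ j then b * u (some x) else 0 :=
      sum_congr rfl fun i _ => by by_cases h : i = j <;> simp [h, mul_comm]
    rw [this]
    ring

/-- The sign of a diagonal index. -/
def colorSign : Option κ → ℝ
  | none => 1
  | some _ => -1

/-- The weights with which a diagonal variable is summed over additional primes of colour `j`. -/
def extendWeight (j : κ) (a : ℝ) (o c : Option κ) : ℝ :=
  if o = c then 1 else if o = some j ∧ c = none then a else 0

lemma sum_deletedBasis_sq (j : κ) (b : ℝ) (u : Option κ → ℝ) :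
    ∑ x, deletedWeight j b x * (∑ o, u o * deletedBasis j b o x) ^ 2 =
      u none ^ 2 + b * (∑ i ∈ univ.erase j, u (some i) ^ 2) -
        b ^ 2 * (∑ i ∈ univ.erase j, u (some i)) ^ 2 := by
  simp_rw [sum_mul_deletedBasis]
  obtain ⟨U, hU⟩ : ∃ U, U = ∑ i ∈ univ.erase j, u (some i) := ⟨_, rfl⟩
  rw [sum_option, ← hU, ← add_sum_erase _ _ (mem_univ j)]
  have h1 : ∀ i ∈ univ.erase j, deletedWeight j b (some i) *
      (u none - b * U + u (some i)) ^ 2 = b * (u none - b * U) ^ 2 +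
        2 * b * (u none - b * U) * u (some i) + b * u (some i) ^ 2 := by
    intro i hi
    rw [deletedWeight, if_neg (ne_of_mem_erase hi)]
    ring
  have hcard : ((univ.erase j).card : ℝ) = Fintype.card κ - 1 := by
    rw [card_erase_of_mem (mem_univ j), card_univ, cast_sub
      (card_pos_iff.2 ⟨j⟩), Nat.cast_one]
  simp only []
  rw [sum_congr rfl h1, sum_add_distrib, sum_add_distrib, sum_const,
    ← mul_sum, ← mul_sum, ← hU, nsmul_eq_mul, hcard]
  simp only [deletedWeight, if_true]
  ring

lemma le_abs_deletedCoeff_sum {n : ℕ} (j : κ) (a b : Fin n → ℝ) (ha : ∀ i, 0 ≤ a i)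
    (hab : ∀ i, a i ≤ b i) (y : (Fin n → Option κ) → ℝ)
    (hy : ∀ s, 0 ≤ y s) (hye : ∀ s i, y s ≤ y (update s i none))
    (z : (Fin n → Option κ) → ℝ) (hz : z = fun s => (∏ i, colorSign (s i)) * y s)
    (c : Fin n → Option κ) :
    (2 - ∏ i, (1 + Fintype.card κ * (b i - a i))) *
        ∑ s, y s * ∏ i, extendWeight j (a i) (s i) (c i) ≤
      |∑ s, z s * ∏ i, deletedCoeff j (a i) (b i) (s i) (c i)| := by
  obtain ⟨τ, hτ⟩ : ∃ τ : Fin n → Option κ → ℝ, τ = fun i o =>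
    colorSign o * colorSign (c i) * deletedCoeff j (a i) (b i) o (c i) := ⟨_, rfl⟩
  have hτ0 : ∀ i o, τ i o = if o = c i then 1 else if c i = none then
      (if o = some j then a i else a i - b i) else 0 := by
    intro i o
    rw [hτ]
    beta_reduce
    cases o with
    | none => cases c i <;> simp [colorSign, deletedCoeff]
    | some i' =>
      cases c i with
      | none => by_cases h : i' = j <;> simp [colorSign, deletedCoeff, h]
      | some i'' => by_cases h : i' = i'' <;> simp [colorSign, deletedCoeff, h]
  have hsgn : |∏ i, colorSign (c i)| = 1 := by
    rw [abs_prod]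
    exact prod_eq_one fun i _ => by cases c i <;> simp [colorSign]
  have habs : |∑ s, z s * ∏ i, deletedCoeff j (a i) (b i) (s i) (c i)| =
      |∑ s, y s * ∏ i, τ i (s i)| := by
    rw [← one_mul |∑ s, z s * _|, ← hsgn, ← abs_mul, mul_sum]
    congr 1
    refine sum_congr rfl fun s _ => ?_
    rw [hz, hτ]
    simp only [prod_mul_distrib]
    ring
  rw [habs]
  refine le_trans ?_ (le_abs_self _)
  have hpt : ∀ s : Fin n → Option κ, 2 * ∏ i, extendWeight j (a i) (s i) (c i) -
      ∏ i, |τ i (s i)| ≤ ∏ i, τ i (s i) := by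
    intro s
    by_cases hs : ∀ i, c i = none → s i = none ∨ s i = some j
    · have h1 : ∀ i, τ i (s i) = extendWeight j (a i) (s i) (c i) := by
        intro i
        rw [hτ0, extendWeight]
        by_cases h1 : s i = c i
        · simp [h1]
        · by_cases h2 : c i = none
          · rcases hs i h2 with h3 | h3
            · exact absurd (h3.trans h2.symm) h1
            · simp [h2, h3]
          · simp [h1, h2]
      have h2 : ∀ i, 0 ≤ extendWeight j (a i) (s i) (c i) := by
        intro i
        unfold extendWeight
        split_ifs
        exacts [zero_le_one, ha i, le_rfl]
      simp_rw [h1, abs_of_nonneg (h2 _)]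
      linarith
    · push Not at hs
      obtain ⟨i, hi, hi1, hi2⟩ := hs
      rw [prod_eq_zero (mem_univ i) (by simp [extendWeight, hi, hi1, hi2]), mul_zero,
        zero_sub, ← abs_prod]
      exact neg_abs_le _
  have hcone : ∑ s, y s * ∏ i, |τ i (s i)| ≤ (∏ i, (1 + Fintype.card κ * (b i - a i))) *
      ∑ s, y s * ∏ i, extendWeight j (a i) (s i) (c i) := by
    have hd : ∀ i, 0 ≤ Fintype.card κ * (b i - a i) := fun i =>
      mul_nonneg (cast_nonneg _) (sub_nonneg.2 (hab i))
    have hw : ∀ i o, 0 ≤ extendWeight j (a i) o (c i) := by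
      intro i o
      unfold extendWeight
      split_ifs
      exacts [zero_le_one, ha i, le_rfl]
    refine sum_mul_prod_le_of_cone none y (fun i o => |τ i o|)
      (fun i o => extendWeight j (a i) o (c i)) _ (fun _ _ => abs_nonneg _) hw
      (fun i => add_nonneg zero_le_one (hd i)) ?_ hy hye
    intro i u hu hun
    cases hc : c i with
    | some i' =>
      have h1 : ∀ o, u o * |τ i o| = u o * extendWeight j (a i) o (some i') := by
        intro o
        rw [hτ0, hc, extendWeight]
        by_cases h : o = some i' <;> simp [h]
      simp_rw [h1]
      refine le_mul_of_one_le_left (sum_nonneg fun o _ => mul_nonneg (hu o) ?_)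
        (le_add_of_nonneg_right (hd i))
      rw [← hc]
      exact hw i o
    | none =>
      have h1 : ∀ o, u o * |τ i o| ≤ u o * extendWeight j (a i) o none +
          if o = none then 0 else u none * (b i - a i) := by
        intro o
        rw [hτ0, hc, extendWeight]
        by_cases h : o = none
        · simp [h]
        · by_cases h2 : o = some j
          · simp only [h2, reduceCtorEq, if_false, if_true, abs_of_nonneg (ha i), true_and]
            exact le_add_of_nonneg_right (mul_nonneg (hu _) (sub_nonneg.2 (hab i)))
          · simp only [h, h2, if_false, if_true, false_and, mul_zero, zero_add]
            rw [abs_sub_comm, abs_of_nonneg (sub_nonneg.2 (hab i))]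
            exact mul_le_mul_of_nonneg_right (hun o) (sub_nonneg.2 (hab i))
      refine (sum_le_sum fun o _ => h1 o).trans ?_
      rw [sum_add_distrib, sum_option (fun o => if o = none then _ else _)]
      simp only [if_true, reduceCtorEq, if_false, zero_add, sum_const, card_univ,
        nsmul_eq_mul]
      have h2 : u none ≤ ∑ o, u o * extendWeight j (a i) o none := by
        rw [sum_option]
        rw [show extendWeight j (a i) none none = 1 by simp [extendWeight], mul_one]
        exact le_add_of_nonneg_right (sum_nonneg fun o _ => mul_nonneg (hu _) (hc ▸ hw i _))
      have h3 := mul_le_mul_of_nonneg_left h2 (hd i)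
      linarith
  have hmain := sum_le_sum fun s (_ : s ∈ univ) =>
    mul_le_mul_of_nonneg_left (hpt s) (hy s)
  refine le_trans ?_ hmain
  rw [sum_congr rfl fun s _ => mul_sub (y s) _ _, sum_sub_distrib]
  have : ∑ s, y s * (2 * ∏ i, extendWeight j (a i) (s i) (c i)) =
      2 * ∑ s, y s * ∏ i, extendWeight j (a i) (s i) (c i) := by
    rw [mul_sum]
    exact sum_congr rfl fun _ _ => by ring
  rw [this, sub_mul]
  exact sub_le_sub_left hcone _

theorem le_tensorMeanSq_sieveCoeff {n : ℕ} (j : κ) (a b : Fin n → ℝ) (ha : ∀ i, 0 ≤ a i)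
    (hab : ∀ i, a i ≤ b i) (hb1 : ∀ i, Fintype.card κ * b i ≤ 1)
    (hab2 : ∀ i, a i * (1 - Fintype.card κ * a i) ≤ b i * (1 - (Fintype.card κ - 1) * b i))
    (hρ : ∏ i, (1 + Fintype.card κ * (b i - a i)) ≤ 2) (y : (Fin n → Option κ) → ℝ)
    (hy : ∀ s, 0 ≤ y s) (hye : ∀ s i, y s ≤ y (update s i none)) :
    (2 - ∏ i, (1 + Fintype.card κ * (b i - a i))) ^ 2 *
      ∑ c : Fin n → Option κ, (∑ s, y s * ∏ i, extendWeight j (a i) (s i) (c i)) ^ 2 *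
        (∏ i, if c i = none then 1 else if c i = some j then 0 else
          a i * (1 - Fintype.card κ * a i)) ≤
    tensorMeanSq (fun i => deletedWeight j (b i)) (fun _ => colorIndicator)
      (sieveCoeff a fun s => (∏ i, colorSign (s i)) * y s) := by
  obtain ⟨z, hz⟩ : ∃ z : (Fin n → Option κ) → ℝ, z = fun s => (∏ i, colorSign (s i)) * y s :=
    ⟨_, rfl⟩
  obtain ⟨g, hg⟩ : ∃ g : Fin n → Option κ → ℝ, g = fun i o => if o = none then 1 else
      if o = some j then 0 else a i * (1 - Fintype.card κ * a i) := ⟨_, rfl⟩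
  have hk1 : (1 : ℝ) ≤ Fintype.card κ := by
    exact_mod_cast (card_pos_iff.2 ⟨j⟩ : 0 < Fintype.card κ)
  have ha1 : ∀ i, Fintype.card κ * a i ≤ 1 := fun i =>
    (mul_le_mul_of_nonneg_left (hab i) (by positivity)).trans (hb1 i)
  have hg0 : ∀ i o, 0 ≤ g i o := by
    intro i o
    rw [hg]
    beta_reduce
    split_ifs
    · exact zero_le_one
    · exact le_rfl
    · exact mul_nonneg (ha i) (sub_nonneg.2 (ha1 i))
  rw [← hz, show sieveCoeff a z = fun c => ∑ s, z s * ∏ i, localCoeff (a i) (s i) (c i) from rfl,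
    ← tensorMeanSq_comp (fun i => deletedWeight j (b i))
      (fun i o x => ∑ c, localCoeff (a i) o c * colorIndicator c x) (fun _ => colorIndicator)
      (fun i => localCoeff (a i)) (fun _ _ _ => rfl),
    tensorMeanSq_comp (fun i => deletedWeight j (b i)) _ (fun i => deletedBasis j (b i))
      (fun i => deletedCoeff j (a i) (b i)) (fun i o x => localCoeff_eq_deletedCoeff j _ _ o x)]
  refine le_trans ?_ (le_tensorMeanSq _ _ g ?_ hg0 ?_ _)
  · rw [mul_sum]
    refine sum_le_sum fun c _ => ?_
    rw [← mul_assoc, ← mul_pow]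
    have hgc : (∏ i, if c i = none then 1 else if c i = some j then 0 else
        a i * (1 - Fintype.card κ * a i)) = ∏ i, g i (c i) := by rw [hg]
    rw [hgc]
    refine mul_le_mul_of_nonneg_right ?_ (prod_nonneg fun i _ => hg0 _ _)
    have hU0 : 0 ≤ ∑ s, y s * ∏ i, extendWeight j (a i) (s i) (c i) :=
      sum_nonneg fun s _ => mul_nonneg (hy s) <| prod_nonneg fun i _ => by
        unfold extendWeight
        split_ifs
        exacts [zero_le_one, ha i, le_rfl]
    rw [← sq_abs (∑ s, z s * _)]
    refine pow_le_pow_left₀ (mul_nonneg (sub_nonneg.2 hρ) hU0) ?_ 2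
    exact le_abs_deletedCoeff_sum j a b ha hab y hy hye z hz c
  · rintro i (_ | i')
    · refine sub_nonneg.2 (le_trans (mul_le_mul_of_nonneg_right ?_ ((ha i).trans (hab i))) (hb1 i))
      exact sub_le_self _ zero_le_one
    · change 0 ≤ if i' = j then 0 else b i
      split_ifs
      · exact le_rfl
      · exact (ha i).trans (hab i)
  · intro i u
    rw [sum_deletedBasis_sq, sum_option, ← add_sum_erase _ _ (mem_univ j)]
    have hsum : ∑ i' ∈ univ.erase j, u (some i') ^ 2 * g i (some i') =
        (a i * (1 - Fintype.card κ * a i)) * ∑ i' ∈ univ.erase j, u (some i') ^ 2 := by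
      rw [mul_sum]
      refine sum_congr rfl fun i' hi' => ?_
      rw [hg]
      simp [ne_of_mem_erase hi', mul_comm]
    have hgj : g i (some j) = 0 := by rw [hg]; simp
    have hgn : g i none = 1 := by rw [hg]; simp
    rw [hsum, hgj, hgn]
    have hcs := sq_sum_le_card_mul_sum_sq (s := univ.erase j) (f := fun i' => u (some i'))
    rw [card_erase_of_mem (mem_univ j), card_univ, cast_sub
      (card_pos_iff.2 ⟨j⟩), Nat.cast_one] at hcs
    have h1 := mul_le_mul_of_nonneg_left hcs (sq_nonneg (b i))
    have h2 := mul_le_mul_of_nonneg_right (hab2 i) (sum_nonneg (s := univ.erase j)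
      (f := fun i' => u (some i') ^ 2) fun i' _ => sq_nonneg _)
    linarith

end LocalModels

section ColorClasses

variable {κ : Type*} [Fintype κ] [DecidableEq κ] {n : ℕ}

/-- The set of positions carrying the colour `i`. -/
def colorClass (s : Fin n → Option κ) (i : κ) : Finset (Fin n) :=
  univ.filter fun l => s l = some i

omit [Fintype κ] in
lemma mem_colorClass {s : Fin n → Option κ} {i : κ} {l : Fin n} :
    l ∈ colorClass s i ↔ s l = some i := by simp [colorClass]

lemma prod_support_eq {M : Type*} [CommMonoid M] (s : Fin n → Option κ) (f : Fin n → M) :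
    (∏ l, if s l = none then 1 else f l) = ∏ i, ∏ l ∈ colorClass s i, f l := by
  simp_rw [colorClass, prod_filter]
  rw [Finset.prod_comm]
  refine prod_congr rfl fun l _ => ?_
  cases h : s l with
  | none => simp
  | some j => simp

lemma suppProd_eq (p : Fin n → ℕ) (s : Fin n → Option κ) :
    suppProd p none s = ∏ i, ∏ l ∈ colorClass s i, p l := by
  rw [← prod_support_eq, suppProd, prod_filter]
  exact prod_congr rfl fun l _ => by by_cases h : s l = none <;> simp [h]

/-- The colouring with prescribed disjoint colour classes. -/
noncomputable def coloringOf (τ : κ → Finset (Fin n)) (l : Fin n) : Option κ :=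
  open Classical in if h : ∃ i, l ∈ τ i then some h.choose else none

lemma colorClass_coloringOf {τ : κ → Finset (Fin n)}
    (hτ : ∀ i i', i ≠ i' → Disjoint (τ i) (τ i')) : colorClass (coloringOf τ) = τ := by
  funext i
  ext l
  rw [mem_colorClass, coloringOf]
  split_ifs with h
  · rw [Option.some.injEq]
    constructor
    · rintro rfl
      exact h.choose_spec
    · intro hl
      by_contra hne
      exact disjoint_left.1 (hτ _ _ hne) h.choose_spec hl
  · simp only [false_iff]
    exact fun hl => h ⟨i, hl⟩

end ColorClasses

section TupleSums

variable {n : ℕ} {p : Fin n → ℕ}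

lemma sum_mem_div_le (hp : ∀ i, (p i).Prime) {f : ℕ → ℝ} (hf : Antitone f) (hf0 : ∀ m, 0 ≤ f m)
    (l : Fin n) :
    ∑ T : Finset (Fin n), (if l ∈ T then f (∏ i ∈ T, p i) / (∏ i ∈ T, p i : ℕ) else 0) ≤
      1 / (p l : ℝ) * ∑ T : Finset (Fin n), f (∏ i ∈ T, p i) / (∏ i ∈ T, p i : ℕ) := by
  rw [← sum_filter]
  have hinj : Set.InjOn (fun T : Finset (Fin n) => T.erase l)
      (univ.filter fun T : Finset (Fin n) => l ∈ T : Finset (Finset (Fin n))) := by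
    intro T hT T' hT' h
    simp only [coe_filter, mem_univ, true_and, Set.mem_ofPred_eq] at hT hT'
    rw [← insert_erase hT, ← insert_erase hT']
    exact congrArg (insert l) h
  calc _ ≤ ∑ T : Finset (Fin n) with l ∈ T,
        1 / (p l : ℝ) * (f (∏ i ∈ T.erase l, p i) / (∏ i ∈ T.erase l, p i : ℕ)) := by
        refine sum_le_sum fun T hT => ?_
        rw [mem_filter] at hT
        rw [← mul_prod_erase T p hT.2, cast_mul, div_mul_div_comm, one_mul]
        refine div_le_div_of_nonneg_right (hf ?_) (by positivity)
        exact Nat.le_mul_of_pos_left _ (hp l).pos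
    _ = 1 / (p l : ℝ) * ∑ T ∈ (univ.filter fun T : Finset (Fin n) => l ∈ T).image
        fun T => T.erase l, f (∏ i ∈ T, p i) / (∏ i ∈ T, p i : ℕ) := by
        rw [sum_image hinj, mul_sum]
    _ ≤ _ := by
        refine mul_le_mul_of_nonneg_left (sum_le_sum_of_subset_of_nonneg
          (subset_univ _) fun T _ _ => ?_) (by positivity)
        exact div_nonneg (hf0 _) (cast_nonneg _)

variable {κ : Type*} [Fintype κ] [DecidableEq κ]

lemma sum_tuple_prod {β : Type*} [Fintype β] (f : κ → β → ℝ) :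
    ∑ τ : κ → β, ∏ i, f i (τ i) = ∏ i, ∑ T, f i T := by
  rw [prod_univ_sum, Fintype.piFinset_univ]

lemma sum_tuple_mem_le {a : ℝ} (μ : κ → Finset (Fin n) → ℝ) (hμ : ∀ i T, 0 ≤ μ i T)
    (l : Fin n) (h : ∀ i, ∑ T, (if l ∈ T then μ i T else 0) ≤ a * ∑ T, μ i T) (S : Finset κ) :
    ∑ τ : κ → Finset (Fin n), (if ∀ i ∈ S, l ∈ τ i then ∏ i, μ i (τ i) else 0) ≤
      a ^ S.card * ∏ i, ∑ T, μ i T := by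
  have h1 : ∀ τ : κ → Finset (Fin n), (if ∀ i ∈ S, l ∈ τ i then ∏ i, μ i (τ i) else 0) =
      ∏ i, if i ∈ S then (if l ∈ τ i then μ i (τ i) else 0) else μ i (τ i) := by
    intro τ
    split_ifs with hτ
    · exact prod_congr rfl fun i _ => by
        by_cases hi : i ∈ S
        · simp [hi, hτ i hi]
        · simp [hi]
    · push Not at hτ
      obtain ⟨i, hi, hi'⟩ := hτ
      rw [prod_eq_zero (mem_univ i)]
      simp [hi, hi']
  simp_rw [h1]
  rw [sum_tuple_prod fun i T => if i ∈ S then (if l ∈ T then μ i T else 0) else μ i T]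
  calc _ ≤ ∏ i, ((if i ∈ S then a else 1) * ∑ T, μ i T) := by
        refine prod_le_prod (fun i _ => sum_nonneg fun T _ => ?_) fun i _ => ?_
        · split_ifs
          exacts [hμ _ _, le_rfl, hμ _ _]
        · by_cases hi : i ∈ S
          · simpa only [hi, if_true] using h i
          · simp [hi]
    _ = _ := by
        rw [prod_mul_distrib, prod_ite_mem, univ_inter, prod_const]

/-- Tuples that are pairwise disjoint and satisfy `q` carry almost all of a product mass. -/
theorem le_sum_disjoint_tuples {a : Fin n → ℝ} (ha : ∀ l, 0 ≤ a l) (μ : κ → Finset (Fin n) → ℝ)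
    (hμ : ∀ i T, 0 ≤ μ i T)
    (h : ∀ l i, ∑ T, (if l ∈ T then μ i T else 0) ≤ a l * ∑ T, μ i T)
    (q : (κ → Finset (Fin n)) → Prop) [DecidablePred q] {Q K : ℝ} (hK : 0 ≤ K)
    (hQ : ∑ τ : κ → Finset (Fin n), (if q τ then 0 else ∏ i, μ i (τ i)) ≤
      Q * ∏ i, ∑ T, μ i T) :
    (1 - (Fintype.card κ ^ 2 + K * Fintype.card κ) * ∑ l, a l ^ 2 - Q) * ∏ i, ∑ T, μ i T ≤
      ∑ τ : κ → Finset (Fin n) with (∀ i i', i ≠ i' → Disjoint (τ i) (τ i')) ∧ q τ,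
        (∏ i, μ i (τ i)) * (1 - K * ∑ i, ∑ l ∈ τ i, a l) := by
  obtain ⟨G, hG⟩ : ∃ G, G = ∏ i, ∑ T, μ i T := ⟨_, rfl⟩
  have hω : ∀ τ : κ → Finset (Fin n), 0 ≤ ∏ i, μ i (τ i) := fun τ =>
    prod_nonneg fun i _ => hμ _ _
  have hpt : ∀ τ : κ → Finset (Fin n), (∏ i, μ i (τ i)) -
      (∑ l, ∑ x ∈ (univ : Finset κ).offDiag,
        if ∀ i ∈ ({x.1, x.2} : Finset κ), l ∈ τ i then ∏ i, μ i (τ i) else 0) -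
      (if q τ then 0 else ∏ i, μ i (τ i)) -
      K * (∑ l, ∑ i, a l * if ∀ i' ∈ ({i} : Finset κ), l ∈ τ i' then ∏ i, μ i (τ i) else 0) ≤
      if (∀ i i', i ≠ i' → Disjoint (τ i) (τ i')) ∧ q τ then
        (∏ i, μ i (τ i)) * (1 - K * ∑ i, ∑ l ∈ τ i, a l) else 0 := by
    intro τ
    have hA : ∀ l, ∀ x : κ × κ, 0 ≤
        if ∀ i ∈ ({x.1, x.2} : Finset κ), l ∈ τ i then ∏ i, μ i (τ i) else 0 := by
      intro l x
      split_ifs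
      exacts [hω τ, le_rfl]
    have hA' : 0 ≤ ∑ l, ∑ x ∈ (univ : Finset κ).offDiag,
        if ∀ i ∈ ({x.1, x.2} : Finset κ), l ∈ τ i then ∏ i, μ i (τ i) else 0 :=
      sum_nonneg fun l _ => sum_nonneg fun x _ => hA l x
    have hC : (∑ l, ∑ i, a l * if ∀ i' ∈ ({i} : Finset κ), l ∈ τ i' then ∏ i, μ i (τ i) else 0) =
        (∏ i, μ i (τ i)) * ∑ i, ∑ l ∈ τ i, a l := by
      rw [sum_comm, mul_sum]
      refine sum_congr rfl fun i _ => ?_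
      rw [mul_sum, ← univ_inter (τ i), ← sum_ite_mem]
      exact sum_congr rfl fun l _ => by by_cases hl : l ∈ τ i <;> simp [hl, mul_comm]
    rw [hC]
    have hC0 : 0 ≤ K * ((∏ i, μ i (τ i)) * ∑ i, ∑ l ∈ τ i, a l) :=
      mul_nonneg hK (mul_nonneg (hω τ) (sum_nonneg fun i _ => sum_nonneg
        fun l _ => ha l))
    by_cases hq : q τ
    swap
    · rw [if_neg hq, if_neg fun h => hq h.2]
      linarith
    by_cases hnd : ∀ i i', i ≠ i' → Disjoint (τ i) (τ i')
    · rw [if_pos hq, if_pos ⟨hnd, hq⟩]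
      linarith
    · rw [if_pos hq, if_neg fun h => hnd h.1]
      push Not at hnd
      obtain ⟨i, i', hne, hnd⟩ := hnd
      obtain ⟨l, hl, hl'⟩ := not_disjoint_iff.1 hnd
      have h1 : ∏ i, μ i (τ i) ≤ ∑ l, ∑ x ∈ (univ : Finset κ).offDiag,
          if ∀ i ∈ ({x.1, x.2} : Finset κ), l ∈ τ i then ∏ i, μ i (τ i) else 0 := by
        refine le_trans ?_ (single_le_sum (f := fun l => ∑ x ∈
          (univ : Finset κ).offDiag,
          if ∀ i ∈ ({x.1, x.2} : Finset κ), l ∈ τ i then ∏ i, μ i (τ i) else 0)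
          (fun l _ => sum_nonneg fun x _ => hA l x) (mem_univ l))
        refine le_trans ?_ (single_le_sum (f := fun x : κ × κ =>
          if ∀ i ∈ ({x.1, x.2} : Finset κ), l ∈ τ i then ∏ i, μ i (τ i) else 0)
          (fun x _ => hA l x) (a := (i, i'))
          (mem_offDiag.2 ⟨mem_univ i, mem_univ i', hne⟩))
        beta_reduce
        rw [if_pos (by simp [hl, hl'])]
      linarith
  rw [sum_filter]
  refine le_trans ?_ (sum_le_sum fun τ _ => hpt τ)
  have htot : ∑ τ : κ → Finset (Fin n), ∏ i, μ i (τ i) = G := by rw [hG, sum_tuple_prod]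
  have hpairs : ∑ τ : κ → Finset (Fin n), ∑ l, ∑ x ∈ (univ : Finset κ).offDiag,
      (if ∀ i ∈ ({x.1, x.2} : Finset κ), l ∈ τ i then ∏ i, μ i (τ i) else 0) ≤
      (Fintype.card κ ^ 2) * (∑ l, a l ^ 2) * G := by
    rw [sum_comm, mul_sum, sum_mul]
    refine sum_le_sum fun l _ => ?_
    rw [sum_comm]
    have hG0 : 0 ≤ G := htot ▸ sum_nonneg fun τ _ => hω τ
    calc _ ≤ ∑ x ∈ (univ : Finset κ).offDiag, a l ^ 2 * G := by
          refine sum_le_sum fun x hx => ?_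
          have := sum_tuple_mem_le μ hμ l (h l) {x.1, x.2}
          rwa [card_pair (mem_offDiag.1 hx).2.2, ← hG] at this
      _ ≤ _ := by
          rw [sum_const, nsmul_eq_mul, mul_assoc]
          refine mul_le_mul_of_nonneg_right ?_ (mul_nonneg (sq_nonneg _) hG0)
          rw [offDiag_card, card_univ, ← sq]
          exact_mod_cast sub_le _ _
  have hsing : ∑ τ : κ → Finset (Fin n), ∑ l, ∑ i,
      (a l * if ∀ i' ∈ ({i} : Finset κ), l ∈ τ i' then ∏ i, μ i (τ i) else 0) ≤
      Fintype.card κ * (∑ l, a l ^ 2) * G := by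
    rw [sum_comm, mul_sum, sum_mul]
    refine sum_le_sum fun l _ => ?_
    rw [sum_comm]
    calc _ ≤ ∑ _i : κ, a l ^ 2 * G := by
          refine sum_le_sum fun i _ => ?_
          have := sum_tuple_mem_le μ hμ l (h l) {i}
          rw [card_singleton, ← hG, pow_one] at this
          rw [← mul_sum, sq, mul_assoc]
          exact mul_le_mul_of_nonneg_left this (ha l)
      _ = _ := by
          rw [sum_const, nsmul_eq_mul, card_univ, mul_assoc]
  rw [sum_sub_distrib, sum_sub_distrib, sum_sub_distrib, ← mul_sum,
    htot, ← hG]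
  rw [← hG] at hQ
  have h3 := mul_le_mul_of_nonneg_left hsing hK
  linarith

end TupleSums

section DiagonalVariables

variable {κ : Type*} [Fintype κ] [DecidableEq κ] {n : ℕ}

/-- Truncated product weights on coloured sets of primes. -/
noncomputable def diagWeight (p : Fin n → ℕ) (g : ℕ → ℝ) (R : ℕ) (s : Fin n → Option κ) : ℝ :=
  if suppProd p none s ≤ R then ∏ i, g (∏ l ∈ colorClass s i, p l) else 0

variable {p : Fin n → ℕ} {g : ℕ → ℝ} {R : ℕ}

local notation "mass₁" => (∑ T : Finset (Fin n), g (∏ l ∈ T, p l) / (∏ l ∈ T, p l : ℕ))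
local notation "extSum(" j "," c ")" => ∑ s, diagWeight p g R s * ∏ l, extendWeight j (1 / (p l : ℝ)) (s l) (c l)
local notation "extTerm(" j "," c ")" => (extSum(j, c)) ^ 2 * ∏ l, ite (c l = none) 1 (ite (c l = some j) 0 (1 / (p l : ℝ) * (1 - Fintype.card κ * (1 / (p l : ℝ)))))
local notation "mass₂" => (∑ T : Finset (Fin n), g (∏ l ∈ T, p l) ^ 2 / (∏ l ∈ T, p l : ℕ))

lemma diagWeight_nonneg (hg : ∀ m, 0 ≤ g m) (s : Fin n → Option κ) : 0 ≤ diagWeight p g R s := by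
  unfold diagWeight
  split_ifs
  exacts [prod_nonneg fun i _ => hg _, le_rfl]

lemma diagWeight_le_one (hg : ∀ m, 0 ≤ g m) (hg1 : ∀ m, g m ≤ 1) (s : Fin n → Option κ) :
    diagWeight p g R s ≤ 1 := by
  unfold diagWeight
  split_ifs
  exacts [prod_le_one (fun i _ => hg _) fun i _ => hg1 _, zero_le_one]

lemma diagWeight_le_update (hp : ∀ i, (p i).Prime) (hg : ∀ m, 0 ≤ g m) (hga : Antitone g)
    (s : Fin n → Option κ) (i : Fin n) :
    diagWeight p g R s ≤ diagWeight p g R (update s i none) := by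
  by_cases h : suppProd p none s ≤ R
  · have hsub : ∀ j, colorClass (update s i none) j ⊆ colorClass s j := by
      intro j l hl
      rw [mem_colorClass] at hl ⊢
      by_cases hli : l = i
      · subst hli; simp at hl
      · rwa [Function.update_of_ne hli] at hl
    have hle : ∀ j, ∏ l ∈ colorClass (update s i none) j, p l ≤
        ∏ l ∈ colorClass s j, p l := fun j =>
      prod_le_prod_of_subset_of_one_le' (hsub j) fun l _ _ => (hp l).pos
    rw [diagWeight, if_pos h, diagWeight, if_pos]
    · exact prod_le_prod (fun j _ => hg _) fun j _ => hga (hle j)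
    · rw [suppProd_eq] at h ⊢
      exact (prod_le_prod' fun j _ => hle j).trans h
  · rw [diagWeight, if_neg h]
    exact diagWeight_nonneg hg _

theorem sum_diagWeight_sq_le :
    ∑ s : Fin n → Option κ, diagWeight p g R s ^ 2 *
        ∏ l, (if s l = none then 1 else 1 / (p l : ℝ)) ≤
      mass₂ ^ Fintype.card κ := by
  have hinj : Injective fun s : Fin n → Option κ => colorClass s := by
    intro s s' h
    funext l
    have h1 : ∀ i, s l = some i ↔ s' l = some i := fun i => by
      rw [← mem_colorClass, ← mem_colorClass]
      exact iff_of_eq (congrArg (fun f => l ∈ f i) h)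
    exact Option.ext h1
  calc _ ≤ ∑ s : Fin n → Option κ, ∏ i, (g (∏ l ∈ colorClass s i, p l) ^ 2 /
        (∏ l ∈ colorClass s i, p l : ℕ)) := by
        refine sum_le_sum fun s _ => ?_
        rw [prod_support_eq, prod_div_distrib, div_eq_mul_inv, ← prod_inv_distrib,
          prod_pow]
        refine mul_le_mul ?_ (le_of_eq (prod_congr rfl fun i _ => ?_))
          (prod_nonneg fun i _ => prod_nonneg fun l _ => by positivity)
          (sq_nonneg _)
        · unfold diagWeight
          split_ifs
          · exact le_rfl
          · rw [zero_pow two_ne_zero]; exact sq_nonneg _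
        · rw [cast_prod, ← prod_inv_distrib]
          exact prod_congr rfl fun l _ => one_div _
    _ = ∑ τ ∈ univ.image fun s : Fin n → Option κ => colorClass s,
        ∏ i, (g (∏ l ∈ τ i, p l) ^ 2 / (∏ l ∈ τ i, p l : ℕ)) := by
        rw [sum_image hinj.injOn]
    _ ≤ ∑ τ : κ → Finset (Fin n), ∏ i, (g (∏ l ∈ τ i, p l) ^ 2 / (∏ l ∈ τ i, p l : ℕ)) :=
        sum_le_sum_of_subset_of_nonneg (subset_univ _) fun τ _ _ =>
          prod_nonneg fun i _ => by positivity
    _ = _ := by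
        rw [sum_tuple_prod fun _ T => g (∏ l ∈ T, p l) ^ 2 / (∏ l ∈ T, p l : ℕ)]
        simp

/-- Summing the diagonal weights over additional primes of colour `j`. -/
lemma le_sum_diagWeight_extend (hp : ∀ i, (p i).Prime) (hg : ∀ m, 0 ≤ g m) (hga : Antitone g)
    {B : ℕ} (hB : ∀ m, B < m → g m = 0) (j : κ) {c : Fin n → Option κ}
    (hcj : colorClass c j = ∅) (hc : suppProd p none c * B ≤ R) :
    (∏ i ∈ univ.erase j, g (∏ l ∈ colorClass c i, p l)) *
        (mass₁ *
          (1 - ∑ i, ∑ l ∈ colorClass c i, 1 / (p l : ℝ))) ≤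
      extSum(j, c) := by
  obtain ⟨D, hD⟩ : ∃ D : Finset (Finset (Fin n)), D =
    univ.filter fun T => ∀ l ∈ T, c l = none := ⟨_, rfl⟩
  obtain ⟨f, hf⟩ : ∃ f : Finset (Fin n) → ℝ, f = fun T => g (∏ l ∈ T, p l) / (∏ l ∈ T, p l : ℕ) :=
    ⟨_, rfl⟩
  have hf0 : ∀ T, 0 ≤ f T := fun T => by rw [hf]; exact div_nonneg (hg _) (cast_nonneg _)
  obtain ⟨S, hS⟩ : ∃ S : Finset (Fin n) → Fin n → Option κ, S =
    fun T l => if l ∈ T then some j else c l := ⟨_, rfl⟩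
  have hcj' : ∀ l, c l ≠ some j := fun l h => by
    have : l ∈ colorClass c j := mem_colorClass.2 h
    simp [hcj] at this
  have hSj : ∀ T, colorClass (S T) j = T := by
    intro T
    ext l
    rw [mem_colorClass, hS]
    by_cases h : l ∈ T <;> simp [h, hcj' l]
  have hSi : ∀ T ∈ D, ∀ i, i ≠ j → colorClass (S T) i = colorClass c i := by
    intro T hT i hij
    rw [hD, mem_filter] at hT
    ext l
    rw [mem_colorClass, mem_colorClass, hS]
    by_cases h : l ∈ T
    · simp [h, hT.2 l h, hij.symm]
    · simp [h]
  have hsum : (∑ T, f T) * (1 - ∑ i, ∑ l ∈ colorClass c i, 1 / (p l : ℝ)) ≤ ∑ T ∈ D, f T := by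
    have h1 : ∀ T, f T - (∑ i, ∑ l ∈ colorClass c i, if l ∈ T then f T else 0) ≤
        if T ∈ D then f T else 0 := by
      intro T
      have h0 : ∀ l, 0 ≤ if l ∈ T then f T else 0 := fun l => by
        split_ifs
        exacts [hf0 T, le_rfl]
      by_cases hT : T ∈ D
      · rw [if_pos hT]
        exact sub_le_self _ (sum_nonneg fun i _ => sum_nonneg fun l _ => h0 l)
      · rw [if_neg hT, sub_nonpos]
        simp only [hD, mem_filter, mem_univ, true_and, not_forall] at hT
        obtain ⟨l, hl, hlc⟩ := hT
        obtain ⟨i, hi⟩ := Option.ne_none_iff_exists'.1 hlc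
        refine le_trans ?_ (single_le_sum (f := fun i => ∑ l ∈ colorClass c i,
          if l ∈ T then f T else 0) (fun i _ => sum_nonneg fun l _ => h0 l)
          (mem_univ i))
        refine le_trans ?_ (single_le_sum (f := fun l => if l ∈ T then f T else 0)
          (fun l _ => h0 l) (mem_colorClass.2 hi))
        rw [if_pos hl]
    have h2 := sum_le_sum fun T (_ : T ∈ univ) => h1 T
    rw [sum_sub_distrib, sum_ite_mem, univ_inter] at h2
    refine le_trans ?_ h2
    rw [mul_sub, mul_one]
    refine sub_le_sub_left ?_ _
    rw [sum_comm, mul_sum]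
    refine sum_le_sum fun i _ => ?_
    rw [sum_comm, mul_sum]
    refine sum_le_sum fun l _ => ?_
    rw [mul_comm]
    simp only [hf]
    exact sum_mem_div_le hp hga hg l
  have hinj : Set.InjOn S D := fun T _ T' _ h => by rw [← hSj T, h, hSj]
  have hterm : ∀ T ∈ D, (∏ i ∈ univ.erase j, g (∏ l ∈ colorClass c i, p l)) * f T ≤
      diagWeight p g R (S T) * ∏ l, extendWeight j (1 / (p l : ℝ)) (S T l) (c l) := by
    intro T hT
    have hw : ∏ l, extendWeight j (1 / (p l : ℝ)) (S T l) (c l) = 1 / (∏ l ∈ T, p l : ℕ) := by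
      rw [cast_prod, one_div, ← prod_inv_distrib, ← univ_inter T,
        ← prod_ite_mem]
      refine prod_congr rfl fun l _ => ?_
      have hTl : l ∈ T → c l = none := by
        rw [hD, mem_filter] at hT
        exact hT.2 l
      rw [hS, extendWeight]
      by_cases h : l ∈ T
      · simp [h, hTl h]
      · simp [h]
    rw [hw]
    by_cases hgT : g (∏ l ∈ T, p l) = 0
    · rw [hf]
      beta_reduce
      rw [hgT, zero_div, mul_zero]
      exact mul_nonneg (diagWeight_nonneg hg _) (by positivity)
    · have hTB : ∏ l ∈ T, p l ≤ B := not_lt.1 fun h => hgT (hB _ h)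
      have hsupp : suppProd p none (S T) = suppProd p none c * ∏ l ∈ T, p l := by
        rw [suppProd_eq, suppProd_eq, ← mul_prod_erase _ _ (mem_univ j),
          ← mul_prod_erase _ (fun i => ∏ l ∈ colorClass c i, p l) (mem_univ j), hSj,
          hcj, prod_empty, one_mul, mul_comm]
        congr 1
        exact prod_congr rfl fun i hi => by rw [hSi T hT i (ne_of_mem_erase hi)]
      rw [diagWeight, if_pos (by rw [hsupp]; exact (Nat.mul_le_mul_left _ hTB).trans hc),
        ← mul_prod_erase _ _ (mem_univ j), hSj, hf]
      refine le_of_eq ?_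
      have : ∏ i ∈ univ.erase j, g (∏ l ∈ colorClass (S T) i, p l) =
          ∏ i ∈ univ.erase j, g (∏ l ∈ colorClass c i, p l) :=
        prod_congr rfl fun i hi => by rw [hSi T hT i (ne_of_mem_erase hi)]
      rw [this]
      ring
  calc _ ≤ (∏ i ∈ univ.erase j, g (∏ l ∈ colorClass c i, p l)) * ∑ T ∈ D, f T := by
        refine mul_le_mul_of_nonneg_left ?_ (prod_nonneg fun i _ => hg _)
        rw [hf] at hsum ⊢
        exact hsum
    _ ≤ ∑ T ∈ D, diagWeight p g R (S T) * ∏ l, extendWeight j (1 / (p l : ℝ)) (S T l) (c l) := by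
        rw [mul_sum]
        exact sum_le_sum hterm
    _ = ∑ s ∈ D.image S, diagWeight p g R s * ∏ l, extendWeight j (1 / (p l : ℝ)) (s l) (c l) := by
        rw [sum_image hinj]
    _ ≤ _ := by
        refine sum_le_sum_of_subset_of_nonneg (subset_univ _) fun s _ _ =>
          mul_nonneg (diagWeight_nonneg hg _) (prod_nonneg fun l _ => ?_)
        unfold extendWeight
        split_ifs
        · exact zero_le_one
        · positivity
        · exact le_rfl

lemma one_sub_sum_le_prod_one_sub {ι : Type*} (s : Finset ι) (x : ι → ℝ) (hx : ∀ i, 0 ≤ x i)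
    (hx1 : ∀ i, x i ≤ 1) : 1 - ∑ i ∈ s, x i ≤ ∏ i ∈ s, (1 - x i) := by
  classical
  induction s using Finset.induction_on with
  | empty => simp
  | insert i s hi ih =>
    rw [sum_insert hi, prod_insert hi]
    have h1 := mul_le_mul_of_nonneg_left ih (sub_nonneg.2 (hx1 i))
    have h2 := mul_nonneg (hx i) (sum_nonneg fun i (_ : i ∈ s) => hx i)
    linarith

lemma le_extend_sq_mul (hp : ∀ i, (p i).Prime) (hg : ∀ m, 0 ≤ g m)
    (hga : Antitone g) {B : ℕ} (hB : ∀ m, B < m → g m = 0)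
    (hpk : ∀ i, Fintype.card κ < p i) (j : κ) {c : Fin n → Option κ}
    (hcj : colorClass c j = ∅) (hc : suppProd p none c * B ≤ R) :
    mass₁ ^ 2 * ((∏ i ∈ univ.erase j, g (∏ l ∈ colorClass c i, p l) ^ 2 /
          (∏ l ∈ colorClass c i, p l : ℕ)) *
        (1 - (Fintype.card κ + 2) * ∑ i, ∑ l ∈ colorClass c i, 1 / (p l : ℝ))) ≤
      extTerm(j, c) := by
  have hbase := le_sum_diagWeight_extend hp hg hga hB j hcj hc
  obtain ⟨U, hU⟩ : ∃ U, U = extSum(j, c) := ⟨_, rfl⟩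
  obtain ⟨G, hG⟩ : ∃ G, G = mass₁ := ⟨_, rfl⟩
  obtain ⟨x, hx⟩ : ∃ x, x = ∑ i, ∑ l ∈ colorClass c i, 1 / (p l : ℝ) := ⟨_, rfl⟩
  obtain ⟨k, hk⟩ : ∃ k : ℝ, k = Fintype.card κ := ⟨_, rfl⟩
  have hk1 : 1 ≤ k := by
    rw [hk]
    exact_mod_cast (card_pos_iff.2 ⟨j⟩ : 0 < Fintype.card κ)
  have hpk' : ∀ i, k < p i := fun i => by
    rw [hk]
    exact_mod_cast hpk i
  have hka0 : ∀ l, 0 ≤ k * (1 / (p l : ℝ)) := fun l => mul_nonneg (by linarith) (by positivity)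
  have hka : ∀ l, k * (1 / (p l : ℝ)) ≤ 1 := fun l => by
    rw [mul_one_div, div_le_one (by linarith [hpk' l])]
    exact (hpk' l).le
  have hG0 : 0 ≤ G := by
    rw [hG]
    exact sum_nonneg fun T _ => div_nonneg (hg _) (cast_nonneg _)
  have hx0 : 0 ≤ x := by
    rw [hx]
    exact sum_nonneg fun i _ => sum_nonneg fun l _ => by positivity
  rw [← hU, ← hG, ← hx] at hbase
  rw [← hU, ← hG, ← hx, ← hk]
  have hcl : ∀ l, c l ≠ some j := fun l h => by
    have : l ∈ colorClass c j := mem_colorClass.2 h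
    simp [hcj] at this
  have hprod : ∏ l, (if c l = none then 1 else if c l = some j then 0 else
      1 / (p l : ℝ) * (1 - k * (1 / (p l : ℝ)))) =
      (∏ i ∈ univ.erase j, 1 / ((∏ l ∈ colorClass c i, p l : ℕ) : ℝ)) *
        ∏ i, ∏ l ∈ colorClass c i, (1 - k * (1 / (p l : ℝ))) := by
    simp_rw [if_neg (hcl _)]
    rw [prod_support_eq, prod_congr rfl fun i _ => prod_mul_distrib,
      prod_mul_distrib]
    congr 1
    rw [← mul_prod_erase _ _ (mem_univ j), hcj, prod_empty, one_mul]
    refine prod_congr rfl fun i _ => ?_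
    rw [cast_prod, one_div, ← prod_inv_distrib]
    exact prod_congr rfl fun l _ => one_div _
  obtain ⟨V, hV⟩ : ∃ V, V = ∏ i ∈ univ.erase j, g (∏ l ∈ colorClass c i, p l) := ⟨_, rfl⟩
  obtain ⟨N, hN⟩ : ∃ N, N = ∏ i ∈ univ.erase j,
    1 / ((∏ l ∈ colorClass c i, p l : ℕ) : ℝ) := ⟨_, rfl⟩
  obtain ⟨Y, hY⟩ : ∃ Y, Y = ∏ i, ∏ l ∈ colorClass c i, (1 - k * (1 / (p l : ℝ))) := ⟨_, rfl⟩
  have hsplit : ∏ i ∈ univ.erase j, g (∏ l ∈ colorClass c i, p l) ^ 2 /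
      (∏ l ∈ colorClass c i, p l : ℕ) = V ^ 2 * N := by
    rw [hV, hN, ← prod_pow, ← prod_mul_distrib]
    exact prod_congr rfl fun i _ => (mul_one_div _ _).symm
  have hV0 : 0 ≤ V := by rw [hV]; exact prod_nonneg fun i _ => hg _
  have hN0 : 0 ≤ N := by rw [hN]; exact prod_nonneg fun i _ => by positivity
  have hY0 : 0 ≤ Y := by
    rw [hY]
    exact prod_nonneg fun i _ => prod_nonneg fun l _ => sub_nonneg.2 (hka l)
  have hYx : 1 - k * x ≤ Y := by
    have h := one_sub_sum_le_prod_one_sub univ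
      (fun l => if c l = none then 0 else k * (1 / (p l : ℝ)))
      (fun l => by split_ifs; exacts [le_rfl, hka0 l])
      (fun l => by split_ifs; exacts [zero_le_one, hka l])
    have h1 : ∏ l, (1 - if c l = none then 0 else k * (1 / (p l : ℝ))) = Y := by
      rw [hY, ← prod_support_eq]
      exact prod_congr rfl fun l _ => by by_cases h : c l = none <;> simp [h]
    have h2 : ∑ l, (if c l = none then 0 else k * (1 / (p l : ℝ))) = k * x := by
      have := prod_support_eq c (fun l => Multiplicative.ofAdd (k * (1 / (p l : ℝ))))
      have h3 := congrArg Multiplicative.toAdd this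
      simp only [toAdd_prod, apply_ite Multiplicative.toAdd, toAdd_one, toAdd_ofAdd] at h3
      rw [h3, hx, mul_sum]
      exact sum_congr rfl fun i _ => (mul_sum _ _ _).symm
    rwa [h1, h2] at h
  rw [hprod, ← hN, ← hY, hsplit]
  rw [← hV] at hbase
  have hgoal : G ^ 2 * (V ^ 2 * N * (1 - (k + 2) * x)) = G ^ 2 * V ^ 2 * N * (1 - (k + 2) * x) := by
    ring
  rw [hgoal]
  by_cases hneg : 1 - (k + 2) * x ≤ 0
  · exact (mul_nonpos_of_nonneg_of_nonpos (by positivity) hneg).trans (by positivity)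
  push Not at hneg
  have hx1 : 0 ≤ 1 - x := by nlinarith
  have h1 : (V * (G * (1 - x))) ^ 2 ≤ U ^ 2 :=
    pow_le_pow_left₀ (mul_nonneg hV0 (mul_nonneg hG0 hx1)) hbase 2
  have h2 : 1 - (k + 2) * x ≤ (1 - x) ^ 2 * (1 - k * x) := by
    have h3 : 0 ≤ 1 - k * x := by nlinarith
    have h4 : 1 - 2 * x ≤ (1 - x) ^ 2 := by nlinarith [sq_nonneg x]
    have h5 := mul_le_mul_of_nonneg_right h4 h3
    nlinarith [mul_nonneg (mul_nonneg (by linarith : (0 : ℝ) ≤ k) hx0) hx0]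
  calc G ^ 2 * V ^ 2 * N * (1 - (k + 2) * x) ≤ G ^ 2 * V ^ 2 * N * ((1 - x) ^ 2 * Y) :=
        mul_le_mul_of_nonneg_left (h2.trans (mul_le_mul_of_nonneg_left hYx (sq_nonneg _)))
          (by positivity)
    _ = (V * (G * (1 - x))) ^ 2 * (N * Y) := by ring
    _ ≤ _ := mul_le_mul_of_nonneg_right h1 (mul_nonneg hN0 hY0)

theorem le_sum_extend_sq (hp : ∀ i, (p i).Prime) (hg : ∀ m, 0 ≤ g m)
    (hga : Antitone g) {B R' : ℕ} (hB : ∀ m, B < m → g m = 0) (hR' : R' * B ≤ R) (hR'0 : 0 < R')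
    (hpk : ∀ i, Fintype.card κ < p i) (j : κ) {θ M : ℝ} (hθ : 0 ≤ θ)
    (hM : ∑ T : Finset (Fin n), g (∏ l ∈ T, p l) ^ 2 / (∏ l ∈ T, p l : ℕ) *
      ((∏ l ∈ T, p l : ℕ) : ℝ) ^ θ ≤
      M * mass₂) :
    mass₁ ^ 2 * ((1 - 4 * Fintype.card κ ^ 2 * (∑ l, (1 / (p l : ℝ)) ^ 2) -
        M ^ (Fintype.card κ - 1) / (R' : ℝ) ^ θ) *
      mass₂ ^ (Fintype.card κ - 1)) ≤
    ∑ c : Fin n → Option κ, extTerm(j, c) := by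
  classical
  obtain ⟨Ψ, hΨ⟩ : ∃ Ψ : (Fin n → Option κ) → ℝ, Ψ = fun c => extTerm(j, c) := ⟨_, rfl⟩
  have hΨ0 : ∀ c, 0 ≤ Ψ c := fun c => by
    rw [hΨ]
    refine mul_nonneg (sq_nonneg _) (prod_nonneg fun l _ => ?_)
    have hpl : (0 : ℝ) < p l := by exact_mod_cast (hp l).pos
    have : (Fintype.card κ : ℝ) * (1 / (p l : ℝ)) ≤ 1 := by
      rw [mul_one_div, div_le_one hpl]
      exact_mod_cast (hpk l).le
    split_ifs
    exacts [zero_le_one, le_rfl, mul_nonneg (by positivity) (sub_nonneg.2 this)]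
  have hΨc : (∑ c : Fin n → Option κ, extTerm(j, c)) = ∑ c, Ψ c := by rw [hΨ]
  rw [hΨc]
  obtain ⟨ν, hν⟩ : ∃ ν : Finset (Fin n) → ℝ, ν = fun T => g (∏ l ∈ T, p l) ^ 2 /
    (∏ l ∈ T, p l : ℕ) := ⟨_, rfl⟩
  have hν0 : ∀ T, 0 ≤ ν T := fun T => by rw [hν]; positivity
  obtain ⟨G2, hG2⟩ : ∃ G2, G2 = ∑ T, ν T := ⟨_, rfl⟩
  have hG2' : mass₂ = G2 := by
    rw [hG2, hν]
  have hG20 : 0 ≤ G2 := hG2 ▸ sum_nonneg fun T _ => hν0 T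
  obtain ⟨G, hG⟩ : ∃ G, G = mass₁ := ⟨_, rfl⟩
  rw [hG2'] at hM ⊢
  rw [← hG]
  obtain ⟨μ, hμ⟩ : ∃ μ : κ → Finset (Fin n) → ℝ, μ = fun i T =>
    if i = j then (if T = ∅ then 1 else 0) else ν T := ⟨_, rfl⟩
  have hμj : ∀ T, μ j T = if T = ∅ then 1 else 0 := fun T => by rw [hμ]; simp
  have hμi : ∀ i, i ≠ j → ∀ T, μ i T = ν T := fun i hi T => by rw [hμ]; simp [hi]
  have hμ0 : ∀ i T, 0 ≤ μ i T := by
    intro i T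
    by_cases hi : i = j
    · subst hi
      rw [hμj]
      split_ifs
      exacts [zero_le_one, le_rfl]
    · rw [hμi i hi]
      exact hν0 T
  have hprodμ : ∀ F : Finset (Fin n) → ℝ, F ∅ = 1 →
      ∏ i, ∑ T, μ i T * F T = (∑ T, ν T * F T) ^ (Fintype.card κ - 1) := by
    intro F hF
    rw [← mul_prod_erase _ _ (mem_univ j)]
    have h1 : ∑ T, μ j T * F T = 1 := by
      simp_rw [hμj]
      simp [hF]
    rw [h1, one_mul, prod_congr rfl fun i hi => sum_congr rfl fun T _ => by
      rw [hμi i (ne_of_mem_erase hi) T], prod_const,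
      card_erase_of_mem (mem_univ j), card_univ]
  have hmass : ∏ i, ∑ T, μ i T = G2 ^ (Fintype.card κ - 1) := by
    have := hprodμ (fun _ => 1) rfl
    simp only [mul_one] at this
    rw [this, hG2]
  have hR'p : (0 : ℝ) < (R' : ℝ) ^ θ := Real.rpow_pos_of_pos (by exact_mod_cast hR'0) _
  have htuple := le_sum_disjoint_tuples (a := fun l => 1 / (p l : ℝ)) (fun l => by positivity) μ hμ0
    (fun l i => by
      by_cases hi : i = j
      · subst hi
        refine le_trans (le_of_eq (sum_eq_zero fun T _ => ?_))
          (mul_nonneg (by positivity) (sum_nonneg fun T _ => hμ0 _ _))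
        rw [hμj]
        by_cases hT : T = ∅
        · simp [hT]
        · simp [hT]
      · simp_rw [hμi i hi, hν]
        exact sum_mem_div_le hp (f := fun m => g m ^ 2)
          (fun m m' h => pow_le_pow_left₀ (hg _) (hga h) 2) (fun m => sq_nonneg _) l)
    (fun τ => ∏ i, ∏ l ∈ τ i, p l ≤ R') (Q := M ^ (Fintype.card κ - 1) / (R' : ℝ) ^ θ)
    (K := Fintype.card κ + 2) (by positivity) (by
      calc _ ≤ ∑ τ : κ → Finset (Fin n), (∏ i, (μ i (τ i) * ((∏ l ∈ τ i, p l : ℕ) : ℝ) ^ θ)) /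
            (R' : ℝ) ^ θ := by
            refine sum_le_sum fun τ _ => ?_
            have h0 : 0 ≤ ∏ i, μ i (τ i) := prod_nonneg fun i _ => hμ0 _ _
            rw [prod_mul_distrib, Real.finsetProd_rpow _ _ fun i _ => cast_nonneg _,
              ← cast_prod, mul_div_assoc]
            split_ifs with hq
            · exact mul_nonneg h0 (div_nonneg (Real.rpow_nonneg (cast_nonneg _) _) hR'p.le)
            · refine le_mul_of_one_le_right h0 ((one_le_div hR'p).2 ?_)
              exact Real.rpow_le_rpow (cast_nonneg _) (by exact_mod_cast (not_le.1 hq).le) hθ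
        _ = (∑ T, ν T * ((∏ l ∈ T, p l : ℕ) : ℝ) ^ θ) ^ (Fintype.card κ - 1) / (R' : ℝ) ^ θ := by
            rw [← sum_div, sum_tuple_prod fun i T => μ i T * ((∏ l ∈ T, p l : ℕ) : ℝ) ^ θ,
              hprodμ _ (by simp)]
        _ ≤ (M * G2) ^ (Fintype.card κ - 1) / (R' : ℝ) ^ θ := by
            refine div_le_div_of_nonneg_right (pow_le_pow_left₀ (sum_nonneg fun T _ =>
              mul_nonneg (hν0 T) (Real.rpow_nonneg (cast_nonneg _) _)) ?_ _) hR'p.le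
            rw [hν]
            exact hM
        _ = _ := by
            rw [hmass, mul_pow]
            ring)
  rw [hmass] at htuple
  obtain ⟨A, hA⟩ : ∃ A, A = ∑ l, (1 / (p l : ℝ)) ^ 2 := ⟨_, rfl⟩
  obtain ⟨D, hD⟩ : ∃ D : Finset (κ → Finset (Fin n)), D = univ.filter fun τ =>
    (∀ i i', i ≠ i' → Disjoint (τ i) (τ i')) ∧ ∏ i, ∏ l ∈ τ i, p l ≤ R' := ⟨_, rfl⟩
  rw [← hA, ← hD] at htuple
  rw [← hA]
  have hinj : Set.InjOn (coloringOf : (κ → Finset (Fin n)) → Fin n → Option κ) D := by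
    intro τ hτ τ' hτ' h
    rw [hD, coe_filter] at hτ hτ'
    rw [← colorClass_coloringOf hτ.2.1, h, colorClass_coloringOf hτ'.2.1]
  have hcard1 : (1 : ℝ) ≤ Fintype.card κ := by
    exact_mod_cast (card_pos_iff.2 ⟨j⟩ : 0 < Fintype.card κ)
  have hA0 : 0 ≤ A := hA ▸ sum_nonneg fun l _ => sq_nonneg _
  calc _ ≤ G ^ 2 * ∑ τ ∈ D, (∏ i, μ i (τ i)) *
        (1 - (Fintype.card κ + 2) * ∑ i, ∑ l ∈ τ i, 1 / (p l : ℝ)) := by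
        refine mul_le_mul_of_nonneg_left (le_trans (mul_le_mul_of_nonneg_right ?_
          (pow_nonneg hG20 _)) htuple) (sq_nonneg _)
        have : ((Fintype.card κ : ℝ) ^ 2 + (Fintype.card κ + 2) * Fintype.card κ) * A ≤
            4 * Fintype.card κ ^ 2 * A := mul_le_mul_of_nonneg_right (by nlinarith) hA0
        linarith
    _ ≤ ∑ τ ∈ D, Ψ (coloringOf τ) := by
        rw [mul_sum]
        refine sum_le_sum fun τ hτ => ?_
        rw [hD, mem_filter] at hτ
        have hcc := colorClass_coloringOf hτ.2.1
        by_cases hτj : τ j = ∅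
        · have hle := le_extend_sq_mul (R := R) hp hg hga hB hpk j (c := coloringOf τ)
            (by rw [hcc, hτj]) (by
              rw [suppProd_eq, hcc]
              exact (Nat.mul_le_mul_right _ hτ.2.2).trans hR')
          rw [hcc, ← hG] at hle
          rw [hΨ]
          refine le_trans (le_of_eq ?_) hle
          rw [← mul_prod_erase _ _ (mem_univ j), hμj, if_pos hτj, one_mul]
          congr 2
          refine prod_congr rfl fun i hi => ?_
          rw [hμi i (ne_of_mem_erase hi), hν]
        · rw [prod_eq_zero (mem_univ j) (by rw [hμj, if_neg hτj]), zero_mul, mul_zero]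
          exact hΨ0 _
    _ = ∑ c ∈ D.image coloringOf, Ψ c := (sum_image hinj).symm
    _ ≤ _ := sum_le_sum_of_subset_of_nonneg (subset_univ _) fun c _ _ => hΨ0 c

theorem le_tensorMeanSq_diagWeight (hp : ∀ i, (p i).Prime) (hg : ∀ m, 0 ≤ g m)
    (hga : Antitone g) {B R' : ℕ} (hB : ∀ m, B < m → g m = 0) (hR' : R' * B ≤ R) (hR'0 : 0 < R')
    (hpk : ∀ i, Fintype.card κ < p i) (j : κ) {η θ M : ℝ} (hη1 : η ≤ 1) (hθ : 0 ≤ θ)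
    (hρ : ∏ i, (1 + Fintype.card κ * (1 / ((p i : ℝ) - 1) - 1 / (p i : ℝ))) ≤ 1 + η)
    (hM : ∑ T : Finset (Fin n), g (∏ l ∈ T, p l) ^ 2 / (∏ l ∈ T, p l : ℕ) *
      ((∏ l ∈ T, p l : ℕ) : ℝ) ^ θ ≤
      M * mass₂) :
    (1 - η) ^ 2 * (mass₁ ^ 2 * ((1 - 4 * Fintype.card κ ^ 2 * (∑ l, (1 / (p l : ℝ)) ^ 2) -
        M ^ (Fintype.card κ - 1) / (R' : ℝ) ^ θ) *
      mass₂ ^ (Fintype.card κ - 1))) ≤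
    tensorMeanSq (fun i => deletedWeight j (1 / ((p i : ℝ) - 1))) (fun _ => colorIndicator)
      (sieveCoeff (fun i => 1 / (p i : ℝ)) fun s => (∏ i, colorSign (s i)) *
        diagWeight p g R s) := by
  obtain ⟨k, hk⟩ : ∃ k : ℝ, k = Fintype.card κ := ⟨_, rfl⟩
  have hk1 : 1 ≤ k := by
    rw [hk]
    exact_mod_cast (card_pos_iff.2 ⟨j⟩ : 0 < Fintype.card κ)
  have hpk' : ∀ i, k + 1 ≤ p i := fun i => by
    rw [hk]
    exact_mod_cast hpk i
  have hmain := le_tensorMeanSq_sieveCoeff j (fun i => 1 / (p i : ℝ))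
    (fun i => 1 / ((p i : ℝ) - 1)) (fun i => by positivity)
    (fun i => one_div_le_one_div_of_le (by linarith [hpk' i]) (by linarith)) (fun i => by
      rw [← hk, mul_one_div, div_le_one (by linarith [hpk' i])]
      linarith [hpk' i]) (fun i => by
      have h1 : (0 : ℝ) < (p i : ℝ) - 1 := by linarith [hpk' i]
      have h2 : (0 : ℝ) < p i := by linarith
      rw [← hk, show 1 / (p i : ℝ) * (1 - k * (1 / (p i : ℝ))) = (p i - k) / (p i : ℝ) ^ 2 by
        field_simp, show 1 / ((p i : ℝ) - 1) * (1 - (k - 1) * (1 / ((p i : ℝ) - 1))) =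
          (p i - k) / ((p i : ℝ) - 1) ^ 2 by field_simp; ring]
      exact div_le_div_of_nonneg_left (by linarith [hpk' i]) (by positivity)
        (pow_le_pow_left₀ h1.le (by linarith) 2))
    (by linarith) (diagWeight p g R) (diagWeight_nonneg hg)
    (fun s i => diagWeight_le_update hp hg hga s i)
  refine le_trans ?_ hmain
  have hcore := le_sum_extend_sq (R := R) hp hg hga hB hR' hR'0 hpk j hθ hM
  refine (mul_le_mul_of_nonneg_left hcore (sq_nonneg _)).trans (mul_le_mul_of_nonneg_right
    (pow_le_pow_left₀ (sub_nonneg.2 hη1) (by linarith) 2) ?_)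
  refine sum_nonneg fun c _ => mul_nonneg (sq_nonneg _) (prod_nonneg fun l _ => ?_)
  have hpl : k * (1 / (p l : ℝ)) ≤ 1 := by
    rw [mul_one_div, div_le_one (by linarith [hpk' l])]
    linarith [hpk' l]
  rw [hk] at hpl
  split_ifs
  exacts [zero_le_one, le_rfl, mul_nonneg (by positivity) (sub_nonneg.2 hpl)]

end DiagonalVariables

lemma abs_sum_Ioc_mul_le {f c : ℕ → ℝ} (hf : Antitone f) (hf0 : ∀ n, 0 ≤ f n) (a b : ℕ)
    (hc : ∀ y, a ≤ y → |∑ n ∈ Ioc a y, c n| ≤ 1) :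
    |∑ n ∈ Ioc a b, f n * c n| ≤ f a := by
  rcases le_total b a with h | h
  · rw [Ioc_eq_empty_of_le h]; simpa using hf0 a
  obtain ⟨N, rfl⟩ := Nat.exists_eq_add_of_le h
  have key : ∀ N, |∑ n ∈ Ioc a (a + N), f n * c n -
      f (a + N) * ∑ n ∈ Ioc a (a + N), c n| ≤ f a - f (a + N) := by
    intro N
    induction N with
    | zero => simp
    | succ N ih =>
      rw [← add_assoc, sum_Ioc_succ_top (by omega), sum_Ioc_succ_top (by omega)]
      have h1 := hc (a + N) (by omega)
      have h2 : f (a + N + 1) ≤ f (a + N) := hf (by omega)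
      generalize ∑ n ∈ Ioc a (a + N), f n * c n = s at *
      generalize ∑ n ∈ Ioc a (a + N), c n = t at *
      calc _ = |(s - f (a + N) * t) + (f (a + N) - f (a + N + 1)) * t| := by congr 1; ring
        _ ≤ |s - f (a + N) * t| + |(f (a + N) - f (a + N + 1)) * t| := abs_add_le _ _
        _ ≤ (f a - f (a + N)) + (f (a + N) - f (a + N + 1)) * 1 := by
            rw [abs_mul, abs_of_nonneg (sub_nonneg.mpr h2)]; gcongr
        _ = _ := by ring
  have h1 := key N
  have h2 : |f (a + N) * ∑ n ∈ Ioc a (a + N), c n| ≤ f (a + N) * 1 := by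
    rw [abs_mul, abs_of_nonneg (hf0 _)]
    exact mul_le_mul_of_nonneg_left (hc _ (by omega)) (hf0 _)
  have h3 := abs_sub_abs_le_abs_sub (∑ n ∈ Ioc a (a + N), f n * c n)
    (f (a + N) * ∑ n ∈ Ioc a (a + N), c n)
  linarith

lemma abs_sum_modEq_sub_le {f : ℕ → ℝ} (hf : Antitone f) (hf0 : ∀ n, 0 ≤ f n) (a b : ℕ) {q : ℕ}
    (hq : 0 < q) (r : ℕ) :
    |∑ n ∈ Ioc a b with n ≡ r [MOD q], f n - (∑ n ∈ Ioc a b, f n) / q| ≤ f a := by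
  have h := abs_sum_Ioc_mul_le hf hf0 a b
    (c := fun n => (if n ≡ r [MOD q] then 1 else 0) - 1 / (q : ℝ)) fun y hy => by
    rw [sum_sub_distrib, sum_boole, sum_const, card_Ioc, nsmul_eq_mul]
    have h1 := Nat.Ioc_filter_modEq_card a y hq r
    have hm : ((a : ℚ) - r) / q ≤ ((y : ℚ) - r) / q := by gcongr
    rw [max_eq_left (sub_nonneg.mpr (Int.floor_mono hm))] at h1
    have h2 : |(((Ioc a y).filter (fun n => n ≡ r [MOD q])).card : ℚ) -
        ((y - a : ℕ) : ℚ) * (1 / q)| ≤ 1 := by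
      have h3 : (((Ioc a y).filter (fun n => n ≡ r [MOD q])).card : ℚ) =
          ⌊((y : ℚ) - r) / q⌋ - ⌊((a : ℚ) - r) / q⌋ := by exact_mod_cast h1
      have h4 : ((y - a : ℕ) : ℚ) * (1 / q) = ((y : ℚ) - r) / q - ((a : ℚ) - r) / q := by
        rw [cast_sub hy]; ring
      rw [h3, h4, abs_le]
      have := Int.floor_le (((y : ℚ) - r) / q)
      have := Int.floor_le (((a : ℚ) - r) / q)
      have := Int.lt_floor_add_one (((y : ℚ) - r) / q)
      have := Int.lt_floor_add_one (((a : ℚ) - r) / q)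
      constructor <;> linarith
    have h5 := (Rat.cast_le (K := ℝ)).mpr h2
    push_cast at h5 ⊢
    exact h5
  convert h using 2
  simp_rw [mul_sub, sum_sub_distrib, mul_ite, mul_one, mul_zero, ← sum_filter,
    ← sum_mul]
  ring

lemma abs_sum_coprime_sub_le {f : ℕ → ℝ} (hf : Antitone f) (hf0 : ∀ n, 0 ≤ f n) (b : ℕ) {W : ℕ}
    (hW : 0 < W) :
    |∑ n ∈ Ioc 0 b with n.Coprime W, f n - W.totient / W * ∑ n ∈ Ioc 0 b, f n| ≤
      W * f 0 := by
  classical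
  have h1 : ∑ n ∈ Ioc 0 b with n.Coprime W, f n =
      ∑ r ∈ (range W).filter (Coprime W), ∑ n ∈ Ioc 0 b with n ≡ r [MOD W], f n := by
    rw [← sum_fiberwise_of_maps_to (g := fun n => n % W)
      (t := (range W).filter (Coprime W))]
    · refine sum_congr rfl fun r hr => sum_congr ?_ fun _ _ => rfl
      simp only [mem_filter, mem_range] at hr
      ext n
      simp only [mem_filter, ModEq, Nat.mod_eq_of_lt hr.1, and_assoc]
      refine and_congr_right fun _ => and_iff_right_of_imp fun h => ?_
      have h' : n ≡ r [MOD W] := by rw [ModEq, h, Nat.mod_eq_of_lt hr.1]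
      exact h'.gcd_eq.trans hr.2.symm
    · intro n hn
      simp only [mem_filter, mem_range] at hn ⊢
      exact ⟨Nat.mod_lt _ hW, Coprime.symm ((Nat.mod_modEq n W).gcd_eq.trans hn.2)⟩
  have h2 : (W.totient : ℝ) / W * ∑ n ∈ Ioc 0 b, f n =
      ∑ r ∈ (range W).filter (Coprime W), (∑ n ∈ Ioc 0 b, f n) / W := by
    rw [sum_const, nsmul_eq_mul, Nat.totient]; ring
  rw [h1, h2, ← sum_sub_distrib]
  calc _ ≤ ∑ r ∈ (range W).filter (Coprime W), f 0 :=
        (abs_sum_le_sum_abs _ _).trans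
          (sum_le_sum fun r _ => abs_sum_modEq_sub_le hf hf0 0 b hW r)
    _ ≤ W * f 0 := by
        rw [sum_const, nsmul_eq_mul]
        refine mul_le_mul_of_nonneg_right ?_ (hf0 0)
        exact_mod_cast (card_filter_le _ _).trans_eq (card_range W)

section SmoothProfile

variable {n B D W : ℕ} {p : Fin n → ℕ}

lemma sum_prod_primes_eq (hp : ∀ i, (p i).Prime) (hinj : Injective p)
    (hD : ∀ i, D < p i) (hcov : ∀ q : ℕ, q.Prime → D < q → q ≤ B → ∃ i, p i = q)
    (hW : ∀ q : ℕ, q.Prime → (q ∣ W ↔ q ≤ D)) {F : ℕ → ℝ} (hF : ∀ t, B < t → F t = 0) :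
    ∑ T : Finset (Fin n), F (∏ i ∈ T, p i) =
      ∑ t ∈ ((Ioc 0 B).filter (Coprime · W)).filter Squarefree, F t := by
  classical
  rw [← sum_filter_of_ne (p := fun T : Finset (Fin n) => ∏ i ∈ T, p i ≤ B)
    fun T _ h => not_lt.mp fun h' => h (hF _ h')]
  refine sum_nbij (fun T => ∏ i ∈ T, p i) (fun T hT => ?_) (fun T _ T' _ h => ?_)
    (fun t ht => ?_) fun _ _ => rfl
  · simp only [mem_filter, mem_univ, true_and, mem_Ioc] at hT ⊢
    refine ⟨⟨⟨prod_pos fun i _ => (hp i).pos, hT⟩, Coprime.prod_left fun i _ => ?_⟩,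
      squarefree_prod_of_injective hp hinj T⟩
    exact (hp i).coprime_iff_not_dvd.mpr fun h => absurd ((hW _ (hp i)).mp h) (by have := hD i; omega)
  · have h' := congrArg Nat.primeFactors h
    simp only [primeFactors_prod_of_injective hp hinj] at h'
    exact image_injective hinj h'
  · simp only [coe_filter, mem_filter, mem_Ioc, Set.mem_ofPred_eq] at ht
    obtain ⟨⟨⟨ht0, htB⟩, htW⟩, hts⟩ := ht
    have himg : (univ.filter fun i => p i ∣ t).image p = t.primeFactors := by
      ext q
      simp only [mem_image, mem_filter, mem_univ, true_and, Nat.mem_primeFactors]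
      constructor
      · rintro ⟨i, hi, rfl⟩; exact ⟨hp i, hi, ht0.ne'⟩
      · rintro ⟨hq, hqt, -⟩
        have h1 : D < q := by
          by_contra h
          exact hq.one_lt.ne' (Nat.eq_one_of_dvd_coprimes htW hqt ((hW q hq).mpr (not_lt.mp h)))
        obtain ⟨i, rfl⟩ := hcov q hq h1 ((le_of_dvd ht0 hqt).trans htB)
        exact ⟨i, hqt, rfl⟩
    have hprod : ∏ i ∈ univ.filter (fun i => p i ∣ t), p i = t := by
      rw [← prod_image (f := fun m : ℕ => m) (g := p) hinj.injOn, himg,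
        Nat.prod_primeFactors_of_squarefree hts]
    exact ⟨univ.filter fun i => p i ∣ t, by simp [hprod, htB], hprod⟩

lemma sum_not_squarefree_le (hD0 : 0 < D) (hW : ∀ q : ℕ, q.Prime → (q ∣ W ↔ q ≤ D)) {g : ℕ → ℝ}
    (hg : ∀ t, 0 ≤ g t) (hga : Antitone g) :
    ∑ t ∈ ((Ioc 0 B).filter (Coprime · W)).filter (¬ Squarefree ·), g t / t ≤
      1 / D * ∑ t ∈ (Ioc 0 B).filter (Coprime · W), g t / t := by
  classical
  have hf : ∀ t : ℕ, 0 ≤ g t / t := fun t => div_nonneg (hg t) (by positivity)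
  have hI : Ioc 0 B = Icc 1 B := rfl
  rw [hI]
  set G := (Icc 1 B).filter (Coprime · W) with hG
  calc _ ≤ ∑ d ∈ Ioc D B, ∑ t ∈ G.filter (d ^ 2 ∣ ·), g t / t := by
        simp_rw [sum_filter (fun t => _ ^ 2 ∣ t)]
        rw [sum_comm, sum_filter]
        refine sum_le_sum fun t ht => ?_
        have h0 : ∀ d ∈ Ioc D B, 0 ≤ if d ^ 2 ∣ t then g t / (t : ℝ) else 0 := fun d _ => by
          split_ifs
          exacts [hf t, le_rfl]
        by_cases hts : Squarefree t
        · rw [if_neg (not_not.mpr hts)]; exact sum_nonneg h0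
        rw [if_pos hts]
        simp only [hG, mem_filter, mem_Icc] at ht
        obtain ⟨⟨ht0, htB⟩, htW⟩ := ht
        rw [Nat.squarefree_iff_prime_squarefree] at hts
        push Not at hts
        obtain ⟨q, hq, hqt⟩ := hts
        have hqt' : q ∣ t := (dvd_mul_right q q).trans hqt
        have hqD : q ∈ Ioc D B := by
          refine mem_Ioc.mpr ⟨?_, (le_of_dvd ht0 hqt').trans htB⟩
          by_contra h
          exact hq.one_lt.ne' (Nat.eq_one_of_dvd_coprimes htW hqt' ((hW q hq).mpr (not_lt.mp h)))
        refine le_trans ?_ (single_le_sum h0 hqD)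
        rw [if_pos (by rwa [sq])]
    _ ≤ ∑ d ∈ Ioc D B, ((d : ℝ) ^ 2)⁻¹ * ∑ t ∈ G, g t / t := by
        refine sum_le_sum fun d hd => ?_
        have hd0 : 0 < d := by rw [mem_Ioc] at hd; omega
        refine (sum_filter_dvd_le (pow_pos hd0 2) _ hf).trans ?_
        rw [mul_sum]
        calc _ ≤ ∑ t ∈ (Icc 1 B).filter (fun e => (d ^ 2 * e).Coprime W),
              ((d : ℝ) ^ 2)⁻¹ * (g t / t) := by
              refine sum_le_sum fun t _ => ?_
              have h1 : g (d ^ 2 * t) ≤ g t := hga (Nat.le_mul_of_pos_left _ (pow_pos hd0 2))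
              calc _ ≤ g t / ((d ^ 2 * t : ℕ) : ℝ) := by gcongr
                _ = _ := by push_cast; rw [← div_div, div_right_comm, inv_mul_eq_div]
          _ ≤ _ := by
              refine sum_le_sum_of_subset_of_nonneg (fun t ht => ?_) fun t _ _ =>
                mul_nonneg (by positivity) (hf t)
              simp only [hG, mem_filter] at ht ⊢
              exact ⟨ht.1, Coprime.coprime_mul_left ht.2⟩
    _ ≤ _ := by
        rw [← sum_mul]
        refine mul_le_mul_of_nonneg_right ?_ (sum_nonneg fun t _ => hf t)
        rcases le_total D B with h | h
        · refine (sum_Ioc_inv_sq_le_sub hD0.ne' h).trans ?_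
          rw [one_div]; linarith [inv_nonneg.mpr (cast_nonneg (α := ℝ) B)]
        · rw [Ioc_eq_empty_of_le h]; simp

/-- Sums of a profile over squarefree products of the available primes, compared with the sum over
all integers. -/
lemma sum_profile_bounds (hp : ∀ i, (p i).Prime) (hinj : Injective p)
    (hD : ∀ i, D < p i) (hcov : ∀ q : ℕ, q.Prime → D < q → q ≤ B → ∃ i, p i = q) (hW0 : 0 < W)
    (hD0 : 0 < D) (hW : ∀ q : ℕ, q.Prime → (q ∣ W ↔ q ≤ D)) {g : ℕ → ℝ}
    (hg : ∀ t, 0 ≤ g t) (hga : Antitone g) (hgB : ∀ t, B < t → g t = 0) (hg1 : g 0 ≤ 1) :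
    (1 - 1 / (D : ℝ)) * (W.totient / W * ∑ t ∈ Ioc 0 B, g t / t - W) ≤
        ∑ T : Finset (Fin n), g (∏ i ∈ T, p i) / ((∏ i ∈ T, p i : ℕ) : ℝ) ∧
      ∑ T : Finset (Fin n), g (∏ i ∈ T, p i) / ((∏ i ∈ T, p i : ℕ) : ℝ) ≤
        W.totient / W * ∑ t ∈ Ioc 0 B, g t / t + W := by
  have hf : ∀ t : ℕ, 0 ≤ g t / t := fun t => div_nonneg (hg t) (by positivity)
  rw [sum_prod_primes_eq hp hinj hD hcov hW (F := fun t => g t / t)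
    fun t ht => by simp only [hgB t ht, zero_div]]
  have h1 := sum_filter_add_sum_filter_not ((Ioc 0 B).filter (Coprime · W))
    Squarefree fun t => g t / (t : ℝ)
  have h2 := sum_not_squarefree_le (B := B) hD0 hW hg hga
  have h2' : 0 ≤ ∑ t ∈ ((Ioc 0 B).filter (Coprime · W)).filter (¬ Squarefree ·),
    g t / (t : ℝ) := sum_nonneg fun t _ => hf t
  have h3 := abs_sum_coprime_sub_le (f := fun t => g t / (max t 1 : ℕ)) (b := B)
    (fun a b hab => div_le_div₀ (hg a) (hga hab) (by positivity)
      (by exact_mod_cast max_le_max_right 1 hab)) (fun t => div_nonneg (hg t) (by positivity)) hW0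
  have h4 : ∀ t ∈ Ioc 0 B, g t / ((max t 1 : ℕ) : ℝ) = g t / t := fun t ht => by
    rw [max_eq_left (by rw [mem_Ioc] at ht; omega)]
  rw [sum_congr rfl h4, sum_congr rfl fun t ht => h4 t (mem_filter.mp ht).1] at h3
  have h5 : (W : ℝ) * (g 0 / ((max 0 1 : ℕ) : ℝ)) ≤ W := by
    simpa using mul_le_of_le_one_right (cast_nonneg W) hg1
  have h6 := abs_le.mp (h3.trans h5)
  have h7 : (0 : ℝ) ≤ 1 - 1 / D := by
    rw [sub_nonneg, div_le_one (by exact_mod_cast hD0)]; exact_mod_cast hD0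
  generalize ∑ t ∈ (Ioc 0 B).filter (Coprime · W), g t / (t : ℝ) = s at *
  constructor
  · have := mul_le_mul_of_nonneg_left (show W.totient / W * ∑ t ∈ Ioc 0 B, g t / t - W ≤ s by
      linarith) h7
    linarith
  · linarith

end SmoothProfile

lemma sum_Ioc_telescope_bounds {f h : ℕ → ℝ} (h1 : h 1 = 0)
    (hl : ∀ t, 1 ≤ t → f (t + 1) ≤ h (t + 1) - h t) (hu : ∀ t, 1 ≤ t → h (t + 1) - h t ≤ f t) (N : ℕ) :
    h (N + 1) ≤ ∑ t ∈ Ioc 0 N, f t ∧ (1 ≤ N → ∑ t ∈ Ioc 0 N, f t ≤ f 1 + h N) := by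
  induction N with
  | zero => simp [h1]
  | succ N ih =>
    rw [sum_Ioc_succ_top (by omega)]
    refine ⟨by linarith [hu (N + 1) (by omega)], fun _ => ?_⟩
    rcases eq_zero_or_pos N with rfl | hN
    · simp [h1]
    · linarith [hl N hN, ih.2 hN]

/-- The cutoff of the sieve profile, as a multiple of the scale. -/
noncomputable def profileLength (A : ℝ) : ℝ := (exp A - 1) / A

/-- The largest integer in the support of the sieve profile. -/
noncomputable def profileEnd (A ℓ : ℝ) : ℕ := ⌊exp (profileLength A * ℓ)⌋₊

/-- The sieve profile `1 / (1 + A u)` with `u = log t / ℓ`, truncated at `u = (exp A - 1) / A`. -/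
noncomputable def profile (A ℓ : ℝ) (t : ℕ) : ℝ :=
  if t ≤ profileEnd A ℓ then 1 / (1 + A / ℓ * log t) else 0

section Profile

variable {A ℓ : ℝ}

lemma one_le_profile_denom (hA : 0 < A) (hℓ : 0 < ℓ) (t : ℕ) : 1 ≤ 1 + A / ℓ * log t := by
  have := mul_nonneg (div_pos hA hℓ).le (log_natCast_nonneg t)
  linarith

lemma profile_nonneg (hA : 0 < A) (hℓ : 0 < ℓ) (t : ℕ) : 0 ≤ profile A ℓ t := by
  have := one_le_profile_denom hA hℓ t
  unfold profile; split_ifs <;> positivity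

lemma profile_le_one (hA : 0 < A) (hℓ : 0 < ℓ) (t : ℕ) : profile A ℓ t ≤ 1 := by
  have := one_le_profile_denom hA hℓ t
  unfold profile; split_ifs
  · exact (div_le_one (by linarith)).mpr this
  · exact zero_le_one

lemma profile_eq_zero {t : ℕ} (ht : profileEnd A ℓ < t) : profile A ℓ t = 0 :=
  if_neg (not_le.mpr ht)

lemma profile_antitone (hA : 0 < A) (hℓ : 0 < ℓ) : Antitone (profile A ℓ) := by
  intro s t hst
  by_cases ht : t ≤ profileEnd A ℓ
  · rw [profile, profile, if_pos ht, if_pos (hst.trans ht)]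
    have h1 := one_le_profile_denom hA hℓ s
    refine one_div_le_one_div_of_le (by linarith) ?_
    have h2 : log s ≤ log t := by
      rcases eq_zero_or_pos s with rfl | hs
      · simpa using log_natCast_nonneg t
      · exact log_le_log (by exact_mod_cast hs) (by exact_mod_cast hst)
    have := (div_pos hA hℓ).le
    gcongr
  · rw [profile_eq_zero (not_le.mp ht)]; exact profile_nonneg hA hℓ s

lemma profileLength_pos (hA : 0 < A) : 0 < profileLength A :=
  div_pos (by linarith [add_one_le_exp A]) hA

lemma one_le_profileEnd (hA : 0 < A) (hℓ : 0 < ℓ) : 1 ≤ profileEnd A ℓ :=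
  le_floor (by simpa using one_le_exp (mul_pos (profileLength_pos hA) hℓ).le)

lemma profile_denom_le (hA : 0 < A) (hℓ : 0 < ℓ) {x : ℝ} (hx : 0 < x) :
    (x ≤ exp (profileLength A * ℓ) → 1 + A / ℓ * log x ≤ exp A) ∧
      (exp (profileLength A * ℓ) ≤ x → exp A ≤ 1 + A / ℓ * log x) := by
  have h1 : exp A = 1 + A / ℓ * (profileLength A * ℓ) := by
    rw [profileLength]; field_simp; ring
  refine ⟨fun h => ?_, fun h => ?_⟩
  · rw [h1]; gcongr; exact (log_le_iff_le_exp hx).mpr h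
  · rw [h1]; gcongr; exact (le_log_iff_exp_le hx).mpr h

lemma sum_profile_div_bounds (hA : 0 < A) (hℓ : 0 < ℓ) :
    (ℓ ≤ ∑ t ∈ Ioc 0 (profileEnd A ℓ), profile A ℓ t / t ∧
      ∑ t ∈ Ioc 0 (profileEnd A ℓ), profile A ℓ t / t ≤ ℓ + 1) ∧
    (ℓ / A * (1 - exp (-A)) ≤ ∑ t ∈ Ioc 0 (profileEnd A ℓ), profile A ℓ t ^ 2 / t ∧
      ∑ t ∈ Ioc 0 (profileEnd A ℓ), profile A ℓ t ^ 2 / t ≤ ℓ / A + 1) := by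
  have hc := div_pos hA hℓ
  have hcl : ℓ / A = (A / ℓ)⁻¹ := by rw [inv_div]
  have hB1 := one_le_profileEnd hA hℓ
  have hBle := floor_le (exp_pos (profileLength A * ℓ)).le
  have hBlt := (Nat.lt_floor_add_one (exp (profileLength A * ℓ))).le
  have eB := (profile_denom_le hA hℓ (x := (profileEnd A ℓ : ℝ)) (by exact_mod_cast hB1)).1 hBle
  have eB' := (profile_denom_le hA hℓ (x := (profileEnd A ℓ : ℝ) + 1) (by positivity)).2 hBlt
  set c := A / ℓ with hcdef
  set B := profileEnd A ℓ
  have hx1 : ∀ t : ℕ, 1 ≤ 1 + c * log t := one_le_profile_denom hA hℓ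
  have hδ : ∀ t : ℕ, 1 ≤ t → ∃ δ : ℝ, 1 / ((t : ℝ) + 1) ≤ δ ∧ δ ≤ 1 / t ∧
      log ((t + 1 : ℕ) : ℝ) = log t + δ := by
    intro t ht
    have ht0 : (0 : ℝ) < t := by exact_mod_cast ht
    have e : log ((t + 1 : ℕ) : ℝ) = log t + log (((t : ℝ) + 1) / t) := by
      rw [← log_mul ht0.ne' (by positivity)]; congr 1; push_cast; field_simp
    refine ⟨_, ?_, ?_, e⟩
    · have := Real.one_sub_inv_le_log_of_pos (x := ((t : ℝ) + 1) / t) (by positivity)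
      refine le_trans (le_of_eq ?_) this
      field_simp; ring
    · have := Real.log_le_sub_one_of_pos (x := ((t : ℝ) + 1) / t) (by positivity)
      refine this.trans (le_of_eq ?_)
      field_simp; ring
  have hstep : ∀ t : ℕ, 1 ≤ t → ∃ x y δ : ℝ, 0 < x ∧ 0 < y ∧ x ≤ y ∧ 1 / ((t : ℝ) + 1) ≤ δ ∧ δ ≤ 1 / t ∧
      0 < δ ∧ y - x = c * δ ∧ x = 1 + c * log t ∧ y = 1 + c * log ((t + 1 : ℕ) : ℝ) := by
    intro t ht
    obtain ⟨δ, h1, h2, h3⟩ := hδ t ht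
    have h0 : 0 < δ := lt_of_lt_of_le (by positivity) h1
    refine ⟨_, _, δ, by linarith [hx1 t], by linarith [hx1 (t + 1)], ?_, h1, h2, h0, ?_, rfl, rfl⟩
    · rw [h3]; nlinarith
    · rw [h3]; ring
  have hfirst := sum_Ioc_telescope_bounds (f := fun t : ℕ => 1 / (1 + c * log t) / t)
    (h := fun t : ℕ => c⁻¹ * log (1 + c * log t)) (by simp)
    (fun t ht => by
      obtain ⟨x, y, δ, hx, hy, hxy, d1, d2, d0, hyx, ex, ey⟩ := hstep t ht
      simp only [← ex, ← ey]
      have hlog := Real.one_sub_inv_le_log_of_pos (x := y / x) (by positivity)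
      rw [log_div hy.ne' hx.ne'] at hlog
      have e : 1 - (y / x)⁻¹ = c * (δ / y) := by
        rw [← mul_div_assoc, ← hyx]; field_simp
      rw [← mul_sub]
      calc 1 / y / ((t + 1 : ℕ) : ℝ) = 1 / ((t : ℝ) + 1) / y := by push_cast; rw [div_right_comm]
        _ ≤ δ / y := by gcongr
        _ = c⁻¹ * (1 - (y / x)⁻¹) := by rw [e]; field_simp
        _ ≤ _ := by gcongr)
    (fun t ht => by
      obtain ⟨x, y, δ, hx, hy, hxy, d1, d2, d0, hyx, ex, ey⟩ := hstep t ht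
      simp only [← ex, ← ey]
      have hlog := Real.log_le_sub_one_of_pos (x := y / x) (by positivity)
      rw [log_div hy.ne' hx.ne'] at hlog
      have e : y / x - 1 = c * (δ / x) := by
        rw [← mul_div_assoc, ← hyx]; field_simp
      rw [← mul_sub]
      calc _ ≤ c⁻¹ * (y / x - 1) := by gcongr
        _ = δ / x := by rw [e]; field_simp
        _ ≤ 1 / t / x := by gcongr
        _ = _ := div_right_comm _ _ _) B
  have hsecond := sum_Ioc_telescope_bounds (f := fun t : ℕ => (1 / (1 + c * log t)) ^ 2 / t)
    (h := fun t : ℕ => c⁻¹ * (1 - 1 / (1 + c * log t))) (by simp)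
    (fun t ht => by
      obtain ⟨x, y, δ, hx, hy, hxy, d1, d2, d0, hyx, ex, ey⟩ := hstep t ht
      simp only [← ex, ← ey]
      have e : c⁻¹ * (1 - 1 / y) - c⁻¹ * (1 - 1 / x) = δ / (x * y) := by
        have : δ = c⁻¹ * (y - x) := by rw [hyx]; field_simp
        rw [this]; field_simp; ring
      rw [e]
      calc (1 / y) ^ 2 / ((t + 1 : ℕ) : ℝ) = 1 / ((t : ℝ) + 1) / (y * y) := by push_cast; field_simp
        _ ≤ δ / (x * y) := by gcongr)
    (fun t ht => by
      obtain ⟨x, y, δ, hx, hy, hxy, d1, d2, d0, hyx, ex, ey⟩ := hstep t ht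
      simp only [← ex, ← ey]
      have e : c⁻¹ * (1 - 1 / y) - c⁻¹ * (1 - 1 / x) = δ / (x * y) := by
        have : δ = c⁻¹ * (y - x) := by rw [hyx]; field_simp
        rw [this]; field_simp; ring
      rw [e]
      calc δ / (x * y) ≤ 1 / t / (x * x) := by gcongr
        _ = _ := by field_simp) B
  have ht0 : ∀ t ∈ Ioc 0 B, profile A ℓ t = 1 / (1 + c * log t) := fun t ht => by
    rw [profile, if_pos (mem_Ioc.mp ht).2]
  have e1 : ∑ t ∈ Ioc 0 B, profile A ℓ t / t =
    ∑ t ∈ Ioc 0 B, 1 / (1 + c * log t) / t := sum_congr rfl fun t ht => by rw [ht0 t ht]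
  have e2 : ∑ t ∈ Ioc 0 B, profile A ℓ t ^ 2 / t =
    ∑ t ∈ Ioc 0 B, (1 / (1 + c * log t)) ^ 2 / t :=
    sum_congr rfl fun t ht => by rw [ht0 t ht]
  rw [e1, e2]
  push_cast at hfirst hsecond
  have hf2 := hfirst.2 hB1
  have hs2 := hsecond.2 hB1
  simp only [Real.log_one, mul_zero, add_zero, div_one, one_pow] at hf2 hs2
  have hxB := hx1 B
  have hAl : c⁻¹ * A = ℓ := by rw [hcdef]; field_simp
  rw [hcl]
  refine ⟨⟨le_trans ?_ hfirst.1, hf2.trans ?_⟩, le_trans ?_ hsecond.1, hs2.trans ?_⟩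
  · rw [← hAl]; gcongr
    rwa [le_log_iff_exp_le (by linarith [exp_pos A])]
  · have : c⁻¹ * log (1 + c * log B) ≤ c⁻¹ * A := by
      gcongr; rwa [log_le_iff_le_exp (by linarith)]
    linarith
  · rw [exp_neg]; gcongr
    rw [← one_div (exp A)]; exact one_div_le_one_div_of_le (exp_pos A) eB'
  · have : c⁻¹ * (1 - 1 / (1 + c * log B)) ≤ c⁻¹ * 1 := by
      gcongr
      have : 0 < 1 / (1 + c * log B) := by positivity
      linarith
    linarith

lemma sum_profile_sq_mul_rpow_le (hA : 1 ≤ A) (hℓ : 0 < ℓ) {ι : Type*} (s : Finset ι) (x : ι → ℕ)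
    (hx : ∀ i, 0 < x i) (h : ∑ i ∈ s, profile A ℓ (x i) / (x i : ℝ) ≤
      (A + 1 / 2) * ∑ i ∈ s, profile A ℓ (x i) ^ 2 / (x i : ℝ)) :
    ∑ i ∈ s, profile A ℓ (x i) ^ 2 / (x i : ℝ) * (x i : ℝ) ^ (1 / (4 * A * profileLength A) / ℓ) ≤
      exp (1 / (4 * A * profileLength A) * (1 - 1 / (4 * A))) *
        ∑ i ∈ s, profile A ℓ (x i) ^ 2 / (x i : ℝ) := by
  have hA0 : 0 < A := by linarith
  have hT := profileLength_pos hA0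
  obtain ⟨T, hTd⟩ : ∃ T, T = profileLength A := ⟨_, rfl⟩
  obtain ⟨r, hr⟩ : ∃ r, r = 1 / (4 * A * T) := ⟨_, rfl⟩
  rw [← hTd] at hT ⊢
  rw [← hr]
  have hr0 : 0 < r := by rw [hr]; positivity
  have hrT : r * T = 1 / (4 * A) := by rw [hr]; field_simp
  have hq : 1 / (4 * A) ≤ 1 / 4 := by gcongr; linarith
  have hterm : ∀ i ∈ s, profile A ℓ (x i) ^ 2 / (x i : ℝ) * (x i : ℝ) ^ (r / ℓ) ≤
      profile A ℓ (x i) ^ 2 / (x i : ℝ) + r * (1 + 1 / (4 * A)) / A *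
        (profile A ℓ (x i) / (x i : ℝ) - profile A ℓ (x i) ^ 2 / (x i : ℝ)) := by
    intro i _
    have hxi : (0 : ℝ) < x i := by exact_mod_cast hx i
    by_cases hB : x i ≤ profileEnd A ℓ
    · obtain ⟨u, hu⟩ : ∃ u, u = log (x i) / ℓ := ⟨_, rfl⟩
      have hu0 : 0 ≤ u := by rw [hu]; exact div_nonneg (log_natCast_nonneg _) hℓ.le
      have huT : u ≤ T := by
        rw [hu, div_le_iff₀ hℓ, log_le_iff_le_exp hxi, hTd]
        exact (Nat.le_floor_iff (exp_pos _).le).mp hB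
      have hg : profile A ℓ (x i) = 1 / (1 + A * u) := by
        rw [profile, if_pos hB, hu]; congr 2; ring
      have hpow : (x i : ℝ) ^ (r / ℓ) = exp (r * u) := by
        rw [rpow_def_of_pos hxi, hu]; congr 1; ring
      have hru : r * u ≤ 1 / (4 * A) := by rw [← hrT]; gcongr
      have hexp : exp (r * u) ≤ 1 + r * u * (1 + 1 / (4 * A)) := by
        have h1 := Real.abs_exp_sub_one_sub_id_le (x := r * u)
          (by rw [abs_of_nonneg (by positivity)]; linarith)
        have h2 := (abs_le.mp h1).2
        nlinarith [mul_nonneg hr0.le hu0]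
      have hid : profile A ℓ (x i) - profile A ℓ (x i) ^ 2 = A * u * profile A ℓ (x i) ^ 2 := by
        rw [hg]
        have : (0 : ℝ) < 1 + A * u := by positivity
        field_simp; ring
      rw [hpow, ← sub_div, hid]
      calc _ ≤ profile A ℓ (x i) ^ 2 / (x i : ℝ) * (1 + r * u * (1 + 1 / (4 * A))) := by gcongr
        _ = _ := by field_simp
    · rw [profile_eq_zero (not_le.mp hB)]; simp
  refine (sum_le_sum hterm).trans ?_
  rw [sum_add_distrib, ← mul_sum, sum_sub_distrib]
  have hG : 0 ≤ ∑ i ∈ s, profile A ℓ (x i) ^ 2 / (x i : ℝ) :=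
    sum_nonneg fun i _ => by positivity
  generalize ∑ i ∈ s, profile A ℓ (x i) ^ 2 / (x i : ℝ) = G2 at *
  generalize ∑ i ∈ s, profile A ℓ (x i) / (x i : ℝ) = G1 at *
  calc _ ≤ G2 + r * (1 + 1 / (4 * A)) / A * ((A + 1 / 2) * G2 - G2) := by gcongr
    _ = (1 + r * (1 - 1 / (4 * A) - 1 / (8 * A ^ 2)) * 1) * G2 := by field_simp; ring
    _ ≤ (1 + r * (1 - 1 / (4 * A))) * G2 := by
        have : 0 ≤ 1 / (8 * A ^ 2) := by positivity
        rw [mul_one]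
        refine mul_le_mul_of_nonneg_right ?_ hG
        have := mul_le_mul_of_nonneg_left (show 1 - 1 / (4 * A) - 1 / (8 * A ^ 2) ≤ 1 - 1 / (4 * A) by
          linarith) hr0.le
        linarith
    _ ≤ _ := by gcongr; linarith [add_one_le_exp (r * (1 - 1 / (4 * A)))]

end Profile

lemma sum_profile_estimates {A ℓ : ℝ} {n D W : ℕ} {p : Fin n → ℕ} (hp : ∀ i, (p i).Prime)
    (hinj : Injective p) (hD : ∀ i, D < p i)
    (hcov : ∀ q : ℕ, q.Prime → D < q → q ≤ profileEnd A ℓ → ∃ i, p i = q) (hW0 : 0 < W)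
    (hW : ∀ q : ℕ, q.Prime → (q ∣ W ↔ q ≤ D)) (hA : 1 ≤ A) (hℓ : 0 < ℓ)
    (hDA : 20 * A ≤ D) (hAexp : 20 * A * exp (-A) ≤ 1)
    (hℓW : (W + 1) * (20 * A) ≤ W.totient / W * (ℓ / A)) :
    1 ≤ ∑ T : Finset (Fin n), profile A ℓ (∏ i ∈ T, p i) ^ 2 / ((∏ i ∈ T, p i : ℕ) : ℝ) ∧
    ∑ T : Finset (Fin n), profile A ℓ (∏ i ∈ T, p i) / ((∏ i ∈ T, p i : ℕ) : ℝ) ≤ (A + 1 / 2) *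
      ∑ T : Finset (Fin n), profile A ℓ (∏ i ∈ T, p i) ^ 2 / ((∏ i ∈ T, p i : ℕ) : ℝ) ∧
    (1 - 1 / A) * (W.totient / W * (ℓ * A)) *
      ∑ T : Finset (Fin n), profile A ℓ (∏ i ∈ T, p i) ^ 2 / ((∏ i ∈ T, p i : ℕ) : ℝ) ≤
      (∑ T : Finset (Fin n), profile A ℓ (∏ i ∈ T, p i) / ((∏ i ∈ T, p i : ℕ) : ℝ)) ^ 2 := by
  have hA0 : 0 < A := by linarith
  have hD0 : 0 < D := by
    have : (0 : ℝ) < D := by linarith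
    exact_mod_cast this
  have hg0 := fun t => profile_nonneg hA0 hℓ t
  have ha := profile_antitone hA0 hℓ
  have b1 := sum_profile_bounds hp hinj hD hcov hW0 hD0 hW hg0 ha
    (fun t ht => profile_eq_zero ht) (profile_le_one hA0 hℓ 0)
  have b2 := sum_profile_bounds hp hinj hD hcov hW0 hD0 hW (g := fun t => profile A ℓ t ^ 2)
    (fun t => sq_nonneg _) (fun s t hst => pow_le_pow_left₀ (hg0 t) (ha hst) 2)
    (fun t ht => by simp only [profile_eq_zero ht]; norm_num)
    (pow_le_one₀ (hg0 0) (profile_le_one hA0 hℓ 0))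
  obtain ⟨⟨c1, c2⟩, c3, c4⟩ := sum_profile_div_bounds hA0 hℓ
  have hφ1 : (W.totient : ℝ) / W ≤ 1 :=
    (div_le_one (by exact_mod_cast hW0)).mpr (by exact_mod_cast W.totient_le)
  have hφ0 : 0 ≤ (W.totient : ℝ) / W := by positivity
  have hW1 : (0 : ℝ) ≤ W := by positivity
  have hδ0 : 0 ≤ 1 / (D : ℝ) := by positivity
  have hδ : 1 / (D : ℝ) ≤ 1 / (20 * A) := by gcongr
  have he0 := exp_pos (-A)
  have he : exp (-A) ≤ 1 / (20 * A) := by rw [le_div_iff₀ (by positivity)]; linarith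
  generalize hG1 : ∑ T : Finset (Fin n), profile A ℓ (∏ i ∈ T, p i) / ((∏ i ∈ T, p i : ℕ) : ℝ) = G1 at *
  generalize hG2 : ∑ T : Finset (Fin n), profile A ℓ (∏ i ∈ T, p i) ^ 2 / ((∏ i ∈ T, p i : ℕ) : ℝ) =
    G2 at *
  generalize (W.totient : ℝ) / W = φ at *
  generalize (W : ℝ) = w at *
  generalize 1 / (D : ℝ) = δ at *
  generalize exp (-A) = e at *
  generalize ∑ t ∈ Ioc 0 (profileEnd A ℓ), profile A ℓ t / t = s1 at *
  generalize ∑ t ∈ Ioc 0 (profileEnd A ℓ), profile A ℓ t ^ 2 / t = s2 at *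
  clear hG1 hG2 hp hinj hD hcov hW hg0 ha hDA hAexp
  obtain ⟨y, hy⟩ : ∃ y, y = φ * (ℓ / A) := ⟨_, rfl⟩
  obtain ⟨q, hq⟩ : ∃ q, q = 1 / (20 * A) := ⟨_, rfl⟩
  have hqA : q * A = 1 / 20 := by rw [hq]; field_simp
  have hq0 : 0 < q := by rw [hq]; positivity
  have hq1 : q ≤ 1 / 20 := by nlinarith
  rw [← hq] at hδ he
  rw [← hy] at hℓW
  have hφℓ : φ * ℓ = y * A := by rw [hy]; field_simp
  have hwy : w + 1 ≤ q * y := by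
    rw [hq, one_div_mul_eq_div, le_div_iff₀ (by positivity)]; exact hℓW
  have hy20 : 20 ≤ y := by nlinarith
  have hδ1 : 0 ≤ 1 - δ := by linarith
  have u1 : G1 ≤ y * A + q * y := by
    have : φ * s1 ≤ φ * (ℓ + 1) := by gcongr
    linarith [b1.2]
  have l1 : (1 - q) * (y * A - q * y) ≤ G1 := by
    have h1 : φ * ℓ ≤ φ * s1 := by gcongr
    have h2 : y * A - q * y ≤ φ * s1 - w := by linarith
    have h3 : 0 ≤ y * A - q * y := by nlinarith
    calc _ ≤ (1 - δ) * (φ * s1 - w) := by gcongr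
      _ ≤ _ := b1.1
  have u2 : G2 ≤ y + q * y := by
    have : φ * s2 ≤ φ * (ℓ / A + 1) := by gcongr
    linarith [b2.2]
  have l2 : (1 - q) * (y * (1 - 2 * q)) ≤ G2 := by
    have h1 : φ * (ℓ / A * (1 - e)) ≤ φ * s2 := by gcongr
    have h2 : y * (1 - 2 * q) ≤ φ * s2 - w := by
      rw [← mul_assoc, ← hy] at h1
      nlinarith
    have h3 : 0 ≤ y * (1 - 2 * q) := mul_nonneg (by linarith) (by linarith)
    calc _ ≤ (1 - δ) * (φ * s2 - w) := by gcongr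
      _ ≤ _ := b2.1
  have hqy : 0 ≤ q * y := by positivity
  have l2' : y * (1 - 3 * q) ≤ G2 := by
    refine le_trans ?_ l2
    have : (1 - q) * (y * (1 - 2 * q)) = y * (1 - 3 * q) + 2 * (q * y) * q := by ring
    rw [this]
    exact le_add_of_nonneg_right (by positivity)
  refine ⟨?_, ?_, ?_⟩
  · have : 20 * (17 / 20) ≤ y * (1 - 3 * q) := by gcongr; linarith
    linarith
  · calc G1 ≤ y * (A + q) := by linarith
      _ ≤ (A + 1 / 2) * (y * (1 - 3 * q)) := by
          have : A + q ≤ (A + 1 / 2) * (1 - 3 * q) := by linarith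
          calc _ ≤ y * ((A + 1 / 2) * (1 - 3 * q)) := by gcongr
            _ = _ := by ring
      _ ≤ _ := by gcongr
  · have hq2 : 1 / A = 20 * q := by rw [hq]; field_simp
    have l1' : y * A * (1 - 2 * q) ≤ G1 := by
      refine le_trans ?_ l1
      have : (1 - q) * (y * A - q * y) = y * A * (1 - 2 * q) + (q * y * (A - 1) + q * y * q) := by ring
      rw [this]
      exact le_add_of_nonneg_right (add_nonneg (mul_nonneg hqy (by linarith)) (by positivity))
    have e1 : φ * (ℓ * A) = y * A ^ 2 := by rw [← mul_assoc, hφℓ]; ring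
    rw [hq2, e1]
    calc (1 - 20 * q) * (y * A ^ 2) * G2 ≤ (1 - 20 * q) * (y * A ^ 2) * (y + q * y) := by
          have : 0 ≤ 1 - 20 * q := by linarith
          gcongr
      _ = (y * A) ^ 2 * ((1 - 20 * q) * (1 + q)) := by ring
      _ ≤ (y * A) ^ 2 * (1 - 2 * q) ^ 2 := by gcongr; nlinarith
      _ = (y * A * (1 - 2 * q)) ^ 2 := by ring
      _ ≤ _ := by
          have : 0 ≤ y * A * (1 - 2 * q) := mul_nonneg (by positivity) (by linarith)
          gcongr

lemma exists_modEq_iff {n W : ℕ} {p : Fin n → ℕ} (hp : ∀ i, (p i).Prime)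
    (hinj : Injective p) (hpW : ∀ i, (p i).Coprime W) (ν : ℕ) (r : Fin n → ℕ)
    (T : Finset (Fin n)) :
    ∃ a, ∀ x, (x ≡ ν [MOD W] ∧ ∀ l ∈ T, p l ∣ x + r l) ↔ x ≡ a [MOD W * ∏ l ∈ T, p l] := by
  induction T using Finset.induction_on with
  | empty => exact ⟨ν, by simp⟩
  | insert i T hi ih =>
    obtain ⟨a, ha⟩ := ih
    have hco : Coprime (W * ∏ l ∈ T, p l) (p i) :=
      Coprime.mul_left (hpW i).symm (Coprime.prod_left fun l hl =>
        (Nat.coprime_primes (hp l) (hp i)).mpr fun h => hi (hinj h ▸ hl))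
    obtain ⟨b, hb1, hb2⟩ := Nat.chineseRemainder hco a ((p i - 1) * r i)
    refine ⟨b, fun x => ?_⟩
    have hs : (p i - 1) * r i + r i ≡ 0 [MOD p i] := by
      rw [← Nat.succ_mul, Nat.succ_eq_add_one, Nat.sub_add_cancel (hp i).one_le]
      exact (Nat.modEq_zero_iff_dvd).mpr (dvd_mul_right _ _)
    have hd : p i ∣ x + r i ↔ x ≡ b [MOD p i] := by
      rw [← Nat.modEq_zero_iff_dvd]
      exact ⟨fun h => ((h.trans hs.symm).add_right_cancel' _).trans hb2.symm,
        fun h => ((h.trans hb2).add_right _).trans hs⟩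
    rw [prod_insert hi, mul_left_comm, mul_comm, forall_mem_insert, hd,
      ← Nat.modEq_and_modEq_iff_modEq_mul hco, and_left_comm, ha, and_comm]
    exact and_congr_left fun _ => ⟨fun h => h.trans hb1.symm, fun h => h.trans hb1⟩

section Colours

variable {κ : Type*} [Fintype κ] [DecidableEq κ] {n D W : ℕ} {p : Fin n → ℕ} {h : κ → ℕ}

/-- Indicator that `q` divides the translate of `x` selected by `c`; no condition if `c = none`. -/
def shiftIndicator (h : κ → ℕ) (q x : ℕ) : Option κ → ℝ
  | none => 1
  | some j => if q ∣ x + h j then 1 else 0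

omit [Fintype κ] in
lemma eq_of_dvd_add (hh : Injective h) (hhD : ∀ j, h j ≤ D) {q : ℕ} (hq : D < q) {x : ℕ}
    {i j : κ} (hi : q ∣ x + h i) (hj : q ∣ x + h j) : i = j := by
  refine hh (ModEq.eq_of_lt_of_lt ?_ ((hhD i).trans_lt hq) ((hhD j).trans_lt hq))
  exact ModEq.add_left_cancel' x (((Nat.modEq_zero_iff_dvd).mpr hi).trans
    ((Nat.modEq_zero_iff_dvd).mpr hj).symm)

omit [Fintype κ] in
lemma shiftIndicator_mul (hh : Injective h) (hhD : ∀ j, h j ≤ D) {q : ℕ} (hq : D < q)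
    (x : ℕ) (c c' : Option κ) : shiftIndicator h q x c * shiftIndicator h q x c' =
      if c = none ∨ c' = none ∨ c = c' then shiftIndicator h q x (c.or c') else 0 := by
  rcases c with _ | i
  · simp [shiftIndicator]
  rcases c' with _ | i'
  · simp [shiftIndicator]
  by_cases hi : i = i'
  · subst hi; simp [shiftIndicator]
  · have : ¬ (q ∣ x + h i ∧ q ∣ x + h i') := fun ⟨h1, h2⟩ => hi (eq_of_dvd_add hh hhD hq h1 h2)
    simp [shiftIndicator, hi] at this ⊢
    exact fun a b => this b a

omit [Fintype κ] in
lemma colorIndicator_mul (x c c' : Option κ) : colorIndicator c x * colorIndicator c' x =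
    if c = none ∨ c' = none ∨ c = c' then colorIndicator (c.or c') x else 0 := by
  rcases c with _ | i <;> rcases c' with _ | i' <;> rcases x with _ | j <;>
    simp [colorIndicator] <;> grind

lemma sum_fullWeight_mul (a : ℝ) (d : Option κ) :
    ∑ x, fullWeight a x * colorIndicator d x = if d = none then 1 else a := by
  rcases d with _ | j <;> simp [fullWeight, colorIndicator, sum_option]

lemma sum_deletedWeight_mul (j : κ) (b : ℝ) (d : Option κ) :
    ∑ x, deletedWeight j b x * colorIndicator d x =
      if d = none then 1 else if d = some j then 0 else b := by
  rcases d with _ | i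
  · simp [deletedWeight, colorIndicator, sum_option, sum_ite, filter_ne',
      cast_sub (card_pos_iff.mpr ⟨j⟩)]
  · simp [deletedWeight, colorIndicator]

/-- Quadratic sieve sums over translates, when the required divisor sums are known. -/
theorem abs_sum_shift_sub_le (hp : ∀ i, (p i).Prime) (hinj : Injective p)
    (hD : ∀ i, D < p i) (hh : Injective h) (hhD : ∀ j, h j ≤ D) (S : Finset ℕ) (u : ℕ → ℝ)
    (γ : ℝ) (π : Fin n → Option κ → ℝ) (lam : (Fin n → Option κ) → ℝ) {M : ℝ} {R : ℕ}
    (hM : ∀ c, |lam c| ≤ M) (hR : ∀ c, lam c ≠ 0 → suppProd p none c ≤ R) (Err : ℕ → ℝ)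
    (hErr : ∀ m, 0 ≤ Err m)
    (H : ∀ d, suppProd p none d ≤ R ^ 2 →
      |∑ x ∈ S, u x * ∏ i, shiftIndicator h (p i) x (d i) -
        γ * ∏ i, ∑ x, π i x * colorIndicator (d i) x| ≤ Err (suppProd p none d)) :
    |∑ x ∈ S, u x * (∑ c, lam c * ∏ i, shiftIndicator h (p i) x (c i)) ^ 2 -
        γ * tensorMeanSq π (fun _ => colorIndicator) lam| ≤
      M ^ 2 * ∑ m ∈ (Icc 1 (R ^ 2)).filter Squarefree,
        (((Fintype.card κ + 1) ^ 2 : ℕ) : ℝ) ^ m.primeFactors.card * Err m := by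
  rw [← Fintype.card_option]
  refine abs_sum_sq_sub_le hp hinj none S u (fun x i => shiftIndicator h (p i) x) γ π
    (fun _ => colorIndicator) lam hM hR Err hErr fun c c' hc => ?_
  have hs : suppProd p (none, none) (fun i => (c i, c' i)) =
      suppProd p none fun i => (c i).or (c' i) := by
    unfold suppProd
    congr 1
    ext i
    simp [Option.or_eq_none_iff]
  simp_rw [mul_assoc, ← prod_mul_distrib, shiftIndicator_mul hh hhD (hD _),
    colorIndicator_mul]
  by_cases hcomp : ∀ i, c i = none ∨ c' i = none ∨ c i = c' i
  · simp_rw [if_pos (hcomp _)]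
    rw [hs] at hc ⊢
    exact H _ hc
  · push Not at hcomp
    obtain ⟨i, hi⟩ := hcomp
    have hi' : ¬ (c i = none ∨ c' i = none ∨ c i = c' i) := by tauto
    have h1 : ∀ x ∈ S, u x * (∏ i, if c i = none ∨ c' i = none ∨ c i = c' i then
        shiftIndicator h (p i) x ((c i).or (c' i)) else 0) = 0 := fun x _ => by
      rw [prod_eq_zero (mem_univ i) (if_neg hi'), mul_zero]
    rw [sum_eq_zero h1, prod_eq_zero (mem_univ i)
      (sum_eq_zero fun x _ => by rw [if_neg hi', mul_zero])]
    simpa using hErr _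

omit [Fintype κ] in
lemma exists_prod_shiftIndicator_eq (hp : ∀ i, (p i).Prime) (hinj : Injective p)
    (hpW : ∀ i, (p i).Coprime W) (ν : ℕ) (d : Fin n → Option κ) :
    ∃ a, (a ≡ ν [MOD W] ∧ ∀ l j, d l = some j → p l ∣ a + h j) ∧
      ∀ x, (if x ≡ ν [MOD W] then ∏ i, shiftIndicator h (p i) x (d i) else 0) =
      if x ≡ a [MOD W * suppProd p none d] then 1 else 0 := by
  obtain ⟨a, ha⟩ := exists_modEq_iff hp hinj hpW ν (fun l => (d l).elim 0 h)
    (univ.filter fun l => d l ≠ none)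
  have hiff : ∀ x, (∀ l ∈ univ.filter fun l => d l ≠ none, p l ∣ x + (d l).elim 0 h) ↔
      ∀ l j, d l = some j → p l ∣ x + h j := by
    intro x
    simp only [mem_filter, mem_univ, true_and, ne_eq, ← Option.isSome_iff_ne_none,
      Option.isSome_iff_exists]
    exact ⟨fun H l j hj => by simpa [hj] using H l ⟨j, hj⟩,
      fun H l ⟨j, hj⟩ => by simpa [hj] using H l j hj⟩
  simp_rw [hiff] at ha
  refine ⟨a, (ha a).mpr rfl, fun x => ?_⟩
  have e : ∏ i, shiftIndicator h (p i) x (d i) =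
      if ∀ l j, d l = some j → p l ∣ x + h j then 1 else 0 := by
    split_ifs with hc
    · refine prod_eq_one fun i _ => ?_
      cases hd : d i with
      | none => rfl
      | some j => simp [shiftIndicator, hc i j hd]
    · push Not at hc
      obtain ⟨l, j, hl, hc⟩ := hc
      exact prod_eq_zero (mem_univ l) (by simp [shiftIndicator, hl, hc])
  rw [e, ← ite_and]
  exact if_congr (ha x) rfl rfl

lemma prod_ite_none (f : ℕ → ℝ) (d : Fin n → Option κ) :
    ∏ i, (if d i = none then 1 else f (p i)) = ∏ i with d i ≠ none, f (p i) := by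
  rw [prod_filter]
  exact prod_congr rfl fun i _ => by by_cases hd : d i = none <;> simp [hd]

/-- The divisor sums of a monotone weight. -/
lemma abs_sum_mul_shiftIndicator_sub_le (hp : ∀ i, (p i).Prime) (hinj : Injective p)
    (hpW : ∀ i, (p i).Coprime W) (hW : 0 < W) {v : ℕ → ℝ} (hv : Antitone v) (hv0 : ∀ n, 0 ≤ v n)
    (a b ν : ℕ) (d : Fin n → Option κ) :
    |∑ x ∈ Ioc a b, (if x ≡ ν [MOD W] then v x else 0) *
        ∏ i, shiftIndicator h (p i) x (d i) - (∑ x ∈ Ioc a b, v x) / W *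
        ∏ i, ∑ x, fullWeight (1 / (p i : ℝ)) x * colorIndicator (d i) x| ≤ v a := by
  obtain ⟨r, -, hr⟩ := exists_prod_shiftIndicator_eq (h := h) hp hinj hpW ν d
  have h1 : ∀ x, (if x ≡ ν [MOD W] then v x else 0) * ∏ i, shiftIndicator h (p i) x (d i) =
      if x ≡ r [MOD W * suppProd p none d] then v x else 0 := fun x => by
    have := congrArg (v x * ·) (hr x)
    simpa only [mul_ite, mul_zero, mul_one, ite_mul, zero_mul] using this
  simp_rw [h1, sum_fullWeight_mul]
  rw [← sum_filter, prod_ite_none (fun q => 1 / (q : ℝ))]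
  have h2 := abs_sum_modEq_sub_le hv hv0 a b (Nat.mul_pos hW (suppProd_pos hp none d)) r
  convert h2 using 3
  rw [prod_div_distrib, prod_const_one, suppProd]
  push_cast
  rw [div_mul_div_comm, mul_one]

/-- The divisor sums of a weight on primes, in terms of its distribution in residue classes. -/
lemma abs_sum_primeLog_mul_shiftIndicator_sub_le (hp : ∀ i, (p i).Prime)
    (hinj : Injective p) (hD : ∀ i, D < p i) (hh : Injective h)
    (hhD : ∀ j, h j ≤ D) (hpW : ∀ i, (p i).Coprime W) (hW : 0 < W) {X0 X1 : ℕ} (hX : D ≤ X0)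
    (hpX : ∀ i, p i ≤ X0) {w E : ℕ → ℝ} {ν Q R : ℕ} (hν : ∀ j, (ν + h j).Coprime W)
    (hE0 : ∀ q, 0 ≤ E q) (hQ : W * R ^ 2 ≤ Q)
    (hE : ∀ q, 0 < q → q ≤ Q → ∀ a : ℕ, a.Coprime q →
      |∑ n ∈ (Ioc X0 X1).filter (fun n => n ≡ a [MOD q]), w n * primeLog n -
        (∑ n ∈ Ioc X0 X1, w n * primeLog n) / q.totient| ≤ E q) (j : κ)
    (d : Fin n → Option κ) (hd : suppProd p none d ≤ R ^ 2) :
    |∑ x ∈ Ioc (X0 - D) X1, (if x ≡ ν [MOD W] then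
        (if X0 < x + h j ∧ x + h j ≤ X1 then w (x + h j) * primeLog (x + h j) else 0) else 0) *
        ∏ i, shiftIndicator h (p i) x (d i) - (∑ n ∈ Ioc X0 X1, w n * primeLog n) / W.totient *
        ∏ i, ∑ x, deletedWeight j (1 / ((p i : ℝ) - 1)) x * colorIndicator (d i) x| ≤
      if (suppProd p none d).Coprime W then E (W * suppProd p none d) else 0 := by
  have hco : (suppProd p none d).Coprime W := Coprime.prod_left fun i _ => hpW i
  rw [if_pos hco]
  simp_rw [sum_deletedWeight_mul]
  by_cases hj : ∃ l, d l = some j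
  · obtain ⟨l, hl⟩ := hj
    rw [prod_eq_zero (mem_univ l) (by simp [hl]), mul_zero, sub_zero,
      sum_eq_zero, abs_zero]
    · exact hE0 _
    · intro x _
      by_cases hx : p l ∣ x + h j
      · have : (if X0 < x + h j ∧ x + h j ≤ X1 then w (x + h j) * primeLog (x + h j) else 0) = 0 := by
          by_cases hc : X0 < x + h j ∧ x + h j ≤ X1
          · rw [if_pos hc, primeLog, if_neg, mul_zero]
            intro hpr
            have := ((Nat.prime_dvd_prime_iff_eq (hp l) hpr).mp hx)
            have := hpX l
            omega
          · rw [if_neg hc]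
        rw [this, ite_self, zero_mul]
      · rw [prod_eq_zero (mem_univ l) (by simp [shiftIndicator, hl, hx]), mul_zero]
  push Not at hj
  simp_rw [if_neg (hj _)]
  rw [prod_ite_none (fun q => 1 / ((q : ℝ) - 1))]
  obtain ⟨r, ⟨hrν, hrd⟩, hr⟩ := exists_prod_shiftIndicator_eq (h := h) hp hinj hpW ν d
  have hprod : ∀ x ∈ Ioc (X0 - D) X1, ∀ s : ℝ, (if x ≡ ν [MOD W] then s else 0) *
      ∏ i, shiftIndicator h (p i) x (d i) = if x ≡ r [MOD W * suppProd p none d] then s else 0 :=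
    fun x _ s => by
      have := congrArg (s * ·) (hr x)
      simpa only [mul_ite, mul_zero, mul_one, ite_mul, zero_mul] using this
  rw [sum_congr rfl fun x hx => hprod x hx _]
  have hcop : (r + h j).Coprime (W * suppProd p none d) := by
    refine Coprime.mul_right ((hrν.add_right (h j)).gcd_eq.trans (hν j))
      (Coprime.prod_right fun l hl => ?_)
    obtain ⟨i, hi⟩ := Option.ne_none_iff_exists'.mp (mem_filter.mp hl).2
    refine ((hp l).coprime_iff_not_dvd.mpr fun hdv => ?_).symm
    exact hj l (by rw [hi, eq_of_dvd_add hh hhD (hD l) (hrd l i hi) hdv])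
  have hmain := hE _ (Nat.mul_pos hW (suppProd_pos hp none d)) ((Nat.mul_le_mul_left W hd).trans hQ)
    _ hcop
  convert hmain using 3
  · rw [← sum_filter, ← sum_filter]
    refine sum_nbij' (· + h j) (· - h j) ?_ ?_ ?_ ?_ fun _ _ => rfl <;>
      have hjD := hhD j <;> simp only [mem_filter, mem_Ioc]
    · exact fun x hx => ⟨hx.2, hx.1.2.add_right _⟩
    · intro x hx
      have e : x - h j + h j = x := by omega
      refine ⟨⟨⟨by omega, by omega⟩, ?_⟩, by omega⟩
      exact ModEq.add_right_cancel' (h j) (by rw [e]; exact hx.2)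
    · intro x _; omega
    · intro x hx; omega
  · rw [Nat.totient_mul hco.symm, cast_mul, ← div_div, div_eq_mul_one_div (_ / _) (Nat.cast _)]
    congr 1
    have h1 : ((suppProd p none d).totient : ℝ) = ∏ i with d i ≠ none, ((p i : ℝ) - 1) := by
      rw [suppProd]
      induction (univ.filter fun i => d i ≠ none) using Finset.induction_on with
      | empty => simp
      | insert i T hi ih =>
        rw [prod_insert hi, prod_insert hi, Nat.totient_mul
          (Coprime.prod_right fun l hl => (Nat.coprime_primes (hp i) (hp l)).mpr fun he =>
            hi (hinj he ▸ hl)), Nat.totient_prime (hp i), cast_mul, ih,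
          Nat.cast_pred (hp i).pos]
    rw [h1, prod_div_distrib, prod_const_one]

end Colours

/-- There are `k` primes in `(k, 17 k (1 + log k)]`. -/
lemma exists_injective_primes {k : ℕ} (hk : 1 ≤ k) :
    ∃ h : Fin k → ℕ, Injective h ∧ (∀ j, (h j).Prime) ∧ (∀ j, k < h j) ∧
      ∀ j, (h j : ℝ) ≤ 17 * k * (1 + log k) := by
  have hk' : (1 : ℝ) ≤ k := by exact_mod_cast hk
  have hlk := log_nonneg hk'
  obtain ⟨N, hN⟩ : ∃ N, N = ⌈16 * k * (1 + log k)⌉₊ := ⟨_, rfl⟩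
  have hN1 : 16 * k * (1 + log k) ≤ N := hN ▸ le_ceil _
  have hN2 : (N : ℝ) ≤ 17 * k * (1 + log k) := by
    have := (Nat.ceil_lt_add_one (by positivity : 0 ≤ 16 * k * (1 + log k))).le
    rw [← hN] at this
    nlinarith
  have hN16 : (16 : ℝ) ≤ N := by nlinarith
  have hlog17 : log 17 ≤ 3 := by
    rw [log_le_iff_le_exp (by norm_num)]
    have := Real.exp_one_gt_d9
    calc (17 : ℝ) ≤ 2.7 ^ 3 := by norm_num
      _ ≤ exp 1 ^ 3 := by gcongr; linarith
      _ = exp 3 := by rw [← exp_nat_mul]; norm_num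
  have h1 : log ((N : ℝ) + 1) ≤ 3 + ((N + 1) / 17 - 1) := by
    have := Real.log_le_sub_one_of_pos (by positivity : (0 : ℝ) < (N + 1) / 17)
    rw [log_div (by positivity) (by norm_num)] at this
    linarith
  have h2 : log N ≤ 3 + 2 * log k := by
    have h3 : (N : ℝ) ≤ 17 * (k : ℝ) ^ 2 := by
      have := Real.log_le_sub_one_of_pos (by positivity : (0 : ℝ) < k)
      nlinarith
    calc log N ≤ log (17 * (k : ℝ) ^ 2) := log_le_log (by linarith) h3
      _ = log 17 + 2 * log k := by
          rw [log_mul (by norm_num) (by positivity), log_pow]; norm_num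
      _ ≤ _ := by linarith
  have hlN : 0 < log N := log_pos (by linarith)
  have hpi : 2 * (k : ℝ) ≤ Nat.primeCounting N := by
    refine le_trans ?_ (Chebyshev.pi_ge N)
    rw [le_div_iff₀ hlN]
    have h3 := log_two_gt_d9
    have h4 : (k : ℝ) * log N ≤ k * (3 + 2 * log k) := by gcongr
    nlinarith
  have hpi' : 2 * k ≤ Nat.primeCounting N := by exact_mod_cast hpi
  obtain ⟨s, hs⟩ : ∃ s, s = (range (N + 1)).filter Nat.Prime \ range (k + 1) :=
    ⟨_, rfl⟩
  have hcard : k ≤ s.card := by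
    have h3 : ((range (N + 1)).filter Nat.Prime).card = Nat.primeCounting N := by
      rw [Nat.primeCounting, Nat.primeCounting', Nat.count_eq_card_filter_range]
    have h4 : ((range (N + 1)).filter Nat.Prime \ Ioc 0 k).card ≤ s.card := by
      refine card_le_card fun x => ?_
      simp only [hs, Finset.mem_sdiff, mem_filter, mem_range, mem_Ioc]
      rintro ⟨⟨h5, h6⟩, h7⟩
      have := h6.pos
      exact ⟨⟨h5, h6⟩, by omega⟩
    have h5 := le_card_sdiff (Ioc 0 k) ((range (N + 1)).filter Nat.Prime)
    rw [card_Ioc, h3] at h5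
    omega
  obtain ⟨t, hts, htc⟩ := exists_subset_card_eq hcard
  have hmem : ∀ j, t.orderEmbOfFin htc j ∈ s := fun j => hts (t.orderEmbOfFin_mem htc j)
  simp only [hs, Finset.mem_sdiff, mem_filter, mem_range] at hmem
  refine ⟨t.orderEmbOfFin htc, (t.orderEmbOfFin htc).injective, fun j => (hmem j).1.2,
    fun j => ?_, fun j => ?_⟩
  · have := (hmem j).2
    omega
  · have := (hmem j).1.1
    exact le_trans (by exact_mod_cast (by omega : t.orderEmbOfFin htc j ≤ N)) hN2

/-- `k` primes exceeding `k` avoid a residue class modulo every prime. -/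
lemma exists_forall_not_dvd_add {k : ℕ} {h : Fin k → ℕ} (hp : ∀ j, (h j).Prime)
    (hk : ∀ j, k < h j) {p : ℕ} (hpp : p.Prime) : ∃ a, ∀ j, ¬ p ∣ a + h j := by
  rcases le_or_gt p k with h1 | h1
  · refine ⟨0, fun j hj => ?_⟩
    rw [zero_add, Nat.prime_dvd_prime_iff_eq hpp (hp j)] at hj
    have := hk j
    omega
  · have : Fact p.Prime := ⟨hpp⟩
    have h2 : ¬ Function.Surjective fun j => -(h j : ZMod p) := fun hs => by
      have := Fintype.card_le_of_surjective _ hs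
      rw [ZMod.card, card_fin] at this
      omega
    simp only [Function.Surjective, not_forall, not_exists] at h2
    obtain ⟨a, ha⟩ := h2
    refine ⟨a.val, fun j hj => ha j ?_⟩
    rw [← ZMod.natCast_eq_zero_iff] at hj
    push_cast at hj
    rw [ZMod.natCast_val, ZMod.cast_id] at hj
    exact (eq_neg_of_add_eq_zero_left hj).symm

lemma exists_coprime_primorial {k : ℕ} {h : Fin k → ℕ} (hp : ∀ j, (h j).Prime)
    (hk : ∀ j, k < h j) (D : ℕ) : ∃ ν, ∀ j, (ν + h j).Coprime (primorial D) := by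
  choose! a ha using fun (p : ℕ) (hpp : p.Prime) => exists_forall_not_dvd_add hp hk hpp
  obtain ⟨ν, hν⟩ := Nat.chineseRemainderOfFinset a id ((range (D + 1)).filter Nat.Prime)
    (fun p hp => (mem_filter.mp hp).2.ne_zero) fun p hp q hq hpq =>
      (Nat.coprime_primes (mem_filter.mp hp).2 (mem_filter.mp hq).2).mpr hpq
  refine ⟨ν, fun j => Coprime.prod_right fun p hpD => Coprime.symm ?_⟩
  have hpp := (mem_filter.mp hpD).2
  refine hpp.coprime_iff_not_dvd.mpr fun hd => ha p hpp j ?_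
  exact (((hν p hpD).add_right (h j)).dvd_iff dvd_rfl).mp hd

/-- Translates of a bounded set containing `m + 1` large primes control the prime gaps. -/
lemma liminf_nth_prime_le {k m H : ℕ} {h : Fin k → ℕ} (hh : Injective h)
    (hH : ∀ j, h j ≤ H)
    (hex : ∀ N, ∃ x, m < (univ.filter fun j => N < x + h j ∧ (x + h j).Prime).card) :
    Filter.liminf (fun n : ℕ => (nth Nat.Prime (n + m) : ℝ) - (nth Nat.Prime n : ℝ)) atTop
      ≤ H := by
  have hmono : StrictMono (nth Nat.Prime) := Nat.nth_strictMono Nat.infinite_setOfPred_prime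
  refine liminf_le_of_frequently_le ?_ ⟨0, ?_⟩
  · rw [frequently_atTop]
    intro n0
    obtain ⟨x, hx⟩ := hex (nth Nat.Prime n0)
    obtain ⟨s, hs⟩ : ∃ s, s = (univ.filter fun j =>
      nth Nat.Prime n0 < x + h j ∧ (x + h j).Prime).image fun j => x + h j := ⟨_, rfl⟩
    have hsc : m < s.card := by
      rw [hs, card_image_of_injective _ fun i j hij => hh (Nat.add_left_cancel hij)]
      exact hx
    have hsm : ∀ q ∈ s, q.Prime ∧ nth Nat.Prime n0 < q ∧ x ≤ q ∧ q ≤ x + H := by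
      intro q hq
      rw [hs, mem_image] at hq
      obtain ⟨j, hj, rfl⟩ := hq
      have := hH j
      have := (mem_filter.mp hj).2
      exact ⟨this.2, this.1, by omega, by omega⟩
    have hne : s.Nonempty := card_pos.mp (by omega)
    obtain ⟨q, hq⟩ : ∃ q, q = s.min' hne := ⟨_, rfl⟩
    obtain ⟨hqp, hqn, hxq, -⟩ := hsm q (hq ▸ s.min'_mem hne)
    have hnq : nth Nat.Prime (count Nat.Prime q) = q := Nat.nth_count hqp
    refine ⟨count Nat.Prime q, hmono.le_iff_le.mp (hqn.le.trans_eq hnq.symm), ?_⟩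
    have hcount : count Nat.Prime q + m < count Nat.Prime (x + H + 1) := by
      have hc : ∀ y, count Nat.Prime y = ((range y).filter Nat.Prime).card :=
        fun y => Nat.count_eq_card_filter_range _ y
      rw [hc, hc]
      have hdisj : Disjoint ((range q).filter Nat.Prime) s :=
        disjoint_left.mpr fun y hy hys => by
          have h1 := s.min'_le y hys
          have := mem_range.mp (mem_filter.mp hy).1
          omega
      calc _ < ((range q).filter Nat.Prime).card + s.card := by omega
        _ = (((range q).filter Nat.Prime) ∪ s).card := (card_union_of_disjoint hdisj).symm
        _ ≤ _ := card_le_card fun y hy => by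
          have hqH := (hsm q (hq ▸ s.min'_mem hne)).2.2.2
          rcases mem_union.mp hy with hy | hy
          · have := mem_filter.mp hy
            have h1 := mem_range.mp this.1
            exact mem_filter.mpr ⟨mem_range.mpr (by omega), this.2⟩
          · have := hsm y hy
            exact mem_filter.mpr ⟨mem_range.mpr (by omega), this.1⟩
    have hlt := Nat.nth_lt_of_lt_count hcount
    rw [hnq, sub_le_iff_le_add]
    exact_mod_cast (by omega : nth Nat.Prime (count Nat.Prime q + m) ≤ H + q)
  · rw [eventually_map]
    refine Eventually.of_forall fun n => sub_nonneg.mpr ?_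
    exact_mod_cast hmono.monotone (Nat.le_add_right n m)

lemma exists_prime_enumeration (D R : ℕ) : ∃ (n : ℕ) (p : Fin n → ℕ), (∀ i, (p i).Prime) ∧
    Injective p ∧ (∀ i, D < p i) ∧ (∀ i, p i ≤ R) ∧
    ∀ q, q.Prime → D < q → q ≤ R → ∃ i, p i = q := by
  obtain ⟨s, hs⟩ : ∃ s, s = (Ioc D R).filter Nat.Prime := ⟨_, rfl⟩
  have hmem : ∀ q, q ∈ s ↔ (D < q ∧ q ≤ R) ∧ q.Prime := fun q => by
    rw [hs, mem_filter, mem_Ioc]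
  have h := fun i => (hmem _).mp (s.orderEmbOfFin_mem rfl i)
  refine ⟨s.card, s.orderEmbOfFin rfl, fun i => (h i).2, (s.orderEmbOfFin rfl).injective,
    fun i => (h i).1.1, fun i => (h i).1.2, fun q hq h1 h2 => ?_⟩
  have : q ∈ Set.range (s.orderEmbOfFin rfl) := by
    rw [range_orderEmbOfFin]
    exact (hmem q).mpr ⟨⟨h1, h2⟩, hq⟩
  exact this

lemma sum_inv_pred_sub_inv_le {n D : ℕ} (hD0 : 0 < D) {p : Fin n → ℕ}
    (hinj : Injective p) (hD : ∀ i, D < p i) :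
    ∑ i, (1 / ((p i : ℝ) - 1) - 1 / (p i : ℝ)) ≤ 1 / D := by
  have hf : ∀ q : ℕ, D < q → 0 ≤ 1 / ((q : ℝ) - 1) - 1 / q := fun q hq => by
    have : (D : ℝ) + 1 ≤ q := by exact_mod_cast hq
    have h0 : (0 : ℝ) < D := by exact_mod_cast hD0
    rw [sub_nonneg]
    exact one_div_le_one_div_of_le (by linarith) (by linarith)
  have htel : ∀ N : ℕ, D ≤ N → ∑ q ∈ Ioc D N, (1 / ((q : ℝ) - 1) - 1 / q) =
      1 / D - 1 / N := fun N hN => by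
    induction N, hN using Nat.le_induction with
    | base => simp
    | succ N hN ih => rw [sum_Ioc_succ_top (by omega), ih]; push_cast; ring
  calc _ = ∑ q ∈ univ.image p, (1 / ((q : ℝ) - 1) - 1 / q) :=
        (sum_image hinj.injOn).symm
    _ ≤ ∑ q ∈ Ioc D (D + ∑ i, p i), (1 / ((q : ℝ) - 1) - 1 / q) := by
        refine sum_le_sum_of_subset_of_nonneg ?_ fun q hq _ => hf q (mem_Ioc.mp hq).1
        intro q hq
        obtain ⟨i, -, rfl⟩ := mem_image.mp hq
        have := single_le_sum (f := p) (fun _ _ => Nat.zero_le _) (mem_univ i)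
        exact mem_Ioc.mpr ⟨hD i, by omega⟩
    _ ≤ 1 / D := by
        rw [htel _ (by omega)]
        have : (0 : ℝ) ≤ 1 / ((D + ∑ i, p i : ℕ) : ℝ) := by positivity
        linarith

lemma profileLength_le_exp {A : ℝ} (hA : 1 ≤ A) : profileLength A ≤ exp A := by
  rw [profileLength, div_le_iff₀ (by linarith)]
  nlinarith [exp_pos A]

/-- Tail of the profile measure outside the support condition. -/
lemma exp_pow_div_rpow_le {A ℓ : ℝ} {k : ℕ} (hA : 100 ≤ A)
    (hk : 32 * A ^ 2 * exp A ≤ k) (hℓ : 1 ≤ ℓ) :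
    exp (1 / (4 * A * profileLength A) * (1 - 1 / (4 * A))) ^ (k - 1) /
      (⌊exp (k * ℓ - profileLength A * ℓ)⌋₊ : ℝ) ^ (1 / (4 * A * profileLength A) / ℓ) ≤
    1 / A := by
  have hA0 : 0 < A := by linarith
  have hT := profileLength_pos hA0
  obtain ⟨T, hTd⟩ : ∃ T, T = profileLength A := ⟨_, rfl⟩
  rw [← hTd] at hT ⊢
  have hAT : A * T = exp A - 1 := by rw [hTd, profileLength]; field_simp
  have hexp := Real.quadratic_le_exp_of_nonneg hA0.le
  have hk1 : (1 : ℝ) ≤ k := by nlinarith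
  have hkN : 1 ≤ k := by exact_mod_cast hk1
  have hTk : T ≤ k := by
    have := hTd ▸ profileLength_le_exp (by linarith : 1 ≤ A)
    nlinarith
  obtain ⟨c, hc⟩ : ∃ c, c = 1 / (4 * A * T) := ⟨_, rfl⟩
  rw [← hc]
  have hc0 : 0 < c := by rw [hc]; positivity
  have hc1 : c ≤ 1 := by
    rw [hc, div_le_one (by positivity)]; nlinarith
  have hcT : c * T = 1 / (4 * A) := by rw [hc]; field_simp
  have hck : 2 * A ≤ c * k / (4 * A) := by
    rw [hc, le_div_iff₀ (by positivity), one_div, inv_mul_eq_div, le_div_iff₀ (by positivity)]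
    nlinarith
  obtain ⟨y, hy⟩ : ∃ y, y = k * ℓ - T * ℓ := ⟨_, rfl⟩
  rw [← hy]
  have hy0 : 0 ≤ y := by rw [hy, ← sub_mul]; exact mul_nonneg (by linarith) (by linarith)
  have hfl : exp y / 2 ≤ ⌊exp y⌋₊ := by
    have h1 := Nat.lt_floor_add_one (exp y)
    have h2 : (1 : ℝ) ≤ ⌊exp y⌋₊ := by
      exact_mod_cast le_floor (by simpa using one_le_exp hy0)
    linarith
  have hcℓ : 0 ≤ c / ℓ := by positivity
  have h2 : (2 : ℝ) ^ (c / ℓ) ≤ 2 :=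
    (rpow_le_rpow_of_exponent_le (by norm_num) ((div_le_self hc0.le hℓ).trans hc1)).trans_eq
      (rpow_one 2)
  have hden : exp (c * k - 1 / (4 * A)) / 2 ≤ (⌊exp y⌋₊ : ℝ) ^ (c / ℓ) := by
    refine le_trans ?_ (Real.rpow_le_rpow (by positivity) hfl hcℓ)
    rw [Real.div_rpow (by positivity) (by norm_num), ← exp_mul]
    have : y * (c / ℓ) = c * k - 1 / (4 * A) := by rw [hy, ← hcT]; field_simp
    rw [this]
    gcongr
  have hsmall : 1 / (4 * A) ≤ 1 := by rw [div_le_one (by positivity)]; linarith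
  calc _ ≤ exp (c * (1 - 1 / (4 * A))) ^ (k - 1) / (exp (c * k - 1 / (4 * A)) / 2) := by
        gcongr
    _ = 2 * exp (c * (1 - 1 / (4 * A)) * (k - 1) - (c * k - 1 / (4 * A))) := by
        rw [← exp_nat_mul, exp_sub _ (c * k - 1 / (4 * A)), cast_sub hkN, Nat.cast_one,
          mul_comm ((k : ℝ) - 1), div_div_eq_mul_div, mul_comm _ (2 : ℝ), mul_div_assoc]
    _ ≤ 2 * exp (1 - A) := by
        refine mul_le_mul_of_nonneg_left (exp_le_exp.mpr ?_) (by norm_num)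
        have e : c * (1 - 1 / (4 * A)) * (k - 1) - (c * k - 1 / (4 * A)) =
          1 / (4 * A) - c * (1 - 1 / (4 * A)) - c * k / (4 * A) := by field_simp; ring
        rw [e]
        have := mul_nonneg hc0.le (sub_nonneg.mpr hsmall)
        linarith
    _ ≤ 1 / A := by
        rw [exp_sub, mul_div_assoc', div_le_div_iff₀ (exp_pos _) hA0]
        have := Real.exp_one_lt_d9
        nlinarith

/-- Sieve coefficients whose two mean squares have ratio about `A` times the scale. -/
theorem exists_sieveCoeff {n k D W R : ℕ} {p : Fin n → ℕ} {A ℓ : ℝ} (hp : ∀ i, (p i).Prime)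
    (hinj : Injective p) (hD : ∀ i, D < p i)
    (hcov : ∀ q, q.Prime → D < q → q ≤ R → ∃ i, p i = q) (hW0 : 0 < W)
    (hW : ∀ q, q.Prime → (q ∣ W ↔ q ≤ D)) (hA : 100 ≤ A) (hk : 32 * A ^ 2 * exp A ≤ k)
    (hDk : 4 * (k : ℝ) ^ 2 * A ≤ D) (hℓ : 1 ≤ ℓ)
    (hℓW : ((W : ℝ) + 1) * (20 * A) ≤ W.totient / W * (ℓ / A)) (hR : R = ⌊exp (k * ℓ)⌋₊) :
    ∃ (lam : (Fin n → Option (Fin k)) → ℝ) (G : ℝ), 1 ≤ G ∧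
      (∀ c, |lam c| ≤ (1 + log R) ^ k) ∧ (∀ c, lam c ≠ 0 → suppProd p none c ≤ R) ∧
      tensorMeanSq (fun i => fullWeight (1 / (p i : ℝ))) (fun _ => colorIndicator) lam ≤ G ∧
      ∀ j, (1 - 5 / A) * (W.totient / W * (ℓ * A)) * G ≤
        tensorMeanSq (fun i => deletedWeight j (1 / ((p i : ℝ) - 1))) (fun _ => colorIndicator)
          lam := by
  have hA0 : 0 < A := by linarith
  have hℓ0 : 0 < ℓ := by linarith
  have hT := profileLength_pos hA0
  have hexp := Real.quadratic_le_exp_of_nonneg hA0.le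
  have hk1 : (1 : ℝ) ≤ k := by nlinarith
  have hkN : 1 ≤ k := by exact_mod_cast hk1
  have hAT : A * profileLength A = exp A - 1 := by rw [profileLength]; field_simp
  have hTk : profileLength A ≤ k := by
    have := profileLength_le_exp (by linarith : 1 ≤ A)
    nlinarith
  have hk3 : (3 : ℝ) ≤ k := by nlinarith
  have hDA : 20 * A ≤ D := by nlinarith
  have hDk' : (k : ℝ) ≤ D := by nlinarith
  have hD0 : (0 : ℝ) < D := by linarith
  have hAexp : 20 * A * exp (-A) ≤ 1 := by
    rw [exp_neg, ← div_eq_mul_inv, div_le_one (exp_pos _)]; nlinarith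
  have hend : profileEnd A ℓ ≤ R := by
    rw [hR, profileEnd]; gcongr
  obtain ⟨hG2, hG1, hmain⟩ := sum_profile_estimates hp hinj hD
    (fun q hq h1 h2 => hcov q hq h1 (h2.trans hend)) hW0 hW (by linarith) hℓ0 hDA hAexp hℓW
  have hM := sum_profile_sq_mul_rpow_le (A := A) (by linarith) hℓ0 univ
    (fun T : Finset (Fin n) => ∏ l ∈ T, p l) (fun T => prod_pos fun i _ => (hp i).pos) hG1
  obtain ⟨R', hR'⟩ : ∃ R', R' = ⌊exp (k * ℓ - profileLength A * ℓ)⌋₊ := ⟨_, rfl⟩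
  have hR'0 : 0 < R' := by
    rw [hR', Nat.floor_pos]
    refine one_le_exp ?_
    rw [← sub_mul]; exact mul_nonneg (by linarith) hℓ0.le
  have hR'B : R' * profileEnd A ℓ ≤ R := by
    rw [hR]
    refine le_floor ?_
    rw [cast_mul, hR', profileEnd]
    calc _ ≤ exp (k * ℓ - profileLength A * ℓ) * exp (profileLength A * ℓ) := by
          gcongr <;> exact floor_le (exp_pos _).le
      _ = _ := by rw [← exp_add]; congr 1; ring
  have hdelta := sum_inv_pred_sub_inv_le (by exact_mod_cast hD0) hinj hD
  have hp2 : ∀ i, (D : ℝ) + 1 ≤ p i := fun i => by exact_mod_cast hD i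
  have hdi : ∀ i, (1 / (p i : ℝ)) ^ 2 ≤ 1 / ((p i : ℝ) - 1) - 1 / (p i : ℝ) := fun i => by
    have h1 := hp2 i
    have h2 : (0 : ℝ) < (p i : ℝ) - 1 := by linarith
    have h3 : (0 : ℝ) < p i := by linarith
    rw [div_sub_div _ _ h2.ne' h3.ne', div_pow, one_pow, div_le_div_iff₀ (by positivity)
      (by positivity)]
    nlinarith
  have hρ : ∏ i, (1 + Fintype.card (Fin k) * (1 / ((p i : ℝ) - 1) - 1 / (p i : ℝ))) ≤
      1 + 1 / A := by
    rw [card_fin]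
    have hx : (k : ℝ) * (1 / D) ≤ 1 / (2 * A) := by
      rw [mul_one_div, div_le_div_iff₀ hD0 (by positivity)]; nlinarith
    calc _ ≤ ∏ i, exp (k * (1 / ((p i : ℝ) - 1) - 1 / (p i : ℝ))) := by
          refine prod_le_prod (fun i _ => ?_) fun i _ => ?_
          · have := (sq_nonneg _).trans (hdi i)
            positivity
          · rw [add_comm]; exact add_one_le_exp _
      _ = exp (k * ∑ i, (1 / ((p i : ℝ) - 1) - 1 / (p i : ℝ))) := by
          rw [← Real.exp_sum, mul_sum]
      _ ≤ exp (1 / (2 * A)) := by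
          gcongr; exact (by gcongr : _ ≤ (k : ℝ) * (1 / D)).trans hx
      _ ≤ 1 / (1 - 1 / (2 * A)) := Real.exp_bound_div_one_sub_of_interval (by positivity) (by
          rw [div_lt_one (by positivity)]; linarith)
      _ ≤ 1 + 1 / A := by
          have h1 : 0 < 1 - 1 / (2 * A) := by
            rw [sub_pos, div_lt_one (by positivity)]; linarith
          rw [div_le_iff₀ h1]
          have : (1 + 1 / A) * (1 - 1 / (2 * A)) = 1 + (A - 1) / (2 * A ^ 2) := by field_simp; ring
          rw [this]
          have : 0 ≤ (A - 1) / (2 * A ^ 2) := div_nonneg (by linarith) (by positivity)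
          linarith
  have hkp : ∀ i, k < p i := fun i => by
    have h1 := hp2 i
    exact_mod_cast (by linarith : (k : ℝ) < p i)
  have hlow := fun j : Fin k => le_tensorMeanSq_diagWeight hp (profile_nonneg hA0 hℓ0)
    (profile_antitone hA0 hℓ0) (fun _ => profile_eq_zero) hR'B hR'0
    (fun i => by rw [card_fin]; exact hkp i) j
    (by rw [div_le_one hA0]; linarith : 1 / A ≤ 1)
    (by positivity : 0 ≤ 1 / (4 * A * profileLength A) / ℓ) hρ hM
  have hup := sum_diagWeight_sq_le (κ := Fin k) (p := p) (g := profile A ℓ) (R := R)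
  have htail := exp_pow_div_rpow_le hA hk hℓ
  rw [← hR'] at htail
  simp only [card_fin] at hlow hup
  have hsign : ∀ s : Fin n → Option (Fin k), |∏ i, colorSign (s i)| = 1 := fun s => by
    rw [abs_prod]
    exact prod_eq_one fun i _ => by cases s i <;> simp [colorSign]
  obtain ⟨z, hz⟩ : ∃ z, z = fun s : Fin n → Option (Fin k) =>
    (∏ i, colorSign (s i)) * diagWeight p (profile A ℓ) R s := ⟨_, rfl⟩
  have hzR : ∀ s, z s ≠ 0 → suppProd p none s ≤ R := fun s hs => by
    by_contra hc
    exact hs (by rw [hz]; simp [diagWeight, hc])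
  have hz1 : ∀ s, |z s| ≤ 1 := fun s => by
    rw [hz]
    simp only [abs_mul, hsign, one_mul]
    rw [abs_of_nonneg (diagWeight_nonneg (profile_nonneg hA0 hℓ0) s)]
    exact diagWeight_le_one (profile_nonneg hA0 hℓ0) (profile_le_one hA0 hℓ0) s
  have hz2 : ∀ s, z s ^ 2 = diagWeight p (profile A ℓ) R s ^ 2 := fun s => by
    rw [hz]
    simp only [mul_pow, ← sq_abs (∏ i, colorSign (s i)), hsign, one_pow, one_mul]
  rw [← hz] at hlow
  have hsq : 4 * (k : ℝ) ^ 2 * ∑ l, (1 / (p l : ℝ)) ^ 2 ≤ 1 / A := by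
    calc _ ≤ 4 * (k : ℝ) ^ 2 * (1 / D) := by
          gcongr; exact (sum_le_sum fun i _ => hdi i).trans hdelta
      _ ≤ 1 / A := by
          rw [mul_one_div, div_le_div_iff₀ hD0 hA0]; linarith
  clear hz hM hρ hdi hp2 hdelta
  obtain ⟨G2, hG₂⟩ : ∃ G2, G2 = ∑ T : Finset (Fin n), profile A ℓ (∏ l ∈ T, p l) ^ 2 /
    (∏ l ∈ T, p l : ℕ) := ⟨_, rfl⟩
  obtain ⟨G1, hG₁⟩ : ∃ G1, G1 = ∑ T : Finset (Fin n), profile A ℓ (∏ l ∈ T, p l) /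
    (∏ l ∈ T, p l : ℕ) := ⟨_, rfl⟩
  simp only [← hG₂, ← hG₁] at hlow hup hmain hG2
  refine ⟨sieveCoeff (fun i => 1 / (p i : ℝ)) z, G2 ^ k, one_le_pow₀ hG2, fun c => ?_,
    suppProd_le_of_sieveCoeff_ne_zero hp _ z hzR, ?_, fun j => le_trans ?_ (hlow j)⟩
  · simpa using abs_sieveCoeff_le hp hinj z hzR hz1 c
  · refine (tensorMeanSq_sieveCoeff_le _ (fun i => by positivity) (fun i => ?_) z).trans ?_
    · rw [card_fin, mul_one_div, div_le_one (by exact_mod_cast (hp i).pos)]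
      exact_mod_cast (hkp i).le
    · simp_rw [hz2]
      exact hup
  · obtain ⟨x, hx⟩ : ∃ x, x = 1 / A := ⟨_, rfl⟩
    have hx0 : 0 < x := by rw [hx]; positivity
    have hx1 : x ≤ 1 / 100 := by rw [hx]; gcongr
    obtain ⟨F, hF⟩ : ∃ F, F = W.totient / W * (ℓ * A) := ⟨_, rfl⟩
    have hF0 : 0 ≤ F := by rw [hF]; positivity
    rw [← hx] at htail hsq hmain ⊢
    rw [← hF] at hmain ⊢
    obtain ⟨P, hP⟩ : ∃ P, P = G2 ^ (k - 1) := ⟨_, rfl⟩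
    have hP0 : 0 ≤ P := by rw [hP]; positivity
    have hGk : G2 ^ k = G2 * P := by
      rw [hP, ← pow_succ', Nat.sub_add_cancel hkN]
    rw [← hP, hGk]
    have h5 : 1 - 5 / A ≤ (1 - x) ^ 2 * ((1 - x) * (1 - 2 * x)) := by
      have : 5 / A = 5 * x := by rw [hx]; ring
      rw [this, show (1 - x) ^ 2 * ((1 - x) * (1 - 2 * x)) =
        1 - 5 * x + x ^ 2 * (9 - 7 * x + 2 * x ^ 2) by ring]
      have : 0 ≤ x ^ 2 * (9 - 7 * x + 2 * x ^ 2) :=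
        mul_nonneg (sq_nonneg x) (by linarith [sq_nonneg x])
      linarith
    calc (1 - 5 / A) * F * (G2 * P)
        ≤ (1 - x) ^ 2 * ((1 - x) * (1 - 2 * x)) * F * (G2 * P) := by gcongr
      _ = (1 - x) ^ 2 * ((1 - x) * F * G2 * ((1 - x - x) * P)) := by ring
      _ ≤ _ := by
          have : 0 ≤ 1 - x - x := by linarith
          gcongr

lemma exists_lt_card_of_sum_lt {k m W X0 X1 ν : ℕ} {h : Fin k → ℕ} {w v s : ℕ → ℝ} {V : ℝ}
    (S : Finset ℕ) (hs : ∀ x, 0 ≤ s x) (hv : ∀ x, 0 ≤ v x) (hw : ∀ n, 0 ≤ w n) (hV0 : 0 ≤ V)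
    (hwv : ∀ x j, X0 < x + h j → w (x + h j) ≤ v x) (hV : ∀ n, n ≤ X1 → primeLog n ≤ V)
    (H : m * V * ∑ x ∈ S, (if x ≡ ν [MOD W] then v x else 0) * s x <
      ∑ j, ∑ x ∈ S, (if x ≡ ν [MOD W] then (if X0 < x + h j ∧ x + h j ≤ X1 then
        w (x + h j) * primeLog (x + h j) else 0) else 0) * s x) :
    ∃ x, m < (univ.filter fun j => X0 < x + h j ∧ (x + h j).Prime).card := by
  by_contra! hc
  refine H.not_ge ?_
  rw [sum_comm, mul_sum]
  refine sum_le_sum fun x _ => ?_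
  rw [← sum_mul, ← mul_assoc]
  refine mul_le_mul_of_nonneg_right ?_ (hs x)
  by_cases hx : x ≡ ν [MOD W]
  · simp only [if_pos hx]
    calc _ ≤ ∑ j, if X0 < x + h j ∧ (x + h j).Prime then V * v x else 0 := by
          refine sum_le_sum fun j _ => ?_
          by_cases h1 : X0 < x + h j ∧ x + h j ≤ X1
          · rw [if_pos h1]
            by_cases h2 : (x + h j).Prime
            · rw [if_pos ⟨h1.1, h2⟩, mul_comm]
              exact mul_le_mul (hV _ h1.2) (hwv x j h1.1) (hw _) hV0
            · rw [if_neg fun h3 => h2 h3.2, primeLog, if_neg h2, mul_zero]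
          · rw [if_neg h1]
            split_ifs
            exacts [mul_nonneg hV0 (hv x), le_rfl]
      _ = (univ.filter fun j => X0 < x + h j ∧ (x + h j).Prime).card * (V * v x) := by
          rw [← sum_filter, sum_const, nsmul_eq_mul]
      _ ≤ m * V * v x := by
          rw [mul_assoc]
          exact mul_le_mul_of_nonneg_right (by exact_mod_cast hc x) (mul_nonneg hV0 (hv x))
  · simp [hx]

lemma two_mul_pow_mul_le {x y : ℝ} {K : ℕ} (hx : 2 ^ K ≤ x) (hy : y ≤ 1 / x ^ (K + 2)) :
    (2 * x) ^ K * y ≤ 1 / x := by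
  have hx0 : 0 < x := lt_of_lt_of_le (by positivity) hx
  calc (2 * x) ^ K * y ≤ (2 * x) ^ K * (1 / x ^ (K + 2)) := by gcongr
    _ ≤ (x * x ^ K) * (1 / x ^ (K + 2)) := by rw [mul_pow]; gcongr
    _ = 1 / x := by field_simp; ring

lemma sum_squarefree_pow_card_le (c N : ℕ) :
    ∑ q ∈ (Icc 1 N).filter Squarefree, (c : ℝ) ^ q.primeFactors.card ≤
      N * (1 + log N) ^ c := by
  refine le_trans ?_ (mul_le_mul_of_nonneg_left (sum_squarefree_pow_card_div_le c N) N.cast_nonneg)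
  rw [mul_sum]
  refine sum_le_sum fun q hq => ?_
  have hq := mem_Icc.mp (mem_filter.mp hq).1
  have h0 : (0 : ℝ) < q := by exact_mod_cast hq.1
  have h1 : (q : ℝ) ≤ N := by exact_mod_cast hq.2
  rw [mul_div_assoc', le_div_iff₀ h0, mul_comm]
  gcongr

section Errors

variable {k c L R : ℕ} {ρ : ℝ}

lemma log_floor_exp_le (hρ0 : 0 ≤ ρ) (hR : R = ⌊exp (ρ * L)⌋₊) : log R ≤ ρ * L := by
  have h1 : (1 : ℝ) ≤ R := by
    rw [hR]
    exact_mod_cast le_floor (by simpa using one_le_exp (by positivity : 0 ≤ ρ * (L : ℝ)))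
  rw [log_le_iff_le_exp (by linarith), hR]
  exact floor_le (exp_pos _).le

lemma monotone_weight_error_le {v ε : ℝ} (hρ0 : 0 ≤ ρ) (hε : 0 ≤ ε) (hρ : ρ = 1 / 4 - 3 * ε)
    (hR : R = ⌊exp (ρ * L)⌋₊) (hv0 : 0 ≤ v)
    (hv : v ≤ exp (-(L / 2))) (hL : 2 ^ (2 * k + c) ≤ (L : ℝ))
    (hL2 : exp (-(6 * ε * L)) ≤ 1 / (L : ℝ) ^ (2 * k + c + 2)) :
    ((1 + log R) ^ k) ^ 2 *
      ∑ q ∈ (Icc 1 (R ^ 2)).filter Squarefree, (c : ℝ) ^ q.primeFactors.card * v ≤ 1 / L := by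
  have hl := log_floor_exp_le hρ0 hR
  have hL1 : (1 : ℝ) ≤ L := (one_le_pow₀ (by norm_num)).trans hL
  have h1 : 1 + log R ≤ 2 * L := by nlinarith
  have h2 : 1 + log ((R ^ 2 : ℕ) : ℝ) ≤ 2 * L := by
    rw [Nat.cast_pow, log_pow]; push_cast; nlinarith
  have h3 : ((R ^ 2 : ℕ) : ℝ) ≤ exp ((1 / 2 - 6 * ε) * L) := by
    have : (R : ℝ) ≤ exp (ρ * L) := hR ▸ floor_le (exp_pos _).le
    calc ((R ^ 2 : ℕ) : ℝ) = (R : ℝ) ^ 2 := by push_cast; rfl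
      _ ≤ exp (ρ * L) ^ 2 := by gcongr
      _ = _ := by rw [← exp_nat_mul, hρ]; congr 1; push_cast; ring
  rw [← sum_mul]
  refine le_trans ?_ (two_mul_pow_mul_le hL hL2)
  calc _ ≤ ((2 * L : ℝ) ^ k) ^ 2 *
        ((exp ((1 / 2 - 6 * ε) * L) * (2 * L) ^ c) * exp (-(L / 2))) := by
        gcongr
        exact (sum_squarefree_pow_card_le c (R ^ 2)).trans (by gcongr)
    _ = (2 * L) ^ (2 * k + c) * (exp ((1 / 2 - 6 * ε) * L) * exp (-(L / 2))) := by ring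
    _ = _ := by rw [← exp_add]; congr 2; ring

lemma prime_weight_error_le {W Q : ℕ} {E : ℕ → ℝ} (hρ0 : 0 ≤ ρ) (hρ1 : ρ ≤ 1)
    (hR : R = ⌊exp (ρ * L)⌋₊) (hL : 2 ^ (2 * k) ≤ (L : ℝ)) (hW : Squarefree W)
    (hQ : W * R ^ 2 ≤ Q) (hE0 : ∀ q, 0 ≤ E q) (hc : 1 ≤ c)
    (hE : ∑ q ∈ (Icc 1 Q).filter Squarefree, (c : ℝ) ^ q.primeFactors.card * E q ≤
      1 / (L : ℝ) ^ (2 * k + 2)) :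
    ((1 + log R) ^ k) ^ 2 *
      ∑ q ∈ (Icc 1 (R ^ 2)).filter Squarefree,
        (c : ℝ) ^ q.primeFactors.card * (if q.Coprime W then E (W * q) else 0) ≤ 1 / L := by
  have hl := log_floor_exp_le hρ0 hR
  have hL1 : (1 : ℝ) ≤ L := (one_le_pow₀ (by norm_num)).trans hL
  have h1 : 1 + log R ≤ 2 * L := by nlinarith
  have hc' : (1 : ℝ) ≤ c := by exact_mod_cast hc
  refine le_trans ?_ (two_mul_pow_mul_le hL hE)
  rw [← pow_mul, mul_comm k 2]
  refine mul_le_mul (by gcongr) ?_ (sum_nonneg fun q _ => ?_) (by positivity)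
  · simp_rw [mul_ite, mul_zero]
    rw [← sum_filter]
    calc _ ≤ ∑ q ∈ ((Icc 1 (R ^ 2)).filter Squarefree).filter fun q => q.Coprime W,
          (c : ℝ) ^ (W * q).primeFactors.card * E (W * q) := by
          refine sum_le_sum fun q hq => mul_le_mul_of_nonneg_right (pow_le_pow_right₀ hc'
            (card_le_card (Nat.primeFactors_mono (dvd_mul_left _ _) ?_))) (hE0 _)
          have := (mem_Icc.mp (mem_filter.mp (mem_filter.mp hq).1).1).1
          exact mul_ne_zero hW.ne_zero (by omega)
      _ = ∑ q ∈ (((Icc 1 (R ^ 2)).filter Squarefree).filter fun q => q.Coprime W).image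
          (W * ·), (c : ℝ) ^ q.primeFactors.card * E q := by
          rw [sum_image fun a _ b _ hab =>
            Nat.eq_of_mul_eq_mul_left (pos_of_ne_zero hW.ne_zero) hab]
      _ ≤ _ := by
          refine sum_le_sum_of_subset_of_nonneg ?_ fun q _ _ =>
            mul_nonneg (by positivity) (hE0 q)
          intro x hx
          obtain ⟨q, hq, rfl⟩ := mem_image.mp hx
          simp only [mem_filter, mem_Icc] at hq ⊢
          exact ⟨⟨Nat.mul_pos (pos_of_ne_zero hW.ne_zero) hq.1.1.1,
            (Nat.mul_le_mul_left W hq.1.1.2).trans hQ⟩,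
            (Nat.squarefree_mul hq.2.symm).mpr ⟨hW, hq.1.2⟩⟩
  · refine mul_nonneg (by positivity) ?_
    split_ifs
    exacts [hE0 _, le_rfl]

end Errors

/-- The decisive numerical inequality between the two sieve sums. -/
lemma sieve_sums_lt {m : ℕ} {A ε ρ k L Y S1 S2 P V : ℝ} (hm : 1 ≤ m) (hA : A = 4 * m + 100)
    (hε : ε = 1 / (16 * A)) (hρ : ρ = 1 / 4 - 3 * ε) (hk : 0 ≤ k) (hL : 1 ≤ L)
    (hY : k + 2 * m ≤ Y) (hV : V ≤ 1 + 2 * ε) (hP : 1 - ε ≤ P) (h1 : L * S1 ≤ V * Y + 1)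
    (h2 : P * (1 - 5 / A) * A * ρ * Y - k / L ≤ S2) :
    m * ((1 + ε) * L) * S1 < S2 := by
  have hm' : (1 : ℝ) ≤ m := by exact_mod_cast hm
  have hA0 : 0 < A := by linarith
  have hεA : ε * A = 1 / 16 := by rw [hε]; field_simp
  have hε0 : 0 < ε := by rw [hε]; positivity
  have hε1 : ε ≤ 1 / 1600 := by rw [hε]; gcongr; linarith
  have hY0 : 1 ≤ Y := by linarith
  have hkL : k / L ≤ k := div_le_self hk hL
  have hεm : 4 * (ε * m) ≤ 1 / 16 := by nlinarith
  have h3 : (m : ℝ) + 23 ≤ P * (1 - 5 / A) * A * ρ := by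
    have e : P * (1 - 5 / A) * A * ρ = P * ρ * (A - 5) := by field_simp
    rw [e]
    have h4 : 1 / 4 - 4 * ε ≤ P * ρ := by
      have : (1 - ε) * ρ ≤ P * ρ := by gcongr; linarith
      nlinarith
    have : (1 / 4 - 4 * ε) * (A - 5) ≤ P * ρ * (A - 5) := by gcongr; linarith
    nlinarith
  have h5 : m * (1 + ε) * (1 + 2 * ε) ≤ m + 1 := by nlinarith
  have h6 : (m + 23) * Y ≤ P * (1 - 5 / A) * A * ρ * Y := by gcongr
  have h7 : m * (1 + ε) * (L * S1) ≤ m * (1 + ε) * ((1 + 2 * ε) * Y + 1) := by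
    gcongr
    exact h1.trans (by gcongr)
  have h8 : m * (1 + ε) * (1 + 2 * ε) * Y ≤ (m + 1) * Y := by gcongr
  nlinarith

lemma sum_frozen_weight_le {X0 X1 D : ℕ} {w : ℕ → ℝ} (hD : D ≤ X0) (hX : X0 ≤ X1) :
    ∑ x ∈ Ioc (X0 - D) X1, w (max x X0) = D * w X0 + ∑ x ∈ Ioc X0 X1, w x := by
  rw [← sum_Ioc_consecutive _ (sub_le X0 D) hX]
  congr 1
  · rw [sum_congr rfl fun x hx => by rw [max_eq_right (mem_Ioc.mp hx).2],
      sum_const, card_Ioc, nsmul_eq_mul, Nat.sub_sub_self hD]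
  · exact sum_congr rfl fun x hx => by rw [max_eq_left (mem_Ioc.mp hx).1.le]

lemma le_exp_half {x : ℝ} (hx : 0 ≤ x) : x ≤ exp (x / 2) := by
  have := Real.quadratic_le_exp_of_nonneg (by positivity : 0 ≤ x / 2)
  nlinarith [sq_nonneg (x / 2 - 1)]

set_option maxHeartbeats 2000000 in
/-- Arbitrarily far out, some translate of an admissible set contains `m + 1` primes. -/
theorem exists_many_primes {k m : ℕ} (hm : 1 ≤ m) {h : Fin k → ℕ} (hinj : Injective h)
    (hpr : ∀ j, (h j).Prime) (hkh : ∀ j, k < h j) {A : ℝ} (hA : A = 4 * m + 100)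
    (hk : 32 * A ^ 2 * exp A ≤ k) (N : ℕ) :
    ∃ x, m < (univ.filter fun j => N < x + h j ∧ (x + h j).Prime).card := by
  have hm' : (1 : ℝ) ≤ m := by exact_mod_cast hm
  have hA100 : 100 ≤ A := by linarith
  have hk0 : (0 : ℝ) < k := lt_of_lt_of_le (by positivity) hk
  obtain ⟨ε, hε⟩ : ∃ ε, ε = 1 / (16 * A) := ⟨_, rfl⟩
  have hε0 : 0 < ε := by rw [hε]; positivity
  have hε1 : ε ≤ 1 / 1600 := by rw [hε]; gcongr; linarith
  obtain ⟨ρ, hρ⟩ : ∃ ρ, ρ = 1 / 4 - 3 * ε := ⟨_, rfl⟩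
  have hρ0 : 0 < ρ := by linarith
  obtain ⟨D, hDd⟩ : ∃ D, D = ∑ j, h j + ⌈4 * (k : ℝ) ^ 2 * A⌉₊ := ⟨_, rfl⟩
  have hhD : ∀ j, h j ≤ D := fun j => by
    have := single_le_sum (f := h) (fun _ _ => Nat.zero_le _) (mem_univ j)
    omega
  have hDk : 4 * (k : ℝ) ^ 2 * A ≤ D :=
    (le_ceil _).trans (by exact_mod_cast (by omega : ⌈4 * (k : ℝ) ^ 2 * A⌉₊ ≤ D))
  obtain ⟨ν, hν⟩ := exists_coprime_primorial hpr hkh D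
  obtain ⟨W, hWd⟩ : ∃ W, W = primorial D := ⟨_, rfl⟩
  rw [← hWd] at hν
  have hW0 : 0 < W := hWd ▸ primorial_pos D
  have hWp : ∀ q, q.Prime → (q ∣ W ↔ q ≤ D) := fun q hq => hWd ▸ hq.dvd_primorial_iff
  have hWsq : Squarefree W := hWd ▸ squarefree_primorial D
  have hW0' : (0 : ℝ) < W := by exact_mod_cast hW0
  have hφ0 : (0 : ℝ) < W.totient := by exact_mod_cast Nat.totient_pos.mpr hW0
  obtain ⟨c, hc⟩ : ∃ c, c = (k + 1) ^ 2 := ⟨_, rfl⟩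
  have hc1 : 1 ≤ c := hc ▸ Nat.one_le_pow _ _ (by omega)
  have hlarge : ∀ b : ℝ, ∀ᶠ L : ℕ in atTop, b ≤ L := fun b =>
    tendsto_natCast_atTop_atTop.eventually_ge_atTop b
  obtain ⟨L, ⟨w, E, hw, hE0, hE, hEs⟩, hL64, hLN, hLD, hLε, hLW, hLℓ, hLG, hLK, hLY, hLexp⟩ :=
    ((frequently_bombieri_vinogradov hε0 (by linarith) c (2 * k + 2)).and_eventually
      ((hlarge 64).and <| (hlarge N).and <| (hlarge D).and <| (hlarge (D / ε)).and <|
        (hlarge (W / (2 * ε))).and <| (hlarge (k / ρ)).and <|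
        (hlarge (k / ρ * (A * (W / W.totient * ((W + 1) * (20 * A)))))).and <|
        (hlarge (2 ^ (2 * k + c))).and <| (hlarge ((k + 2 * m) * W)).and <|
        eventually_exp_neg_le (by linarith : 0 < 6 * ε) (2 * k + c + 2))).exists
  have hL0 : (0 : ℝ) < L := by linarith
  have hL1 : (1 : ℝ) ≤ L := by linarith
  have hX := exp_half_lt_lowerEnd (by linarith : ε ≤ 1 / 4) (by exact_mod_cast hL64 : 64 ≤ L)
  have hX01 := lowerEnd_le_upperEnd hε0.le L
  have hΛ : ∀ n, n ≤ upperEnd ε L → primeLog n ≤ (1 + ε) * L := fun n hn => by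
    have h0 : 0 ≤ (1 + ε) * (L : ℝ) := by positivity
    rw [primeLog]
    split_ifs with hp
    · rw [log_le_iff_le_exp (by exact_mod_cast hp.pos)]
      exact le_trans (by exact_mod_cast hn) (floor_le (exp_pos _).le)
    · exact h0
  obtain ⟨X0, hX0⟩ : ∃ X0, X0 = lowerEnd ε L := ⟨_, rfl⟩
  obtain ⟨X1, hX1⟩ : ∃ X1, X1 = upperEnd ε L := ⟨_, rfl⟩
  rw [← hX0] at hX
  rw [← hX1] at hΛ
  rw [← hX0, ← hX1] at hw hE hX01
  have hLX : (L : ℝ) ≤ X0 := (le_exp_half hL0.le).trans hX.le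
  have hNX : N ≤ X0 := by exact_mod_cast hLN.trans hLX
  have hDX : D ≤ X0 := by exact_mod_cast hLD.trans hLX
  have hX₀0 : (0 : ℝ) < X0 := (exp_pos _).trans hX
  obtain ⟨ℓ, hℓd⟩ : ∃ ℓ, ℓ = ρ * L / k := ⟨_, rfl⟩
  have hkℓ : k * ℓ = ρ * L := by rw [hℓd]; field_simp
  have hℓ1 : 1 ≤ ℓ := by
    rw [hℓd, one_le_div₀ hk0]
    rw [div_le_iff₀ hρ0] at hLℓ
    linarith
  have hℓW : ((W : ℝ) + 1) * (20 * A) ≤ W.totient / W * (ℓ / A) := by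
    have e : W.totient / W * (ℓ / A) = W.totient / W * (ρ / k * L / A) := by rw [hℓd]; ring
    have e2 : ((W : ℝ) + 1) * (20 * A) = W.totient / W *
      (ρ / k * (k / ρ * (A * (W / W.totient * ((W + 1) * (20 * A))))) / A) := by field_simp
    rw [e, e2]
    gcongr
  obtain ⟨R, hR⟩ : ∃ R, R = ⌊exp (ρ * L)⌋₊ := ⟨_, rfl⟩
  have hRle : (R : ℝ) ≤ exp (ρ * L) := hR ▸ floor_le (exp_pos _).le
  have hRX : R ≤ X0 := by
    have : exp (ρ * L) ≤ exp (L / 2) := by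
      rw [exp_le_exp, div_eq_inv_mul]
      exact mul_le_mul_of_nonneg_right (by linarith only [hρ, hε0]) hL0.le
    exact_mod_cast hRle.trans (this.trans hX.le)
  have hQ : W * R ^ 2 ≤ levelBound ε L := by
    refine le_floor ?_
    rw [div_le_iff₀ (by positivity)] at hLW
    have h1 : (W : ℝ) ≤ exp (2 * ε * L) := by
      have := add_one_le_exp (2 * ε * L)
      linarith
    calc ((W * R ^ 2 : ℕ) : ℝ) = W * (R : ℝ) ^ 2 := by push_cast; rfl
      _ ≤ exp (2 * ε * L) * exp (ρ * L) ^ 2 := by gcongr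
      _ = _ := by
          rw [← exp_nat_mul, ← exp_add, hρ]; congr 1; push_cast; ring
  obtain ⟨n, p, hp, hpinj, hpD, hpR, hcov⟩ := exists_prime_enumeration D R
  obtain ⟨lam, G, hG1, hlam, hlamR, hup, hlow⟩ := exists_sieveCoeff hp hpinj hpD hcov hW0 hWp
    hA100 hk hDk hℓ1 hℓW (by rw [hkℓ]; exact hR)
  have hpW : ∀ i, (p i).Coprime W := fun i =>
    (hp i).coprime_iff_not_dvd.mpr fun hd => (hpD i).not_ge ((hWp _ (hp i)).mp hd)
  have hpX : ∀ i, p i ≤ X0 := fun i => (hpR i).trans hRX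
  have hwanti : ∀ a b, X0 ≤ a → a ≤ b → w b ≤ w a := fun a b ha hab => by
    induction b, hab using Nat.le_induction with
    | base => exact le_rfl
    | succ b hb ih => exact (hw.succ_le b (ha.trans hb)).trans ih
  have hv : Antitone fun x => w (max x X0) := fun a b hab =>
    hwanti _ _ (le_max_right _ _) (max_le_max_right _ hab)
  have hwX : w X0 ≤ exp (-(L / 2)) := by
    refine (hw.le_inv X0).trans ?_
    rw [exp_neg, one_div]
    exact inv_anti₀ (exp_pos _) hX.le
  have hV : ∑ x ∈ Ioc (X0 - D) X1, w (max x X0) ≤ 1 + 2 * ε := by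
    rw [sum_frozen_weight_le hDX hX01]
    have h1 : (D : ℝ) * w X0 ≤ ε := by
      rw [div_le_iff₀ hε0] at hLε
      calc (D : ℝ) * w X0 ≤ D * (1 / X0) := by gcongr; exact hw.le_inv X0
        _ ≤ ε := by
            rw [mul_one_div, div_le_iff₀ hX₀0]
            exact hLε.trans (by rw [mul_comm]; exact mul_le_mul_of_nonneg_left hLX hε0.le)
    linarith only [hw.sum_le, h1]
  have hS1 := abs_sum_shift_sub_le hp hpinj hpD hinj hhD (Ioc (X0 - D) X1)
    (fun x => if x ≡ ν [MOD W] then w (max x X0) else 0) _ _ lam hlam hlamR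
    (fun _ => w (max (X0 - D) X0)) (fun _ => hw.nonneg _) fun d _ =>
    abs_sum_mul_shiftIndicator_sub_le hp hpinj hpW hW0 hv (fun _ => hw.nonneg _) (X0 - D) X1 ν d
  have hS2 := fun j => abs_sum_shift_sub_le hp hpinj hpD hinj hhD (Ioc (X0 - D) X1) _ _ _ lam
    hlam hlamR (fun q => if q.Coprime W then E (W * q) else 0)
    (fun q => by split_ifs; exacts [hE0 _, le_rfl]) fun d hd =>
    abs_sum_primeLog_mul_shiftIndicator_sub_le hp hpinj hpD hinj hhD hpW hW0 hDX hpX hν hE0 hQ hE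
      j d hd
  rw [card_fin, ← hc, max_eq_right (sub_le _ _)] at hS1
  simp only [card_fin, ← hc] at hS2
  have herr1 := monotone_weight_error_le (k := k) (c := c) hρ0.le hε0.le hρ hR (hw.nonneg X0) hwX
    hLK hLexp
  have herr2 := prime_weight_error_le (k := k) hρ0.le (by linarith) hR
    ((pow_le_pow_right₀ (by norm_num) (Nat.le_add_right _ _)).trans hLK) hWsq hQ hE0 hc1 hEs
  suffices H : ∃ x, m < (univ.filter fun j => X0 < x + h j ∧ (x + h j).Prime).card by
    obtain ⟨x, hx⟩ := H
    refine ⟨x, hx.trans_le (card_le_card fun j => ?_)⟩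
    simp only [mem_filter, mem_univ, true_and]
    exact fun hj => ⟨hNX.trans_lt hj.1, hj.2⟩
  refine exists_lt_card_of_sum_lt (W := W) (ν := ν) (X1 := X1) (v := fun x => w (max x X0))
    (Ioc (X0 - D) X1) (fun x => sq_nonneg (∑ c, lam c * ∏ i, shiftIndicator h (p i) x (c i)))
    (fun _ => hw.nonneg _) hw.nonneg
    (by positivity) (fun x j hxj => hwanti _ _ (le_max_right _ _) (max_le (Nat.le_add_right _ _)
      hxj.le)) hΛ (sieve_sums_lt (Y := L * G / W) hm hA hε hρ hk0.le hL1 ?_ hV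
      hw.le_sum_primeLog ?_ ?_)
  · rw [le_div_iff₀ hW0', mul_comm]
    refine (mul_comm _ _).trans_le (hLY.trans (le_mul_of_one_le_right hL0.le hG1)) |>.trans_eq' ?_
    ring
  · have h1 := (abs_le.mp (hS1.trans herr1)).2
    have hV0 : 0 ≤ (∑ x ∈ Ioc (X0 - D) X1, w (max x X0)) / W :=
      div_nonneg (sum_nonneg fun _ _ => hw.nonneg _) hW0'.le
    have h2 := mul_le_mul_of_nonneg_left hup hV0
    have h3 := mul_le_mul_of_nonneg_left ((sub_le_iff_le_add.mp h1).trans (add_le_add_right h2 _)) hL0.le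
    refine h3.trans (le_of_eq ?_)
    field_simp
    ring
  · have hP0 : 0 ≤ (∑ x ∈ Ioc X0 X1, w x * primeLog x) / W.totient :=
      div_nonneg (by linarith [hw.le_sum_primeLog]) hφ0.le
    have h1 : ∀ j : Fin k, (∑ x ∈ Ioc X0 X1, w x * primeLog x) / W.totient *
        ((1 - 5 / A) * (W.totient / W * (ℓ * A)) * G) - 1 / (L : ℝ) ≤ _ := fun j => by
      have h2 := (abs_le.mp ((hS2 j).trans herr2)).1
      have h3 := mul_le_mul_of_nonneg_left (hlow j) hP0
      exact sub_le_iff_le_add.mpr (h3.trans (neg_le_sub_iff_le_add.mp h2))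
    refine le_trans (le_of_eq ?_) (sum_le_sum fun j _ => h1 j)
    rw [sum_const, card_univ, card_fin, nsmul_eq_mul, hℓd]
    field_simp

end MaynardGap

theorem maynard_liminf_prime_gap_m :
    ∃ C : ℝ, 0 < C ∧ ∀ m : ℕ, 1 ≤ m →
      Filter.liminf
          (fun n : ℕ => (Nat.nth Nat.Prime (n + m) : ℝ) - (Nat.nth Nat.Prime n : ℝ)) atTop
        ≤ C * (m : ℝ) ^ 3 * Real.exp (4 * (m : ℝ) + 5) := by
  refine ⟨2244 * 104 ^ 3 * Real.exp 95, by positivity, fun m hm => ?_⟩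
  have hm' : (1 : ℝ) ≤ m := by exact_mod_cast hm
  obtain ⟨A, hA⟩ : ∃ A : ℝ, A = 4 * m + 100 := ⟨_, rfl⟩
  have hA100 : 100 ≤ A := by linarith
  have hx : 1 ≤ A ^ 2 * Real.exp A :=
    one_le_mul_of_one_le_of_one_le (one_le_pow₀ (by linarith)) (Real.one_le_exp (by linarith))
  obtain ⟨k, hkd⟩ : ∃ k, k = ⌈32 * A ^ 2 * Real.exp A⌉₊ := ⟨_, rfl⟩
  have hk : 32 * A ^ 2 * Real.exp A ≤ k := hkd ▸ Nat.le_ceil _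
  have hk33 : (k : ℝ) ≤ 33 * A ^ 2 * Real.exp A := by
    have := Nat.ceil_lt_add_one (by positivity : 0 ≤ 32 * A ^ 2 * Real.exp A)
    rw [← hkd] at this
    linarith
  have hk1 : (1 : ℝ) ≤ k := by linarith
  have hlog : 1 + Real.log k ≤ 4 * A := by
    have h1 : (k : ℝ) ≤ Real.exp (3 * A) := by
      have h33 : 33 ≤ Real.exp A := by linarith [Real.add_one_le_exp A]
      have hA2 : A ^ 2 ≤ Real.exp A := by
        have := Real.pow_div_factorial_le_exp A (by linarith) 3
        norm_num [Nat.factorial] at this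
        nlinarith
      calc (k : ℝ) ≤ Real.exp A * Real.exp A * Real.exp A := hk33.trans (by gcongr)
        _ = Real.exp (3 * A) := by rw [← Real.exp_add, ← Real.exp_add]; ring_nf
    have := (Real.log_le_iff_le_exp (by linarith)).mpr h1
    linarith
  obtain ⟨h, hinj, hpr, hkh, hle⟩ := MaynardGap.exists_injective_primes (k := k)
    (by exact_mod_cast hk1)
  refine (MaynardGap.liminf_nth_prime_le hinj (H := ⌊17 * k * (1 + Real.log k)⌋₊)
    (fun j => Nat.le_floor (hle j)) (MaynardGap.exists_many_primes hm hinj hpr hkh hA hk)).trans ?_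
  have hlog0 := Real.log_nonneg hk1
  calc (⌊17 * k * (1 + Real.log k)⌋₊ : ℝ) ≤ 17 * k * (1 + Real.log k) :=
        Nat.floor_le (by positivity)
    _ ≤ 17 * (33 * A ^ 2 * Real.exp A) * (4 * A) := by gcongr
    _ = 2244 * A ^ 3 * Real.exp A := by ring
    _ ≤ 2244 * (104 * m) ^ 3 * Real.exp A := by gcongr; linarith
    _ = 2244 * (104 * m) ^ 3 * (Real.exp 95 * Real.exp (4 * m + 5)) := by
        rw [← Real.exp_add, hA]; ring_nf
    _ = _ := by ring
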